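/- As X → ∞, the counting function N_3^-(X) of cubic fields of negative discriminant satisfies N_3^-(X) = (3/(12·ζ(3)))·X + √3·(4·ζ(1/3)/(5·Γ(2/3)³·ζ(5/3)))·X^{5/6} + o(X^{5/6}); that is, (N_3^-(X) − X/(4·ζ(3)) − 4√3·ζ(1/3)·X^{5/6}/(5·Γ(2/3)³·ζ(5/3)))/X^{5/6} tends to 0 as X → ∞. -/

import Mathlib

open Filter Topology

/-- A cubic field: a number field of degree 3 over `ℚ`. -/
structure CubicField where
  carrier : Type
  [field : Field carrier]
  [nf : NumberField carrier]
  deg : Module.finrank ℚ carrier = 3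

attribute [instance] CubicField.field CubicField.nf

/-- Two cubic fields are identified if they are isomorphic. -/
instance CubicField.setoid : Setoid CubicField where
  r A B := Nonempty (A.carrier ≃+* B.carrier)
  iseqv := ⟨fun _ => ⟨RingEquiv.refl _⟩, fun ⟨e⟩ => ⟨e.symm⟩, fun ⟨e⟩ ⟨f⟩ => ⟨e.trans f⟩⟩

/-- The number of isomorphism classes of cubic fields whose discriminant satisfies `P`. -/
noncomputable def countCubic (P : ℤ → Prop) : ℕ :=
  Nat.card {C : Quotient CubicField.setoid //
    ∃ K : CubicField, ⟦K⟧ = C ∧ P (NumberField.discr K.carrier)}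

/-- An integral binary cubic form `a x³ + b x² y + c x y² + d y³`. -/
@[ext]
structure BCF where
  a : ℤ
  b : ℤ
  c : ℤ
  d : ℤ

namespace BCF

/-- The value of a form. -/
def eval (f : BCF) (x y : ℤ) : ℤ := f.a * x ^ 3 + f.b * x ^ 2 * y + f.c * x * y ^ 2 + f.d * y ^ 3

/-- The discriminant of a form. -/
def disc (f : BCF) : ℤ :=
  f.b ^ 2 * f.c ^ 2 - 4 * f.a * f.c ^ 3 - 4 * f.b ^ 3 * f.d - 27 * f.a ^ 2 * f.d ^ 2
    + 18 * f.a * f.b * f.c * f.d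

/-- The substitution `f(px + qy, rx + sy)`. -/
def sub (f : BCF) (p q r s : ℤ) : BCF where
  a := f.a * p ^ 3 + f.b * p ^ 2 * r + f.c * p * r ^ 2 + f.d * r ^ 3
  b := 3 * f.a * p ^ 2 * q + f.b * (p ^ 2 * s + 2 * p * q * r) + f.c * (2 * p * r * s + q * r ^ 2)
    + 3 * f.d * r ^ 2 * s
  c := 3 * f.a * p * q ^ 2 + f.b * (q ^ 2 * r + 2 * p * q * s) + f.c * (2 * q * r * s + p * s ^ 2)
    + 3 * f.d * r * s ^ 2
  d := f.a * q ^ 3 + f.b * q ^ 2 * s + f.c * q * s ^ 2 + f.d * s ^ 3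

/-- Multiplication of a form by an integer. -/
def smul (n : ℤ) (f : BCF) : BCF := ⟨n * f.a, n * f.b, n * f.c, n * f.d⟩

lemma sub_eval (f : BCF) (p q r s x y : ℤ) :
    (f.sub p q r s).eval x y = f.eval (p * x + q * y) (r * x + s * y) := by
  simp only [eval, sub]; ring

lemma sub_sub (f : BCF) (p q r s p' q' r' s' : ℤ) :
    (f.sub p q r s).sub p' q' r' s' =
      f.sub (p * p' + q * r') (p * q' + q * s') (r * p' + s * r') (r * q' + s * s') := by
  ext <;> simp only [sub] <;> ring

lemma sub_one (f : BCF) : f.sub 1 0 0 1 = f := by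
  ext <;> simp [sub]

lemma sub_scalar (f : BCF) (n : ℤ) : f.sub n 0 0 n = smul (n ^ 3) f := by
  ext <;> simp only [sub, smul] <;> ring

lemma sub_disc (f : BCF) (p q r s : ℤ) :
    (f.sub p q r s).disc = (p * s - q * r) ^ 6 * f.disc := by
  simp only [disc, sub]; ring

lemma smul_disc (n : ℤ) (f : BCF) : (smul n f).disc = n ^ 4 * f.disc := by
  simp only [disc, smul]; ring

lemma smul_eval (n : ℤ) (f : BCF) (x y : ℤ) : (smul n f).eval x y = n * f.eval x y := by
  simp only [eval, smul]; ring

lemma smul_sub (n : ℤ) (f : BCF) (p q r s : ℤ) :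
    (smul n f).sub p q r s = smul n (f.sub p q r s) := by
  ext <;> simp only [sub, smul] <;> ring

lemma smul_smul (n m : ℤ) (f : BCF) : smul n (smul m f) = smul (n * m) f := by
  ext <;> simp only [smul] <;> ring

lemma smul_inj {n : ℤ} (hn : n ≠ 0) {f g : BCF} (h : smul n f = smul n g) : f = g := by
  simp only [smul, BCF.mk.injEq, mul_eq_mul_left_iff, hn, or_false] at h
  ext <;> tauto

/-- No nontrivial integral zeros. -/
def Irr (f : BCF) : Prop := ∀ x y, f.eval x y = 0 → x = 0 ∧ y = 0

lemma Irr.a_ne {f : BCF} (h : f.Irr) : f.a ≠ 0 := by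
  intro h0
  have := h 1 0 (by simp [eval, h0])
  simp at this

lemma Irr.sub {f : BCF} (h : f.Irr) {p q r s : ℤ} (hd : p * s - q * r ≠ 0) :
    (f.sub p q r s).Irr := by
  intro x y hxy
  rw [sub_eval] at hxy
  obtain ⟨h1, h2⟩ := h _ _ hxy
  constructor
  · have : (p * s - q * r) * x = 0 := by linear_combination s * h1 - q * h2
    exact (mul_eq_zero.mp this).resolve_left hd
  · have : (p * s - q * r) * y = 0 := by linear_combination p * h2 - r * h1
    exact (mul_eq_zero.mp this).resolve_left hd

lemma Irr.of_smul {f : BCF} {n : ℤ} (h : (smul n f).Irr) : f.Irr := by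
  intro x y hxy
  exact h x y (by rw [smul_eval, hxy, mul_zero])

lemma Irr.smul {f : BCF} {n : ℤ} (h : f.Irr) (hn : n ≠ 0) : (smul n f).Irr := by
  intro x y hxy
  rw [smul_eval] at hxy
  exact h x y ((mul_eq_zero.mp hxy).resolve_left hn)

/-- The forms we count: irreducible with negative discriminant. -/
def Good (f : BCF) : Prop := f.Irr ∧ f.disc < 0

lemma Good.sub {f : BCF} (h : f.Good) {p q r s : ℤ} (hd : p * s - q * r ≠ 0) :
    (f.sub p q r s).Good :=
  ⟨h.1.sub hd, by rw [sub_disc]; exact mul_neg_of_pos_of_neg (by positivity) h.2⟩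

lemma Good.smul {f : BCF} {n : ℤ} (h : f.Good) (hn : n ≠ 0) : (smul n f).Good :=
  ⟨h.1.smul hn, by rw [smul_disc]; exact mul_neg_of_pos_of_neg (by positivity) h.2⟩

lemma Good.of_smul {f : BCF} {n : ℤ} (h : (BCF.smul n f).Good) : f.Good := by
  refine ⟨h.1.of_smul, ?_⟩
  have := h.2
  rw [smul_disc] at this
  by_contra h0
  have : 0 ≤ n ^ 4 * f.disc := mul_nonneg (by positivity) (by linarith)
  linarith

/-- `GL₂(ℤ)`-equivalence of forms. -/
def Rel (f g : BCF) : Prop :=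
  ∃ p q r s : ℤ, IsUnit (p * s - q * r) ∧ g = f.sub p q r s

lemma Rel.refl (f : BCF) : Rel f f := ⟨1, 0, 0, 1, by simp, (sub_one f).symm⟩

lemma Rel.trans {f g h : BCF} (h1 : Rel f g) (h2 : Rel g h) : Rel f h := by
  obtain ⟨p, q, r, s, hu, rfl⟩ := h1
  obtain ⟨p', q', r', s', hu', rfl⟩ := h2
  refine ⟨_, _, _, _, ?_, sub_sub _ _ _ _ _ _ _ _ _⟩
  convert hu.mul hu' using 1
  ring

lemma Rel.symm {f g : BCF} (h1 : Rel f g) : Rel g f := by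
  obtain ⟨p, q, r, s, hu, rfl⟩ := h1
  rcases Int.isUnit_iff.mp hu with h | h
  · refine ⟨s, -q, -r, p, by convert hu using 1; ring, ?_⟩
    rw [sub_sub]
    conv_lhs => rw [← sub_one f]
    congr 1 <;> linarith
  · refine ⟨-s, q, r, -p, by convert hu using 1; ring, ?_⟩
    rw [sub_sub]
    conv_lhs => rw [← sub_one f]
    congr 1 <;> linarith

lemma Rel.disc_eq {f g : BCF} (h : Rel f g) : g.disc = f.disc := by
  obtain ⟨p, q, r, s, hu, rfl⟩ := h
  rw [sub_disc]
  rcases Int.isUnit_iff.mp hu with h | h <;> rw [h] <;> ring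

/-- Good forms as a type. -/
abbrev GF := {f : BCF // f.Good}

instance gfSetoid : Setoid GF where
  r f g := Rel f.1 g.1
  iseqv := ⟨fun f => Rel.refl f.1, fun h => h.symm, fun h1 h2 => h1.trans h2⟩

/-- The `GL₂(ℤ)`-orbits of irreducible forms of negative discriminant. -/
abbrev Orb := Quotient gfSetoid

/-- The discriminant of an orbit. -/
def Orb.disc (ω : Orb) : ℤ := Quotient.liftOn ω (fun f => f.1.disc) (fun _ _ h => h.disc_eq.symm)

/-- The orbit of a form. -/
def orb (f : BCF) (h : f.Good) : Orb := Quotient.mk gfSetoid ⟨f, h⟩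

lemma orb_eq_iff {f g : BCF} {hf : f.Good} {hg : g.Good} : orb f hf = orb g hg ↔ Rel f g :=
  Quotient.eq (r := gfSetoid)

lemma orb_disc {f : BCF} (hf : f.Good) : (orb f hf).disc = f.disc := rfl

lemma Orb.exists_rep (ω : Orb) : ∃ f, ∃ h : f.Good, orb f h = ω := by
  induction ω using Quotient.inductionOn with
  | h f => exact ⟨f.1, f.2, rfl⟩

lemma Orb.disc_neg (ω : Orb) : ω.disc < 0 := by
  obtain ⟨f, h, rfl⟩ := ω.exists_rep
  exact h.2

/-- `g = f ∘ M / p` for some integral `M` of determinant `± p`. -/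
def FStep (p : ℤ) (g f : BCF) : Prop :=
  ∃ m n k l : ℤ, |m * l - n * k| = p ∧ smul p g = f.sub m n k l

lemma FStep.congr {p : ℤ} {g f g' f' : BCF} (h : FStep p g f) (hg : Rel g g') (hf : Rel f f') :
    FStep p g' f' := by
  obtain ⟨m, n, k, l, hd, h⟩ := h
  obtain ⟨m', n', k', l', hu', rfl⟩ := hg
  obtain ⟨m'', n'', k'', l'', hu'', rfl⟩ := hf.symm
  have e := (smul_sub p g m' n' k' l').symm
  rw [h, sub_sub, sub_sub] at e
  refine ⟨_, _, _, _, ?_, e⟩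
  · have e1 : |m' * l' - n' * k'| = 1 := Int.isUnit_iff_abs_eq.mp hu'
    have e2 : |m'' * l'' - n'' * k''| = 1 := Int.isUnit_iff_abs_eq.mp hu''
    calc _ = |(m' * l' - n' * k') * (m * l - n * k) * (m'' * l'' - n'' * k'')| := by
          congr 1; ring
      _ = p := by rw [abs_mul, abs_mul, e1, e2, hd]; ring

/-- Orbits related by an index `p` inclusion. -/
def Step (p : ℤ) (ω ω' : Orb) : Prop :=
  Quotient.liftOn₂ ω ω' (fun g f => FStep p g.1 f.1) (fun _ _ _ _ h1 h2 => propext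
    ⟨fun h => h.congr h1 h2, fun h => h.congr h1.symm h2.symm⟩)

lemma step_orb {p : ℤ} {g f : BCF} (hg : g.Good) (hf : f.Good) :
    Step p (orb g hg) (orb f hf) ↔ FStep p g f := Iff.rfl

lemma FStep.disc_eq {p : ℤ} (hp : p ≠ 0) {g f : BCF} (h : FStep p g f) :
    g.disc = p ^ 2 * f.disc := by
  obtain ⟨m, n, k, l, hd, h⟩ := h
  have h1 := congrArg disc h
  rw [smul_disc, sub_disc] at h1
  have h2 : (m * l - n * k) ^ 6 = p ^ 6 := by
    rw [← hd]; exact (Even.pow_abs (by decide) _).symm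
  rw [h2] at h1
  have : p ^ 4 * (g.disc - p ^ 2 * f.disc) = 0 := by linear_combination h1
  have := (mul_eq_zero.mp this).resolve_left (by positivity)
  linarith

lemma FStep.good_iff {p : ℤ} (hp : p ≠ 0) {g f : BCF} (h : FStep p g f) : g.Good ↔ f.Good := by
  obtain ⟨m, n, k, l, hd, h⟩ := h
  have hdet : m * l - n * k ≠ 0 := by
    intro h0; rw [h0] at hd; simp at hd; exact hp hd.symm
  constructor
  · intro hg
    have h2 : (smul p g).sub l (-n) (-k) m = smul ((m * l - n * k) ^ 3) f := by
      rw [h, sub_sub, ← sub_scalar]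
      congr 1 <;> ring
    have h3 := (hg.smul hp).sub (p := l) (q := -n) (r := -k) (s := m)
      (by intro h0; apply hdet; linarith)
    rw [h2] at h3
    exact h3.of_smul
  · intro hf
    have := hf.sub hdet
    rw [← h] at this
    exact this.of_smul

lemma Step.disc_eq {p : ℤ} (hp : p ≠ 0) {ω ω' : Orb} (h : Step p ω ω') :
    ω.disc = p ^ 2 * ω'.disc := by
  obtain ⟨f, hf, rfl⟩ := ω.exists_rep
  obtain ⟨g, hg, rfl⟩ := ω'.exists_rep
  exact FStep.disc_eq hp h

/-- Multiplication of an orbit by a nonzero integer. -/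
def Orb.smul (n : ℤ) (hn : n ≠ 0) (ω : Orb) : Orb :=
  Quotient.map (fun f : GF => (⟨BCF.smul n f.1, f.2.smul hn⟩ : GF)) (by
    rintro ⟨f, hf⟩ ⟨g, hg⟩ ⟨p, q, r, s, hu, h⟩
    exact ⟨p, q, r, s, hu, by rw [smul_sub]; exact congrArg (BCF.smul n) h⟩) ω

lemma orb_smul {n : ℤ} (hn : n ≠ 0) {f : BCF} (hf : f.Good) :
    (orb f hf).smul n hn = orb (BCF.smul n f) (hf.smul hn) := rfl

lemma Orb.smul_disc {n : ℤ} (hn : n ≠ 0) (ω : Orb) : (ω.smul n hn).disc = n ^ 4 * ω.disc := by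
  obtain ⟨f, hf, rfl⟩ := ω.exists_rep
  exact BCF.smul_disc n f

lemma Orb.smul_injective {n : ℤ} (hn : n ≠ 0) : Function.Injective (Orb.smul n hn) := by
  intro ω ω' h
  obtain ⟨f, hf, rfl⟩ := ω.exists_rep
  obtain ⟨g, hg, rfl⟩ := ω'.exists_rep
  rw [orb_smul, orb_smul, orb_eq_iff] at h
  obtain ⟨p, q, r, s, hu, h⟩ := h
  rw [smul_sub] at h
  exact orb_eq_iff.mpr ⟨p, q, r, s, hu, smul_inj hn h⟩

lemma step_smul_iff {p : ℤ} (hp : 0 < p) {ω ω' : Orb} :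
    Step p (ω.smul p hp.ne') ω' ↔ Step p ω' ω := by
  obtain ⟨f, hf, rfl⟩ := ω.exists_rep
  obtain ⟨g, hg, rfl⟩ := ω'.exists_rep
  rw [orb_smul, step_orb, step_orb]
  have key : ∀ m n k l : ℤ, |m * l - n * k| = p →
      ∃ ε : ℤ, ε * ε = 1 ∧ m * l - n * k = ε * p := by
    intro m n k l hd
    rcases abs_eq hp.le |>.mp hd with h | h
    · exact ⟨1, by norm_num, by linarith⟩
    · exact ⟨-1, by norm_num, by linarith⟩
  constructor
  · rintro ⟨m, n, k, l, hd, h⟩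
    obtain ⟨ε, hε, hdet⟩ := key m n k l hd
    refine ⟨ε * l, -ε * n, -ε * k, ε * m, ?_, ?_⟩
    · rw [← hd]; congr 1; linear_combination (m * l - n * k) * hε
    · have h2 : ((smul p (smul p f)).sub (ε * l) (-ε * n) (-ε * k) (ε * m)) = smul (p ^ 3) g := by
        rw [h, sub_sub, ← sub_scalar]
        have e3 : ε * (m * l - n * k) = p := by rw [hdet]; linear_combination p * hε
        congr 1
        · linear_combination e3
        · ring
        · ring
        · linear_combination e3
      rw [smul_sub, smul_sub] at h2
      apply smul_inj (n := p ^ 2) (by positivity)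
      rw [smul_smul] at h2 ⊢
      rw [show p ^ 2 * p = p ^ 3 by ring, ← h2]
      congr 1; ring
  · rintro ⟨m, n, k, l, hd, h⟩
    obtain ⟨ε, hε, hdet⟩ := key m n k l hd
    refine ⟨ε * l, -ε * n, -ε * k, ε * m, ?_, ?_⟩
    · rw [← hd]; congr 1; linear_combination (m * l - n * k) * hε
    · have e3 : ε * (m * l - n * k) = p := by rw [hdet]; linear_combination p * hε
      have h2 : ((smul p g).sub (ε * l) (-ε * n) (-ε * k) (ε * m)) = smul (p ^ 3) f := by
        rw [h, sub_sub, ← sub_scalar]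
        congr 1
        · linear_combination e3
        · ring
        · ring
        · linear_combination e3
      rw [smul_sub] at h2
      apply smul_inj (n := p) hp.ne'
      rw [h2, smul_smul, smul_smul]
      congr 1; ring

end BCF

namespace BCF

/-- The value of a form at a real vector. -/
def evalR (f : BCF) (x y : ℝ) : ℝ := f.a * x ^ 3 + f.b * x ^ 2 * y + f.c * x * y ^ 2 + f.d * y ^ 3

lemma evalR_intCast (f : BCF) (x y : ℤ) : f.evalR x y = (f.eval x y : ℤ) := by
  simp only [evalR, eval]; push_cast; ring

lemma sub_evalR (f : BCF) (p q r s : ℤ) (x y : ℝ) :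
    (f.sub p q r s).evalR x y = f.evalR (p * x + q * y) (r * x + s * y) := by
  simp only [evalR, sub]; push_cast; ring

lemma exists_root (f : BCF) (ha : f.a ≠ 0) : ∃ θ : ℝ, f.evalR θ 1 = 0 := by
  have ha' : (f.a : ℝ) ≠ 0 := by exact_mod_cast ha
  set T : ℝ := 1 + |(f.b : ℝ)| + |(f.c : ℝ)| + |(f.d : ℝ)| with hT
  have hcont : Continuous fun x : ℝ => f.a * f.evalR x 1 := by unfold evalR; fun_prop
  have h1 : (1 : ℝ) ≤ T := by
    have := abs_nonneg (f.b : ℝ); have := abs_nonneg (f.c : ℝ); have := abs_nonneg (f.d : ℝ)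
    linarith
  have ha1 : (1 : ℝ) ≤ |(f.a : ℝ)| := by exact_mod_cast Int.one_le_abs ha
  have key : ∀ x : ℝ, |x| = T → |f.b * x ^ 2 + f.c * x + f.d| ≤ |(f.a : ℝ)| * |x| ^ 3 := by
    intro x hx
    have e1 : |f.b * x ^ 2 + f.c * x + f.d| ≤ |(f.b : ℝ)| * T ^ 2 + |(f.c : ℝ)| * T + |(f.d : ℝ)| := by
      refine (abs_add_three _ _ _).trans ?_
      rw [abs_mul, abs_mul, abs_pow, hx]
    have e2 : |(f.c : ℝ)| * T ≤ |(f.c : ℝ)| * T ^ 2 := by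
      apply mul_le_mul_of_nonneg_left _ (abs_nonneg _); nlinarith
    have e3 : |(f.d : ℝ)| ≤ |(f.d : ℝ)| * T ^ 2 := by
      apply le_mul_of_one_le_right (abs_nonneg _); nlinarith
    have e4 : T ^ 3 ≤ |(f.a : ℝ)| * T ^ 3 := by nlinarith [show 0 < T ^ 3 by positivity]
    rw [hx]
    nlinarith [show 0 < T ^ 2 by positivity]
  have hp := key T (abs_of_pos (by linarith))
  have hn := key (-T) (by rw [abs_neg, abs_of_pos (by linarith)])
  have hTp : |T| = T := abs_of_pos (by linarith)
  rw [abs_neg] at hn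
  rw [hTp] at hp hn
  have mulab : ∀ z : ℝ, |z| ≤ |(f.a : ℝ)| * T ^ 3 → |f.a * z| ≤ (f.a : ℝ) ^ 2 * T ^ 3 := by
    intro z hz
    rw [abs_mul, ← sq_abs]
    nlinarith [abs_nonneg (f.a : ℝ)]
  have hpos : 0 ≤ f.a * f.evalR T 1 := by
    have := (abs_le.mp (mulab _ hp)).1
    simp only [evalR]; nlinarith
  have hneg : f.a * f.evalR (-T) 1 ≤ 0 := by
    have := (abs_le.mp (mulab _ hn)).2
    simp only [evalR]; nlinarith
  obtain ⟨θ, -, h⟩ := intermediate_value_Icc (by linarith : -T ≤ T) hcont.continuousOn ⟨hneg, hpos⟩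
  have hθ := (mul_eq_zero.mp h).resolve_left ha'
  exact ⟨θ, hθ⟩

/-- `f = a (x - θ y)(x² + B x y + C y²)`. -/
structure Splitting (f : BCF) (θ B C : ℝ) : Prop where
  hb : (f.b : ℝ) = f.a * (B - θ)
  hc : (f.c : ℝ) = f.a * (C - B * θ)
  hd : (f.d : ℝ) = - f.a * C * θ

lemma Splitting.evalR_eq {f : BCF} {θ B C : ℝ} (h : Splitting f θ B C) (x y : ℝ) :
    f.evalR x y = f.a * (x - θ * y) * (x ^ 2 + B * x * y + C * y ^ 2) := by
  simp only [evalR, h.hb, h.hc, h.hd]; ring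

lemma Splitting.disc_eq {f : BCF} {θ B C : ℝ} (h : Splitting f θ B C) :
    -(f.disc : ℝ) = f.a ^ 4 * (4 * C - B ^ 2) * (θ ^ 2 + B * θ + C) ^ 2 := by
  simp only [disc]; push_cast; rw [h.hb, h.hc, h.hd]; ring

lemma exists_splitting {f : BCF} (ha : f.a ≠ 0) : ∃ θ B C : ℝ, Splitting f θ B C := by
  obtain ⟨θ, h⟩ := exists_root f ha
  have ha' : (f.a : ℝ) ≠ 0 := by exact_mod_cast ha
  refine ⟨θ, f.b / f.a + θ, f.c / f.a + (f.b / f.a + θ) * θ, ?_, ?_, ?_⟩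
  · field_simp; ring
  · field_simp; ring
  · simp only [evalR] at h; field_simp; linear_combination h

lemma Splitting.pos {f : BCF} {θ B C : ℝ} (h : Splitting f θ B C) (hf : f.disc < 0) :
    0 < 4 * C - B ^ 2 := by
  have h1 := h.disc_eq
  have h2 : (f.disc : ℝ) < 0 := by exact_mod_cast hf
  by_contra h0
  have : f.a ^ 4 * (4 * C - B ^ 2) * (θ ^ 2 + B * θ + C) ^ 2 ≤ 0 := by
    apply mul_nonpos_of_nonpos_of_nonneg _ (by positivity)
    exact mul_nonpos_of_nonneg_of_nonpos (by positivity) (by linarith)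
  linarith

lemma Splitting.quad_pos {f : BCF} {θ B C : ℝ} (h : Splitting f θ B C) (hf : f.disc < 0) {x y : ℝ}
    (hxy : x ≠ 0 ∨ y ≠ 0) : 0 < x ^ 2 + B * x * y + C * y ^ 2 := by
  have := h.pos hf
  rcases hxy with hx | hy
  · by_cases hy : y = 0
    · subst hy; simp; positivity
    · have : 0 < y ^ 2 := by positivity
      nlinarith [sq_nonneg (x + B / 2 * y)]
  · have : 0 < y ^ 2 := by positivity
    nlinarith [sq_nonneg (x + B / 2 * y)]

/-- Two real zeros of a form of negative discriminant are proportional. -/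
lemma real_zero_unique {f : BCF} (hf : f.Good) {x y x' y' : ℝ} (h : f.evalR x y = 0)
    (h' : f.evalR x' y' = 0) : x * y' - x' * y = 0 := by
  obtain ⟨θ, B, C, hF⟩ := exists_splitting hf.1.a_ne
  have ha : (f.a : ℝ) ≠ 0 := by exact_mod_cast hf.1.a_ne
  have key : ∀ x y : ℝ, f.evalR x y = 0 → x = θ * y := by
    intro x y h
    rw [hF.evalR_eq] at h
    by_cases hxy : x ≠ 0 ∨ y ≠ 0
    · have := hF.quad_pos hf.2 hxy
      have h2 := (mul_eq_zero.mp h).resolve_right this.ne'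
      have := (mul_eq_zero.mp h2).resolve_left ha
      linarith
    · push Not at hxy
      rw [hxy.1, hxy.2]; simp
  rw [key _ _ h, key _ _ h']; ring

lemma Irr.quad_eq_zero {f : BCF} (hf : f.Irr) {θ : ℝ} (hθ : f.evalR θ 1 = 0) {α β γ : ℤ}
    (h : (α : ℝ) * θ ^ 2 + β * θ + γ = 0) : α = 0 ∧ β = 0 ∧ γ = 0 := by
  have ha := hf.a_ne
  have hlin : ∀ r s : ℤ, (r : ℝ) * θ + s = 0 → r = 0 ∧ s = 0 := by
    intro r s hrs
    by_cases hr : r = 0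
    · subst hr; simp at hrs; exact ⟨rfl, hrs⟩
    · exfalso
      have e : (s : ℝ) = - r * θ := by linarith
      have : f.evalR (-s : ℤ) (r : ℤ) = 0 := by
        have h3 : f.evalR (-s : ℤ) (r : ℤ) = r ^ 3 * f.evalR θ 1 := by
          simp only [evalR]; push_cast; rw [e]; ring
        rw [h3, hθ, mul_zero]
      rw [evalR_intCast] at this
      exact hr (hf _ _ (by exact_mod_cast this)).2
  by_cases hα : α = 0
  · subst hα
    simp only [Int.cast_zero, zero_mul, zero_add] at h
    exact ⟨rfl, hlin _ _ h⟩
  · exfalso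
    -- division of `f` by the quadratic polynomial
    have h1 := hlin (f.c * α ^ 2 - α * f.a * γ - β * (α * f.b - β * f.a))
      (f.d * α ^ 2 - γ * (α * f.b - β * f.a)) (by
        push_cast
        simp only [evalR] at hθ
        linear_combination (α : ℝ) ^ 2 * hθ - (α * f.a * θ + (α * f.b - β * f.a)) * h)
    have h2 : f.eval (-(α * f.b - β * f.a)) (α * f.a) * α ^ 2 = 0 := by
      simp only [eval]
      linear_combination (-(α * f.b - β * f.a)) * (α * f.a) ^ 2 * h1.1 + (α * f.a) ^ 3 * h1.2
    have h3 := (mul_eq_zero.mp h2).resolve_right (by positivity)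
    exact (mul_ne_zero hα ha) (hf _ _ h3).2

/-- Substitutions act freely on good forms. -/
lemma Good.sub_inj {f : BCF} (hf : f.Good) {m n k l m' n' k' l' : ℤ}
    (hd : m * l - n * k ≠ 0) (h : f.sub m n k l = f.sub m' n' k' l') :
    m = m' ∧ n = n' ∧ k = k' ∧ l = l' := by
  have hg := hf.sub hd
  obtain ⟨θ, hθ⟩ := exists_root _ hg.1.a_ne
  have h1 := hθ
  rw [sub_evalR] at h1
  have h2 := hθ
  rw [h, sub_evalR] at h2
  have h3 := real_zero_unique hf h1 h2
  obtain ⟨e1, e2, e3⟩ := hg.1.quad_eq_zero hθ (α := m * k' - m' * k)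
    (β := m * l' + n * k' - m' * l - n' * k) (γ := n * l' - n' * l) (by
      push_cast; linear_combination h3)
  set δ := m * l - n * k with hδ
  set c := m * l' - n' * k with hc
  have c1 : c * m = δ * m' := by rw [hc, hδ]; linear_combination m * e2 - n * e1
  have c2 : c * n = δ * n' := by rw [hc, hδ]; linear_combination m * e3
  have c3 : c * k = δ * k' := by
    rw [hc, hδ]; linear_combination k * e2 - l * e1
  have c4 : c * l = δ * l' := by
    rw [hc, hδ]; linear_combination k * e3
  have h5 : BCF.smul (c ^ 3) (f.sub m n k l) = BCF.smul (δ ^ 3) (f.sub m n k l) := by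
    have : BCF.smul (c ^ 3) (f.sub m n k l) = f.sub (c * m) (c * n) (c * k) (c * l) := by
      ext <;> simp only [BCF.sub, BCF.smul] <;> ring
    rw [this, c1, c2, c3, c4, h]
    ext <;> simp only [BCF.sub, BCF.smul] <;> ring
  have h6 : c ^ 3 = δ ^ 3 := by
    have := congrArg BCF.a h5
    simp only [BCF.smul] at this
    exact mul_right_cancel₀ hg.1.a_ne this
  have h7 : c = δ := (Odd.strictMono_pow (by decide : Odd 3)).injective h6
  rw [h7] at c1 c2 c3 c4
  exact ⟨mul_left_cancel₀ hd c1, mul_left_cancel₀ hd c2, mul_left_cancel₀ hd c3,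
    mul_left_cancel₀ hd c4⟩

end BCF

namespace BCF

/-- The number of zeros of `f` on the projective line modulo `p`. -/
def np (p : ℕ) (f : BCF) : ℕ :=
  ((Finset.range p).filter fun t : ℕ => (p : ℤ) ∣ f.eval t 1).card + if (p : ℤ) ∣ f.a then 1 else 0

/-- Evaluation modulo `p`. -/
def evalZ (p : ℕ) (f : BCF) (x y : ZMod p) : ZMod p :=
  f.a * x ^ 3 + f.b * x ^ 2 * y + f.c * x * y ^ 2 + f.d * y ^ 3

lemma evalZ_intCast (p : ℕ) (f : BCF) (x y : ℤ) :
    evalZ p f x y = ((f.eval x y : ℤ) : ZMod p) := by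
  simp only [evalZ, eval]; push_cast; ring

lemma sub_evalZ (P : ℕ) (f : BCF) (p q r s : ℤ) (x y : ZMod P) :
    evalZ P (f.sub p q r s) x y = evalZ P f (p * x + q * y) (r * x + s * y) := by
  simp only [evalZ, sub]; push_cast; ring

lemma card_zeros (p : ℕ) [Fact p.Prime] (f : BCF) :
    (Finset.univ.filter fun v : ZMod p × ZMod p => evalZ p f v.1 v.2 = 0).card
      = 1 + (p - 1) * np p f := by
  classical
  have hroots : ((Finset.range p).filter fun t : ℕ => (p : ℤ) ∣ f.eval t 1).card =
      (Finset.univ.filter fun t : ZMod p => evalZ p f t 1 = 0).card := by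
    refine Finset.card_nbij' (fun t => (t : ZMod p)) (fun t => t.val) ?_ ?_ ?_ ?_
    · intro t ht
      simp only [Finset.coe_filter, Finset.mem_range, Set.mem_ofPred_eq, Finset.mem_univ,
        true_and] at ht ⊢
      have := evalZ_intCast p f t 1
      push_cast at this
      rw [this]; exact (ZMod.intCast_zmod_eq_zero_iff_dvd _ _).mpr ht.2
    · intro t ht
      simp only [Finset.coe_filter, Finset.mem_range, Set.mem_ofPred_eq, Finset.mem_univ,
        true_and] at ht ⊢
      refine ⟨ZMod.val_lt t, ?_⟩
      rw [← ZMod.intCast_zmod_eq_zero_iff_dvd, ← evalZ_intCast]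
      push_cast
      rw [ZMod.natCast_zmod_val]; exact ht
    · intro t ht
      simp only [Finset.coe_filter, Finset.mem_range, Set.mem_ofPred_eq] at ht
      exact ZMod.val_cast_of_lt ht.1
    · intro t _
      exact ZMod.natCast_zmod_val t
  have hsum : (Finset.univ.filter fun v : ZMod p × ZMod p => evalZ p f v.1 v.2 = 0).card =
      ∑ y : ZMod p, (Finset.univ.filter fun x : ZMod p => evalZ p f x y = 0).card := by
    simp only [Finset.card_filter]
    rw [Fintype.sum_prod_type_right]
  have hy : ∀ y ∈ ({0}ᶜ : Finset (ZMod p)),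
      (Finset.univ.filter fun x : ZMod p => evalZ p f x y = 0).card =
      (Finset.univ.filter fun t : ZMod p => evalZ p f t 1 = 0).card := by
    intro y hy
    have hy0 : y ≠ 0 := by simpa using hy
    have hs : ∀ t, evalZ p f (t * y) y = y ^ 3 * evalZ p f t 1 := by
      intro t; simp only [evalZ]; ring
    refine Finset.card_nbij' (fun x => x / y) (fun t => t * y) ?_ ?_ ?_ ?_
    · intro x hx
      simp only [Finset.coe_filter, Finset.mem_univ, true_and, Set.mem_ofPred_eq] at hx ⊢
      have := hs (x / y)
      rw [div_mul_cancel₀ _ hy0, hx] at this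
      exact (mul_eq_zero.mp this.symm).resolve_left (pow_ne_zero _ hy0)
    · intro t ht
      simp only [Finset.coe_filter, Finset.mem_univ, true_and, Set.mem_ofPred_eq] at ht ⊢
      rw [hs, ht, mul_zero]
    · intro x _; exact div_mul_cancel₀ _ hy0
    · intro t _; exact mul_div_cancel_right₀ _ hy0
  have h0 : (Finset.univ.filter fun x : ZMod p => evalZ p f x 0 = 0).card =
      1 + (p - 1) * if (p : ℤ) ∣ f.a then 1 else 0 := by
    have e : ∀ x : ZMod p, evalZ p f x 0 = f.a * x ^ 3 := by intro x; simp [evalZ]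
    simp only [e]
    split_ifs with h
    · have : (f.a : ZMod p) = 0 := (ZMod.intCast_zmod_eq_zero_iff_dvd _ _).mpr h
      simp only [this, zero_mul, Finset.filter_true, Finset.card_univ, ZMod.card]
      have := (Fact.out : p.Prime).one_lt
      omega
    · have : (f.a : ZMod p) ≠ 0 := fun h' => h ((ZMod.intCast_zmod_eq_zero_iff_dvd _ _).mp h')
      have e2 : (Finset.univ.filter fun x : ZMod p => (f.a : ZMod p) * x ^ 3 = 0) = {0} := by
        ext x; simp [this]
      rw [e2]; simp
  rw [hsum, Fintype.sum_eq_add_sum_compl 0, h0, Finset.sum_congr rfl hy, Finset.sum_const,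
    Finset.card_compl, Finset.card_singleton, ZMod.card, np, hroots, smul_eq_mul]
  ring

lemma np_eq_of_card {p : ℕ} (hp : p.Prime) {f g : BCF}
    (φ : ZMod p × ZMod p → ZMod p × ZMod p) (hφ : Function.Bijective φ)
    (h : ∀ v, evalZ p g v.1 v.2 = 0 ↔ evalZ p f (φ v).1 (φ v).2 = 0) : np p g = np p f := by
  have := Fact.mk hp
  have e : (Finset.univ.filter fun v : ZMod p × ZMod p => evalZ p g v.1 v.2 = 0).card =
      (Finset.univ.filter fun v : ZMod p × ZMod p => evalZ p f v.1 v.2 = 0).card := by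
    refine Finset.card_bij (fun v _ => φ v) ?_ ?_ ?_
    · intro v hv
      simp only [Finset.mem_filter, Finset.mem_univ, true_and] at hv ⊢
      exact (h v).mp hv
    · intro v _ w _ hvw; exact hφ.1 hvw
    · intro w hw
      obtain ⟨v, rfl⟩ := hφ.2 w
      simp only [Finset.mem_filter, Finset.mem_univ, true_and] at hw ⊢
      exact ⟨v, (h v).mpr hw, rfl⟩
  rw [card_zeros, card_zeros] at e
  have h1 : 0 < p - 1 := by have := hp.one_lt; omega
  exact Nat.eq_of_mul_eq_mul_left h1 (by omega)

lemma np_smul {p : ℕ} (hp : p.Prime) {n : ℤ} (hn : ¬ (p : ℤ) ∣ n) (f : BCF) :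
    np p (smul n f) = np p f := by
  have := Fact.mk hp
  refine np_eq_of_card hp id Function.bijective_id ?_
  intro v
  have : (n : ZMod p) ≠ 0 := fun h' => hn ((ZMod.intCast_zmod_eq_zero_iff_dvd _ _).mp h')
  have e : evalZ p (smul n f) v.1 v.2 = n * evalZ p f v.1 v.2 := by
    simp only [evalZ, smul]; push_cast; ring
  rw [e]; simp [this]

lemma np_sub {P : ℕ} (hP : P.Prime) {p q r s : ℤ} (h : ¬ (P : ℤ) ∣ p * s - q * r) (f : BCF) :
    np P (f.sub p q r s) = np P f := by
  have := Fact.mk hP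
  have hd : (p * s - q * r : ZMod P) ≠ 0 := fun h' =>
    h ((ZMod.intCast_zmod_eq_zero_iff_dvd _ _).mp (by push_cast; exact h'))
  refine np_eq_of_card hP (fun v => (p * v.1 + q * v.2, r * v.1 + s * v.2)) ?_ ?_
  · apply Function.Injective.bijective_of_finite
    rintro ⟨x, y⟩ ⟨x', y'⟩ hv
    simp only [Prod.mk.injEq] at hv
    obtain ⟨h1, h2⟩ := hv
    have e1 : (p * s - q * r : ZMod P) * (x - x') = 0 := by
      linear_combination (s : ZMod P) * h1 - q * h2
    have e2 : (p * s - q * r : ZMod P) * (y - y') = 0 := by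
      linear_combination (p : ZMod P) * h2 - r * h1
    have e1 := (mul_eq_zero.mp e1).resolve_left hd
    have e2 := (mul_eq_zero.mp e2).resolve_left hd
    rw [sub_eq_zero.mp e1, sub_eq_zero.mp e2]
  · intro v; rw [sub_evalZ]

/-- Matrices representing the sublattices of index `p`. -/
def ptMat (p : ℤ) : Option ℕ → ℤ × ℤ × ℤ × ℤ
  | none => (1, 0, 0, p)
  | some t => (t, p, 1, 0)

/-- Substitution by `ptMat`. -/
def subPt (p : ℤ) (f : BCF) (o : Option ℕ) : BCF :=
  f.sub (ptMat p o).1 (ptMat p o).2.1 (ptMat p o).2.2.1 (ptMat p o).2.2.2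

lemma hnf {p : ℕ} (hp : p.Prime) {m n k l : ℤ} (h : |m * l - n * k| = p) :
    ∃ o : Option ℕ, (∀ t ∈ o, t < p) ∧ ∃ u v w x : ℤ, IsUnit (u * x - v * w) ∧
      (m * u + n * w, m * v + n * x, k * u + l * w, k * v + l * x) = ptMat p o := by
  have hp0 : (p : ℤ) ≠ 0 := by exact_mod_cast hp.ne_zero
  obtain ⟨ε, hε, hdet⟩ : ∃ ε : ℤ, ε * ε = 1 ∧ m * l - n * k = ε * p := by
    rcases abs_eq (by positivity) |>.mp h with h | h
    · exact ⟨1, by norm_num, by linarith⟩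
    · exact ⟨-1, by norm_num, by linarith⟩
  by_cases hc : IsCoprime k l
  · obtain ⟨u, v, huv⟩ := hc
    set t0 := m * u + n * v with ht0
    refine ⟨some (t0 % p).toNat, ?_, u - l * ε * (t0 / p), l * ε, v + k * ε * (t0 / p), -k * ε, ?_, ?_⟩
    · intro t ht
      simp only [Option.mem_def, Option.some.injEq] at ht
      rw [← ht]
      have := Int.emod_lt_of_pos t0 (by positivity : (0 : ℤ) < p) |>.trans_eq rfl
      have := Int.emod_nonneg t0 hp0
      omega
    · have : (u - l * ε * (t0 / p)) * (-k * ε) - l * ε * (v + k * ε * (t0 / p)) = -ε := by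
        linear_combination (-ε) * huv
      rw [this]
      exact IsUnit.of_mul_eq_one (-ε) (by linear_combination hε)
    · have e1 : (((t0 % p).toNat : ℕ) : ℤ) = t0 % p := Int.toNat_of_nonneg (Int.emod_nonneg t0 hp0)
      simp only [ptMat, Prod.mk.injEq, e1]
      refine ⟨?_, ?_, ?_, ?_⟩
      · have := Int.emod_add_mul_ediv t0 p
        linear_combination -this - (t0 / p) * ε * hdet - (t0 / p) * p * hε
      · linear_combination ε * hdet + p * hε
      · linear_combination huv
      · ring
  · have hg : ∃ q : ℕ, q.Prime ∧ (q : ℤ) ∣ k ∧ (q : ℤ) ∣ l := by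
      rw [Int.isCoprime_iff_gcd_eq_one] at hc
      refine ⟨(Int.gcd k l).minFac, Nat.minFac_prime hc, ?_, ?_⟩
      · exact (Int.natCast_dvd_natCast.mpr (Nat.minFac_dvd _)).trans (Int.gcd_dvd_left ..)
      · exact (Int.natCast_dvd_natCast.mpr (Nat.minFac_dvd _)).trans (Int.gcd_dvd_right ..)
    obtain ⟨q, hq, hqk, hql⟩ := hg
    have hqp : q ∣ p := by
      have : (q : ℤ) ∣ |m * l - n * k| :=
        (dvd_abs _ _).mpr (dvd_sub (hql.mul_left _) (hqk.mul_left _))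
      rw [h] at this
      exact Int.natCast_dvd_natCast.mp this
    obtain rfl : q = p := (Nat.prime_dvd_prime_iff_eq hq hp).mp hqp
    obtain ⟨k', rfl⟩ := hqk
    obtain ⟨l', rfl⟩ := hql
    have h1 : m * l' - n * k' = ε := by
      apply mul_left_cancel₀ hp0; linear_combination hdet
    refine ⟨none, by simp, ε * l', -ε * n, -ε * k', ε * m, ?_, ?_⟩
    · have : ε * l' * (ε * m) - -ε * n * (-ε * k') = ε := by
        linear_combination ε * ε * h1 + ε * hε
      rw [this]
      exact IsUnit.of_mul_eq_one ε hε
    · simp only [ptMat, Prod.mk.injEq]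
      refine ⟨?_, ?_, ?_, ?_⟩
      · linear_combination ε * h1 + hε
      · ring
      · ring
      · linear_combination q * ε * h1 + q * hε

lemma subPt_dvd {p : ℕ} {f : BCF} {o : Option ℕ} :
    (∃ g, smul p g = subPt p f o) ↔ (p : ℤ) ∣ (match o with | none => f.a | some t => f.eval t 1) := by
  constructor
  · rintro ⟨g, hg⟩
    have := congrArg BCF.a hg
    cases o with
    | none => exact ⟨g.a, by simp [smul, subPt, sub, ptMat] at this; exact this.symm⟩
    | some t => exact ⟨g.a, by
        simp only [smul, subPt, sub, ptMat] at this; simp only [eval]; linear_combination -this⟩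
  · cases o with
    | none =>
      rintro ⟨x, hx⟩
      simp only at hx
      refine ⟨⟨x, f.b, f.c * p, f.d * p ^ 2⟩, ?_⟩
      ext <;> simp only [smul, subPt, sub, ptMat] <;> try rw [hx]
      all_goals ring
    | some t =>
      rintro ⟨x, hx⟩
      simp only [eval] at hx
      refine ⟨⟨x, 3 * f.a * t ^ 2 + 2 * f.b * t + f.c, 3 * f.a * t * p + f.b * p,
        f.a * p ^ 2⟩, ?_⟩
      ext <;> simp only [smul, subPt, sub, ptMat]
      · linear_combination -hx
      all_goals ring

lemma ptMat_det {p : ℕ} (o : Option ℕ) :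
    |(ptMat p o).1 * (ptMat p o).2.2.2 - (ptMat p o).2.1 * (ptMat p o).2.2.1| = p := by
  cases o <;> simp [ptMat]

/-- The zeros of `f` modulo `p` as a finset of points. -/
def pts (p : ℕ) (f : BCF) : Finset (Option ℕ) :=
  Finset.disjUnion (((Finset.range p).filter fun t : ℕ => (p : ℤ) ∣ f.eval t 1).map
    Function.Embedding.some) (if (p : ℤ) ∣ f.a then {none} else ∅) (by
      rw [Finset.disjoint_left]
      intro o ho ho'
      simp only [Finset.mem_map] at ho
      obtain ⟨t, -, rfl⟩ := ho
      split_ifs at ho' <;> simp at ho')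

lemma card_pts (p : ℕ) (f : BCF) : (pts p f).card = np p f := by
  rw [pts, Finset.card_disjUnion, Finset.card_map, np]
  split_ifs <;> simp

lemma mem_pts {p : ℕ} {f : BCF} {o : Option ℕ} : o ∈ pts p f ↔
    (∀ t ∈ o, t < p) ∧ (p : ℤ) ∣ (match o with | none => f.a | some t => f.eval t 1) := by
  rw [pts, Finset.mem_disjUnion]
  cases o with
  | none => split_ifs with h <;> simp [h]
  | some t => split_ifs with h <;> simp

theorem ncard_step {p : ℕ} (hp : p.Prime) {f : BCF} (hf : f.Good) :
    {ω : Orb | Step p ω (orb f hf)}.Finite ∧ {ω : Orb | Step p ω (orb f hf)}.ncard = np p f := by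
  classical
  have hp0 : (p : ℤ) ≠ 0 := by exact_mod_cast hp.ne_zero
  let F : Option ℕ → Orb := fun o =>
    if h : ∃ g, ∃ _ : g.Good, BCF.smul p g = subPt p f o then orb h.choose h.choose_spec.choose
    else orb f hf
  have hF : ∀ o ∈ pts p f, ∃ g, ∃ hg : g.Good, BCF.smul p g = subPt p f o ∧ F o = orb g hg := by
    intro o ho
    obtain ⟨g, hg⟩ := subPt_dvd.mpr (mem_pts.mp ho).2
    have hgood : g.Good := (FStep.good_iff hp0 (f := f) ⟨_, _, _, _, ptMat_det o, hg⟩).mpr hf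
    have hex : ∃ g, ∃ _ : g.Good, BCF.smul p g = subPt p f o := ⟨g, hgood, hg⟩
    refine ⟨hex.choose, hex.choose_spec.choose, hex.choose_spec.choose_spec, ?_⟩
    simp only [F, dif_pos hex]
  have himg : {ω : Orb | Step p ω (orb f hf)} = F '' (pts p f : Set (Option ℕ)) := by
    ext ω
    simp only [Set.mem_ofPred_eq, Set.mem_image, Finset.mem_coe]
    constructor
    · intro h
      obtain ⟨g, hg, rfl⟩ := ω.exists_rep
      obtain ⟨m, n, k, l, hd, h⟩ := h
      simp only at h
      obtain ⟨o, ho, u, v, w, x, hu, hM⟩ := hnf hp hd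
      have e : BCF.smul p (g.sub u v w x) = subPt p f o := by
        rw [← smul_sub, h, sub_sub, subPt, ← hM]
      have hmem : o ∈ pts p f := mem_pts.mpr ⟨ho, subPt_dvd.mp ⟨_, e⟩⟩
      refine ⟨o, hmem, ?_⟩
      obtain ⟨g', hg', h1, h2⟩ := hF o hmem
      rw [h2]
      have : g' = g.sub u v w x := smul_inj hp0 (h1.trans e.symm)
      subst this
      exact (orb_eq_iff.mpr ⟨u, v, w, x, hu, rfl⟩).symm
    · rintro ⟨o, ho, rfl⟩
      obtain ⟨g, hg, h1, h2⟩ := hF o ho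
      rw [h2]
      exact ⟨_, _, _, _, ptMat_det o, h1⟩
  have hinj : Set.InjOn F (pts p f : Set (Option ℕ)) := by
    intro o ho o' ho' h
    obtain ⟨g, hg, h1, h2⟩ := hF o ho
    obtain ⟨g', hg', h1', h2'⟩ := hF o' ho'
    rw [h2, h2', orb_eq_iff] at h
    obtain ⟨u, v, w, x, hu, rfl⟩ := h
    rw [← smul_sub, h1, subPt, sub_sub] at h1'
    obtain ⟨e1, e2, e3, e4⟩ := hf.sub_inj (by
      have h3 := ptMat_det (p := p) o'
      have h4 : (ptMat p o').1 * (ptMat p o').2.2.2 - (ptMat p o').2.1 * (ptMat p o').2.2.1 ≠ 0 := by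
        intro h0; rw [h0] at h3; simp at h3; exact hp0 h3.symm
      exact h4) h1'.symm
    have hlt := (mem_pts.mp ho).1
    have hlt' := (mem_pts.mp ho').1
    cases o with
    | none =>
      cases o' with
      | none => rfl
      | some t' =>
        exfalso
        simp [ptMat] at e1 e2 e3 e4
        have : (p : ℤ) ∣ 1 := ⟨w, e3⟩
        exact hp.one_lt.ne' (by exact_mod_cast Int.eq_one_of_dvd_one (by positivity) this)
    | some t =>
      cases o' with
      | none =>
        exfalso
        simp [ptMat] at e1 e2 e3 e4
        subst e3
        have : (p : ℤ) ∣ 1 := ⟨w, by linarith⟩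
        exact hp.one_lt.ne' (by exact_mod_cast Int.eq_one_of_dvd_one (by positivity) this)
      | some t' =>
        simp [ptMat] at e1 e2 e3 e4 hlt hlt'
        subst e3
        congr 1
        have h5 : (p : ℤ) ∣ t' - t := ⟨w, by linarith⟩
        have h6 := Int.eq_zero_of_abs_lt_dvd h5 (by rw [abs_lt]; constructor <;> linarith)
        omega
  rw [himg]
  exact ⟨(Finset.finite_toSet _).image _, by
    rw [hinj.ncard_image, Set.ncard_coe_finset, card_pts]⟩

end BCF

namespace BCF

/-- Divisibility of a form by an integer. -/
def Dvd (p : ℤ) (f : BCF) : Prop := ∃ g, f = smul p g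

lemma Dvd.smul {p : ℤ} {f : BCF} (h : Dvd p f) (n : ℤ) : Dvd p (smul n f) := by
  obtain ⟨g, rfl⟩ := h
  exact ⟨BCF.smul n g, by rw [smul_smul, smul_smul, mul_comm]⟩

lemma Dvd.sub {p : ℤ} {f : BCF} (h : Dvd p f) (m n k l : ℤ) : Dvd p (f.sub m n k l) := by
  obtain ⟨g, rfl⟩ := h
  exact ⟨g.sub m n k l, by rw [smul_sub]⟩

lemma dvd_iff {p : ℤ} {f : BCF} : Dvd p f ↔ p ∣ f.a ∧ p ∣ f.b ∧ p ∣ f.c ∧ p ∣ f.d := by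
  constructor
  · rintro ⟨g, rfl⟩; exact ⟨⟨_, rfl⟩, ⟨_, rfl⟩, ⟨_, rfl⟩, ⟨_, rfl⟩⟩
  · rintro ⟨⟨a, ha⟩, ⟨b, hb⟩, ⟨c, hc⟩, ⟨d, hd⟩⟩
    exact ⟨⟨a, b, c, d⟩, by ext <;> simp [BCF.smul, *]⟩

/-- The partial derivative in the first variable. -/
def evalX (f : BCF) (x y : ℤ) : ℤ := 3 * f.a * x ^ 2 + 2 * f.b * x * y + f.c * y ^ 2

/-- The partial derivative in the second variable. -/
def evalY (f : BCF) (x y : ℤ) : ℤ := f.b * x ^ 2 + 2 * f.c * x * y + 3 * f.d * y ^ 2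

lemma smul_evalX (n : ℤ) (f : BCF) (x y : ℤ) : (smul n f).evalX x y = n * f.evalX x y := by
  simp only [evalX, smul]; ring

lemma smul_evalY (n : ℤ) (f : BCF) (x y : ℤ) : (smul n f).evalY x y = n * f.evalY x y := by
  simp only [evalY, smul]; ring

/-- The criterion for nonmaximality at `p`. -/
def Crit (p : ℤ) (f : BCF) : Prop :=
  Dvd p f ∨ ∃ x y, ¬ (p ∣ x ∧ p ∣ y) ∧ p ^ 2 ∣ f.eval x y ∧ p ∣ f.evalX x y ∧ p ∣ f.evalY x y

lemma Crit.smul {p : ℤ} {f : BCF} (h : Crit p f) (n : ℤ) : Crit p (smul n f) := by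
  rcases h with h | ⟨x, y, h0, h1, h2, h3⟩
  · exact Or.inl (h.smul n)
  · refine Or.inr ⟨x, y, h0, ?_, ?_, ?_⟩
    · rw [smul_eval]; exact h1.mul_left _
    · rw [smul_evalX]; exact h2.mul_left n
    · rw [smul_evalY]; exact h3.mul_left n

lemma Dvd.of_smul {p : ℤ} (hp : Prime p) {n : ℤ} (hn : ¬ p ∣ n) {f : BCF} (h : Dvd p (BCF.smul n f)) :
    Dvd p f := by
  rw [dvd_iff] at h ⊢
  simp only [BCF.smul] at h
  exact ⟨(hp.dvd_or_dvd h.1).resolve_left hn, (hp.dvd_or_dvd h.2.1).resolve_left hn,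
    (hp.dvd_or_dvd h.2.2.1).resolve_left hn, (hp.dvd_or_dvd h.2.2.2).resolve_left hn⟩

lemma Crit.of_smul {p : ℤ} (hp : Prime p) {n : ℤ} (hn : ¬ p ∣ n) {f : BCF}
    (h : Crit p (BCF.smul n f)) : Crit p f := by
  rcases h with h | ⟨x, y, h0, h1, h2, h3⟩
  · exact Or.inl (h.of_smul hp hn)
  · refine Or.inr ⟨x, y, h0, ?_, ?_, ?_⟩
    · rw [smul_eval] at h1
      have : IsCoprime (p ^ 2) n := IsCoprime.pow_left ((Prime.coprime_iff_not_dvd hp).mpr hn)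
      exact this.dvd_of_dvd_mul_left h1
    · refine (hp.dvd_or_dvd (a := n) ?_).resolve_left hn
      rwa [smul_evalX] at h2
    · refine (hp.dvd_or_dvd (a := n) ?_).resolve_left hn
      rwa [smul_evalY] at h3

lemma sub_adj (f : BCF) (m n k l : ℤ) :
    (f.sub m n k l).sub l (-n) (-k) m = smul ((m * l - n * k) ^ 3) f := by
  rw [sub_sub, ← sub_scalar]
  congr 1 <;> ring

lemma Crit.of_sub {p : ℤ} (hp : Prime p) {m n k l : ℤ} (hd : ¬ p ∣ m * l - n * k) {f : BCF}
    (h : Crit p (f.sub m n k l)) : Crit p f := by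
  have hinv : ∀ x y : ℤ, p ∣ m * x + n * y → p ∣ k * x + l * y → p ∣ x ∧ p ∣ y := by
    intro x y h1 h2
    constructor
    · refine (hp.dvd_or_dvd (a := m * l - n * k) ?_).resolve_left hd
      convert dvd_sub (h1.mul_left l) (h2.mul_left n) using 1; ring
    · refine (hp.dvd_or_dvd (a := m * l - n * k) ?_).resolve_left hd
      convert dvd_sub (h2.mul_left m) (h1.mul_left k) using 1; ring
  have hinv' : ∀ x y : ℤ, p ∣ m * x + k * y → p ∣ n * x + l * y → p ∣ x ∧ p ∣ y := by
    intro x y h1 h2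
    constructor
    · refine (hp.dvd_or_dvd (a := m * l - n * k) ?_).resolve_left hd
      convert dvd_sub (h1.mul_left l) (h2.mul_left k) using 1; ring
    · refine (hp.dvd_or_dvd (a := m * l - n * k) ?_).resolve_left hd
      convert dvd_sub (h2.mul_left m) (h1.mul_left n) using 1; ring
  rcases h with h | ⟨x, y, h0, h1, h2, h3⟩
  · have := h.sub l (-n) (-k) m
    rw [sub_adj] at this
    exact Or.inl (this.of_smul hp fun h => hd (hp.dvd_of_dvd_pow h))
  · have h4 := hinv' (f.evalX (m * x + n * y) (k * x + l * y))
      (f.evalY (m * x + n * y) (k * x + l * y))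
      (by convert h2 using 1; simp only [evalX, evalY, BCF.sub]; ring)
      (by convert h3 using 1; simp only [evalX, evalY, BCF.sub]; ring)
    refine Or.inr ⟨m * x + n * y, k * x + l * y, fun h => h0 (hinv _ _ h.1 h.2), ?_, h4⟩
    rwa [sub_eval] at h1

lemma crit_sub_iff {p : ℤ} (hp : Prime p) {m n k l : ℤ} (hd : ¬ p ∣ m * l - n * k) {f : BCF} :
    Crit p (f.sub m n k l) ↔ Crit p f := by
  refine ⟨fun h => h.of_sub hp hd, fun h => ?_⟩
  have := h.smul ((m * l - n * k) ^ 3)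
  rw [← sub_adj] at this
  exact this.of_sub hp (by convert hd using 2; ring)

lemma crit_smul_iff {p : ℤ} (hp : Prime p) {n : ℤ} (hn : ¬ p ∣ n) {f : BCF} :
    Crit p (smul n f) ↔ Crit p f := ⟨fun h => h.of_smul hp hn, fun h => h.smul n⟩

lemma crit_iff_of_step {p q : ℤ} (hp : Prime p) (hq : ¬ p ∣ q) {f g : BCF} (h : FStep q f g) :
    Crit p f ↔ Crit p g := by
  obtain ⟨m, n, k, l, hd, h⟩ := h
  rw [← crit_smul_iff hp hq, h, crit_sub_iff hp]
  rwa [← dvd_abs, hd]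

lemma FStep.crit {p : ℤ} (hp : Prime p) {f g : BCF} (h : FStep p f g) : Crit p f := by
  obtain ⟨m, n, k, l, hd, h⟩ := h
  have hp0 : p ≠ 0 := hp.ne_zero
  have hpd : p ∣ m * l - n * k := by rw [← dvd_abs, hd]
  obtain ⟨x, y, u, v, h0, h1, h2⟩ : ∃ x y u v : ℤ, ¬ (p ∣ x ∧ p ∣ y) ∧ m * x + n * y = p * u ∧
      k * x + l * y = p * v := by
    obtain ⟨t, ht⟩ := hpd
    by_cases hA : p ∣ l ∧ p ∣ k
    · by_cases hB : p ∣ n ∧ p ∣ m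
      · exfalso
        obtain ⟨⟨l', rfl⟩, ⟨k', rfl⟩⟩ := hA
        obtain ⟨⟨n', rfl⟩, ⟨m', rfl⟩⟩ := hB
        have : p * p ∣ p := by
          conv_rhs => rw [← hd]
          rw [dvd_abs]
          exact ⟨m' * l' - n' * k', by ring⟩
        have h1 := (mul_dvd_mul_iff_left hp0).mp ((mul_one p).symm ▸ this : p * p ∣ p * 1)
        exact hp.not_isUnit (isUnit_of_dvd_one h1)
      · exact ⟨n, -m, 0, -t, by rwa [dvd_neg], by ring, by linear_combination -ht⟩
    · exact ⟨l, -k, t, 0, by rwa [dvd_neg], by linear_combination ht, by ring⟩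
  refine Or.inr ⟨x, y, h0, ?_, ?_, ?_⟩
  · refine ⟨g.eval u v, mul_left_cancel₀ hp0 ?_⟩
    rw [← smul_eval, h, sub_eval, h1, h2]
    simp only [eval]; ring
  · refine ⟨m * g.evalX u v + k * g.evalY u v, mul_left_cancel₀ hp0 ?_⟩
    have : p * f.evalX x y = (smul p f).evalX x y := by simp only [evalX, BCF.smul]; ring
    rw [this, h]
    have : (g.sub m n k l).evalX x y = m * g.evalX (m * x + n * y) (k * x + l * y) +
      k * g.evalY (m * x + n * y) (k * x + l * y) := by simp only [evalX, evalY, BCF.sub]; ring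
    rw [this, h1, h2]; simp only [evalX, evalY]; ring
  · refine ⟨n * g.evalX u v + l * g.evalY u v, mul_left_cancel₀ hp0 ?_⟩
    have : p * f.evalY x y = (smul p f).evalY x y := by simp only [evalY, BCF.smul]; ring
    rw [this, h]
    have : (g.sub m n k l).evalY x y = n * g.evalX (m * x + n * y) (k * x + l * y) +
      l * g.evalY (m * x + n * y) (k * x + l * y) := by simp only [evalX, evalY, BCF.sub]; ring
    rw [this, h1, h2]; simp only [evalX, evalY]; ring

lemma Crit.exists_step {p : ℤ} (hpp : 0 < p) (hp : Prime p) {f : BCF} (h : Crit p f) :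
    Dvd p f ∨ ∃ g, FStep p f g := by
  rcases h with h | ⟨x, y, h0, h1, h2, h3⟩
  · exact Or.inl h
  right
  by_cases hy : p ∣ y
  · -- the point at infinity
    obtain ⟨y', rfl⟩ := hy
    have hx : ¬ p ∣ x := fun h => h0 ⟨h, dvd_mul_right _ _⟩
    have hcop : IsCoprime p x := (Prime.coprime_iff_not_dvd hp).mpr hx
    have hb : p ∣ f.b := by
      have : p ∣ f.b * x ^ 2 := by
        have e : f.b * x ^ 2 = f.evalY x (p * y') - p * (2 * f.c * x * y' + 3 * f.d * p * y' ^ 2) := by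
          simp only [evalY]; ring
        rw [e]; exact dvd_sub h3 (dvd_mul_right _ _)
      exact (hcop.pow_right (n := 2)).dvd_of_dvd_mul_right this
    have ha : p ^ 2 ∣ f.a := by
      obtain ⟨b', hb'⟩ := hb
      have : p ^ 2 ∣ f.a * x ^ 3 := by
        have e : f.a * x ^ 3 = f.eval x (p * y') - p ^ 2 * (b' * x ^ 2 * y' + f.c * x * y' ^ 2
            + f.d * p * y' ^ 3) := by
          simp only [eval]; rw [hb']; ring
        rw [e]; exact dvd_sub h1 (dvd_mul_right _ _)
      exact (IsCoprime.pow hcop (m := 2) (n := 3)).dvd_of_dvd_mul_right this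
    obtain ⟨b', hb⟩ := hb
    obtain ⟨a', ha⟩ := ha
    refine ⟨⟨a', b', f.c, p * f.d⟩, p, 0, 0, 1, by simp [abs_of_pos hpp], ?_⟩
    ext <;> simp only [BCF.smul, BCF.sub]
    · rw [ha]; ring
    · rw [hb]; ring
    all_goals ring
  · obtain ⟨u, v, huv⟩ := (Prime.coprime_iff_not_dvd hp).mpr hy
    -- `t = v x` is the root
    set t := v * x with ht
    have hxt : x = t * y + p * (u * x) := by rw [ht]; linear_combination (-x) * huv
    set w := u * x with hw
    have hcop : IsCoprime p y := (Prime.coprime_iff_not_dvd hp).mpr hy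
    have hx' : p ∣ f.evalX t 1 := by
      have : p ∣ f.evalX t 1 * y ^ 2 := by
        have e : f.evalX t 1 * y ^ 2 = f.evalX x y - p * (3 * f.a * (2 * t * y * w + p * w ^ 2) +
            2 * f.b * w * y) := by
          simp only [evalX]; rw [hxt]; ring
        rw [e]; exact dvd_sub h2 (dvd_mul_right _ _)
      exact (hcop.pow_right (n := 2)).dvd_of_dvd_mul_right this
    have h1' : p ^ 2 ∣ f.eval t 1 := by
      obtain ⟨s, hs⟩ := hx'
      have : p ^ 2 ∣ f.eval t 1 * y ^ 3 := by
        have e : f.eval t 1 * y ^ 3 = f.eval x y - p ^ 2 * (s * w * y ^ 2 +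
            w ^ 2 * (3 * f.a * t * y + f.b * y) + f.a * p * w ^ 3) := by
          have hs' : p * s * (p * w * y ^ 2) = f.evalX t 1 * (p * w * y ^ 2) := by rw [hs]
          simp only [evalX] at hs'
          simp only [eval]; rw [hxt]; linear_combination hs'
        rw [e]; exact dvd_sub h1 (dvd_mul_right _ _)
      exact (IsCoprime.pow hcop (m := 2) (n := 3)).dvd_of_dvd_mul_right this
    obtain ⟨b', hb⟩ := hx'
    obtain ⟨a', ha⟩ := h1'
    simp only [evalX] at hb
    simp only [eval] at ha
    -- `f (t x + y, x)` has leading coefficients divisible by `p²`, `p`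
    refine ⟨⟨a', b', 3 * f.a * t + f.b, p * f.a⟩, 0, p, 1, -t, by simp [abs_of_pos hpp], ?_⟩
    ext <;> simp only [BCF.smul, BCF.sub]
    · ring
    · ring
    · linear_combination p * hb
    · linear_combination p * ha - p * t * hb

/-- The target of a step from a form not divisible by `p` is unique. -/
lemma FStep.unique {p : ℕ} (hp : p.Prime) {f g g' : BCF} (hf : ¬ Dvd p f) (h : FStep p f g)
    (h' : FStep p f g') : Rel g g' := by
  have hp0 : (p : ℤ) ≠ 0 := by exact_mod_cast hp.ne_zero
  have hpp : Prime (p : ℤ) := Nat.prime_iff_prime_int.mp hp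
  have key : ∀ g, FStep p f g → ∃ o : Option ℕ, (∀ t ∈ o, t < p) ∧ ∃ g', Rel g g' ∧
      smul p f = g'.sub (ptMat p o).1 (ptMat p o).2.2.1 (ptMat p o).2.1 (ptMat p o).2.2.2 := by
    rintro g ⟨m, n, k, l, hd, h⟩
    obtain ⟨o, ho, u, v, w, x, hu, hM⟩ := hnf hp (m := m) (n := k) (k := n) (l := l)
      (by rw [← hd]; congr 1; ring)
    obtain ⟨g', hg'⟩ : ∃ g', g = BCF.sub g' u w v x ∧ Rel g g' := by
      have hr : Rel (g.sub (IsUnit.unit hu * x) (-(IsUnit.unit hu * w)) (-(IsUnit.unit hu * v))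
          (IsUnit.unit hu * u)) g := by
        refine Rel.symm ⟨_, _, _, _, ?_, rfl⟩
        have : (IsUnit.unit hu : ℤ) * x * (IsUnit.unit hu * u) - -(IsUnit.unit hu * w) *
          -(IsUnit.unit hu * v) = (IsUnit.unit hu : ℤ) * IsUnit.unit hu * (u * x - v * w) := by ring
        rw [this]
        exact ((IsUnit.unit hu).isUnit.mul (IsUnit.unit hu).isUnit).mul hu
      have hsq : (u * x - v * w) * (u * x - v * w) = 1 := Int.isUnit_mul_self hu
      refine ⟨_, ?_, hr.symm⟩
      rw [sub_sub]
      simp only [IsUnit.unit_spec]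
      conv_lhs => rw [← sub_one g]
      congr 1
      · linear_combination -hsq
      · ring
      · ring
      · linear_combination -hsq
    refine ⟨o, ho, g', hg'.2, ?_⟩
    rw [h, hg'.1, sub_sub]
    simp only [← hM]
    congr 1 <;> ring
  obtain ⟨o, ho, g1, hr, e⟩ := key g h
  obtain ⟨o', ho', g1', hr', e'⟩ := key g' h'
  refine hr.trans (Rel.trans ?_ hr'.symm)
  have hinj : ∀ o g h : _, smul p f = BCF.sub g (ptMat p o).1 (ptMat p o).2.2.1 (ptMat p o).2.1
      (ptMat p o).2.2.2 → smul p f = BCF.sub h (ptMat p o).1 (ptMat p o).2.2.1 (ptMat p o).2.1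
      (ptMat p o).2.2.2 → g = h := by
    intro o g h hg hh
    rw [hg] at hh
    have h2 := congrArg (fun f => f.sub (ptMat p o).2.2.2 (-(ptMat p o).2.2.1) (-(ptMat p o).2.1)
      (ptMat p o).1) hh
    simp only [sub_adj] at h2
    refine smul_inj (pow_ne_zero 3 ?_) h2
    intro h0
    have := ptMat_det (p := p) o
    rw [show (ptMat p o).1 * (ptMat p o).2.2.2 - (ptMat p o).2.1 * (ptMat p o).2.2.1 = 0 by
      linear_combination h0] at this
    simp at this; exact hp0 this.symm
  by_cases hoo : o = o'
  · subst hoo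
    rw [hinj o _ _ e e']
    exact Rel.refl _
  · exfalso
    have hfin : ∀ δ γ : ℤ, ∀ t u v : ℤ, (p : ℤ) ∣ δ → (p : ℤ) ∣ γ →
        f = ⟨δ * t ^ 3 + γ * t ^ 2 + p * u, 3 * δ * t ^ 2 + 2 * γ * t + p * v, 3 * δ * t + γ, δ⟩ →
        False := by
      rintro _ _ t u v ⟨δ, rfl⟩ ⟨γ, rfl⟩ h
      refine hf ⟨⟨δ * t ^ 3 + γ * t ^ 2 + u, 3 * δ * t ^ 2 + 2 * γ * t + v, 3 * δ * t + γ, δ⟩, ?_⟩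
      rw [h]; ext <;> simp only [BCF.smul] <;> ring
    have hnone : ∀ g : BCF, smul p f = g.sub 1 0 0 p → (p : ℤ) ∣ f.c ∧ (p : ℤ) ∣ f.d := by
      intro g h
      have h1 := congrArg BCF.c h
      have h2 := congrArg BCF.d h
      simp only [BCF.smul, BCF.sub] at h1 h2
      exact ⟨⟨g.c, mul_left_cancel₀ hp0 (by linear_combination h1)⟩,
        ⟨p * g.d, mul_left_cancel₀ hp0 (by linear_combination h2)⟩⟩
    have hsome : ∀ (g : BCF) (t : ℤ), smul p f = g.sub t 1 p 0 → ∃ δ γ u v : ℤ,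
        f = ⟨δ * t ^ 3 + γ * t ^ 2 + p * u, 3 * δ * t ^ 2 + 2 * γ * t + p * v,
          3 * δ * t + γ, δ⟩ := by
      intro g t h
      have h1 := congrArg BCF.a h
      have h2 := congrArg BCF.b h
      have h3 := congrArg BCF.c h
      have h4 := congrArg BCF.d h
      simp only [BCF.smul, BCF.sub] at h1 h2 h3 h4
      refine ⟨f.d, g.b, g.c * t + p * g.d, g.c, ?_⟩
      ext <;> apply mul_left_cancel₀ hp0 <;> dsimp only
      · linear_combination h1 - t ^ 3 * h4
      · linear_combination h2 - 3 * t ^ 2 * h4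
      · linear_combination h3 - 3 * t * h4
    have hmix : ∀ (g g' : BCF) (t : ℤ), smul p f = g.sub t 1 p 0 → smul p f = g'.sub 1 0 0 p →
        False := by
      intro g g' t h h'
      obtain ⟨δ, γ, u, v, h1⟩ := hsome g t h
      obtain ⟨h2, h3⟩ := hnone g' h'
      rw [h1] at h2 h3
      simp only at h2 h3
      refine hfin δ γ t u v h3 ?_ h1
      have := dvd_sub h2 (h3.mul_left (3 * t))
      rwa [show 3 * δ * t + γ - 3 * t * δ = γ by ring] at this
    cases o with
    | none =>
      cases o' with
      | none => exact hoo rfl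
      | some t' => exact hmix _ _ _ e' e
    | some t =>
      cases o' with
      | none => exact hmix _ _ _ e e'
      | some t' =>
        obtain ⟨δ, γ, u, v, h1⟩ := hsome _ (t : ℤ) e
        obtain ⟨δ', γ', u', v', h1'⟩ := hsome _ (t' : ℤ) e'
        have h2 := h1.symm.trans h1'
        simp only [BCF.mk.injEq] at h2
        obtain ⟨ea, eb, ec, rfl⟩ := h2
        have hs : ¬ (p : ℤ) ∣ (t : ℤ) - t' := by
          intro hdvd
          have a1 := ho t rfl
          have a2 := ho' t' rfl
          have := Int.eq_zero_of_abs_lt_dvd hdvd (by rw [abs_lt]; constructor <;> omega)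
          apply hoo; congr 1; omega
        have k1 : (p : ℤ) ∣ 3 * δ * (t - t') + 2 * γ := by
          refine (hpp.dvd_or_dvd (a := (t : ℤ) - t') ?_).resolve_left hs
          exact ⟨v' - v, by linear_combination eb - 2 * t' * ec⟩
        have k2 : (p : ℤ) ∣ δ * (t - t') + γ := by
          refine (hpp.dvd_or_dvd (a := (t : ℤ) - t') ?_).resolve_left hs
          refine (hpp.dvd_or_dvd (a := (t : ℤ) - t') ?_).resolve_left hs
          exact ⟨u' - u - t' * (v' - v), by
            linear_combination ea - t' * eb + t' ^ 2 * ec⟩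
        have k3 : (p : ℤ) ∣ δ := by
          refine (hpp.dvd_or_dvd (b := δ) (a := (t : ℤ) - t') ?_).resolve_left hs
          convert dvd_sub k1 (k2.mul_left 2) using 1; ring
        refine hfin δ γ t u v k3 ?_ h1
        have := dvd_sub k2 (k3.mul_left ((t : ℤ) - t'))
        rwa [show δ * ((t : ℤ) - t') + γ - (t - t') * δ = γ by ring] at this

end BCF

namespace BCF

lemma Splitting.theta_eq {f : BCF} {θ B C : ℝ} (h : Splitting f θ B C) (hf : f.disc < 0)
    (ha : f.a ≠ 0) {x y : ℝ} (hxy : f.evalR x y = 0) : x = θ * y := by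
  have ha : (f.a : ℝ) ≠ 0 := by exact_mod_cast ha
  rw [h.evalR_eq] at hxy
  by_cases h0 : x ≠ 0 ∨ y ≠ 0
  · have := h.quad_pos hf h0
    have h2 := (mul_eq_zero.mp hxy).resolve_right this.ne'
    have := (mul_eq_zero.mp h2).resolve_left ha
    linarith
  · push Not at h0
    rw [h0.1, h0.2]; simp

lemma Splitting.unique {f : BCF} {θ B C θ' B' C' : ℝ} (h : Splitting f θ B C)
    (h' : Splitting f θ' B' C') (hf : f.disc < 0) (ha : f.a ≠ 0) : θ = θ' ∧ B = B' ∧ C = C' := by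
  have h0 : f.evalR θ 1 = 0 := by rw [h.evalR_eq]; ring
  have e := h'.theta_eq hf ha h0
  rw [mul_one] at e
  have ha : (f.a : ℝ) ≠ 0 := by exact_mod_cast ha
  subst e
  have e2 : B = B' := by
    have := mul_left_cancel₀ ha (h.hb.symm.trans h'.hb); linarith
  subst e2
  have e3 : C = C' := by
    have := mul_left_cancel₀ ha (h.hc.symm.trans h'.hc); linarith
  exact ⟨rfl, rfl, e3⟩

lemma Splitting.sub {f : BCF} {θ B C : ℝ} (h : Splitting f θ B C) {p q r s : ℤ}
    (h1 : (p : ℝ) - θ * r ≠ 0) (h2 : (p : ℝ) ^ 2 + B * p * r + C * r ^ 2 ≠ 0) :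
    Splitting (f.sub p q r s) ((θ * s - q) / (p - θ * r))
      ((2 * p * q + B * (p * s + q * r) + 2 * C * r * s) / (p ^ 2 + B * p * r + C * r ^ 2))
      ((q ^ 2 + B * q * s + C * s ^ 2) / (p ^ 2 + B * p * r + C * r ^ 2)) := by
  have ea : ((f.sub p q r s).a : ℝ) = f.a * (p - θ * r) * (p ^ 2 + B * p * r + C * r ^ 2) := by
    simp only [BCF.sub]; push_cast; rw [h.hb, h.hc, h.hd]; ring
  constructor
  · rw [ea, div_sub_div _ _ h2 h1, mul_div_assoc', eq_div_iff (mul_ne_zero h2 h1)]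
    simp only [BCF.sub]; push_cast; rw [h.hb, h.hc, h.hd]; ring
  · rw [ea, div_mul_div_comm, div_sub_div _ _ h2 (mul_ne_zero h2 h1), mul_div_assoc',
      eq_div_iff (mul_ne_zero h2 (mul_ne_zero h2 h1))]
    simp only [BCF.sub]; push_cast; rw [h.hb, h.hc, h.hd]; ring
  · rw [ea, mul_assoc, div_mul_div_comm, mul_div_assoc', eq_div_iff (mul_ne_zero h2 h1)]
    simp only [BCF.sub]; push_cast; rw [h.hb, h.hc, h.hd]; ring

/-- Reduced forms (closed fundamental domain). -/
def CRed (f : BCF) : Prop :=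
  0 < f.a ∧ ∃ θ B C : ℝ, Splitting f θ B C ∧ 0 ≤ B ∧ B ≤ 1 ∧ 1 ≤ C

/-- Strictly reduced forms (open fundamental domain). -/
def ORed (f : BCF) : Prop :=
  0 < f.a ∧ ∃ θ B C : ℝ, Splitting f θ B C ∧ 0 < B ∧ B < 1 ∧ 1 < C

lemma ORed.cred {f : BCF} (h : ORed f) : CRed f := by
  obtain ⟨ha, θ, B, C, h, h1, h2, h3⟩ := h
  exact ⟨ha, θ, B, C, h, h1.le, h2.le, h3.le⟩

lemma exists_min_quad {B C : ℝ} (h : 0 < 4 * C - B ^ 2) : ∃ p r : ℤ, IsCoprime p r ∧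
    ∀ x y : ℤ, (x ≠ 0 ∨ y ≠ 0) →
      (p : ℝ) ^ 2 + B * p * r + C * r ^ 2 ≤ (x : ℝ) ^ 2 + B * x * y + C * y ^ 2 := by
  set Q : ℤ × ℤ → ℝ := fun v => (v.1 : ℝ) ^ 2 + B * v.1 * v.2 + C * v.2 ^ 2 with hQ
  set A : Set (ℤ × ℤ) := {v | v ≠ 0 ∧ Q v ≤ 1} with hA
  have hQpos : ∀ v : ℤ × ℤ, v ≠ 0 → 0 < Q v := by
    rintro ⟨x, y⟩ hv
    simp only [hQ]
    by_cases hy : y = 0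
    · subst hy
      have hx : (x : ℝ) ≠ 0 := by
        intro h0; apply hv; simp at h0; simp [h0]
      simp; positivity
    · have hy : (y : ℝ) ≠ 0 := by exact_mod_cast hy
      have : 0 < (y : ℝ) ^ 2 := by positivity
      nlinarith [sq_nonneg ((x : ℝ) + B / 2 * y)]
  have hfin : A.Finite := by
    set δ := 4 * C - B ^ 2 with hδ
    obtain ⟨N, hN⟩ := exists_nat_ge (4 / δ + 1)
    obtain ⟨M, hM⟩ := exists_nat_ge (1 + |B| * N)
    apply ((Set.finite_Icc (-(M : ℤ)) M).prod (Set.finite_Icc (-(N : ℤ)) N)).subset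
    rintro ⟨x, y⟩ ⟨-, hv⟩
    simp only [hQ] at hv
    have hy2 : (y : ℝ) ^ 2 ≤ 4 / δ := by
      rw [le_div_iff₀ h]
      nlinarith [sq_nonneg ((x : ℝ) + B / 2 * y)]
    have hd : 0 ≤ 4 / δ := by positivity
    have hy : |(y : ℝ)| ≤ N := by
      apply abs_le_of_sq_le_sq _ (by positivity)
      nlinarith
    have hx1 : |(x : ℝ) + B / 2 * y| ≤ 1 := by
      apply abs_le_of_sq_le_sq _ (by positivity)
      have : 0 ≤ (y : ℝ) ^ 2 * δ := by positivity
      nlinarith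
    have hx : |(x : ℝ)| ≤ M := by
      have e : (x : ℝ) = (x + B / 2 * y) - B / 2 * y := by ring
      have h3 : |B / 2 * (y : ℝ)| ≤ |B| * N := by
        rw [abs_mul, abs_div, abs_two]
        have := abs_nonneg B
        have := mul_le_mul (by linarith : |B| / 2 ≤ |B|) hy (abs_nonneg _) (abs_nonneg B)
        exact this
      rw [e]
      exact (abs_sub _ _).trans (by linarith)
    rw [abs_le] at hx hy
    simp only [Set.mem_prod, Set.mem_Icc]
    exact ⟨⟨by exact_mod_cast hx.1, by exact_mod_cast hx.2⟩,
      ⟨by exact_mod_cast hy.1, by exact_mod_cast hy.2⟩⟩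
  have hne : A.Nonempty := ⟨(1, 0), by simp [hA, hQ]⟩
  obtain ⟨⟨p, r⟩, hpr, hmin⟩ := Set.exists_min_image A Q hfin hne
  have hmin' : ∀ v : ℤ × ℤ, v ≠ 0 → Q (p, r) ≤ Q v := by
    intro v hv
    by_cases h1 : Q v ≤ 1
    · exact hmin v ⟨hv, h1⟩
    · exact hpr.2.trans (by linarith)
  refine ⟨p, r, ?_, fun x y hxy => hmin' (x, y) (by
    simp only [ne_eq, Prod.mk_eq_zero, not_and_or]; exact hxy)⟩
  rw [Int.isCoprime_iff_gcd_eq_one]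
  by_contra hg
  have hg0 : Int.gcd p r ≠ 0 := by
    intro h0; rw [Int.gcd_eq_zero_iff] at h0; apply hpr.1; simp [h0]
  obtain ⟨p', hp'⟩ := Int.gcd_dvd_left (a := p) (b := r)
  obtain ⟨r', hr'⟩ := Int.gcd_dvd_right (a := p) (b := r)
  set g := Int.gcd p r with hgdef
  have hv : (p', r') ≠ (0 : ℤ × ℤ) := by
    intro h0
    simp only [Prod.mk_eq_zero] at h0
    apply hpr.1; rw [hp', hr', h0.1, h0.2]; simp
  have h1 := hmin' _ hv
  have h2 := hQpos _ hv
  have h3 : Q (p, r) = (g : ℝ) ^ 2 * Q (p', r') := by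
    simp only [hQ]
    have e1 : (p : ℝ) = g * p' := by exact_mod_cast hp'
    have e2 : (r : ℝ) = g * r' := by exact_mod_cast hr'
    rw [e1, e2]; ring
  have h4 : (2 : ℝ) ≤ g := by
    have : 2 ≤ g := by omega
    exact_mod_cast this
  rw [h3] at h1
  have h5 : (4 : ℝ) ≤ (g : ℝ) ^ 2 := by nlinarith
  nlinarith

/-- Every form is equivalent to a reduced one. -/
lemma exists_cred {f : BCF} (hf : f.Good) : ∃ g, Rel f g ∧ CRed g := by
  obtain ⟨θ, B, C, hS⟩ := exists_splitting hf.1.a_ne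
  obtain ⟨p, r, ⟨s, q, hsq⟩, hmin⟩ := exists_min_quad (hS.pos hf.2)
  -- minimal vector `(p, r)`, completed by `(-q, s)`
  have hdet : p * s - (-q) * r = 1 := by linear_combination hsq
  set g := f.sub p (-q) r s with hg
  have hfg : Rel f g := ⟨p, -q, r, s, by rw [hdet]; exact isUnit_one, rfl⟩
  have hgG : g.Good := hf.sub (by rw [hdet]; exact one_ne_zero)
  have hpr : (p : ℝ) ≠ 0 ∨ (r : ℝ) ≠ 0 := by
    by_contra h0
    push Not at h0
    have h1 : p = 0 := by exact_mod_cast h0.1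
    have h2 : r = 0 := by exact_mod_cast h0.2
    rw [h1, h2] at hsq; simp at hsq
  have hlam := hS.quad_pos hf.2 hpr
  have hL : (p : ℝ) - θ * r ≠ 0 := by
    intro h0
    have : f.evalR p r = 0 := by rw [hS.evalR_eq, h0]; ring
    rw [evalR_intCast] at this
    have := hf.1 p r (by exact_mod_cast this)
    rcases hpr with h | h <;> apply h
    · exact_mod_cast this.1
    · exact_mod_cast this.2
  have hS1 := hS.sub (q := -q) (s := s) hL hlam.ne'
  rw [← hg] at hS1
  set θ1 := _ / ((p : ℝ) - θ * r) with hθ1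
  set lam := (p : ℝ) ^ 2 + B * p * r + C * r ^ 2 with hlamdef
  push_cast at hS1
  set B1 := (2 * (p : ℝ) * -q + B * (p * s + -q * r) + 2 * C * r * s) / lam with hB1
  set C1 := ((-q : ℝ) ^ 2 + B * -q * s + C * s ^ 2) / lam with hC1
  have hmin1 : ∀ x y : ℤ, (x ≠ 0 ∨ y ≠ 0) → 1 ≤ (x : ℝ) ^ 2 + B1 * x * y + C1 * y ^ 2 := by
    intro x y hxy
    have h1 := hmin (p * x - q * y) (r * x + s * y) (by
      by_contra h0
      push Not at h0
      have hx : x = 0 := by linear_combination (-x) * hsq + s * h0.1 + q * h0.2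
      have hy : y = 0 := by linear_combination (-y) * hsq + p * h0.2 - r * h0.1
      rcases hxy with h | h
      · exact h hx
      · exact h hy)
    have h2 : lam * ((x : ℝ) ^ 2 + B1 * x * y + C1 * y ^ 2) =
        ((p * x - q * y : ℤ) : ℝ) ^ 2 + B * ((p * x - q * y : ℤ) : ℝ) * ((r * x + s * y : ℤ) : ℝ)
          + C * ((r * x + s * y : ℤ) : ℝ) ^ 2 := by
      have e1 : lam * B1 = 2 * (p : ℝ) * -q + B * (p * s + -q * r) + 2 * C * r * s :=
        mul_div_cancel₀ _ hlam.ne'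
      have e2 : lam * C1 = (-q : ℝ) ^ 2 + B * -q * s + C * s ^ 2 := mul_div_cancel₀ _ hlam.ne'
      push_cast
      linear_combination x * y * e1 + y ^ 2 * e2 + x ^ 2 * hlamdef
    rw [← h2] at h1
    exact le_of_mul_le_mul_left (by rw [mul_one]; exact h1) hlam
  -- translate
  obtain ⟨n, ε, hε, hn0, hn1⟩ : ∃ n ε : ℤ, ε * ε = 1 ∧ 0 ≤ ε * (B1 + 2 * n) ∧
      ε * (B1 + 2 * n) ≤ 1 := by
    have h1 := Int.floor_le ((1 - B1) / 2)
    have h2 := Int.lt_floor_add_one ((1 - B1) / 2)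
    set n := ⌊(1 - B1) / 2⌋
    by_cases h : 0 ≤ B1 + 2 * n
    · exact ⟨n, 1, by norm_num, by push_cast; linarith, by push_cast; linarith⟩
    · exact ⟨n, -1, by norm_num, by push_cast; linarith, by push_cast; linarith⟩
  have hεR : (ε : ℝ) * ε = 1 := by exact_mod_cast hε
  -- sign
  obtain ⟨σ, hσ, hσa⟩ : ∃ σ : ℤ, σ * σ = 1 ∧ 0 < σ * g.a := by
    rcases lt_or_gt_of_ne hgG.1.a_ne with h | h
    · exact ⟨-1, by norm_num, by linarith⟩
    · exact ⟨1, by norm_num, by linarith⟩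
  have hσR : (σ : ℝ) * σ = 1 := by exact_mod_cast hσ
  have hσ0 : (σ : ℝ) ≠ 0 := by intro h0; rw [h0] at hσR; simp at hσR
  have hS2 := hS1.sub (p := σ) (q := σ * ε * n) (r := 0) (s := σ * ε) (by simpa using hσ0)
    (by simpa using hσ0)
  have hdet2 : σ * (σ * ε) - σ * ε * n * 0 = ε := by linear_combination ε * hσ
  refine ⟨g.sub σ (σ * ε * n) 0 (σ * ε), hfg.trans ⟨_, _, _, _, ?_, rfl⟩, ?_, _, _, _, hS2, ?_⟩
  · rw [hdet2]; exact IsUnit.of_mul_eq_one ε hε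
  · simp only [BCF.sub]
    have : g.a * σ ^ 3 = σ * g.a := by linear_combination σ * g.a * hσ
    simpa [this] using hσa
  · push_cast
    have hden : (σ : ℝ) ^ 2 + B1 * σ * 0 + C1 * 0 ^ 2 = 1 := by rw [sq, hσR]; ring
    rw [hden, div_one, div_one]
    have eB : 2 * (σ : ℝ) * (σ * ε * n) + B1 * (σ * (σ * ε) + σ * ε * n * 0) +
        2 * C1 * 0 * (σ * ε) = ε * (B1 + 2 * n) := by
      linear_combination (2 * ε * n + B1 * ε) * hσR
    have eC : ((σ : ℝ) * ε * n) ^ 2 + B1 * (σ * ε * n) * (σ * ε) + C1 * (σ * ε) ^ 2 =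
        (n : ℝ) ^ 2 + B1 * n * (1 : ℤ) + C1 * (1 : ℤ) ^ 2 := by
      push_cast
      linear_combination (n ^ 2 + B1 * n + C1) * (ε * ε * hσR + hεR)
    rw [eB, eC]
    exact ⟨hn0, hn1, hmin1 n 1 (Or.inr one_ne_zero)⟩

lemma one_lt_quad {B C : ℝ} (hB0 : 0 < B) (hB1 : B < 1) (hC : 1 < C) {x y : ℤ} (hy : y ≠ 0) :
    1 < (x : ℝ) ^ 2 + B * x * y + C * y ^ 2 := by
  have hy2 : (1 : ℝ) ≤ (y : ℝ) ^ 2 := by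
    have : (1 : ℤ) ≤ y ^ 2 := by have := sq_pos_of_ne_zero hy; omega
    exact_mod_cast this
  by_cases hx : x = 0
  · subst hx; simp; nlinarith
  · have h1 : (1 : ℝ) ≤ (|(x : ℝ)| - |(y : ℝ)|) ^ 2 + |(x : ℝ)| * |(y : ℝ)| := by
      have ax : (1 : ℝ) ≤ |(x : ℝ)| := by exact_mod_cast Int.one_le_abs hx
      have ay : (1 : ℝ) ≤ |(y : ℝ)| := by exact_mod_cast Int.one_le_abs hy
      nlinarith [sq_nonneg (|(x : ℝ)| - |(y : ℝ)|)]
    have h2 : B * (x * y) ≥ - (|(x : ℝ)| * |(y : ℝ)|) := by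
      rw [← abs_mul]
      have := neg_abs_le ((x : ℝ) * y)
      have := abs_nonneg ((x : ℝ) * y)
      nlinarith
    have h3 : (x : ℝ) ^ 2 = |(x : ℝ)| ^ 2 := (sq_abs _).symm
    have h4 : (y : ℝ) ^ 2 = |(y : ℝ)| ^ 2 := (sq_abs _).symm
    have h5 : 0 < (C - 1) * (y : ℝ) ^ 2 := by apply mul_pos <;> linarith
    nlinarith

/-- Equivalent strictly reduced forms are equal. -/
lemma ORed.eq_of_rel {f g : BCF} (hf : f.Good) (hg : g.Good) (h : Rel f g) (hfr : ORed f)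
    (hgr : ORed g) : f = g := by
  obtain ⟨ha, θ, B, C, hS, hB0, hB1, hC⟩ := hfr
  obtain ⟨ha', θ', B', C', hS', hB0', hB1', hC'⟩ := hgr
  obtain ⟨p, q, r, s, hu, rfl⟩ := h
  have hδ := Int.isUnit_mul_self hu
  set δ := p * s - q * r with hδdef
  have hpr : (p : ℝ) ≠ 0 ∨ (r : ℝ) ≠ 0 := by
    by_contra h0
    push Not at h0
    have h1 : p = 0 := by exact_mod_cast h0.1
    have h2 : r = 0 := by exact_mod_cast h0.2
    rw [hδdef, h1, h2] at hδ; simp at hδ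
  have hlam := hS.quad_pos hf.2 hpr
  have hL : (p : ℝ) - θ * r ≠ 0 := by
    intro h0
    have : f.evalR p r = 0 := by rw [hS.evalR_eq, h0]; ring
    rw [evalR_intCast] at this
    have := hf.1 p r (by exact_mod_cast this)
    rcases hpr with h | h <;> apply h
    · exact_mod_cast this.1
    · exact_mod_cast this.2
  obtain ⟨-, eB, eC⟩ := (hS.sub (q := q) (s := s) hL hlam.ne').unique hS' hg.2 hg.1.a_ne
  rw [div_eq_iff hlam.ne'] at eB eC
  -- preimage of `(1, 0)`
  have hr : r = 0 := by
    by_contra hr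
    have h1 := one_lt_quad hB0 hB1 hC (x := p) hr
    have h2 : (1 : ℝ) ≤ (s : ℝ) ^ 2 + B' * s * (-r) + C' * (-r) ^ 2 := by
      have := one_lt_quad hB0' hB1' hC' (x := s) (y := -r) (neg_ne_zero.mpr hr)
      push_cast at this; exact this.le
    have hδR : ((p : ℝ) * s - q * r) * (p * s - q * r) = 1 := by exact_mod_cast hδ
    have h3 : ((p : ℝ) ^ 2 + B * p * r + C * r ^ 2) * ((s : ℝ) ^ 2 + B' * s * (-r) + C' * (-r) ^ 2)
        = 1 := by
      linear_combination hδR + s * r * eB - r ^ 2 * eC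
    nlinarith
  subst hr
  have hps : p * s * (p * s) = 1 := by rw [hδdef] at hδ; linear_combination hδ
  have hp2 : p * p = 1 := by
    have : IsUnit p := IsUnit.of_mul_eq_one (s * (p * s)) (by linear_combination hps)
    exact Int.isUnit_mul_self this
  have hs2 : s * s = 1 := by
    have : IsUnit s := IsUnit.of_mul_eq_one (p * (p * s)) (by linear_combination hps)
    exact Int.isUnit_mul_self this
  have hp2R : (p : ℝ) ^ 2 = 1 := by rw [sq]; exact_mod_cast hp2
  simp only [Int.cast_zero, mul_zero, add_zero, ne_eq, OfNat.ofNat_ne_zero, not_false_eq_true,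
    zero_pow, hp2R, mul_one, zero_mul] at eB
  have hpsu : p * s = 1 ∨ p * s = -1 := Int.isUnit_iff.mp (IsUnit.of_mul_eq_one _ hps)
  have hq : p * q = 0 ∧ p * s = 1 := by
    rcases hpsu with h | h
    · have hR : (p : ℝ) * s = 1 := by exact_mod_cast h
      rw [hR] at eB
      have h1 : -1 < 2 * (p * q : ℝ) := by linarith
      have h2 : 2 * (p * q : ℝ) < 1 := by linarith
      have h1' : -1 < 2 * (p * q) := by exact_mod_cast h1
      have h2' : 2 * (p * q) < 1 := by exact_mod_cast h2
      exact ⟨by omega, h⟩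
    · exfalso
      have hR : (p : ℝ) * s = -1 := by exact_mod_cast h
      rw [hR] at eB
      have h1 : 0 < 2 * (p * q : ℝ) := by linarith
      have h2 : 2 * (p * q : ℝ) < 2 := by linarith
      have h1' : 0 < 2 * (p * q) := by exact_mod_cast h1
      have h2' : 2 * (p * q) < 2 := by exact_mod_cast h2
      omega
  have hq0 : q = 0 := by linear_combination (-q) * hp2 + p * hq.1
  subst hq0
  have hsp : s = p := by linear_combination p * hq.2 - s * hp2
  subst hsp
  have hs1 : s = 1 := by
    have : 0 < f.a * s ^ 3 := by simpa [BCF.sub] using ha'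
    have h3 : s ^ 3 = s := by linear_combination s * hs2
    rw [h3] at this
    have hpos : 0 < s := pos_of_mul_pos_right this ha.le
    nlinarith
  subst hs1
  exact (sub_one f).symm

end BCF

namespace BCF

lemma Splitting.neg_disc {f : BCF} {θ B C : ℝ} (h : Splitting f θ B C) :
    -(f.disc : ℝ) = (f.a : ℝ) ^ 4 * (4 * (C - B ^ 2 / 4)) *
      ((θ + B / 2) ^ 2 + (C - B ^ 2 / 4)) ^ 2 := by
  rw [h.disc_eq]; ring

lemma red_ineq {a B t D : ℝ} (h0 : 0 ≤ B) (h1 : B ≤ 1) (hD : 3 / 4 ≤ D) :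
    a ^ 4 ≤ a ^ 4 * (4 * D) * (t ^ 2 + D) ^ 2 ∧
    (a * (B - (t - B / 2))) ^ 4 ≤ 12 * (a ^ 4 * (4 * D) * (t ^ 2 + D) ^ 2) ∧
    a ^ 2 * (a * (D + B ^ 2 / 4 - B * (t - B / 2))) ^ 2 ≤
      2 * (a ^ 4 * (4 * D) * (t ^ 2 + D) ^ 2) ∧
    a ^ 2 * (a * (D + B ^ 2 / 4) * (t - B / 2)) ^ 2 ≤ a ^ 4 * (4 * D) * (t ^ 2 + D) ^ 2 := by
  have ha : 0 ≤ a ^ 4 := by positivity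
  have hE : (t ^ 2 + D) ^ 2 * 3 ≤ 4 * D * (t ^ 2 + D) ^ 2 := by nlinarith [sq_nonneg (t ^ 2 + D)]
  have hD0 : 0 < D := by linarith
  have hB2 : B ^ 2 ≤ 1 := by nlinarith
  have ht : |t| ^ 2 = t ^ 2 := sq_abs t
  have ht0 := abs_nonneg t
  have htt := le_abs_self t
  have htn := neg_abs_le t
  refine ⟨?_, ?_, ?_, ?_⟩
  · rw [mul_assoc]
    apply le_mul_of_one_le_right ha
    nlinarith [sq_nonneg t, sq_nonneg (t ^ 2)]
  · have h : (B - (t - B / 2)) ^ 2 ≤ 6 * (t ^ 2 + D) := by nlinarith [sq_nonneg (t + 3 / 2 * B)]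
    have h' : (B - (t - B / 2)) ^ 4 ≤ 12 * (4 * D * (t ^ 2 + D) ^ 2) := by
      have : ((B - (t - B / 2)) ^ 2) ^ 2 ≤ (6 * (t ^ 2 + D)) ^ 2 :=
        pow_le_pow_left₀ (sq_nonneg _) h 2
      nlinarith
    calc _ = a ^ 4 * (B - (t - B / 2)) ^ 4 := by ring
      _ ≤ a ^ 4 * (12 * (4 * D * (t ^ 2 + D) ^ 2)) := mul_le_mul_of_nonneg_left h' ha
      _ = _ := by ring
  · have h : |D + B ^ 2 / 4 - B * (t - B / 2)| ≤ 7 / 3 * (t ^ 2 + D) := by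
      have e1 : |t| ≤ t ^ 2 + 1 / 4 := by nlinarith [sq_nonneg (|t| - 1 / 2)]
      have e2 : B * t ≤ |t| := by nlinarith
      have e3 : -|t| ≤ B * t := by nlinarith
      rw [abs_le]; constructor <;> nlinarith [sq_nonneg t]
    have h' : (D + B ^ 2 / 4 - B * (t - B / 2)) ^ 2 ≤ 2 * (4 * D * (t ^ 2 + D) ^ 2) := by
      have := pow_le_pow_left₀ (abs_nonneg _) h 2
      rw [sq_abs] at this
      nlinarith
    calc _ = a ^ 4 * (D + B ^ 2 / 4 - B * (t - B / 2)) ^ 2 := by ring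
      _ ≤ a ^ 4 * (2 * (4 * D * (t ^ 2 + D) ^ 2)) := mul_le_mul_of_nonneg_left h' ha
      _ = _ := by ring
  · have h1 : (D + B ^ 2 / 4) ^ 2 ≤ 16 / 9 * D ^ 2 := by
      have := pow_le_pow_left₀ (by positivity) (by linarith : D + B ^ 2 / 4 ≤ 4 / 3 * D) 2
      nlinarith
    have h2 : (t - B / 2) ^ 2 ≤ 2 * t ^ 2 + 1 / 2 := by nlinarith [sq_nonneg (t + B / 2)]
    have h3 : D * (2 * t ^ 2 + 1 / 2) ≤ 7 / 6 * (t ^ 2 + D) ^ 2 := by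
      nlinarith [sq_nonneg (t ^ 2 - D), sq_nonneg t]
    have h' : (D + B ^ 2 / 4) ^ 2 * (t - B / 2) ^ 2 ≤ 4 * D * (t ^ 2 + D) ^ 2 := by
      calc _ ≤ 16 / 9 * D ^ 2 * (2 * t ^ 2 + 1 / 2) :=
            mul_le_mul h1 h2 (sq_nonneg _) (by positivity)
        _ = 16 / 9 * D * (D * (2 * t ^ 2 + 1 / 2)) := by ring
        _ ≤ 16 / 9 * D * (7 / 6 * (t ^ 2 + D) ^ 2) :=
            mul_le_mul_of_nonneg_left h3 (by positivity)
        _ ≤ _ := by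
          have : 0 ≤ D * (t ^ 2 + D) ^ 2 := by positivity
          nlinarith
    calc _ = a ^ 4 * ((D + B ^ 2 / 4) ^ 2 * (t - B / 2) ^ 2) := by ring
      _ ≤ a ^ 4 * (4 * D * (t ^ 2 + D) ^ 2) := mul_le_mul_of_nonneg_left h' ha
      _ = _ := by ring

lemma CRed.bounds {f : BCF} (h : CRed f) : f.a ^ 4 ≤ -f.disc ∧ f.b ^ 4 ≤ 12 * -f.disc ∧
    f.a ^ 2 * f.c ^ 2 ≤ 2 * -f.disc ∧ f.a ^ 2 * f.d ^ 2 ≤ -f.disc := by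
  obtain ⟨ha, θ, B, C, h, h0, h1, h2⟩ := h
  have hD : 3 / 4 ≤ C - B ^ 2 / 4 := by nlinarith
  obtain ⟨i1, i2, i3, i4⟩ := red_ineq (a := f.a) (t := θ + B / 2) h0 h1 hD
  rw [← h.neg_disc] at i1 i2 i3 i4
  have e1 : (f.a : ℝ) * (B - (θ + B / 2 - B / 2)) = f.b := by rw [h.hb]; ring
  have e2 : (f.a : ℝ) * (C - B ^ 2 / 4 + B ^ 2 / 4 - B * (θ + B / 2 - B / 2)) = f.c := by
    rw [h.hc]; ring
  have e3 : ((f.a : ℝ) * (C - B ^ 2 / 4 + B ^ 2 / 4) * (θ + B / 2 - B / 2)) ^ 2 = f.d ^ 2 := by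
    rw [h.hd]; ring
  rw [e1] at i2
  rw [e2] at i3
  rw [e3] at i4
  exact ⟨by exact_mod_cast i1, by exact_mod_cast i2, by exact_mod_cast i3, by exact_mod_cast i4⟩

lemma finite_box (N : ℤ) : {f : BCF | |f.a| ≤ N ∧ |f.b| ≤ N ∧ |f.c| ≤ N ∧ |f.d| ≤ N}.Finite := by
  have hI := Set.finite_Icc (-N) N
  apply Set.Finite.of_finite_image (f := fun f : BCF => (f.a, f.b, f.c, f.d))
  · apply ((hI.prod (hI.prod (hI.prod hI)))).subset
    rintro _ ⟨f, ⟨h1, h2, h3, h4⟩, rfl⟩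
    simp only [Set.mem_prod, Set.mem_Icc]
    exact ⟨abs_le.mp h1, abs_le.mp h2, abs_le.mp h3, abs_le.mp h4⟩
  · intro f _ g _ h
    simp only [Prod.mk.injEq] at h
    ext
    exacts [h.1, h.2.1, h.2.2.1, h.2.2.2]

lemma finite_cred (X : ℝ) : {f : BCF | CRed f ∧ -(f.disc : ℝ) < X}.Finite := by
  obtain ⟨N, hN⟩ := exists_nat_ge X
  apply (finite_box (12 * N)).subset
  rintro f ⟨hc, hX⟩
  obtain ⟨h1, h2, h3, h4⟩ := hc.bounds
  have hd : -f.disc < N := by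
    have : (-f.disc : ℝ) < N := hX.trans_le hN
    exact_mod_cast this
  have ha : 1 ≤ f.a := hc.1
  have ha2 : 1 ≤ f.a ^ 2 := by nlinarith
  have key : ∀ x : ℤ, x ^ 2 ≤ 12 * N → |x| ≤ 12 * N := by
    intro x hx
    have : |x| ≤ |x| ^ 2 := by
      rcases eq_or_ne x 0 with h | h
      · simp [h]
      · nlinarith [Int.one_le_abs h]
    rw [sq_abs] at this
    linarith
  have key4 : ∀ x : ℤ, x ^ 2 ≤ x ^ 4 := by
    intro x
    rcases eq_or_ne x 0 with h | h
    · simp [h]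
    · have : 0 < x ^ 2 := by positivity
      nlinarith
  refine ⟨key _ ?_, key _ ?_, key _ ?_, key _ ?_⟩
  · have := key4 f.a; nlinarith [sq_nonneg f.a]
  · have := key4 f.b; linarith
  · nlinarith [sq_nonneg f.c]
  · nlinarith [sq_nonneg f.d]

/-- Orbits of bounded discriminant. -/
def Om (X : ℝ) : Set Orb := {ω | -(ω.disc : ℝ) < X}

lemma finite_Om (X : ℝ) : (Om X).Finite := by
  classical
  have h := finite_cred X
  have h' : {g : GF | CRed g.1 ∧ -(g.1.disc : ℝ) < X}.Finite :=
    Set.Finite.preimage Subtype.val_injective.injOn h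
  apply (h'.image (fun g : GF => orb g.1 g.2)).subset
  intro ω hω
  obtain ⟨f, hf, rfl⟩ := Orb.exists_rep ω
  obtain ⟨g, hg, hr⟩ := exists_cred hf
  obtain ⟨p, q, r, s, hu, e⟩ := hg
  have hgG : g.Good := by rw [e]; exact hf.sub hu.ne_zero
  refine ⟨⟨g, hgG⟩, ⟨hr, ?_⟩, ?_⟩
  · rw [Om, Set.mem_ofPred_eq, orb_disc] at hω
    have : g.disc = f.disc := (Rel.disc_eq ⟨p, q, r, s, hu, e⟩)
    rw [this]; exact hω
  · exact (orb_eq_iff.mpr ⟨p, q, r, s, hu, e⟩).symm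

end BCF

namespace BCF

lemma isUnit_not_dvd {p : ℕ} (hp : p.Prime) {u : ℤ} (hu : IsUnit u) : ¬ (p : ℤ) ∣ u := by
  intro h
  exact (Nat.prime_iff_prime_int.mp hp).not_isUnit (isUnit_of_dvd_unit h hu)

lemma Rel.crit_iff {p : ℕ} (hp : p.Prime) {f g : BCF} (h : Rel f g) : Crit p g ↔ Crit p f := by
  obtain ⟨m, n, k, l, hu, rfl⟩ := h
  exact crit_sub_iff (Nat.prime_iff_prime_int.mp hp) (isUnit_not_dvd hp hu)

/-- Maximality at `p`. -/
def Orb.MaxAt (p : ℕ) (ω : Orb) : Prop := ∀ f, ∀ hf : f.Good, orb f hf = ω → ¬ Crit p f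

lemma maxAt_orb {p : ℕ} (hp : p.Prime) {f : BCF} (hf : f.Good) :
    (orb f hf).MaxAt p ↔ ¬ Crit p f := by
  constructor
  · intro h; exact h f hf rfl
  · intro h g hg e
    rwa [(orb_eq_iff.mp e).symm.crit_iff hp]

/-- The number of `p`-overorders of index `p`. -/
noncomputable def Orb.np (p : ℕ) (ω : Orb) : ℕ := {ω' : Orb | Step p ω' ω}.ncard

lemma np_orb {p : ℕ} (hp : p.Prime) {f : BCF} (hf : f.Good) : (orb f hf).np p = BCF.np p f :=
  (ncard_step hp hf).2

/-- Weights invariant under steps at `p`. -/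
def Stable (p : ℕ) (w : Orb → ℝ) : Prop :=
  (∀ ω ω', Step p ω ω' → w ω = w ω') ∧ ∀ (hp : (p : ℤ) ≠ 0) ω, w (ω.smul p hp) = w ω

lemma Stable.mul {p : ℕ} {w v : Orb → ℝ} (hw : Stable p w) (hv : Stable p v) :
    Stable p (fun ω => w ω * v ω) :=
  ⟨fun ω ω' h => by simp only [hw.1 _ _ h, hv.1 _ _ h], fun h ω => by
    simp only [hw.2 h, hv.2 h]⟩

lemma stable_one (p : ℕ) : Stable p (fun _ => 1) := ⟨fun _ _ _ => rfl, fun _ _ => rfl⟩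

lemma Stable.prod {p : ℕ} {ι : Type} (s : Finset ι) {w : ι → Orb → ℝ} (h : ∀ i ∈ s, Stable p (w i)) :
    Stable p (fun ω => ∏ i ∈ s, w i ω) :=
  ⟨fun _ _ hs => Finset.prod_congr rfl fun i hi => (h i hi).1 _ _ hs, fun hp ω =>
    Finset.prod_congr rfl fun i hi => (h i hi).2 hp ω⟩

lemma not_dvd_primes {p q : ℕ} (hp : p.Prime) (hq : q.Prime) (h : p ≠ q) : ¬ (p : ℤ) ∣ q := by
  intro h'
  exact h ((Nat.prime_dvd_prime_iff_eq hp hq).mp (by exact_mod_cast h'))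

lemma stable_np {p q : ℕ} (hp : p.Prime) (hq : q.Prime) (hpq : p ≠ q) :
    Stable q (fun ω => (ω.np p : ℝ) - 1) := by
  have hd := not_dvd_primes hp hq hpq
  constructor
  · intro ω ω' h
    obtain ⟨f, hf, rfl⟩ := ω.exists_rep
    obtain ⟨g, hg, rfl⟩ := ω'.exists_rep
    obtain ⟨m, n, k, l, hdet, h⟩ := h
    have h1 := np_smul hp hd f
    rw [h, np_sub hp (by rwa [← dvd_abs, hdet])] at h1
    simp only [np_orb hp, h1]
  · intro h0 ω
    obtain ⟨f, hf, rfl⟩ := ω.exists_rep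
    rw [orb_smul]
    simp only [np_orb hp, np_smul hp hd]

open scoped Classical in
/-- Indicator of maximality. -/
noncomputable def Orb.maxInd (p : ℕ) (ω : Orb) : ℝ := if ω.MaxAt p then 1 else 0

lemma maxInd_congr {p : ℕ} {ω ω' : Orb} (h : ω.MaxAt p ↔ ω'.MaxAt p) :
    ω.maxInd p = ω'.maxInd p := by
  unfold Orb.maxInd
  by_cases h1 : ω.MaxAt p
  · rw [if_pos h1, if_pos (h.mp h1)]
  · rw [if_neg h1, if_neg (fun h2 => h1 (h.mpr h2))]

lemma stable_maxInd {p q : ℕ} (hp : p.Prime) (hq : q.Prime) (hpq : p ≠ q) :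
    Stable q (fun ω => ω.maxInd p) := by
  have hd := not_dvd_primes hp hq hpq
  have hpp := Nat.prime_iff_prime_int.mp hp
  constructor
  · intro ω ω' h
    obtain ⟨f, hf, rfl⟩ := ω.exists_rep
    obtain ⟨g, hg, rfl⟩ := ω'.exists_rep
    exact maxInd_congr (by rw [maxAt_orb hp, maxAt_orb hp, crit_iff_of_step hpp hd h])
  · intro h0 ω
    obtain ⟨f, hf, rfl⟩ := ω.exists_rep
    rw [orb_smul]
    exact maxInd_congr (by rw [maxAt_orb hp, maxAt_orb hp, crit_smul_iff hpp hd])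

/-- Orbits of bounded discriminant as a finset. -/
noncomputable def OmF (X : ℝ) : Finset Orb := (finite_Om X).toFinset

lemma mem_OmF {X : ℝ} {ω : Orb} : ω ∈ OmF X ↔ -(ω.disc : ℝ) < X := by
  simp [OmF, Om]

lemma step_mem {p : ℕ} (hp : p.Prime) {X : ℝ} {ω ω' : Orb} (h : Step p ω ω') :
    ω ∈ OmF X ↔ ω' ∈ OmF (X / p ^ 2) := by
  have hp0 : (0 : ℝ) < (p : ℝ) ^ 2 := by have := hp.pos; positivity
  rw [mem_OmF, mem_OmF, h.disc_eq (by exact_mod_cast hp.ne_zero), lt_div_iff₀ hp0]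
  push_cast
  constructor <;> intro h <;> linarith

lemma smul_mem {p : ℕ} (hp : (p : ℤ) ≠ 0) {X : ℝ} {ω : Orb} :
    ω.smul p hp ∈ OmF X ↔ ω ∈ OmF (X / p ^ 4) := by
  have hp0 : (0 : ℝ) < (p : ℝ) ^ 4 := by
    have : 0 < p := Nat.pos_of_ne_zero (by exact_mod_cast hp)
    positivity
  rw [mem_OmF, mem_OmF, Orb.smul_disc, lt_div_iff₀ hp0]
  push_cast
  constructor <;> intro h <;> linarith

open scoped Classical in
lemma maxInd_eq {p : ℕ} (hp : p.Prime) (X : ℝ) {ω : Orb} (hω : ω ∈ OmF X) :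
    ω.maxInd p = 1 - (∑ ω' ∈ OmF (X / p ^ 2), if Step p ω ω' then 1 else 0)
      + ∑ ω' ∈ OmF (X / p ^ 4), if Orb.smul p (by exact_mod_cast hp.ne_zero) ω' = ω then
          (ω'.np p : ℝ) - 1 else 0 := by
  have hp0 : (p : ℤ) ≠ 0 := by exact_mod_cast hp.ne_zero
  have hp1 : (0 : ℤ) < p := by exact_mod_cast hp.pos
  have hpp := Nat.prime_iff_prime_int.mp hp
  by_cases h : ∃ ω', Orb.smul p hp0 ω' = ω
  · obtain ⟨ω', rfl⟩ := h
    have e1 : (∑ ω₁ ∈ OmF (X / p ^ 2), if Step p (ω'.smul p hp0) ω₁ then (1 : ℝ) else 0)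
        = ω'.np p := by
      rw [Finset.sum_boole, Orb.np, ← Set.ncard_coe_finset]
      congr 2
      ext ω₁
      simp only [Finset.coe_filter, Set.mem_ofPred_eq]
      rw [step_smul_iff hp1, and_iff_right_iff_imp]
      intro h
      rw [← step_mem hp ((step_smul_iff hp1).mpr h)]
      exact hω
    have e2 : (∑ ω₁ ∈ OmF (X / p ^ 4), if Orb.smul p hp0 ω₁ = ω'.smul p hp0 then
        (ω₁.np p : ℝ) - 1 else 0) = ω'.np p - 1 := by
      rw [Finset.sum_eq_single ω']
      · simp
      · intro b _ hb
        rw [if_neg]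
        intro h; exact hb (Orb.smul_injective hp0 h)
      · intro h; exact absurd ((smul_mem hp0).mp hω) h
    rw [e1, e2, Orb.maxInd, if_neg]
    · ring
    · obtain ⟨f, hf, rfl⟩ := ω'.exists_rep
      rw [orb_smul, maxAt_orb hp, not_not]
      exact Or.inl ⟨f, rfl⟩
  · have e2 : (∑ ω₁ ∈ OmF (X / p ^ 4), if Orb.smul p hp0 ω₁ = ω then
        (ω₁.np p : ℝ) - 1 else 0) = 0 := by
      apply Finset.sum_eq_zero
      intro ω₁ _
      rw [if_neg]
      intro h'; exact h ⟨_, h'⟩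
    rw [e2]
    obtain ⟨f, hf, rfl⟩ := ω.exists_rep
    have hnd : ¬ Dvd p f := by
      rintro ⟨g, rfl⟩
      have hg : g.Good := (Good.of_smul hf)
      exact h ⟨orb g hg, rfl⟩
    by_cases hc : Crit p f
    · have hm : ¬ (orb f hf).MaxAt p := by rw [maxAt_orb hp, not_not]; exact hc
      rw [Orb.maxInd, if_neg hm]
      obtain ⟨g, hg⟩ := (hc.exists_step hp1 hpp).resolve_left hnd
      have hgG : g.Good := (hg.good_iff hp0).mp hf
      have hs : Step p (orb f hf) (orb g hgG) := hg
      rw [Finset.sum_eq_single (orb g hgG)]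
      · rw [if_pos hs]; ring
      · intro b _ hb
        rw [if_neg]
        intro h'
        obtain ⟨g', hg', rfl⟩ := b.exists_rep
        exact hb (orb_eq_iff.mpr (FStep.unique hp hnd h' hg))
      · intro h'; exact absurd ((step_mem hp hs).mp hω) h'
    · rw [Orb.maxInd, if_pos ((maxAt_orb hp hf).mpr hc), Finset.sum_eq_zero]
      · ring
      · intro b _
        rw [if_neg]
        intro hst
        obtain ⟨g', hg', rfl⟩ := b.exists_rep
        exact hc (FStep.crit hpp hst)

/-- The sieve identity at one prime. -/
lemma sieve_prime {p : ℕ} (hp : p.Prime) (X : ℝ) {w : Orb → ℝ} (hw : Stable p w) :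
    ∑ ω ∈ OmF X, w ω * ω.maxInd p = ∑ ω ∈ OmF X, w ω - ∑ ω ∈ OmF (X / p ^ 2), w ω
      - ∑ ω ∈ OmF (X / p ^ 2), w ω * ((ω.np p : ℝ) - 1)
      + ∑ ω ∈ OmF (X / p ^ 4), w ω * ((ω.np p : ℝ) - 1) := by
  classical
  have hp0 : (p : ℤ) ≠ 0 := by exact_mod_cast hp.ne_zero
  have e0 : ∑ ω ∈ OmF X, w ω * ω.maxInd p = ∑ ω ∈ OmF X, (w ω -
      (∑ ω' ∈ OmF (X / p ^ 2), if Step p ω ω' then w ω' else 0)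
      + ∑ ω' ∈ OmF (X / p ^ 4), if Orb.smul p (by exact_mod_cast hp.ne_zero) ω' = ω then 
          w ω' * ((ω'.np p : ℝ) - 1) else 0) := by
    apply Finset.sum_congr rfl
    intro ω hω
    rw [maxInd_eq hp X hω, mul_add, mul_sub, mul_one, Finset.mul_sum, Finset.mul_sum]
    congr 1
    · congr 1
      apply Finset.sum_congr rfl
      intro ω' _
      split_ifs with h
      · rw [hw.1 _ _ h, mul_one]
      · simp
    · apply Finset.sum_congr rfl
      intro ω' _
      split_ifs with h
      · rw [← h, hw.2]
      · simp
  rw [e0, Finset.sum_add_distrib, Finset.sum_sub_distrib, Finset.sum_comm]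
  have e1 : ∀ ω' ∈ OmF (X / p ^ 2), (∑ ω ∈ OmF X, if Step p ω ω' then w ω' else 0) =
      w ω' * ω'.np p := by
    intro ω' hω'
    rw [← Finset.sum_filter, Finset.sum_const, nsmul_eq_mul, mul_comm, Orb.np,
      ← Set.ncard_coe_finset]
    congr 3
    ext ω
    simp only [Finset.coe_filter, Set.mem_ofPred_eq, and_iff_right_iff_imp]
    intro h
    exact (step_mem hp h).mpr hω'
  rw [Finset.sum_congr rfl e1]
  have e2 : (∑ ω ∈ OmF X, ∑ ω' ∈ OmF (X / p ^ 4), if Orb.smul p hp0 ω' = ω then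
          w ω' * ((ω'.np p : ℝ) - 1) else 0) =
      ∑ ω' ∈ OmF (X / p ^ 4), w ω' * ((ω'.np p : ℝ) - 1) := by
    rw [Finset.sum_comm]
    apply Finset.sum_congr rfl
    intro ω' hω'
    rw [Finset.sum_ite_eq, if_pos ((smul_mem hp0).mpr hω')]
  rw [e2]
  simp only [mul_sub, mul_one, Finset.sum_sub_distrib]
  ring

/-- The sieve identity for a finite set of primes. -/
theorem sieve (P : Finset ℕ) (hP : ∀ p ∈ P, p.Prime) (w : Orb → ℝ) (hw : ∀ p ∈ P, Stable p w)
    (X : ℝ) : ∑ ω ∈ OmF X, w ω * ∏ p ∈ P, ω.maxInd p =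
      ∑ J ∈ P.powerset, ∑ K ∈ P.powerset, (-1) ^ (J.card + K.card) *
        ∑ ω ∈ OmF (X / (((∏ p ∈ J, p : ℕ) : ℝ) * ((∏ p ∈ K, p : ℕ) : ℝ)) ^ 2),
          w ω * ∏ p ∈ K, ((ω.np p : ℝ) - 1) := by
  classical
  induction P using Finset.induction_on generalizing w X with
  | empty => simp
  | insert p P hpP ih =>
    have hp : p.Prime := hP p (Finset.mem_insert_self _ _)
    have hP' : ∀ q ∈ P, q.Prime := fun q hq => hP q (Finset.mem_insert_of_mem hq)
    have hne : ∀ q ∈ P, q ≠ p := fun q hq h => hpP (h ▸ hq)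
    have h1 : ∑ ω ∈ OmF X, w ω * ∏ q ∈ insert p P, ω.maxInd q =
        ∑ ω ∈ OmF X, (w ω * ω.maxInd p) * ∏ q ∈ P, ω.maxInd q := by
      apply Finset.sum_congr rfl
      intro ω _
      rw [Finset.prod_insert hpP, mul_assoc]
    rw [h1, ih hP' (fun ω => w ω * ω.maxInd p) (fun q hq =>
      (hw q (Finset.mem_insert_of_mem hq)).mul (stable_maxInd hp (hP' q hq) (hne q hq).symm)) X]
    rw [Finset.sum_powerset_insert hpP, ← Finset.sum_add_distrib]
    apply Finset.sum_congr rfl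
    intro J hJ
    have hpJ : p ∉ J := fun h => hpP (Finset.mem_powerset.mp hJ h)
    rw [Finset.sum_powerset_insert hpP, Finset.sum_powerset_insert hpP,
      ← Finset.sum_add_distrib, ← Finset.sum_add_distrib, ← Finset.sum_add_distrib]
    apply Finset.sum_congr rfl
    intro K hK
    have hpK : p ∉ K := fun h => hpP (Finset.mem_powerset.mp hK h)
    have hst : Stable p (fun ω => w ω * ∏ q ∈ K, ((ω.np q : ℝ) - 1)) := by
      apply (hw p (Finset.mem_insert_self _ _)).mul
      apply Stable.prod
      intro q hq
      have hq := Finset.mem_powerset.mp hK hq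
      exact stable_np (hP' q hq) hp (hne q hq)
    have h2 := sieve_prime hp (X / (((∏ p ∈ J, p : ℕ) : ℝ) * ((∏ p ∈ K, p : ℕ) : ℝ)) ^ 2) hst
    have h3 : ∀ Z : ℝ, ∑ ω ∈ OmF Z, w ω * ω.maxInd p * ∏ q ∈ K, ((ω.np q : ℝ) - 1) =
        ∑ ω ∈ OmF Z, w ω * (∏ q ∈ K, ((ω.np q : ℝ) - 1)) * ω.maxInd p := by
      intro Z
      apply Finset.sum_congr rfl
      intro ω _; ring
    have h4 : ∀ Z : ℝ, ∑ ω ∈ OmF Z, w ω * ∏ q ∈ insert p K, ((ω.np q : ℝ) - 1) =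
        ∑ ω ∈ OmF Z, w ω * (∏ q ∈ K, ((ω.np q : ℝ) - 1)) * ((ω.np p : ℝ) - 1) := by
      intro Z
      apply Finset.sum_congr rfl
      intro ω _; rw [Finset.prod_insert hpK]; ring
    rw [h3, h2, h4, h4, Finset.card_insert_of_notMem hpJ, Finset.card_insert_of_notMem hpK,
      Finset.prod_insert hpJ, Finset.prod_insert hpK]
    push_cast
    have d1 : ∀ u v : ℝ, X / (u * v) ^ 2 / (p : ℝ) ^ 2 = X / (p * u * v) ^ 2 := by
      intro u v; rw [div_div]; congr 1; ring
    have d2 : ∀ u v : ℝ, X / (u * v) ^ 2 / (p : ℝ) ^ 4 = X / (p * u * (p * v)) ^ 2 := by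
      intro u v; rw [div_div]; congr 1; ring
    have d3 : ∀ u v : ℝ, X / (u * (p * v)) ^ 2 = X / (p * u * v) ^ 2 := by
      intro u v; rw [show u * (p * v) = p * u * v by ring]
    rw [d1, d2, d3]
    ring_nf

end BCF

section

open Polynomial

namespace BCF

/-- `f` has a root in `K`. -/
def Rt (K : Type) [Field K] (f : BCF) : Prop :=
  ∃ ρ : K, (f.a : K) * ρ ^ 3 + f.b * ρ ^ 2 + f.c * ρ + f.d = 0

/-- The dehomogenized polynomial. -/
noncomputable def poly (f : BCF) : ℚ[X] :=
  C (f.a : ℚ) * X ^ 3 + C (f.b : ℚ) * X ^ 2 + C (f.c : ℚ) * X + C (f.d : ℚ)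

lemma poly_natDegree {f : BCF} (ha : f.a ≠ 0) : f.poly.natDegree = 3 :=
  natDegree_cubic (by exact_mod_cast ha)

lemma Irr.poly_irreducible {f : BCF} (h : f.Irr) : Irreducible f.poly := by
  have hd := poly_natDegree h.a_ne
  apply irreducible_of_degree_le_three_of_not_isRoot (by rw [hd]; decide)
  intro x hx
  have hx : (f.a : ℚ) * x ^ 3 + f.b * x ^ 2 + f.c * x + f.d = 0 := by
    simpa [poly, IsRoot] using hx
  have hden : (x.den : ℚ) ≠ 0 := by exact_mod_cast x.den_ne_zero
  have hxd : x * x.den = x.num := Rat.mul_den_eq_num x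
  have : f.eval x.num x.den = 0 := by
    have : ((f.eval x.num x.den : ℤ) : ℚ) = 0 := by
      simp only [eval]; push_cast
      rw [← hxd]
      linear_combination (x.den : ℚ) ^ 3 * hx
    exact_mod_cast this
  have h2 := (h _ _ this).2
  exact x.den_ne_zero (by exact_mod_cast h2)

lemma rt_iff {K : Type} [Field K] [CharZero K] {f : BCF} :
    Rt K f ↔ ∃ ρ : K, aeval ρ f.poly = 0 := by
  simp [Rt, poly]

lemma Rt.equiv {K : Type} [Field K] [NumberField K] (hK : Module.finrank ℚ K = 3) {f : BCF}
    (hf : f.Irr) (h : Rt K f) : Nonempty (AdjoinRoot f.poly ≃+* K) := by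
  have : Fact (Irreducible f.poly) := ⟨hf.poly_irreducible⟩
  obtain ⟨ρ, hρ⟩ := rt_iff.mp h
  let φ : AdjoinRoot f.poly →ₐ[ℚ] K := AdjoinRoot.liftAlgHom f.poly (Algebra.ofId ℚ K) ρ (by
    simpa [aeval_def] using hρ)
  have hinj : Function.Injective φ := φ.toRingHom.injective
  have hfin : Module.finrank ℚ (AdjoinRoot f.poly) = 3 := by
    rw [(AdjoinRoot.powerBasis hf.poly_irreducible.ne_zero).finrank,
      AdjoinRoot.powerBasis_dim, poly_natDegree hf.a_ne]
  have : FiniteDimensional ℚ (AdjoinRoot f.poly) :=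
    (AdjoinRoot.powerBasis hf.poly_irreducible.ne_zero).finite
  have hb : Function.Bijective φ := by
    refine ⟨hinj, ?_⟩
    exact (LinearMap.injective_iff_surjective_of_finrank_eq_finrank (f := φ.toLinearMap)
      (by rw [hfin, hK])).mp hinj
  exact ⟨RingEquiv.ofBijective φ.toRingHom hb⟩

lemma exists_field {f : BCF} (hf : f.Irr) : ∃ K : CubicField, Rt K.carrier f := by
  have : Fact (Irreducible f.poly) := ⟨hf.poly_irreducible⟩
  have : FiniteDimensional ℚ (AdjoinRoot f.poly) :=
    (AdjoinRoot.powerBasis hf.poly_irreducible.ne_zero).finite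
  have : CharZero (AdjoinRoot f.poly) := charZero_of_injective_algebraMap
    (algebraMap ℚ (AdjoinRoot f.poly)).injective
  have : NumberField (AdjoinRoot f.poly) := by
    refine @NumberField.mk _ _ inferInstance ?_
    convert (inferInstance : FiniteDimensional ℚ (AdjoinRoot f.poly))
  refine ⟨⟨AdjoinRoot f.poly, ?_⟩, ?_⟩
  · have : Module.finrank ℚ (AdjoinRoot f.poly) = 3 := by
      rw [(AdjoinRoot.powerBasis hf.poly_irreducible.ne_zero).finrank,
        AdjoinRoot.powerBasis_dim, poly_natDegree hf.a_ne]
    convert this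
  · refine rt_iff.mpr ⟨AdjoinRoot.root f.poly, ?_⟩
    convert AdjoinRoot.eval₂_root f.poly using 1
    rw [aeval_def]
    congr 1

lemma Rt.map {K L : Type} [Field K] [Field L] (e : K →+* L) {f : BCF} (h : Rt K f) : Rt L f := by
  obtain ⟨ρ, h⟩ := h
  refine ⟨e ρ, ?_⟩
  have := congrArg e h
  simpa using this

lemma Rt.smul {K : Type} [Field K] {n : ℤ} {f : BCF} (h : Rt K f) : Rt K (smul n f) := by
  obtain ⟨ρ, h⟩ := h
  refine ⟨ρ, ?_⟩
  simp only [BCF.smul]; push_cast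
  linear_combination (n : K) * h

lemma Rt.of_smul {K : Type} [Field K] [CharZero K] {n : ℤ} (hn : n ≠ 0) {f : BCF}
    (h : Rt K (BCF.smul n f)) : Rt K f := by
  obtain ⟨ρ, h⟩ := h
  refine ⟨ρ, ?_⟩
  have hn : (n : K) ≠ 0 := by exact_mod_cast hn
  apply mul_left_cancel₀ hn
  simp only [BCF.smul] at h; push_cast at h
  linear_combination h

lemma Irr.root_ne {K : Type} [Field K] [CharZero K] {f : BCF} (hf : f.Irr) {ρ : K}
    (h : (f.a : K) * ρ ^ 3 + f.b * ρ ^ 2 + f.c * ρ + f.d = 0) {x y : ℤ}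
    (hxy : (y : K) * ρ = x) : x = 0 ∧ y = 0 := by
  apply hf
  have : ((f.eval x y : ℤ) : K) = 0 := by
    simp only [eval]; push_cast
    rw [← hxy]
    linear_combination (y : K) ^ 3 * h
  exact_mod_cast this

lemma Rt.of_sub {K : Type} [Field K] [CharZero K] {p q r s : ℤ} {f : BCF}
    (hf : (f.sub p q r s).Irr) (hd : p * s - q * r ≠ 0)
    (h : Rt K (f.sub p q r s)) : Rt K f := by
  obtain ⟨ρ, h⟩ := h
  have hne : (r : K) * ρ + s ≠ 0 := by
    intro h0
    have := hf.root_ne h (x := -s) (y := r) (by push_cast; linear_combination h0)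
    apply hd; rw [this.2, neg_eq_zero.mp this.1]; ring
  refine ⟨(p * ρ + q) / (r * ρ + s), ?_⟩
  simp only [BCF.sub] at h
  push_cast at h
  set v := (r : K) * ρ + s with hv
  set u := (p : K) * ρ + q with hu
  have key : (f.a : K) * u ^ 3 + f.b * u ^ 2 * v + f.c * u * v ^ 2 + f.d * v ^ 3 = 0 := by
    rw [hu, hv]; linear_combination h
  have e : (f.a : K) * (u / v) ^ 3 + f.b * (u / v) ^ 2 + f.c * (u / v) + f.d =
      (f.a * u ^ 3 + f.b * u ^ 2 * v + f.c * u * v ^ 2 + f.d * v ^ 3) / v ^ 3 := by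
    clear_value u v
    field_simp
  rw [e, key, zero_div]

lemma Rel.rt {K : Type} [Field K] [CharZero K] {f g : BCF} (hg : g.Irr) (h : Rel f g)
    (h' : Rt K g) : Rt K f := by
  obtain ⟨p, q, r, s, hu, rfl⟩ := h
  exact h'.of_sub hg hu.ne_zero

lemma FStep.rt {K : Type} [Field K] [CharZero K] {f g : BCF} {p : ℤ} (hp : p ≠ 0)
    (hf : f.Good) (h : FStep p f g) (h' : Rt K f) : Rt K g := by
  obtain ⟨m, n, k, l, hd, h⟩ := h
  have hI := (hf.smul hp).1
  have h2 : Rt K (BCF.smul p f) := h'.smul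
  rw [h] at h2 hI
  refine h2.of_sub hI ?_
  intro h0; rw [h0, abs_zero] at hd; exact hp hd.symm

end BCF

end

namespace BCF

/-- `1, ω, θ` is a basis of `𝓞 K` with multiplication table given by `f`. -/
structure IsIndex (K : Type) [Field K] [NumberField K] (f : BCF)
    (e : Module.Basis (Fin 3) ℤ (NumberField.RingOfIntegers K)) : Prop where
  e0 : e 0 = 1
  h12 : e 1 * e 2 = ((-f.a * f.d : ℤ) : NumberField.RingOfIntegers K)
  h11 : e 1 ^ 2 = ((-f.a * f.c : ℤ) : NumberField.RingOfIntegers K) + f.b * e 1 - f.a * e 2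
  h22 : e 2 ^ 2 = ((-f.b * f.d : ℤ) : NumberField.RingOfIntegers K) + f.d * e 1 - f.c * e 2

section
variable {K : Type} [Field K] [NumberField K]

local notation "O" => NumberField.RingOfIntegers K

lemma int_isUnit {n : ℤ} {x : O} (h : (n : O) * x = 1) : IsUnit n := by
  have h1 := congrArg (Algebra.norm ℤ) h
  rw [map_mul, map_one, ← eq_intCast (algebraMap ℤ O) n, Algebra.norm_algebraMap] at h1
  have h2 := IsUnit.of_mul_eq_one _ h1
  refine (isUnit_pow_iff ?_).mp h2
  rw [NumberField.RingOfIntegers.rank]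
  exact Module.finrank_pos.ne'

lemma exists_basis_one (hK : Module.finrank ℚ K = 3) :
    ∃ e : Module.Basis (Fin 3) ℤ O, e 0 = 1 := by
  have hr : Module.finrank ℤ O = 3 := by rw [NumberField.RingOfIntegers.rank, hK]
  let b : Module.Basis (Fin 3) ℤ O := (Module.finBasis ℤ O).reindex (finCongr hr)
  obtain ⟨n, S⟩ := Submodule.smithNormalForm b (Submodule.span ℤ {(1 : O)})
  have hn : n = 1 := by
    have h1 := Module.finrank_eq_card_basis S.bN
    rw [← (LinearEquiv.toSpanNonzeroSingleton ℤ O 1 one_ne_zero).finrank_eq] at h1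
    simpa using h1.symm
  subst hn
  have h1 : (1 : O) = ((S.bN.repr ⟨1, Submodule.mem_span_singleton_self 1⟩ 0 * S.a 0 : ℤ) : O)
      * S.bM (S.f 0) := by
    have := congrArg Subtype.val (S.bN.sum_repr ⟨1, Submodule.mem_span_singleton_self 1⟩)
    simp only [Fin.sum_univ_one, Submodule.coe_smul, S.snf] at this
    refine Eq.trans this.symm ?_
    simp [zsmul_eq_mul, mul_assoc]
  have hu := int_isUnit h1.symm
  set u := S.bN.repr ⟨1, Submodule.mem_span_singleton_self 1⟩ 0 * S.a 0
  let e := (S.bM.unitsSMul (fun _ => hu.unit)).reindex (Equiv.swap (S.f 0) 0)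
  refine ⟨e, ?_⟩
  simp only [e, Module.Basis.reindex_apply, Equiv.symm_swap, Equiv.swap_apply_right,
    Module.Basis.unitsSMul_apply]
  refine Eq.trans ?_ h1.symm
  rw [Units.smul_def, IsUnit.unit_spec, zsmul_eq_mul]

lemma coords (e : Module.Basis (Fin 3) ℤ O) (h0 : e 0 = 1) (x : O) :
    ∃ n p q : ℤ, x = n + p * e 1 + q * e 2 := by
  refine ⟨e.repr x 0, e.repr x 1, e.repr x 2, ?_⟩
  conv_lhs => rw [← e.sum_repr x]
  rw [Fin.sum_univ_three, h0]
  simp [zsmul_eq_mul]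

lemma coords_zero (e : Module.Basis (Fin 3) ℤ O) (h0 : e 0 = 1) {n p q : ℤ}
    (h : (n : O) + p * e 1 + q * e 2 = 0) : n = 0 ∧ p = 0 ∧ q = 0 := by
  have h1 := Fintype.linearIndependent_iff.mp e.linearIndependent ![n, p, q] (by
    rw [Fin.sum_univ_three, h0]; simpa [zsmul_eq_mul] using h)
  exact ⟨h1 0, h1 1, h1 2⟩

lemma coords_eq (e : Module.Basis (Fin 3) ℤ O) (h0 : e 0 = 1) {n p q n' p' q' : ℤ}
    (h : (n : O) + p * e 1 + q * e 2 = n' + p' * e 1 + q' * e 2) : n = n' ∧ p = p' ∧ q = q' := by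
  have := coords_zero e h0 (n := n - n') (p := p - p') (q := q - q')
    (by push_cast; linear_combination h)
  omega

/-- A normalized basis exists. -/
lemma exists_isIndex (hK : Module.finrank ℚ K = 3) :
    ∃ (f : BCF) (e : Module.Basis (Fin 3) ℤ O), IsIndex K f e := by
  obtain ⟨e, he⟩ := exists_basis_one hK
  obtain ⟨n, x, y, hxy⟩ := coords e he (e 1 * e 2)
  -- translate the basis
  let v : Fin 3 → O := ![1, e 1 - y, e 2 - x]
  have hli : LinearIndependent ℤ v := by
    rw [Fintype.linearIndependent_iff]
    intro g hg
    rw [Fin.sum_univ_three] at hg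
    simp only [v, zsmul_eq_mul] at hg
    simp only [Matrix.cons_val_zero, Matrix.cons_val_one, Matrix.cons_val] at hg
    have := coords_zero e he (n := g 0 - g 1 * y - g 2 * x) (p := g 1) (q := g 2)
      (by push_cast; linear_combination hg)
    have h0 : g 0 = 0 := by rw [this.2.1, this.2.2] at this; simpa using this.1
    intro i
    fin_cases i
    exacts [h0, this.2.1, this.2.2]
  have hsp : ⊤ ≤ Submodule.span ℤ (Set.range v) := by
    intro z _
    obtain ⟨m, p, q, rfl⟩ := coords e he z
    have hv : ∀ i, v i ∈ Submodule.span ℤ (Set.range v) := fun i => Submodule.subset_span ⟨i, rfl⟩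
    have e1 : (m : O) + p * e 1 + q * e 2 = (m + p * y + q * x : ℤ) • v 0 + p • v 1 + q • v 2 := by
      simp [v, zsmul_eq_mul]; ring
    rw [e1]
    exact Submodule.add_mem _ (Submodule.add_mem _ (Submodule.smul_mem _ _ (hv 0))
      (Submodule.smul_mem _ _ (hv 1))) (Submodule.smul_mem _ _ (hv 2))
  let e' := Module.Basis.mk hli hsp
  have h0 : e' 0 = 1 := by simp [e', v]
  have h12 : e' 1 * e' 2 = ((n + x * y : ℤ) : O) := by
    simp only [e', v, Module.Basis.mk_apply, Matrix.cons_val_one, Matrix.cons_val]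
    push_cast; linear_combination hxy
  obtain ⟨m, b, a, h11⟩ := coords e' h0 (e' 1 ^ 2)
  obtain ⟨l, d, c, h22⟩ := coords e' h0 (e' 2 ^ 2)
  clear_value e'
  set k := n + x * y with hk
  clear_value k
  set w := e' 1
  set t := e' 2
  have hA := coords_eq e' h0 (n := 0) (p := k) (q := 0) (n' := b * k + a * l) (p' := a * d)
    (q' := m + a * c) (by push_cast; linear_combination (-w + b) * h12 + t * h11 + a * h22)
  have hB := coords_eq e' h0 (n := 0) (p := 0) (q := k) (n' := d * m + c * k) (p' := l + d * b)
    (q' := d * a) (by push_cast; linear_combination (-t + c) * h12 + w * h22 + d * h11)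
  refine ⟨⟨-a, b, -c, d⟩, e', ⟨h0, ?_, ?_, ?_⟩⟩
  · rw [h12, hA.2.1]; push_cast; ring
  · rw [h11, show m = -(a * c) by linarith [hA.2.2]]; push_cast; ring
  · rw [h22, show l = -(d * b) by linarith [hB.2.1]]; push_cast; ring

lemma IsIndex.discr {f : BCF} {e : Module.Basis (Fin 3) ℤ O} (h : IsIndex K f e) :
    NumberField.discr K = f.disc := by
  have rp : ∀ n p q : ℤ, e.repr (n + p * e 1 + q * e 2) = Finsupp.single 0 n + Finsupp.single 1 p
      + Finsupp.single 2 q := by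
    intro n p q
    have : (n + p * e 1 + q * e 2 : O) = n • e 0 + p • e 1 + q • e 2 := by
      rw [h.e0]; simp [zsmul_eq_mul]
    rw [this, map_add, map_add, map_zsmul, map_zsmul, map_zsmul]
    simp
  have t0 : Algebra.trace ℤ O 1 = 3 := by
    rw [Algebra.trace_eq_matrix_trace e, map_one]; simp
  have hm1 : Algebra.leftMulMatrix e (e 1) = !![0, -f.a * f.c, -f.a * f.d; 1, f.b, 0; 0, -f.a, 0] := by
    have c0 := rp 0 1 0
    have c1 := rp (-f.a * f.c) f.b (-f.a)
    have c2 := rp (-f.a * f.d) 0 0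
    rw [show ((-f.a * f.c : ℤ) : O) + f.b * e 1 + ((-f.a : ℤ) : O) * e 2 = e 1 * e 1 by
      rw [← sq, h.h11]; push_cast; ring] at c1
    simp only [Int.cast_zero, zero_mul, add_zero, ← h.h12, zero_add, Int.cast_one, one_mul]
      at c0 c2
    ext i j
    rw [Algebra.leftMulMatrix_eq_repr_mul]
    fin_cases j
    · simp only [Fin.zero_eta, h.e0, mul_one, c0]
      fin_cases i <;> simp
    · simp only [Fin.mk_one, c1]
      fin_cases i <;> simp
    · simp only [Fin.reduceFinMk, c2]
      fin_cases i <;> simp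
  have hm2 : Algebra.leftMulMatrix e (e 2) = !![0, -f.a * f.d, -f.b * f.d; 0, 0, f.d; 1, 0, -f.c] := by
    have c0 := rp 0 0 1
    have c1 := rp (-f.a * f.d) 0 0
    have c2 := rp (-f.b * f.d) f.d (-f.c)
    rw [show ((-f.b * f.d : ℤ) : O) + f.d * e 1 + ((-f.c : ℤ) : O) * e 2 = e 2 * e 2 by
      rw [← sq, h.h22]; push_cast; ring] at c2
    simp only [Int.cast_zero, zero_mul, add_zero, ← h.h12, zero_add, Int.cast_one, one_mul]
      at c0 c1
    ext i j
    rw [Algebra.leftMulMatrix_eq_repr_mul]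
    fin_cases j
    · simp only [Fin.zero_eta, h.e0, mul_one, c0]
      fin_cases i <;> simp
    · simp only [Fin.mk_one, mul_comm (e 2), c1]
      fin_cases i <;> simp
    · simp only [Fin.reduceFinMk, c2]
      fin_cases i <;> simp
  have t1 : Algebra.trace ℤ O (e 1) = f.b := by
    rw [Algebra.trace_eq_matrix_trace e, hm1]; simp [Matrix.trace, Fin.sum_univ_three]
  have t2 : Algebra.trace ℤ O (e 2) = -f.c := by
    rw [Algebra.trace_eq_matrix_trace e, hm2]; simp [Matrix.trace, Fin.sum_univ_three]
  have tr : ∀ n p q : ℤ, Algebra.trace ℤ O (n + p * e 1 + q * e 2) = 3 * n + f.b * p - f.c * q := by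
    intro n p q
    have : (n + p * e 1 + q * e 2 : O) = n • 1 + p • e 1 + q • e 2 := by simp [zsmul_eq_mul]
    rw [this, map_add, map_add, map_zsmul, map_zsmul, map_zsmul, t0, t1, t2]
    simp; ring
  rw [← NumberField.discr_eq_discr K e, Algebra.discr_def]
  have e00 := tr 1 0 0
  have e01 := tr 0 1 0
  have e02 := tr 0 0 1
  have e11 := tr (-f.a * f.c) f.b (-f.a)
  have e12 := tr (-f.a * f.d) 0 0
  have e22 := tr (-f.b * f.d) f.d (-f.c)
  have x11 : e 1 * e 1 = ((-f.a * f.c : ℤ) : O) + f.b * e 1 + ((-f.a : ℤ) : O) * e 2 := by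
    rw [← sq, h.h11]; push_cast; ring
  have x22 : e 2 * e 2 = ((-f.b * f.d : ℤ) : O) + f.d * e 1 + ((-f.c : ℤ) : O) * e 2 := by
    rw [← sq, h.h22]; push_cast; ring
  rw [← x11] at e11
  rw [← x22] at e22
  simp only [Int.cast_zero, zero_mul, add_zero, ← h.h12] at e12
  have e12' := e12
  rw [mul_comm] at e12'
  simp only [Int.cast_zero, zero_mul, add_zero, zero_add, Int.cast_one, one_mul] at e00 e01 e02
  rw [Matrix.det_fin_three]
  simp only [Algebra.traceMatrix_apply, Algebra.traceForm_apply, h.e0, one_mul, mul_one, e00, e01, e02, e11, e12, e12', e22]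
  simp only [disc]; ring

end
end BCF

namespace BCF

section
variable {K : Type} [Field K] [NumberField K]

local notation "O" => NumberField.RingOfIntegers K

lemma IsIndex.irr {f : BCF} {e : Module.Basis (Fin 3) ℤ O} (h : IsIndex K f e) : f.Irr := by
  have ha : f.a ≠ 0 := by
    intro h0
    have h1 := h.h11
    rw [h0] at h1
    have h2 : e 1 * (e 1 - f.b) = 0 := by
      push_cast at h1; linear_combination h1
    rcases mul_eq_zero.mp h2 with h3 | h3
    · have := coords_zero e h.e0 (n := 0) (p := 1) (q := 0) (by push_cast; linear_combination h3)
      omega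
    · have := coords_zero e h.e0 (n := -f.b) (p := 1) (q := 0)
        (by push_cast; linear_combination h3)
      omega
  intro x y hxy
  have hid : ((f.a * x : ℤ) + y * e 1 + (0 : ℤ) * e 2 : O)
      * ((f.a * x ^ 2 + f.b * x * y : ℤ) + (-x * y : ℤ) * e 1 + (-y ^ 2 : ℤ) * e 2) = 0 := by
    have h1 : ((f.eval x y : ℤ) : O) = 0 := by rw [hxy]; simp
    simp only [eval] at h1
    have h11 := h.h11
    have h12 := h.h12
    push_cast at h1 h11 h12 ⊢
    linear_combination (f.a : O) * h1 - (y : O) ^ 3 * h12 - (x : O) * y ^ 2 * h11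
  rcases mul_eq_zero.mp hid with h1 | h1
  · obtain ⟨h2, h3, -⟩ := coords_zero e h.e0 h1
    exact ⟨(mul_eq_zero.mp h2).resolve_left ha, h3⟩
  · obtain ⟨-, -, h2⟩ := coords_zero e h.e0 h1
    have hy : y = 0 := by simpa using h2
    subst hy
    refine ⟨?_, rfl⟩
    simp only [eval] at hxy
    have : f.a * x ^ 3 = 0 := by linear_combination hxy
    simpa [ha] using this

lemma IsIndex.rt {f : BCF} {e : Module.Basis (Fin 3) ℤ O} (h : IsIndex K f e) : Rt K f := by
  have ha : (f.a : K) ≠ 0 := by exact_mod_cast h.irr.a_ne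
  have h3 : (e 1 : O) ^ 3 - f.b * e 1 ^ 2 + f.a * f.c * e 1 - f.a ^ 2 * f.d = 0 := by
    have h11 := h.h11
    have h12 := h.h12
    push_cast at h11 h12
    linear_combination e 1 * h11 - (f.a : O) * h12
  have h4 := congrArg (algebraMap O K) h3
  simp only [map_add, map_sub, map_mul, map_pow, map_intCast, map_zero] at h4
  refine ⟨-algebraMap O K (e 1) / f.a, ?_⟩
  set w := algebraMap O K (e 1)
  have : (f.a : K) ^ 2 * (f.a * (-w / f.a) ^ 3 + f.b * (-w / f.a) ^ 2 + f.c * (-w / f.a) + f.d) = 0 := by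
    field_simp
    linear_combination -h4
  exact (mul_eq_zero.mp this).resolve_left (pow_ne_zero 2 ha)

lemma isIntegral_of_cubic {x : K} {b c d : ℤ} (h : x ^ 3 + b * x ^ 2 + c * x + d = 0) :
    IsIntegral ℤ x := by
  refine ⟨Polynomial.X ^ 3 + (Polynomial.C b * Polynomial.X ^ 2 + Polynomial.C c * Polynomial.X
    + Polynomial.C d), Polynomial.monic_X_pow_add ?_, ?_⟩
  · exact lt_of_le_of_lt (Polynomial.degree_quadratic_le) (by norm_num)
  · simp only [Polynomial.eval₂_add, Polynomial.eval₂_mul, Polynomial.eval₂_pow,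
      Polynomial.eval₂_X, Polynomial.eval₂_C]
    simp only [eq_intCast]
    linear_combination h

lemma IsIndex.exists_sub {f : BCF} {e : Module.Basis (Fin 3) ℤ O} (h : IsIndex K f e) {g : BCF}
    (hg : g.Irr) (hr : Rt K g) : ∃ p q r s : ℤ, p * s - q * r ≠ 0 ∧
      smul (p * s - q * r) g = f.sub p q r s := by
  obtain ⟨ρ, hρ⟩ := hr
  have hW : IsIntegral ℤ (-(g.a : K) * ρ) := by
    apply isIntegral_of_cubic (b := -g.b) (c := g.a * g.c) (d := -g.a ^ 2 * g.d)
    push_cast; linear_combination (-(g.a : K) ^ 2) * hρ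
  have hT : IsIntegral ℤ (-(g.a * ρ ^ 2 + g.b * ρ + g.c : K)) := by
    apply isIntegral_of_cubic (b := g.c) (c := g.b * g.d) (d := g.a * g.d ^ 2)
    push_cast
    linear_combination (-(g.a : K) ^ 2 * ρ ^ 3 - 2 * g.a * g.b * ρ ^ 2 - g.a * g.c * ρ
      - g.b ^ 2 * ρ + g.a * g.d - g.b * g.c) * hρ
  have hWT : (-(g.a : K) * ρ) * (-(g.a * ρ ^ 2 + g.b * ρ + g.c : K)) = -g.a * g.d := by
    linear_combination (g.a : K) * hρ
  have hWW : (-(g.a : K) * ρ) ^ 2 = -g.a * g.c + g.b * (-(g.a : K) * ρ)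
      - g.a * (-(g.a * ρ ^ 2 + g.b * ρ + g.c : K)) := by ring
  have hTT : (-(g.a * ρ ^ 2 + g.b * ρ + g.c : K)) ^ 2 = -g.b * g.d + g.d * (-(g.a : K) * ρ)
      - g.c * (-(g.a * ρ ^ 2 + g.b * ρ + g.c : K)) := by
    linear_combination ((g.a : K) * ρ + g.b) * hρ
  obtain ⟨n, p, q, hW'⟩ := coords e h.e0 (⟨_, hW⟩ : O)
  obtain ⟨l, r, s, hT'⟩ := coords e h.e0 (⟨_, hT⟩ : O)
  have eW : -(g.a : K) * ρ = algebraMap O K (n + p * e 1 + q * e 2) := by rw [← hW']; rfl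
  have eT : -(g.a * ρ ^ 2 + g.b * ρ + g.c : K) = algebraMap O K (l + r * e 1 + s * e 2) := by
    rw [← hT']; rfl
  have hirr := hg.root_ne hρ (x := -n) (y := g.a)
  rw [eW, eT] at hWT hWW hTT
  have inj := NumberField.RingOfIntegers.coe_injective (K := K)
  have h1 : ((n + p * e 1 + q * e 2) * (l + r * e 1 + s * e 2) : O) = -g.a * g.d := by
    apply inj; simpa using hWT
  have h2 : ((n + p * e 1 + q * e 2) ^ 2 : O) = -g.a * g.c + g.b * (n + p * e 1 + q * e 2)
      - g.a * (l + r * e 1 + s * e 2) := by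
    apply inj; simpa using hWW
  have h3 : ((l + r * e 1 + s * e 2) ^ 2 : O) = -g.b * g.d + g.d * (n + p * e 1 + q * e 2)
      - g.c * (l + r * e 1 + s * e 2) := by
    apply inj; simpa using hTT
  have h11 := h.h11
  have h12 := h.h12
  have h22 := h.h22
  push_cast at h11 h12 h22
  obtain ⟨-, a1, a2⟩ := coords_eq e h.e0
    (n := n * l - p * r * f.a * f.c - q * s * f.b * f.d - (p * s + q * r) * f.a * f.d)
    (p := n * r + l * p + f.b * p * r + f.d * q * s) (q := n * s + l * q - f.a * p * r - f.c * q * s)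
    (n' := -g.a * g.d) (p' := 0) (q' := 0) (by
      push_cast
      linear_combination h1 - (p : O) * r * h11 - (q : O) * s * h22 - ((p : O) * s + q * r) * h12)
  obtain ⟨-, b1, b2⟩ := coords_eq e h.e0
    (n := n * n - p * p * f.a * f.c - q * q * f.b * f.d - (2 * p * q) * f.a * f.d)
    (p := 2 * n * p + f.b * p * p + f.d * q * q) (q := 2 * n * q - f.a * p * p - f.c * q * q)
    (n' := -g.a * g.c + g.b * n - g.a * l) (p' := g.b * p - g.a * r) (q' := g.b * q - g.a * s) (by
      push_cast
      linear_combination h2 - (p : O) ^ 2 * h11 - (q : O) ^ 2 * h22 - (2 * (p : O) * q) * h12)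
  obtain ⟨-, c1, c2⟩ := coords_eq e h.e0
    (n := l * l - r * r * f.a * f.c - s * s * f.b * f.d - (2 * r * s) * f.a * f.d)
    (p := 2 * l * r + f.b * r * r + f.d * s * s) (q := 2 * l * s - f.a * r * r - f.c * s * s)
    (n' := -g.b * g.d + g.d * n - g.c * l) (p' := g.d * p - g.c * r) (q' := g.d * q - g.c * s) (by
      push_cast
      linear_combination h3 - (r : O) ^ 2 * h11 - (s : O) ^ 2 * h22 - (2 * (r : O) * s) * h12)
  refine ⟨p, r, q, s, ?_, ?_⟩
  · intro h0
    have : f.eval p q = 0 := by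
      simp only [eval]
      linear_combination q * b1 - p * b2 + g.a * h0
    obtain ⟨rfl, rfl⟩ := h.irr _ _ this
    have := hirr (by
      push_cast
      simp at eW
      linear_combination -eW)
    exact hg.a_ne this.2
  · ext
    · simp only [smul, sub]; linear_combination p * b2 - q * b1
    · simp only [smul, sub]; linear_combination r * b2 - s * b1 + 2 * (p * a2 - q * a1)
    · simp only [smul, sub]; linear_combination p * c2 - q * c1 + 2 * (r * a2 - s * a1)
    · simp only [smul, sub]; linear_combination r * c2 - s * c1

end

lemma disc_of_smul_eq {f g : BCF} {p q r s : ℤ} (h0 : p * s - q * r ≠ 0)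
    (h : smul (p * s - q * r) g = f.sub p q r s) : g.disc = (p * s - q * r) ^ 2 * f.disc := by
  have := congrArg disc h
  rw [smul_disc, sub_disc] at this
  have h4 := pow_ne_zero 4 h0
  apply mul_left_cancel₀ h4
  linear_combination this

/-- A proper overring at `l` forces the nonmaximality criterion. -/
lemma crit_of_smul_eq {l : ℤ} (hl : Prime l) {f g : BCF} : ∀ (N : ℕ) (p q r s m : ℤ),
    (p * s - q * r).natAbs ≤ N → p * s - q * r ≠ 0 → (l ∣ p * s - q * r ∨ l ∣ m) →
    smul (p * s - q * r) g = smul m (f.sub p q r s) → Crit l g := by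
  intro N
  induction N with
  | zero =>
    intro p q r s m h1 h2
    omega
  | succ N ih =>
    intro p q r s m hN h0 hd h
    by_cases hall : l ∣ p ∧ l ∣ q ∧ l ∣ r ∧ l ∣ s
    · obtain ⟨⟨p, rfl⟩, ⟨q, rfl⟩, ⟨r, rfl⟩, ⟨s, rfl⟩⟩ := hall
      have e1 : l * p * (l * s) - l * q * (l * r) = l ^ 2 * (p * s - q * r) := by ring
      rw [e1] at h0 h hN
      have hd0 : p * s - q * r ≠ 0 := right_ne_zero_of_mul h0
      have hl2 : l ^ 2 ≠ 0 := left_ne_zero_of_mul h0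
      refine ih p q r s (m * l) ?_ hd0 (Or.inr (dvd_mul_left _ _)) ?_
      · rw [Int.natAbs_mul, Int.natAbs_pow] at hN
        have h1 : 2 ≤ l.natAbs := (Int.prime_iff_natAbs_prime.mp hl).two_le
        have h2 : 1 ≤ (p * s - q * r).natAbs := Nat.one_le_iff_ne_zero.mpr (Int.natAbs_ne_zero.mpr hd0)
        have h3 : 4 ≤ l.natAbs ^ 2 := by nlinarith
        nlinarith
      · apply smul_inj hl2
        rw [smul_smul, smul_smul, h]
        ext <;> simp only [smul, sub] <;> ring
    · by_cases hdd : l ∣ p * s - q * r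
      · obtain ⟨k, hk⟩ := hdd
        set δ := p * s - q * r with hδ
        have key : ∀ x y : ℤ, (∃ u v : ℤ, p * x + q * y = δ * u ∧ r * x + s * y = δ * v) →
            l ^ 2 ∣ g.eval x y ∧ l ∣ g.evalX x y ∧ l ∣ g.evalY x y := by
          rintro x y ⟨u, v, hu, hv⟩
          refine ⟨?_, ?_, ?_⟩
          · have e := congrArg (fun F : BCF => F.eval x y) h
            simp only [smul_eval, sub_eval, hu, hv] at e
            have : g.eval x y = δ ^ 2 * (m * f.eval u v) := by
              apply mul_left_cancel₀ h0
              rw [e]; simp only [eval]; ring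
            rw [this, hk]
            exact ⟨k ^ 2 * (m * f.eval u v), by ring⟩
          · have e := congrArg (fun F : BCF => F.evalX x y) h
            have e2 : (f.sub p q r s).evalX x y = p * f.evalX (p * x + q * y) (r * x + s * y)
                + r * f.evalY (p * x + q * y) (r * x + s * y) := by
              simp only [evalX, evalY, sub]; ring
            simp only [smul_evalX, e2, hu, hv] at e
            have : g.evalX x y = δ * (m * (p * f.evalX u v + r * f.evalY u v)) := by
              apply mul_left_cancel₀ h0
              rw [e]; simp only [evalX, evalY]; ring
            rw [this, hk]
            exact ⟨k * (m * (p * f.evalX u v + r * f.evalY u v)), by ring⟩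
          · have e := congrArg (fun F : BCF => F.evalY x y) h
            have e2 : (f.sub p q r s).evalY x y = q * f.evalX (p * x + q * y) (r * x + s * y)
                + s * f.evalY (p * x + q * y) (r * x + s * y) := by
              simp only [evalX, evalY, sub]; ring
            simp only [smul_evalY, e2, hu, hv] at e
            have : g.evalY x y = δ * (m * (q * f.evalX u v + s * f.evalY u v)) := by
              apply mul_left_cancel₀ h0
              rw [e]; simp only [evalX, evalY]; ring
            rw [this, hk]
            exact ⟨k * (m * (q * f.evalX u v + s * f.evalY u v)), by ring⟩
        by_cases h1 : l ∣ s ∧ l ∣ r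
        · refine Or.inr ⟨-q, p, ?_, key _ _ ⟨0, 1, by ring, by rw [hδ]; ring⟩⟩
          rintro ⟨h2, h3⟩
          exact hall ⟨h3, by simpa using h2, h1.2, h1.1⟩
        · refine Or.inr ⟨s, -r, ?_, key _ _ ⟨1, 0, by rw [hδ]; ring, by ring⟩⟩
          rintro ⟨h2, h3⟩
          exact h1 ⟨h2, by simpa using h3⟩
      · have hm := hd.resolve_left hdd
        obtain ⟨m', rfl⟩ := hm
        refine Or.inl (Dvd.of_smul hl hdd ⟨smul m' (f.sub p q r s), ?_⟩)
        rw [h, smul_smul]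

lemma rel_of_max {f g : BCF} {p q r s : ℤ} (h0 : p * s - q * r ≠ 0)
    (h : smul (p * s - q * r) g = f.sub p q r s) (hg : ∀ l : ℕ, l.Prime → ¬ Crit l g) :
    Rel f g := by
  have hu : IsUnit (p * s - q * r) := by
    by_contra hn
    rw [Int.isUnit_iff_natAbs_eq] at hn
    obtain ⟨l, hl, hd⟩ := Nat.exists_prime_and_dvd hn
    refine hg l hl (crit_of_smul_eq (f := f) (Nat.prime_iff_prime_int.mp hl) _ p q r s 1 le_rfl h0
      (Or.inl (Int.natCast_dvd.mpr hd)) ?_)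
    rw [h]; ext <;> simp [smul]
  rcases Int.isUnit_iff.mp hu with h1 | h1
  · refine ⟨p, q, r, s, hu, ?_⟩
    rw [← h, h1]; ext <;> simp [smul]
  · refine ⟨-p, -q, -r, -s, by convert hu using 1; ring, ?_⟩
    have : f.sub (-p) (-q) (-r) (-s) = smul (-1) (f.sub p q r s) := by
      ext <;> simp only [sub, smul] <;> ring
    rw [this, ← h, h1, smul_smul]; ext <;> simp [smul]

section
variable {K : Type} [Field K] [NumberField K]

lemma IsIndex.max {f : BCF} {e : Module.Basis (Fin 3) ℤ (NumberField.RingOfIntegers K)}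
    (h : IsIndex K f e) (hd : f.disc < 0) {p : ℕ} (hp : p.Prime) : ¬ Crit p f := by
  intro hc
  have hp2 : (2 : ℤ) ≤ p := by exact_mod_cast hp.two_le
  have hp0 : (p : ℤ) ≠ 0 := by omega
  have main : ∀ g : BCF, g.Irr → Rt K g → f.disc = p ^ 4 * g.disc ∨ f.disc = p ^ 2 * g.disc → False := by
    intro g hg hr he
    obtain ⟨a, b, c, d, h0, h1⟩ := h.exists_sub hg hr
    have h2 := disc_of_smul_eq h0 h1
    have h3 : 1 ≤ (a * d - b * c) ^ 2 := by
      have : 0 < (a * d - b * c) ^ 2 := by positivity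
      omega
    have hgd : g.disc ≤ f.disc := by rw [h2]; nlinarith
    have p2 : (4 : ℤ) ≤ (p : ℤ) ^ 2 := by nlinarith
    have p4 : (16 : ℤ) ≤ (p : ℤ) ^ 4 := by nlinarith
    rcases he with he | he <;> nlinarith
  rcases hc.exists_step (by omega) (Nat.prime_iff_prime_int.mp hp) with ⟨g, hg⟩ | ⟨g, hg⟩
  · have hI : g.Irr := by have := h.irr; rw [hg] at this; exact this.of_smul
    have hR : Rt K g := by have := h.rt; rw [hg] at this; exact this.of_smul hp0
    exact main g hI hR (Or.inl (by rw [hg, smul_disc]))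
  · have hG : f.Good := ⟨h.irr, hd⟩
    have hR := hg.rt hp0 hG h.rt
    obtain ⟨m, n, k, l, hd', h'⟩ := hg
    have hI : g.Irr := by
      have : (g.sub m n k l).Irr := by rw [← h']; exact h.irr.smul hp0
      intro x y hxy
      have h1 := this (l * x - n * y) (-k * x + m * y) (by
        rw [sub_eval]
        have : g.eval (m * (l * x - n * y) + n * (-k * x + m * y))
          (k * (l * x - n * y) + l * (-k * x + m * y)) = (m * l - n * k) ^ 3 * g.eval x y := by
          simp only [eval]; ring
        rw [this, hxy, mul_zero])
      have hdet : m * l - n * k ≠ 0 := by intro h0; rw [h0] at hd'; simp at hd'; omega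
      constructor
      · apply (mul_eq_zero.mp (?_ : (m * l - n * k) * x = 0)).resolve_left hdet
        linear_combination m * h1.1 + n * h1.2
      · apply (mul_eq_zero.mp (?_ : (m * l - n * k) * y = 0)).resolve_left hdet
        linear_combination k * h1.1 + l * h1.2
    refine main g hI hR (Or.inr ?_)
    have := congrArg disc h'
    rw [smul_disc, sub_disc] at this
    have e6 : (m * l - n * k) ^ 6 = (p : ℤ) ^ 6 := by
      rw [← hd', ← abs_pow, abs_of_nonneg]; positivity
    rw [e6] at this
    apply mul_left_cancel₀ (pow_ne_zero 4 hp0)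
    linear_combination this

lemma discr_of_max (hK : Module.finrank ℚ K = 3) {f : BCF} (hf : f.Irr) (hr : Rt K f)
    (hm : ∀ l : ℕ, l.Prime → ¬ Crit l f) : NumberField.discr K = f.disc := by
  obtain ⟨g, e, h⟩ := exists_isIndex (K := K) hK
  obtain ⟨p, q, r, s, h0, h1⟩ := h.exists_sub hf hr
  rw [h.discr, (rel_of_max h0 h1 hm).disc_eq]

lemma rel_of_rt (hK : Module.finrank ℚ K = 3) {f g : BCF} (hf : f.Irr) (hr : Rt K f)
    (hm : ∀ l : ℕ, l.Prime → ¬ Crit l f) (hg : g.Irr) (hr' : Rt K g)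
    (hm' : ∀ l : ℕ, l.Prime → ¬ Crit l g) : Rel f g := by
  obtain ⟨k, e, h⟩ := exists_isIndex (K := K) hK
  obtain ⟨p, q, r, s, h0, h1⟩ := h.exists_sub hf hr
  obtain ⟨p', q', r', s', h0', h1'⟩ := h.exists_sub hg hr'
  exact (rel_of_max h0 h1 hm).symm.trans (rel_of_max h0' h1' hm')

end

open scoped Classical in
theorem countCubic_eq (X : ℝ) : countCubic (fun d => -X < (d : ℝ) ∧ (d : ℝ) < 0) =
    ((OmF X).filter (fun ω => ∀ p : ℕ, p.Prime → ω.MaxAt p)).card := by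
  rw [countCubic, ← Nat.card_eq_finsetCard]
  symm
  set T := (OmF X).filter (fun ω => ∀ p : ℕ, p.Prime → ω.MaxAt p) with hT
  have hrep : ∀ t : T, ∃ (f : BCF) (hf : f.Good) (K : CubicField), orb f hf = t.1 ∧
      Rt K.carrier f ∧ (∀ l : ℕ, l.Prime → ¬ Crit l f) := by
    intro t
    obtain ⟨f, hf, h⟩ := t.1.exists_rep
    obtain ⟨K, hK⟩ := exists_field hf.1
    have ht := (Finset.mem_filter.mp t.2).2
    exact ⟨f, hf, K, h, hK, fun l hl => ht l hl f hf h⟩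
  choose F hF K hO hR hM using hrep
  have hdisc : ∀ t : T, NumberField.discr (K t).carrier = (F t).disc := fun t =>
    discr_of_max (K t).deg (hF t).1 (hR t) (hM t)
  have hmem : ∀ t : T, -((F t).disc : ℝ) < X := fun t => by
    have := mem_OmF.mp (Finset.mem_filter.mp t.2).1
    rwa [← hO t, orb_disc] at this
  apply Nat.card_eq_of_bijective (fun t : T => (⟨⟦K t⟧, K t, rfl, by
    rw [hdisc t]
    exact ⟨by linarith [hmem t], by exact_mod_cast (hF t).2⟩⟩ :
      {C : Quotient CubicField.setoid // ∃ K : CubicField, ⟦K⟧ = C ∧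
        -X < ((NumberField.discr K.carrier : ℤ) : ℝ) ∧ ((NumberField.discr K.carrier : ℤ) : ℝ) < 0}))
  constructor
  · intro t t' h
    obtain ⟨e⟩ : Nonempty ((K t).carrier ≃+* (K t').carrier) := Quotient.exact (Subtype.ext_iff.mp h)
    have h1 : Rt (K t').carrier (F t) := (hR t).map e.toRingHom
    have := rel_of_rt (K t').deg (hF t).1 h1 (hM t) (hF t').1 (hR t') (hM t')
    apply Subtype.ext
    rw [← hO t, ← hO t', orb_eq_iff]
    exact this
  · rintro ⟨C, L, rfl, hL1, hL2⟩
    obtain ⟨f, e, h⟩ := exists_isIndex (K := L.carrier) L.deg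
    have hf : f.Good := ⟨h.irr, by rw [← h.discr]; exact_mod_cast hL2⟩
    have hmax : ∀ p : ℕ, p.Prime → (orb f hf).MaxAt p := fun p hp =>
      (maxAt_orb hp hf).mpr (h.max hf.2 hp)
    let t : T := ⟨orb f hf, Finset.mem_filter.mpr ⟨mem_OmF.mpr (by
      rw [orb_disc, ← h.discr]; linarith), hmax⟩⟩
    refine ⟨t, Subtype.ext (Quotient.sound ?_)⟩
    have h1 : Rel f (F t) := (orb_eq_iff.mp (hO t)).symm
    have h2 : Rt (K t).carrier f := h1.rt (hF t).1 (hR t)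
    obtain ⟨e1⟩ := h2.equiv (K t).deg hf.1
    obtain ⟨e2⟩ := h.rt.equiv L.deg hf.1
    exact ⟨e1.symm.trans e2⟩

end BCF

section

open MeasureTheory

/-- Membership in `S` changes at no more than `h` points of the line. -/
def Fr (h : ℕ) (S : Set ℝ) : Prop :=
  ∃ F : Finset ℝ, F.card ≤ h ∧ ∀ x y, x ≤ y → (x ∈ S ↔ y ∈ S) ∨ ∃ z ∈ F, x ≤ z ∧ z ≤ y

namespace Fr

lemma mono {h k : ℕ} (hk : h ≤ k) {S : Set ℝ} (H : Fr h S) : Fr k S := by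
  obtain ⟨F, h1, h2⟩ := H
  exact ⟨F, h1.trans hk, h2⟩

lemma inter {h k : ℕ} {S T : Set ℝ} (hS : Fr h S) (hT : Fr k T) : Fr (h + k) (S ∩ T) := by
  classical
  obtain ⟨F, h1, h2⟩ := hS
  obtain ⟨G, h3, h4⟩ := hT
  refine ⟨F ∪ G, (Finset.card_union_le _ _).trans (by omega), fun x y hxy => ?_⟩
  rcases h2 x y hxy with h | ⟨z, hz, h⟩
  · rcases h4 x y hxy with h' | ⟨z, hz, h'⟩
    · exact Or.inl (by simp [h, h'])
    · exact Or.inr ⟨z, Finset.mem_union_right _ hz, h'⟩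
  · exact Or.inr ⟨z, Finset.mem_union_left _ hz, h⟩

lemma preimage {h : ℕ} {S : Set ℝ} (hS : Fr h S) (t : ℝ) : Fr h ((fun x => x + t) ⁻¹' S) := by
  classical
  obtain ⟨F, h1, h2⟩ := hS
  refine ⟨F.image (fun z => z - t), Finset.card_image_le.trans h1, fun x y hxy => ?_⟩
  rcases h2 (x + t) (y + t) (by linarith) with h | ⟨z, hz, h, h'⟩
  · exact Or.inl h
  · exact Or.inr ⟨z - t, Finset.mem_image_of_mem _ hz, by linarith, by linarith⟩

end Fr

lemma int_indicator_eq {S : Set ℝ} (hS : MeasurableSet S) {M N : ℤ}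
    (hb : S ⊆ Set.Ico (M : ℝ) N) :
    volume.real S = ∑ n ∈ Finset.Ico M N, ∫ x in Set.Ico (n : ℝ) (n + 1), S.indicator 1 x := by
  have h1 : ∀ n : ℤ, ∫ x in Set.Ico (n : ℝ) (n + 1), S.indicator (1 : ℝ → ℝ) x
      = volume.real (S ∩ Set.Ico (n : ℝ) (n + 1)) := by
    intro n
    rw [integral_indicator_one hS]
    rw [measureReal_restrict_apply hS]
  simp only [h1]
  have hU : S = ⋃ n ∈ Finset.Ico M N, S ∩ Set.Ico (n : ℝ) (n + 1) := by
    ext x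
    rw [Set.mem_iUnion₂]
    constructor
    · intro hx
      obtain ⟨h2, h3⟩ := hb hx
      exact ⟨⌊x⌋, Finset.mem_Ico.mpr ⟨Int.le_floor.mpr h2, Int.floor_lt.mpr h3⟩, hx,
        Int.floor_le x, Int.lt_floor_add_one x⟩
    · rintro ⟨n, -, hx, -⟩
      exact hx
  conv_lhs => rw [hU]
  rw [measureReal_biUnion_finset (h := fun i _ =>
    ((measure_mono Set.inter_subset_right).trans_lt (by simp)).ne)]
  · intro i _ j _ hij
    apply Disjoint.mono Set.inter_subset_right Set.inter_subset_right
    rw [Set.disjoint_left]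
    rintro x ⟨h1, h2⟩ ⟨h3, h4⟩
    apply hij
    have e1 : (i : ℝ) < j + 1 := by linarith
    have e2 : (j : ℝ) < i + 1 := by linarith
    have e1' : i < j + 1 := by exact_mod_cast e1
    have e2' : j < i + 1 := by exact_mod_cast e2
    omega
  · intro i _
    exact hS.inter measurableSet_Ico
open scoped Classical in
/-- Counting integers in a set of the line. -/
lemma Fr.card_int {h : ℕ} {S : Set ℝ} (H : Fr h S) (hS : MeasurableSet S) {J : Finset ℤ}
    {x0 x1 : ℝ} (hb : S ⊆ Set.Icc x0 x1) (hJ : ∀ n : ℤ, (n : ℝ) ∈ S → n ∈ J) :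
    |((J.filter (fun n : ℤ => (n : ℝ) ∈ S)).card : ℝ) - volume.real S| ≤ h := by
  obtain ⟨F, h1, h2⟩ := H
  set M := ⌊x0⌋
  set N := max (⌊x1⌋ + 1) M
  have hb' : S ⊆ Set.Ico (M : ℝ) N := by
    intro x hx
    obtain ⟨h3, h4⟩ := hb hx
    refine ⟨(Int.floor_le x0).trans h3, ?_⟩
    have : ((⌊x1⌋ + 1 : ℤ) : ℝ) ≤ N := by exact_mod_cast le_max_left _ _
    have h5 := Int.lt_floor_add_one x1
    push_cast at this
    linarith
  have hcard : J.filter (fun n : ℤ => (n : ℝ) ∈ S) =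
      (Finset.Ico M N).filter (fun n : ℤ => (n : ℝ) ∈ S) := by
    ext n
    simp only [Finset.mem_filter]
    constructor
    · rintro ⟨-, h3⟩
      refine ⟨?_, h3⟩
      obtain ⟨h4, h5⟩ := hb' h3
      rw [Finset.mem_Ico]
      exact ⟨by exact_mod_cast h4, by exact_mod_cast h5⟩
    · rintro ⟨-, h3⟩
      exact ⟨hJ n h3, h3⟩
  rw [hcard, int_indicator_eq hS hb', Finset.card_filter, Nat.cast_sum,
    ← Finset.sum_sub_distrib]
  have hterm : ∀ n ∈ Finset.Ico M N, |((if (n : ℝ) ∈ S then 1 else 0 : ℕ) : ℝ)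
      - ∫ x in Set.Ico (n : ℝ) (n + 1), S.indicator 1 x| ≤
      if n ∈ F.image (fun z : ℝ => ⌊z⌋) then 1 else 0 := by
    intro n _
    have hvol : volume.real (Set.Ico (n : ℝ) (n + 1)) = 1 := by simp [measureReal_def]
    split_ifs with h3 h4 h4
    all_goals
      rw [integral_indicator_one hS, measureReal_restrict_apply hS]
    · have e1 : volume.real (S ∩ Set.Ico (n : ℝ) (n + 1)) ≤ 1 := by
        exact (measureReal_mono Set.inter_subset_right (by simp)).trans hvol.le
      have e2 : 0 ≤ volume.real (S ∩ Set.Ico (n : ℝ) (n + 1)) := measureReal_nonneg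
      rw [abs_le]; push_cast; constructor <;> linarith
    · have : S ∩ Set.Ico (n : ℝ) (n + 1) = Set.Ico (n : ℝ) (n + 1) := by
        apply Set.inter_eq_right.mpr
        rintro x ⟨hx1, hx2⟩
        rcases h2 n x hx1 with h | ⟨z, hz, h5, h6⟩
        · exact h.mp h3
        · exact absurd (Finset.mem_image.mpr ⟨z, hz, Int.floor_eq_iff.mpr ⟨h5, by linarith⟩⟩) h4
      rw [this, hvol]; simp
    · have e1 : volume.real (S ∩ Set.Ico (n : ℝ) (n + 1)) ≤ 1 := by
        exact (measureReal_mono Set.inter_subset_right (by simp)).trans hvol.le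
      have e2 : 0 ≤ volume.real (S ∩ Set.Ico (n : ℝ) (n + 1)) := measureReal_nonneg
      rw [abs_le]; push_cast; constructor <;> linarith
    · have : S ∩ Set.Ico (n : ℝ) (n + 1) = ∅ := by
        apply Set.eq_empty_of_forall_notMem
        rintro x ⟨hx, hx1, hx2⟩
        rcases h2 n x hx1 with h | ⟨z, hz, h5, h6⟩
        · exact h3 (h.mpr hx)
        · exact absurd (Finset.mem_image.mpr ⟨z, hz, Int.floor_eq_iff.mpr ⟨h5, by linarith⟩⟩) h4
      rw [this]; simp
  refine (Finset.abs_sum_le_sum_abs _ _).trans ((Finset.sum_le_sum hterm).trans ?_)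
  rw [← Finset.sum_filter, Finset.sum_const, nsmul_eq_mul, mul_one]
  have : ((Finset.Ico M N).filter (fun n => n ∈ F.image (fun z : ℝ => ⌊z⌋))).card ≤ h :=
    (Finset.card_le_card (fun x hx => (Finset.mem_filter.mp hx).2)).trans
      (Finset.card_image_le.trans h1)
  exact_mod_cast this

end

section

open MeasureTheory
open scoped Classical in

/-- Davenport's lemma in a sheared lattice of the plane. -/
lemma card_sheared {h : ℕ} {S : Set (ℝ × ℝ)} (hS : MeasurableSet S) (κ : ℝ) {x0 y0 L1 L2 : ℝ}
    (hL1 : 0 ≤ L1) (hL2 : 0 ≤ L2)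
    (hb : S ⊆ Set.Icc x0 (x0 + L1) ×ˢ Set.Icc y0 (y0 + L2))
    (hrow : ∀ y, Fr h {x | (x, y) ∈ S}) (hcol : ∀ x, Fr h {y | (x, y) ∈ S})
    {J : Finset (ℤ × ℤ)} (hJ : ∀ i j : ℤ, ((i : ℝ) + κ * j, (j : ℝ)) ∈ S → (i, j) ∈ J) :
    |((J.filter (fun z : ℤ × ℤ => ((z.1 : ℝ) + κ * z.2, (z.2 : ℝ)) ∈ S)).card : ℝ)
      - volume.real S| ≤ h * (L1 + L2 + 1) := by
  set J2 : Finset ℤ := Finset.Icc ⌈y0⌉ ⌊y0 + L2⌋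
  have hJ2 : (J2.card : ℝ) ≤ L2 + 1 := by
    have h1 : ((⌊y0 + L2⌋ + 1 - ⌈y0⌉ : ℤ) : ℝ) ≤ L2 + 1 := by
      have := Int.floor_le (y0 + L2)
      have := Int.le_ceil y0
      push_cast; linarith
    rw [Int.card_Icc]
    rcases le_total 0 (⌊y0 + L2⌋ + 1 - ⌈y0⌉) with h0 | h0
    · have e : (((⌊y0 + L2⌋ + 1 - ⌈y0⌉).toNat : ℤ) : ℝ) = ((⌊y0 + L2⌋ + 1 - ⌈y0⌉ : ℤ) : ℝ) := by
        rw [Int.toNat_of_nonneg h0]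
      rw [← e] at h1
      exact_mod_cast h1
    · rw [Int.toNat_of_nonpos h0]; simp; linarith
  have memJ2 : ∀ (x : ℝ) (j : ℤ), (x, (j : ℝ)) ∈ S → j ∈ J2 := by
    intro x j hx
    obtain ⟨-, h1, h2⟩ := hb hx
    exact Finset.mem_Icc.mpr ⟨Int.ceil_le.mpr h1, Int.le_floor.mpr h2⟩
  have hcard : ((J.filter (fun z : ℤ × ℤ => ((z.1 : ℝ) + κ * z.2, (z.2 : ℝ)) ∈ S)).card : ℝ) =
      ∑ j ∈ J2, (((J.image Prod.fst).filter (fun i : ℤ => ((i : ℝ) + κ * j, (j : ℝ)) ∈ S)).card : ℝ) := by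
    rw [← Nat.cast_sum, ← Finset.card_sigma]
    congr 1
    symm
    apply Finset.card_bij (fun z _ => (z.2, z.1))
    · rintro ⟨j, i⟩ hz
      simp only [Finset.mem_sigma, Finset.mem_filter] at hz
      exact Finset.mem_filter.mpr ⟨hJ _ _ hz.2.2, hz.2.2⟩
    · rintro ⟨j, i⟩ _ ⟨j', i'⟩ _ he
      simp only [Prod.mk.injEq] at he
      rw [he.1, he.2]
    · rintro ⟨i, j⟩ hz
      rw [Finset.mem_filter] at hz
      refine ⟨⟨j, i⟩, ?_, rfl⟩
      simp only [Finset.mem_sigma, Finset.mem_filter]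
      exact ⟨memJ2 _ _ hz.2, Finset.mem_image.mpr ⟨_, hz.1, rfl⟩, hz.2⟩
  have mrow : ∀ y : ℝ, MeasurableSet {x | (x, y) ∈ S} := fun y =>
    hS.preimage (measurable_id.prodMk measurable_const)
  have mcol : ∀ x : ℝ, MeasurableSet {y | (x, y) ∈ S} := fun x =>
    hS.preimage (measurable_const.prodMk measurable_id)
  have hvr : ∀ y, volume {x | (x, y) ∈ S} < ⊤ := fun y =>
    (measure_mono (t := Set.Icc x0 (x0 + L1)) fun x hx => (hb hx).1).trans_lt (by simp)
  have step1 : |((J.filter (fun z : ℤ × ℤ => ((z.1 : ℝ) + κ * z.2, (z.2 : ℝ)) ∈ S)).card : ℝ)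
      - ∑ j ∈ J2, volume.real {x : ℝ | (x, (j : ℝ)) ∈ S}| ≤ h * (L2 + 1) := by
    rw [hcard, ← Finset.sum_sub_distrib]
    have : ∀ j ∈ J2, |(((J.image Prod.fst).filter (fun i : ℤ => ((i : ℝ) + κ * j, (j : ℝ)) ∈ S)).card : ℝ)
        - volume.real {x : ℝ | (x, (j : ℝ)) ∈ S}| ≤ h := by
      intro j _
      have hv : volume.real {x : ℝ | (x, (j : ℝ)) ∈ S}
          = volume.real ((fun x => x + κ * j) ⁻¹' {x : ℝ | (x, (j : ℝ)) ∈ S}) := by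
        simp only [measureReal_def, measure_preimage_add_right]
      rw [hv]
      refine Fr.card_int ((hrow j).preimage (κ * j)) ((mrow j).preimage (by fun_prop))
        (x0 := x0 - κ * j) (x1 := x0 + L1 - κ * j) ?_ ?_
      · intro x hx
        have := (hb hx).1
        constructor <;> linarith [this.1, this.2]
      · intro i hi
        exact Finset.mem_image.mpr ⟨_, hJ i j hi, rfl⟩
    refine (Finset.abs_sum_le_sum_abs _ _).trans ((Finset.sum_le_sum this).trans ?_)
    rw [Finset.sum_const, nsmul_eq_mul, mul_comm]
    gcongr
  have step2 : ∑ j ∈ J2, volume.real {x : ℝ | (x, (j : ℝ)) ∈ S} =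
      ∫ x in Set.Icc x0 (x0 + L1), ((J2.filter (fun j : ℤ => (x, (j : ℝ)) ∈ S)).card : ℝ) := by
    have e : ∀ x : ℝ, ((J2.filter (fun j : ℤ => (x, (j : ℝ)) ∈ S)).card : ℝ) =
        ∑ j ∈ J2, ({x : ℝ | (x, (j : ℝ)) ∈ S}).indicator 1 x := by
      intro x
      rw [Finset.card_filter, Nat.cast_sum]
      refine Finset.sum_congr rfl fun j _ => ?_
      simp [Set.indicator_apply]
    simp only [e]
    rw [integral_finsetSum]
    · refine Finset.sum_congr rfl fun j _ => ?_
      rw [integral_indicator_one (mrow j), measureReal_restrict_apply (mrow j)]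
      have hi : {x : ℝ | (x, (j : ℝ)) ∈ S} ∩ Set.Icc x0 (x0 + L1) = {x : ℝ | (x, (j : ℝ)) ∈ S} :=
        Set.inter_eq_left.mpr (fun x hx => (hb hx).1)
      rw [hi]
    · intro j _
      exact (integrable_indicator_iff (mrow j)).mpr (integrableOn_const (hs := by
        refine ((Measure.restrict_apply_le _ _).trans_lt (hvr j)).ne) (hC := by simp))
  have hvS : volume S < ⊤ := by
    refine (measure_mono hb).trans_lt ?_
    rw [Measure.volume_eq_prod, Measure.prod_prod]
    simp [ENNReal.mul_lt_top]
  have step3 : volume.real S = ∫ x in Set.Icc x0 (x0 + L1), volume.real {y | (x, y) ∈ S} := by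
    rw [setIntegral_eq_integral_of_forall_compl_eq_zero]
    · rw [← integral_indicator_one hS, Measure.volume_eq_prod, integral_prod]
      · congr 1
        ext x
        rw [← integral_indicator_one (mcol x)]
        rfl
      · exact (integrable_indicator_iff hS).mpr (integrableOn_const (hs := hvS.ne) (hC := by simp))
    · intro x hx
      have : {y | (x, y) ∈ S} = ∅ := Set.eq_empty_of_forall_notMem fun y hy => hx (hb hy).1
      rw [this]; simp
  have step4 : |∑ j ∈ J2, volume.real {x : ℝ | (x, (j : ℝ)) ∈ S} - volume.real S| ≤ h * L1 := by
    rw [step2, step3]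
    have i1 : IntegrableOn (fun x : ℝ => ((J2.filter (fun j : ℤ => (x, (j : ℝ)) ∈ S)).card : ℝ))
        (Set.Icc x0 (x0 + L1)) := by
      have e : (fun x : ℝ => ((J2.filter (fun j : ℤ => (x, (j : ℝ)) ∈ S)).card : ℝ)) =
          fun x => ∑ j ∈ J2, ({x : ℝ | (x, (j : ℝ)) ∈ S}).indicator 1 x := by
        ext x
        rw [Finset.card_filter, Nat.cast_sum]
        refine Finset.sum_congr rfl fun j _ => ?_
        simp [Set.indicator_apply]
      rw [e]
      refine integrable_finsetSum _ fun j _ => ?_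
      exact (integrable_indicator_iff (mrow j)).mpr (integrableOn_const (hs := by
        refine ((Measure.restrict_apply_le _ _).trans_lt (hvr j)).ne) (hC := by simp))
    have i2 : IntegrableOn (fun x : ℝ => volume.real {y | (x, y) ∈ S}) (Set.Icc x0 (x0 + L1)) := by
      have : Integrable (S.indicator (1 : ℝ × ℝ → ℝ)) (volume.prod volume) :=
        (integrable_indicator_iff hS).mpr (integrableOn_const (hs := hvS.ne) (hC := by simp))
      have h2 := this.integral_prod_left
      refine (h2.congr (Eventually.of_forall fun x => ?_)).integrableOn
      change _ = volume.real {y | (x, y) ∈ S}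
      rw [← integral_indicator_one (mcol x)]
      rfl
    rw [← integral_sub i1 i2, ← Real.norm_eq_abs]
    refine (norm_setIntegral_le_of_norm_le_const (C := h) (by simp) ?_).trans ?_
    · intro x _
      rw [Real.norm_eq_abs]
      exact Fr.card_int (hcol x) (mcol x) (x0 := y0) (x1 := y0 + L2) (fun y hy => (hb hy).2)
        (fun j hj => memJ2 x j hj)
    · simp [measureReal_def, hL1]
  calc _ ≤ _ := abs_sub_le _ (∑ j ∈ J2, volume.real {x : ℝ | (x, (j : ℝ)) ∈ S}) _
    _ ≤ h * (L2 + 1) + h * L1 := add_le_add step1 step4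
    _ = _ := by ring

end

section

open MeasureTheory

/-- Plane regions suited to lattice point counting. -/
structure Nice (h : ℕ) (R : ℝ) (S : Set (ℝ × ℝ)) : Prop where
  meas : MeasurableSet S
  box : ∀ z ∈ S, |z.1| ≤ R ∧ |z.2| ≤ R
  line : ∀ p q u v : ℝ, Fr h {t : ℝ | (p + t * u, q + t * v) ∈ S}

lemma Nice.swap {h : ℕ} {R : ℝ} {S : Set (ℝ × ℝ)} (H : Nice h R S) : Nice h R (Prod.swap ⁻¹' S) where
  meas := H.meas.preimage measurable_swap
  box _ hz := (H.box _ hz).symm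
  line p q u v := H.line q p v u

lemma volume_real_shear {S : Set (ℝ × ℝ)} {p q r s : ℝ} (hd : p * s - q * r ≠ 0)
    (c0 d0 : ℝ) : volume.real {z : ℝ × ℝ | (c0 + (p * z.1 + q * z.2), d0 + (r * z.1 + s * z.2)) ∈ S}
      = volume.real S / |p * s - q * r| := by
  set L : ℝ × ℝ →ₗ[ℝ] ℝ × ℝ := Matrix.toLin (Module.Basis.finTwoProd ℝ) (Module.Basis.finTwoProd ℝ)
    !![p, q; r, s] with hL
  have hdet : LinearMap.det L = p * s - q * r := by
    rw [hL, LinearMap.det_toLin, Matrix.det_fin_two_of]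
  have e : {z : ℝ × ℝ | (c0 + (p * z.1 + q * z.2), d0 + (r * z.1 + s * z.2)) ∈ S} =
      L ⁻¹' ((fun z => ((c0, d0) : ℝ × ℝ) + z) ⁻¹' S) := by
    ext z
    simp only [Set.mem_preimage, hL, Matrix.toLin_finTwoProd_apply, Prod.mk_add_mk]
    rfl
  rw [e, measureReal_def, Measure.addHaar_preimage_linearMap _ (by rw [hdet]; exact hd),
    measure_preimage_add, ENNReal.toReal_mul, ENNReal.toReal_ofReal (abs_nonneg _), hdet, abs_inv,
    measureReal_def]
  ring

open scoped Classical in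
lemma card_basis {h : ℕ} {R : ℝ} {S : Set (ℝ × ℝ)} (H : Nice h R S) (hR : 0 ≤ R)
    {u v u' v' D : ℤ} (hD : u * v' - u' * v = D) (hD0 : D ≠ 0) (hu : u ≠ 0) (huv : |v| ≤ |u|)
    (c0 d0 : ℤ) {J : Finset (ℤ × ℤ)}
    (hJ : ∀ i j : ℤ, (((c0 + u * i + u' * j : ℤ) : ℝ), ((d0 + v * i + v' * j : ℤ) : ℝ)) ∈ S → (i, j) ∈ J) :
    |((J.filter (fun z : ℤ × ℤ => (((c0 + u * z.1 + u' * z.2 : ℤ) : ℝ),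
        ((d0 + v * z.1 + v' * z.2 : ℤ) : ℝ)) ∈ S)).card : ℝ) - volume.real S / (|(D : ℝ)|)|
      ≤ h * (2 * R / |(u : ℝ)| + 4 * R * |(u : ℝ)| / |(D : ℝ)| + 1) := by
  have hu' : (u : ℝ) ≠ 0 := by exact_mod_cast hu
  have hD' : (D : ℝ) ≠ 0 := by exact_mod_cast hD0
  have huv' : |(v : ℝ)| ≤ |(u : ℝ)| := by exact_mod_cast huv
  have hDr : (u : ℝ) * v' - u' * v = D := by exact_mod_cast hD
  set S' : Set (ℝ × ℝ) := {z : ℝ × ℝ | ((c0 : ℝ) + ((u : ℝ) * z.1 + 0 * z.2),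
    (d0 : ℝ) + ((v : ℝ) * z.1 + (D / u : ℝ) * z.2)) ∈ S} with hS'
  have hvol : volume.real S' = volume.real S / |(D : ℝ)| := by
    have e : (u : ℝ) * (D / u) - 0 * v = D := by field_simp; ring
    rw [hS', volume_real_shear (by rw [e]; exact hD'), e]
  have hmem : ∀ i j : ℤ, ((((c0 + u * i + u' * j : ℤ) : ℝ), ((d0 + v * i + v' * j : ℤ) : ℝ)) ∈ S ↔
      ((i : ℝ) + (u' / u : ℝ) * j, (j : ℝ)) ∈ S') := by
    intro i j
    rw [hS', Set.mem_ofPred_eq]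
    have e1 : ((c0 + u * i + u' * j : ℤ) : ℝ) = (c0 : ℝ) + ((u : ℝ) * ((i : ℝ) + (u' / u : ℝ) * j) + 0 * j) := by
      push_cast; field_simp; ring
    have e2 : ((d0 + v * i + v' * j : ℤ) : ℝ) =
        (d0 : ℝ) + ((v : ℝ) * ((i : ℝ) + (u' / u : ℝ) * j) + (D / u : ℝ) * j) := by
      push_cast; rw [← hDr]; field_simp; ring
    rw [e1, e2]
  have key := card_sheared (h := h) (S := S') (κ := (u' / u : ℝ))
    (x0 := -(R / |(u : ℝ)|) - c0 / u) (L1 := 2 * R / |(u : ℝ)|)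
    (y0 := -(2 * R * |(u : ℝ)| / |(D : ℝ)|) - ((d0 : ℝ) * u - v * c0) / D)
    (L2 := 4 * R * |(u : ℝ)| / |(D : ℝ)|)
    (H.meas.preimage (by fun_prop)) (by positivity) (by positivity) ?_ ?_ ?_ (J := J)
    (fun i j hij => hJ i j ((hmem i j).mpr hij))
  · rw [hvol] at key
    have : (J.filter (fun z : ℤ × ℤ => (((c0 + u * z.1 + u' * z.2 : ℤ) : ℝ),
        ((d0 + v * z.1 + v' * z.2 : ℤ) : ℝ)) ∈ S)) =
        (J.filter (fun z : ℤ × ℤ => ((z.1 : ℝ) + (u' / u : ℝ) * z.2, (z.2 : ℝ)) ∈ S')) :=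
      Finset.filter_congr fun z _ => hmem z.1 z.2
    rw [this]
    exact key
  · rintro ⟨x, y⟩ hz
    obtain ⟨h1, h2⟩ := H.box _ hz
    simp only at h1 h2
    set c : ℝ := (c0 : ℝ) + ((u : ℝ) * x + 0 * y) with hc
    set d : ℝ := (d0 : ℝ) + ((v : ℝ) * x + (D / u : ℝ) * y) with hd
    have ex : x = c / u - c0 / u := by rw [hc]; field_simp; ring
    have ey : y = (d * u - v * c) / D - ((d0 : ℝ) * u - v * c0) / D := by
      rw [hc, hd]; field_simp; ring
    have b1 : |c / u| ≤ R / |(u : ℝ)| := by rw [abs_div]; gcongr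
    have b2 : |(d * u - v * c) / D| ≤ 2 * R * |(u : ℝ)| / |(D : ℝ)| := by
      rw [abs_div]
      gcongr
      calc |d * u - v * c| ≤ |d * u| + |v * c| := abs_sub _ _
        _ = |d| * |(u : ℝ)| + |(v : ℝ)| * |c| := by rw [abs_mul, abs_mul]
        _ ≤ R * |(u : ℝ)| + |(u : ℝ)| * R := by gcongr
        _ = _ := by ring
    rw [abs_le] at b1 b2
    have e1 : 2 * R / |(u : ℝ)| = R / |(u : ℝ)| + R / |(u : ℝ)| := by ring
    have e2 : 4 * R * |(u : ℝ)| / |(D : ℝ)| =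
      2 * R * |(u : ℝ)| / |(D : ℝ)| + 2 * R * |(u : ℝ)| / |(D : ℝ)| := by ring
    rw [e1, e2]
    refine ⟨⟨?_, ?_⟩, ?_, ?_⟩ <;> simp only <;> linarith
  · intro y
    have := H.line c0 (d0 + (D / u : ℝ) * y) u v
    convert this using 3 with x
    simp only [hS', Set.mem_ofPred_eq]
    rw [show (c0 : ℝ) + (u * x + 0 * y) = c0 + x * u by ring,
      show (d0 : ℝ) + (v * x + (D / u : ℝ) * y) = d0 + (D / u : ℝ) * y + x * v by ring]
  · intro x
    have := H.line (c0 + u * x) (d0 + v * x) 0 (D / u : ℝ)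
    convert this using 3 with y
    simp only [hS', Set.mem_ofPred_eq]
    rw [show (c0 : ℝ) + (u * x + 0 * y) = c0 + u * x + y * 0 by ring,
      show (d0 : ℝ) + (v * x + (D / u : ℝ) * y) = d0 + v * x + y * (D / u : ℝ) by ring]

lemma volume_real_swap (S : Set (ℝ × ℝ)) : volume.real (Prod.swap ⁻¹' S) = volume.real S := by
  have := volume_real_shear (S := S) (p := 0) (q := 1) (r := 1) (s := 0) (by norm_num) 0 0
  norm_num at this
  rw [← this]
  rfl

open scoped Classical in
lemma card_coset {h : ℕ} {R : ℝ} {S : Set (ℝ × ℝ)} (H : Nice h R S) (hR : 0 ≤ R) {m : ℕ} (hm : 0 < m)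
    {α β α' β' r t : ℤ} (hdet : α * β' - α' * β = 1) (hα : α ≠ 0) {JJ : Finset (ℤ × ℤ)}
    (hJJ : ∀ c d : ℤ, ((c : ℝ), (d : ℝ)) ∈ S → (c, d) ∈ JJ) {s : ℝ}
    (hs : s = max |(α : ℝ)| |((m * β - α * r : ℤ) : ℝ)|) :
    |((JJ.filter (fun z : ℤ × ℤ => ((z.1 : ℝ), (z.2 : ℝ)) ∈ S ∧ (m : ℤ) ∣ z.1 * r + z.2 - t)).card : ℝ)
      - volume.real S / m| ≤ h * (2 * R / s + 4 * R * s / m + 1) := by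
  have hm' : (m : ℤ) ≠ 0 := by exact_mod_cast hm.ne'
  set v := m * β - α * r with hv
  set v' := m * β' - α' * r with hv'
  set J : Finset (ℤ × ℤ) := JJ.image (fun z => (β' * z.1 - α' * ((z.1 * r + z.2 - t) / m),
    α * ((z.1 * r + z.2 - t) / m) - β * z.1)) with hJdef
  have hl : ∀ i j : ℤ, (α * i + α' * j) * r + (t + v * i + v' * j) - t = m * (β * i + β' * j) := by
    intro i j; rw [hv, hv']; ring
  have hinv : ∀ i j : ℤ, ((((α * i + α' * j : ℤ) : ℝ), ((t + v * i + v' * j : ℤ) : ℝ)) ∈ S → (i, j) ∈ J) := by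
    intro i j hij
    refine Finset.mem_image.mpr ⟨_, hJJ _ _ hij, ?_⟩
    simp only
    rw [hl, Int.mul_ediv_cancel_left _ hm']
    ext
    · linear_combination i * hdet
    · linear_combination j * hdet
  have hcard : (JJ.filter (fun z : ℤ × ℤ => ((z.1 : ℝ), (z.2 : ℝ)) ∈ S ∧ (m : ℤ) ∣ z.1 * r + z.2 - t)).card
      = (J.filter (fun z : ℤ × ℤ => (((α * z.1 + α' * z.2 : ℤ) : ℝ),
        ((t + v * z.1 + v' * z.2 : ℤ) : ℝ)) ∈ S)).card := by
    symm
    apply Finset.card_bij (fun z _ => (α * z.1 + α' * z.2, t + v * z.1 + v' * z.2))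
    · rintro ⟨i, j⟩ hz
      obtain ⟨-, h2⟩ := Finset.mem_filter.mp hz
      exact Finset.mem_filter.mpr ⟨hJJ _ _ h2, h2, by simp only; rw [hl]; exact dvd_mul_right _ _⟩
    · rintro ⟨i, j⟩ _ ⟨i', j'⟩ _ he
      simp only [Prod.mk.injEq] at he
      obtain ⟨h1, h2⟩ := he
      have h3 : (m : ℤ) * (β * i + β' * j) = m * (β * i' + β' * j') := by
        rw [← hl, ← hl, h1, h2]
      have h4 := mul_left_cancel₀ hm' h3
      ext
      · simp only; linear_combination β' * h1 - α' * h4 - (i - i') * hdet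
      · simp only; linear_combination α * h4 - β * h1 - (j - j') * hdet
    · rintro ⟨c, d⟩ hz
      obtain ⟨-, h2, l, h3⟩ := Finset.mem_filter.mp hz
      simp only at h2 h3
      have e1 : α * (β' * c - α' * l) + α' * (α * l - β * c) = c := by linear_combination c * hdet
      have e2 : t + v * (β' * c - α' * l) + v' * (α * l - β * c) = d := by
        rw [hv, hv']; linear_combination (m * l - c * r) * hdet - h3
      refine ⟨(β' * c - α' * l, α * l - β * c), Finset.mem_filter.mpr ⟨?_, ?_⟩, ?_⟩
      · apply hinv; rw [e1, e2]; exact h2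
      · simp only; rw [e1, e2]; exact h2
      · simp only; rw [e1, e2]
  have hdet' : α * v' - α' * v = m := by rw [hv, hv']; linear_combination m * hdet
  rcases le_total |v| |α| with hle | hle
  · have hs' : s = |(α : ℝ)| := by
      rw [hs]; exact max_eq_left (by exact_mod_cast hle)
    have := card_basis H hR hdet' hm' hα hle 0 t (J := J) (by
      intro i j hij; apply hinv; simpa using hij)
    rw [hcard, hs']
    simpa using this
  · have hv0 : v ≠ 0 := by
      intro h0; rw [h0, abs_zero] at hle; exact hα (abs_nonpos_iff.mp hle)
    have hs' : s = |(v : ℝ)| := by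
      rw [hs]; exact max_eq_right (by exact_mod_cast hle)
    have := card_basis H.swap hR (u := v) (v := α) (u' := v') (v' := α') (D := -m)
      (by linear_combination -hdet') (neg_ne_zero.mpr hm') hv0 hle t 0 (J := J) (by
      intro i j hij; apply hinv; simpa using hij)
    rw [volume_real_swap] at this
    rw [hcard, hs']
    simpa using this
open scoped Classical in
/-- Counting lattice points of index `m` with a short vector. -/
lemma exists_card_coset {h : ℕ} {R : ℝ} {S : Set (ℝ × ℝ)} (H : Nice h R S) (hR : 0 ≤ R) {m : ℕ}
    (hm : 0 < m) {r : ℤ} (hr0 : 0 ≤ r) (hrm : r < m) (JJ : Finset (ℤ × ℤ))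
    (hJJ : ∀ c d : ℤ, ((c : ℝ), (d : ℝ)) ∈ S → (c, d) ∈ JJ) :
    ∃ α β : ℤ, 1 ≤ α ∧ 0 ≤ β ∧ β ≤ α ∧ ∀ t : ℤ,
    |((JJ.filter (fun z : ℤ × ℤ => ((z.1 : ℝ), (z.2 : ℝ)) ∈ S ∧ (m : ℤ) ∣ z.1 * r + z.2 - t)).card : ℝ)
      - volume.real S / m| ≤ h * (2 * R / (max |(α : ℝ)| |((m * β - α * r : ℤ) : ℝ)|)
        + 4 * R / √m + 1) := by
  have hm1 : (1 : ℝ) ≤ m := by exact_mod_cast hm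
  have hn : 0 < Nat.sqrt m := Nat.sqrt_pos.mpr hm
  obtain ⟨q, hq1, hq2⟩ := Real.exists_rat_abs_sub_le_and_den_le ((r : ℝ) / m) hn
  have hden : (0 : ℝ) < q.den := by exact_mod_cast q.den_pos
  have hqc : (q : ℝ) = q.num / q.den := Rat.cast_def q
  set n := Nat.sqrt m with hndef
  have hn1 : √(m : ℝ) ≤ n + 1 := by
    rw [Real.sqrt_le_left (by positivity)]
    exact_mod_cast (Nat.lt_succ_sqrt' m).le
  have hn2 : (n : ℝ) ≤ √m := by
    apply Real.le_sqrt_of_sq_le; exact_mod_cast Nat.sqrt_le' m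
  have hsm : 0 < √(m : ℝ) := Real.sqrt_pos.mpr (by linarith)
  -- the second coordinate is short
  have hkey : |(r : ℝ) * q.den - m * q.num| ≤ m / (n + 1) := by
    have e : (r : ℝ) * q.den - m * q.num = (r / m - q) * (m * q.den) := by
      rw [hqc]; field_simp
    rw [e, abs_mul, abs_of_pos (show (0 : ℝ) < m * q.den by positivity)]
    calc _ ≤ 1 / ((n + 1 : ℝ) * q.den) * (m * q.den) := by gcongr
      _ = _ := by field_simp
  have hv : |((m * q.num - q.den * r : ℤ) : ℝ)| ≤ √m := by
    have : ((m * q.num - q.den * r : ℤ) : ℝ) = -((r : ℝ) * q.den - m * q.num) := by push_cast; ring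
    rw [this, abs_neg]
    refine hkey.trans ?_
    rw [div_le_iff₀ (by positivity)]
    calc (m : ℝ) = √m * √m := (Real.mul_self_sqrt (by linarith)).symm
      _ ≤ _ := by gcongr
  have hvm : |(m : ℤ) * q.num - q.den * r| < m := by
    have h1 : |((m * q.num - q.den * r : ℤ) : ℝ)| < m := by
      have e : ((m * q.num - q.den * r : ℤ) : ℝ) = -((r : ℝ) * q.den - m * q.num) := by push_cast; ring
      rw [e, abs_neg]
      refine hkey.trans_lt ?_
      rw [div_lt_iff₀ (by positivity)]
      have : (1 : ℝ) ≤ n := by exact_mod_cast hn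
      nlinarith
    exact_mod_cast h1
  have hdz : (0 : ℤ) < q.den := by exact_mod_cast q.den_pos
  obtain ⟨x, y, hxy⟩ : IsCoprime q.num (q.den : ℤ) := by
    rw [Int.isCoprime_iff_gcd_eq_one]
    simpa [Int.gcd] using q.reduced
  refine ⟨q.den, q.num, by omega, ?_, ?_, fun t => ?_⟩
  · rw [abs_lt] at hvm
    by_contra hneg
    push Not at hneg
    have : (m : ℤ) * q.num ≤ -m := by nlinarith
    nlinarith [mul_nonneg hdz.le hr0]
  · rw [abs_lt] at hvm
    by_contra hneg
    push Not at hneg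
    have h1 : (m : ℤ) * q.num ≥ m * (q.den + 1) := by
      apply mul_le_mul_of_nonneg_left (by omega) (by omega)
    nlinarith [mul_le_mul_of_nonneg_left hrm.le hdz.le]
  · refine (card_coset H hR hm (α := q.den) (β := q.num) (α' := -x) (β' := y) (by linarith)
      hdz.ne' hJJ rfl).trans ?_
    gcongr ?_ * (_ + ?_ + _)
    have hmax : max |((q.den : ℤ) : ℝ)| |((m * q.num - q.den * r : ℤ) : ℝ)| ≤ √m := by
      refine max_le ?_ hv
      rw [Int.cast_natCast, abs_of_pos hden]
      exact le_trans (by exact_mod_cast hq2) hn2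
    calc _ ≤ 4 * R * √m / m := by gcongr
      _ = 4 * R * √m / (√m * √m) := by rw [Real.mul_self_sqrt (by linarith)]
      _ = _ := by field_simp

open scoped Classical in
/-- Equidistribution of lattice points of index `m`, on average over the residue class. -/
lemma sum_card_coset {h : ℕ} {R : ℝ} {S : Set (ℝ × ℝ)} (H : Nice h R S) (hR : 0 ≤ R) {m : ℕ}
    (hm : 0 < m) {M : ℝ} (hM0 : 0 ≤ M) (hM : M ^ 4 = m) (JJ : Finset (ℤ × ℤ))
    (hJJ : ∀ c d : ℤ, ((c : ℝ), (d : ℝ)) ∈ S → (c, d) ∈ JJ) (t : ℕ → ℤ) :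
    ∑ r ∈ Finset.range m, |((JJ.filter (fun z : ℤ × ℤ => ((z.1 : ℝ), (z.2 : ℝ)) ∈ S ∧
      (m : ℤ) ∣ z.1 * r + z.2 - t r)).card : ℝ) - volume.real S / m| ≤ h * (18 * R * M ^ 3 + m) := by
  have hm1 : (1 : ℝ) ≤ m := by exact_mod_cast hm
  have hM1 : 1 ≤ M := by
    by_contra hlt
    push Not at hlt
    have : M ^ 4 < 1 := pow_lt_one₀ hM0 hlt (by norm_num)
    linarith
  have hsq : √(m : ℝ) = M ^ 2 := by
    rw [← hM, show M ^ 4 = (M ^ 2) ^ 2 by ring, Real.sqrt_sq (by positivity)]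
  have hex : ∀ r : ℕ, ∃ α β : ℤ, r < m → (1 ≤ α ∧ 0 ≤ β ∧ β ≤ α ∧ ∀ t : ℤ,
    |((JJ.filter (fun z : ℤ × ℤ => ((z.1 : ℝ), (z.2 : ℝ)) ∈ S ∧ (m : ℤ) ∣ z.1 * r + z.2 - t)).card : ℝ)
      - volume.real S / m| ≤ h * (2 * R / (max |(α : ℝ)| |((m * β - α * r : ℤ) : ℝ)|)
        + 4 * R / √m + 1)) := by
    intro r
    by_cases hr : r < m
    · obtain ⟨α, β, h1⟩ := exists_card_coset H hR hm (r := r) (by positivity) (by exact_mod_cast hr) JJ hJJ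
      exact ⟨α, β, fun _ => h1⟩
    · exact ⟨0, 0, fun h => absurd h hr⟩
  choose α β hαβ using hex
  set N := ⌊M⌋₊ with hN
  have hNM : (N : ℝ) ≤ M := Nat.floor_le hM0
  have hMN : M < N + 1 := Nat.lt_floor_add_one M
  have hN1 : 1 ≤ N := Nat.le_floor (by exact_mod_cast hM1)
  set bad := (Finset.range m).filter (fun r => α r ≤ N ∧ |(m : ℤ) * β r - α r * r| ≤ N) with hbad
  have hcard : bad.card ≤ 6 * N ^ 3 := by
    have h1 : bad.card ≤ ((Finset.Icc (1 : ℤ) N) ×ˢ (Finset.Icc (0 : ℤ) N) ×ˢ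
        (Finset.Icc (-(N : ℤ)) N)).card := by
      apply Finset.card_le_card_of_injOn (fun r => (α r, β r, (m : ℤ) * β r - α r * r))
      · intro r hr
        obtain ⟨h1, h2, h3⟩ := Finset.mem_filter.mp hr
        obtain ⟨h4, h5, h6, -⟩ := hαβ r (Finset.mem_range.mp h1)
        have := abs_le.mp h3
        simp only [Finset.coe_product, Finset.coe_Icc, Set.mem_prod, Set.mem_Icc]
        omega
      · intro r hr r' hr' he
        simp only [Prod.mk.injEq] at he
        obtain ⟨h1, -, -⟩ := Finset.mem_filter.mp hr
        obtain ⟨h4, -⟩ := hαβ r (Finset.mem_range.mp h1)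
        obtain ⟨e1, e2, e3⟩ := he
        rw [← e1, ← e2] at e3
        have : α r * (r : ℤ) = α r * r' := by linarith
        exact_mod_cast mul_left_cancel₀ (by omega) this
    refine h1.trans ?_
    rw [Finset.card_product, Finset.card_product, Int.card_Icc, Int.card_Icc, Int.card_Icc]
    have e1 : ((N : ℤ) + 1 - 1).toNat = N := by omega
    have e2 : ((N : ℤ) + 1 - 0).toNat = N + 1 := by omega
    have e3 : ((N : ℤ) + 1 - -(N : ℤ)).toNat = 2 * N + 1 := by omega
    rw [e1, e2, e3]
    have : 1 ≤ N ^ 2 := Nat.one_le_pow _ _ hN1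
    nlinarith
  have hterm : ∀ r ∈ Finset.range m, |((JJ.filter (fun z : ℤ × ℤ => ((z.1 : ℝ), (z.2 : ℝ)) ∈ S ∧
      (m : ℤ) ∣ z.1 * r + z.2 - t r)).card : ℝ) - volume.real S / m|
      ≤ h * ((2 * R / M + 4 * R / M ^ 2 + 1) + if r ∈ bad then 2 * R else 0) := by
    intro r hr
    obtain ⟨h1, h2, h3, h4⟩ := hαβ r (Finset.mem_range.mp hr)
    refine (h4 (t r)).trans ?_
    rw [hsq]
    have hα1 : (1 : ℝ) ≤ |(α r : ℝ)| := by
      rw [le_abs]; left; exact_mod_cast h1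
    refine mul_le_mul_of_nonneg_left ?_ (Nat.cast_nonneg h)
    split_ifs with hb
    · have : 2 * R / (max |(α r : ℝ)| |((m * β r - α r * r : ℤ) : ℝ)|) ≤ 2 * R := by
        apply div_le_self (by positivity)
        exact hα1.trans (le_max_left _ _)
      have h5 : 0 ≤ 2 * R / M := by positivity
      linarith
    · have : M ≤ max |(α r : ℝ)| |((m * β r - α r * r : ℤ) : ℝ)| := by
        have h5 : ¬ (α r ≤ N ∧ |(m : ℤ) * β r - α r * r| ≤ N) := fun h5 =>
          hb (Finset.mem_filter.mpr ⟨hr, h5⟩)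
        rw [le_max_iff]
        rw [not_and_or] at h5
        refine h5.imp (fun h5 => ?_) (fun h5 => ?_)
        · push Not at h5
          have : (N : ℤ) + 1 ≤ α r := by omega
          have : (N : ℝ) + 1 ≤ α r := by exact_mod_cast this
          exact hMN.le.trans (this.trans (le_abs_self _))
        · push Not at h5
          have : (N : ℤ) + 1 ≤ |(m : ℤ) * β r - α r * r| := by omega
          have : (N : ℝ) + 1 ≤ |((m * β r - α r * r : ℤ) : ℝ)| := by exact_mod_cast this
          exact hMN.le.trans this
      have : 2 * R / (max |(α r : ℝ)| |((m * β r - α r * r : ℤ) : ℝ)|) ≤ 2 * R / M := by gcongr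
      linarith
  refine (Finset.sum_le_sum hterm).trans ?_
  rw [← Finset.mul_sum, Finset.sum_add_distrib, ← Finset.sum_filter, Finset.sum_const,
    Finset.sum_const, nsmul_eq_mul, nsmul_eq_mul, Finset.card_range]
  refine mul_le_mul_of_nonneg_left ?_ (Nat.cast_nonneg h)
  have hf : (Finset.range m).filter (fun r => r ∈ bad) = bad := by
    ext r; simp only [Finset.mem_filter]
    exact ⟨fun h => h.2, fun h => ⟨(Finset.mem_filter.mp h).1, h⟩⟩
  rw [hf]
  have hb2 : (bad.card : ℝ) ≤ 6 * M ^ 3 := by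
    calc (bad.card : ℝ) ≤ 6 * (N : ℝ) ^ 3 := by exact_mod_cast hcard
      _ ≤ _ := by gcongr
  have e : (m : ℝ) * (2 * R / M + 4 * R / M ^ 2 + 1) = 2 * R * M ^ 3 + 4 * R * M ^ 2 + m := by
    rw [← hM]; field_simp
  rw [e]
  have h6 : (bad.card : ℝ) * (2 * R) ≤ 6 * M ^ 3 * (2 * R) := by gcongr
  have h7 : R * M ^ 2 ≤ R * M ^ 3 := by gcongr; norm_num
  linarith

end

section

open MeasureTheory

namespace Cub

/-- Minus the discriminant of a real cubic form `(a, b, z.1, z.2)`. -/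
def nd (a b : ℝ) (z : ℝ × ℝ) : ℝ :=
  4 * a * z.1 ^ 3 + 4 * b ^ 3 * z.2 + 27 * a ^ 2 * z.2 ^ 2 - b ^ 2 * z.1 ^ 2 - 18 * a * b * z.1 * z.2

/-- Sign condition for `0 < B`. -/
def P1 (a b : ℝ) (z : ℝ × ℝ) : ℝ := b * z.1 - a * z.2

/-- Sign condition for `B < 1`. -/
def P2 (a b : ℝ) (z : ℝ × ℝ) : ℝ := (a - b) ^ 2 + z.1 * (a - b) + a * z.2

/-- Sign condition for `1 < C`. -/
def P3 (a b : ℝ) (z : ℝ × ℝ) : ℝ := z.2 ^ 2 - a ^ 2 + a * z.1 - b * z.2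

/-- The open fundamental domain for given `a`, `b`. -/
def SOp (a b Y : ℝ) : Set (ℝ × ℝ) :=
  {z | 0 < P1 a b z ∧ 0 < P2 a b z ∧ 0 < P3 a b z ∧ 0 < nd a b z ∧ nd a b z < Y}

/-- The closed fundamental domain for given `a`, `b`. -/
def SCl (a b Y : ℝ) : Set (ℝ × ℝ) :=
  {z | 0 ≤ P1 a b z ∧ 0 ≤ P2 a b z ∧ 0 ≤ P3 a b z ∧ 0 < nd a b z ∧ nd a b z < Y}

lemma sOp_subset (a b Y : ℝ) : SOp a b Y ⊆ SCl a b Y :=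
  fun _ h => ⟨h.1.le, h.2.1.le, h.2.2.1.le, h.2.2.2⟩

/-- Coordinates: `B` and `D = C - B² / 4`. -/
noncomputable def phi (a b : ℝ) (z : ℝ × ℝ) : ℝ × ℝ :=
  (a * (z.2 + z.1 ^ 2 / 4 - z.1 * (z.1 - b / a)), -a * (z.2 + z.1 ^ 2 / 4) * (z.1 - b / a))

/-- The quadratic factor at the root. -/
noncomputable def qd (a b : ℝ) (z : ℝ × ℝ) : ℝ := (3 / 2 * z.1 - b / a) ^ 2 + z.2

/-- Minus the discriminant in the coordinates `(B, D)`. -/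
noncomputable def ndc (a b : ℝ) (z : ℝ × ℝ) : ℝ := 4 * a ^ 4 * z.2 * qd a b z ^ 2

/-- The open domain in the coordinates `(B, D)`. -/
def ROp : Set (ℝ × ℝ) := {z | 0 < z.1 ∧ z.1 < 1 ∧ 1 < z.2 + z.1 ^ 2 / 4}

/-- The closed domain in the coordinates `(B, D)`. -/
def RCl : Set (ℝ × ℝ) := {z | 0 ≤ z.1 ∧ z.1 ≤ 1 ∧ 1 ≤ z.2 + z.1 ^ 2 / 4}

lemma pos_of_mem_rCl {z : ℝ × ℝ} (h : z ∈ RCl) : 3 / 4 ≤ z.2 := by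
  obtain ⟨h0, h1, h2⟩ := h; nlinarith

lemma rOp_subset : ROp ⊆ RCl := fun _ h => ⟨h.1.le, h.2.1.le, h.2.2.le⟩

section
variable {a b : ℝ} (ha : 0 < a)
include ha

lemma nd_phi (z : ℝ × ℝ) : nd a b (phi a b z) = ndc a b z := by
  simp only [nd, phi, ndc, qd]; field_simp; ring

lemma p1_phi (z : ℝ × ℝ) : P1 a b (phi a b z) = a ^ 2 * z.1 * ((z.1 / 2 - b / a) ^ 2 + z.2) := by
  simp only [P1, phi]; field_simp; ring

lemma p2_phi (z : ℝ × ℝ) :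
    P2 a b (phi a b z) = a ^ 2 * (1 - z.1) * ((1 + z.1 / 2 - b / a) ^ 2 + z.2) := by
  simp only [P2, phi]; field_simp; ring

lemma p3_phi (z : ℝ × ℝ) : P3 a b (phi a b z) = a ^ 2 * (z.2 + z.1 ^ 2 / 4 - 1) *
    ((1 + z.1 * (z.1 - b / a) / 2) ^ 2 + z.2 * (z.1 - b / a) ^ 2) := by
  simp only [P3, phi]; field_simp; ring

lemma exists_phi (w : ℝ × ℝ) : ∃ z, phi a b z = w := by
  obtain ⟨c, d⟩ := w
  obtain ⟨θ, hθ⟩ : ∃ θ : ℝ, a * θ ^ 3 + b * θ ^ 2 + c * θ + d = 0 := by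
    set T := 1 + (|b| + |c| + |d|) / a with hT
    have hT1 : 1 ≤ T := by rw [hT]; have : 0 ≤ (|b| + |c| + |d|) / a := by positivity
                           linarith
    have hTa : a * T = a + (|b| + |c| + |d|) := by rw [hT]; field_simp
    have key : |b| * T ^ 2 + |c| * T + |d| ≤ a * T ^ 3 := by
      have e : a * T ^ 3 = (a + (|b| + |c| + |d|)) * T ^ 2 := by rw [← hTa]; ring
      have h1 : |c| * T ≤ |c| * T ^ 2 := by
        apply mul_le_mul_of_nonneg_left _ (abs_nonneg c); nlinarith
      have h2 : |d| ≤ |d| * T ^ 2 := by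
        apply le_mul_of_one_le_right (abs_nonneg d); nlinarith
      rw [e]; nlinarith [sq_nonneg T]
    have hcont : Continuous fun x : ℝ => a * x ^ 3 + b * x ^ 2 + c * x + d := by fun_prop
    have hb := abs_le.mp (le_refl |b|)
    have hc := abs_le.mp (le_refl |c|)
    have hd := abs_le.mp (le_refl |d|)
    have hT2 : 0 ≤ T ^ 2 := sq_nonneg T
    obtain ⟨θ, -, h⟩ := intermediate_value_Icc (by linarith : -T ≤ T) hcont.continuousOn
      (show (0 : ℝ) ∈ Set.Icc _ _ from ⟨by nlinarith, by nlinarith⟩)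
    exact ⟨θ, h⟩
  refine ⟨(b / a + θ, c / a + (b / a + θ) * θ - (b / a + θ) ^ 2 / 4), ?_⟩
  have e : b / a + θ - b / a = θ := by ring
  have e1 : a * (b / a) = b := by field_simp
  have e2 : a * (c / a) = c := by field_simp
  simp only [phi, e]
  ext
  · simp only; linear_combination e2
  · simp only; linear_combination -hθ - θ * e2 - θ ^ 2 * e1

lemma phi_injOn : Set.InjOn (phi a b) {z | 0 < z.2} := by
  rintro ⟨B, D⟩ hz ⟨B', D'⟩ hz' he
  simp only [Set.mem_ofPred_eq] at hz hz'
  simp only [phi, Prod.mk.injEq] at he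
  obtain ⟨h1, h2⟩ := he
  set θ := B - b / a with hθ
  set θ' := B' - b / a with hθ'
  have h1' : D + B ^ 2 / 4 - B * θ = D' + B' ^ 2 / 4 - B' * θ' := mul_left_cancel₀ ha.ne' h1
  have h2' : (D + B ^ 2 / 4) * θ = (D' + B' ^ 2 / 4) * θ' :=
    mul_left_cancel₀ (neg_ne_zero.mpr ha.ne') (by linear_combination h2)
  have hB : B - θ = B' - θ' := by rw [hθ, hθ']; ring
  -- `θ'` is a root of the first cubic
  have h3 : (θ' - θ) * ((θ' + B / 2) ^ 2 + D) = 0 := by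
    linear_combination θ' ^ 2 * hB + θ' * h1' - h2'
  have h4 : θ' - θ = 0 := by
    rcases mul_eq_zero.mp h3 with h | h
    · exact h
    · nlinarith [sq_nonneg (θ' + B / 2)]
  have h5 : B = B' := by linarith
  subst h5
  ext
  · rfl
  · simp only; linear_combination h1'

lemma phi_mem_sOp {Y : ℝ} {z : ℝ × ℝ} : phi a b z ∈ SOp a b Y ↔ z ∈ ROp ∧ ndc a b z < Y := by
  have ha2 : 0 < a ^ 2 := by positivity
  have aux : 0 < ndc a b z → 0 < z.2 := by
    intro h
    by_contra h0
    push Not at h0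
    have : ndc a b z ≤ 0 := by
      unfold ndc
      apply mul_nonpos_of_nonpos_of_nonneg _ (sq_nonneg _)
      exact mul_nonpos_of_nonneg_of_nonpos (by positivity) h0
    linarith
  simp only [SOp, Set.mem_ofPred_eq, nd_phi ha, p1_phi ha, p2_phi ha, p3_phi ha, ROp]
  have pos1 : 0 < z.2 → 0 < (z.1 / 2 - b / a) ^ 2 + z.2 := fun h => by positivity
  have pos2 : 0 < z.2 → 0 < (1 + z.1 / 2 - b / a) ^ 2 + z.2 := fun h => by positivity
  have pos3 : 0 < z.2 → 0 < (1 + z.1 * (z.1 - b / a) / 2) ^ 2 + z.2 * (z.1 - b / a) ^ 2 := by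
    intro h
    by_cases h0 : z.1 - b / a = 0
    · rw [h0]; norm_num
    · positivity
  constructor
  · rintro ⟨h1, h2, h3, h4, h5⟩
    have hD := aux h4
    have g1 := (mul_pos_iff_of_pos_left ha2).mp ((mul_pos_iff_of_pos_right (pos1 hD)).mp h1)
    have g2 := (mul_pos_iff_of_pos_left ha2).mp ((mul_pos_iff_of_pos_right (pos2 hD)).mp h2)
    have g3 := (mul_pos_iff_of_pos_left ha2).mp ((mul_pos_iff_of_pos_right (pos3 hD)).mp h3)
    exact ⟨⟨g1, by linarith, by linarith⟩, h5⟩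
  · rintro ⟨⟨h1, h2, h3⟩, h5⟩
    have hD : 0 < z.2 := by nlinarith
    have i1 := pos1 hD
    have i2 := pos2 hD
    have i3 := pos3 hD
    have i4 : 0 < 1 - z.1 := by linarith
    have i5 : 0 < z.2 + z.1 ^ 2 / 4 - 1 := by linarith
    have i6 : 0 < qd a b z := by unfold qd; positivity
    exact ⟨by positivity, by positivity, by positivity, by unfold ndc; positivity, h5⟩

lemma phi_mem_sCl {Y : ℝ} {z : ℝ × ℝ} : phi a b z ∈ SCl a b Y ↔ z ∈ RCl ∧ ndc a b z < Y := by
  have ha2 : 0 < a ^ 2 := by positivity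
  have aux : 0 < ndc a b z → 0 < z.2 := by
    intro h
    by_contra h0
    push Not at h0
    have : ndc a b z ≤ 0 := by
      unfold ndc
      apply mul_nonpos_of_nonpos_of_nonneg _ (sq_nonneg _)
      exact mul_nonpos_of_nonneg_of_nonpos (by positivity) h0
    linarith
  simp only [SCl, Set.mem_ofPred_eq, nd_phi ha, p1_phi ha, p2_phi ha, p3_phi ha, RCl]
  have pos1 : 0 < z.2 → 0 < (z.1 / 2 - b / a) ^ 2 + z.2 := fun h => by positivity
  have pos2 : 0 < z.2 → 0 < (1 + z.1 / 2 - b / a) ^ 2 + z.2 := fun h => by positivity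
  have pos3 : 0 < z.2 → 0 < (1 + z.1 * (z.1 - b / a) / 2) ^ 2 + z.2 * (z.1 - b / a) ^ 2 := by
    intro h
    by_cases h0 : z.1 - b / a = 0
    · rw [h0]; norm_num
    · positivity
  constructor
  · rintro ⟨h1, h2, h3, h4, h5⟩
    have hD := aux h4
    have g1 := (mul_nonneg_iff_of_pos_left ha2).mp ((mul_nonneg_iff_of_pos_right (pos1 hD)).mp h1)
    have g2 := (mul_nonneg_iff_of_pos_left ha2).mp ((mul_nonneg_iff_of_pos_right (pos2 hD)).mp h2)
    have g3 := (mul_nonneg_iff_of_pos_left ha2).mp ((mul_nonneg_iff_of_pos_right (pos3 hD)).mp h3)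
    exact ⟨⟨g1, by linarith, by linarith⟩, h5⟩
  · rintro ⟨⟨h1, h2, h3⟩, h5⟩
    have hD : 0 < z.2 := by nlinarith
    have i1 := pos1 hD
    have i2 := pos2 hD
    have i3 := pos3 hD
    have i4 : 0 ≤ 1 - z.1 := by linarith
    have i5 : 0 ≤ z.2 + z.1 ^ 2 / 4 - 1 := by linarith
    have i6 : 0 < qd a b z := by unfold qd; positivity
    exact ⟨by positivity, by positivity, by positivity, by unfold ndc; positivity, h5⟩

lemma sOp_eq_image (Y : ℝ) : SOp a b Y = phi a b '' {z | z ∈ ROp ∧ ndc a b z < Y} := by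
  ext w
  constructor
  · intro h
    obtain ⟨z, rfl⟩ := exists_phi (b := b) ha w
    exact ⟨z, (phi_mem_sOp ha).mp h, rfl⟩
  · rintro ⟨z, h, rfl⟩
    exact (phi_mem_sOp ha).mpr h

lemma sCl_eq_image (Y : ℝ) : SCl a b Y = phi a b '' {z | z ∈ RCl ∧ ndc a b z < Y} := by
  ext w
  constructor
  · intro h
    obtain ⟨z, rfl⟩ := exists_phi (b := b) ha w
    exact ⟨z, (phi_mem_sCl ha).mp h, rfl⟩
  · rintro ⟨z, h, rfl⟩
    exact (phi_mem_sCl ha).mpr h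

/-- Bounds on the coefficients of reduced forms. -/
lemma sCl_bounds {Y : ℝ} {w : ℝ × ℝ} (h : w ∈ SCl a b Y) : a ^ 4 ≤ Y ∧ b ^ 4 ≤ 12 * Y ∧
    (a * w.1) ^ 2 ≤ 2 * Y ∧ (a * w.2) ^ 2 ≤ Y := by
  rw [sCl_eq_image ha] at h
  obtain ⟨z, ⟨hz, hY⟩, rfl⟩ := h
  obtain ⟨i1, i2, i3, i4⟩ := BCF.red_ineq (a := a) (B := z.1) (t := 3 / 2 * z.1 - b / a) hz.1 hz.2.1
    (pos_of_mem_rCl hz)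
  have e0 : a ^ 4 * (4 * z.2) * ((3 / 2 * z.1 - b / a) ^ 2 + z.2) ^ 2 = ndc a b z := by
    simp only [ndc, qd]; ring
  have e1 : a * (z.1 - (3 / 2 * z.1 - b / a - z.1 / 2)) = b := by field_simp; ring
  have e2 : a * (z.2 + z.1 ^ 2 / 4 - z.1 * (3 / 2 * z.1 - b / a - z.1 / 2)) = (phi a b z).1 := by
    simp only [phi]; ring
  have e3 : (a * (z.2 + z.1 ^ 2 / 4) * (3 / 2 * z.1 - b / a - z.1 / 2)) ^ 2 = (phi a b z).2 ^ 2 := by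
    simp only [phi]; ring
  rw [e0] at i1 i2 i3 i4
  rw [e1] at i2
  rw [e2] at i3
  rw [e3] at i4
  refine ⟨by linarith, by linarith, ?_, ?_⟩
  · rw [mul_pow]; linarith
  · rw [mul_pow]; linarith

end

end Cub

end

section

open MeasureTheory

namespace Cub

lemma fr_of_root {S : Set ℝ} (p : Polynomial ℝ) {n : ℕ} (hn : p.natDegree ≤ n)
    (hS : ∀ x y, (0 < p.eval x ↔ 0 < p.eval y) → (p.eval x < 0 ↔ p.eval y < 0) →
      (x ∈ S ↔ y ∈ S)) : Fr n S := by
  classical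
  refine ⟨p.roots.toFinset, (Multiset.toFinset_card_le _).trans ((p.card_roots').trans hn),
    fun x y hxy => ?_⟩
  by_cases h0 : p = 0
  · left; apply hS <;> simp [h0]
  by_cases hr : ∃ z ∈ p.roots.toFinset, x ≤ z ∧ z ≤ y
  · exact Or.inr hr
  left
  push Not at hr
  have hr' : ∀ z, x ≤ z → z ≤ y → p.eval z ≠ 0 := by
    intro z h1 h2 h3
    exact absurd (hr z (by simp [h0, h3]) h1) (not_lt.mpr h2)
  have hc : ContinuousOn (fun z => p.eval z) (Set.Icc x y) := p.continuous.continuousOn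
  have hx := hr' x le_rfl hxy
  have hy := hr' y hxy le_rfl
  rcases lt_or_gt_of_ne hx with h1 | h1 <;> rcases lt_or_gt_of_ne hy with h2 | h2
  · exact hS x y (by constructor <;> intro <;> linarith) (by tauto)
  · obtain ⟨z, hz, h⟩ := intermediate_value_Icc hxy hc (show (0 : ℝ) ∈ Set.Icc _ _ from ⟨h1.le, h2.le⟩)
    exact absurd h (hr' z hz.1 hz.2)
  · obtain ⟨z, hz, h⟩ := intermediate_value_Icc' hxy hc (show (0 : ℝ) ∈ Set.Icc _ _ from ⟨h2.le, h1.le⟩)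
    exact absurd h (hr' z hz.1 hz.2)
  · exact hS x y (by tauto) (by constructor <;> intro <;> linarith)

lemma fr_pos {f : ℝ → ℝ} (n : ℕ) (p : Polynomial ℝ) (hn : p.natDegree ≤ n)
    (hp : ∀ t, f t = p.eval t) : Fr n {t | 0 < f t} := by
  refine fr_of_root p hn fun x y h1 h2 => ?_
  simp only [Set.mem_ofPred_eq, hp]; exact h1

lemma fr_nonneg {f : ℝ → ℝ} (n : ℕ) (p : Polynomial ℝ) (hn : p.natDegree ≤ n)
    (hp : ∀ t, f t = p.eval t) : Fr n {t | 0 ≤ f t} := by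
  refine fr_of_root p hn fun x y h1 h2 => ?_
  simp only [Set.mem_ofPred_eq, hp, ← not_lt]; exact not_congr h2

section
open Polynomial

lemma poly_p1 (a b p q u v : ℝ) : ∃ P : ℝ[X], P.natDegree ≤ 1 ∧
    ∀ t, P1 a b (p + t * u, q + t * v) = P.eval t :=
  ⟨C (b * u - a * v) * X + C (b * p - a * q), natDegree_linear_le,
    fun t => by simp [P1]; ring⟩

lemma poly_p2 (a b p q u v : ℝ) : ∃ P : ℝ[X], P.natDegree ≤ 1 ∧
    ∀ t, P2 a b (p + t * u, q + t * v) = P.eval t :=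
  ⟨C (u * (a - b) + a * v) * X + C ((a - b) ^ 2 + p * (a - b) + a * q), natDegree_linear_le,
    fun t => by simp [P2]; ring⟩

lemma poly_p3 (a b p q u v : ℝ) : ∃ P : ℝ[X], P.natDegree ≤ 2 ∧
    ∀ t, P3 a b (p + t * u, q + t * v) = P.eval t :=
  ⟨C (v ^ 2) * X ^ 2 + C (2 * q * v + a * u - b * v) * X + C (q ^ 2 - a ^ 2 + a * p - b * q),
    natDegree_quadratic_le, fun t => by simp [P3]; ring⟩

lemma poly_nd (a b p q u v s Y : ℝ) : ∃ P : ℝ[X], P.natDegree ≤ 3 ∧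
    ∀ t, Y + s * nd a b (p + t * u, q + t * v) = P.eval t :=
  ⟨C (s * (4 * a * u ^ 3)) * X ^ 3 + C (s * (12 * a * p * u ^ 2 + 27 * a ^ 2 * v ^ 2
      - b ^ 2 * u ^ 2 - 18 * a * b * u * v)) * X ^ 2 +
    C (s * (12 * a * p ^ 2 * u + 4 * b ^ 3 * v + 54 * a ^ 2 * q * v - 2 * b ^ 2 * p * u
      - 18 * a * b * (p * v + q * u))) * X +
    C (Y + s * nd a b (p, q)),
    natDegree_cubic_le, fun t => by simp [nd]; ring⟩

end

lemma measurable_nd (a b : ℝ) : Measurable (nd a b) := by unfold nd; fun_prop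
lemma measurable_p1 (a b : ℝ) : Measurable (P1 a b) := by unfold P1; fun_prop
lemma measurable_p2 (a b : ℝ) : Measurable (P2 a b) := by unfold P2; fun_prop
lemma measurable_p3 (a b : ℝ) : Measurable (P3 a b) := by unfold P3; fun_prop

lemma box_bound {a Y x : ℝ} (ha : 0 < a) (h : (a * x) ^ 2 ≤ 2 * Y) : |x| ≤ 2 * √Y / a := by
  have hY : 0 ≤ Y := by nlinarith [sq_nonneg (a * x)]
  rw [le_div_iff₀ ha]
  apply abs_le_of_sq_le_sq' _ (by positivity) |>.2.trans' _ 
  · exact |x| * a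
  · rw [mul_pow, sq_abs, mul_pow, Real.sq_sqrt hY]; nlinarith
  · exact le_rfl

lemma nice_sOp {a : ℝ} (ha : 0 < a) (b Y : ℝ) : Nice 10 (2 * √Y / a) (SOp a b Y) where
  meas := by
    refine (measurableSet_lt measurable_const (measurable_p1 a b)).inter
      ((measurableSet_lt measurable_const (measurable_p2 a b)).inter
      ((measurableSet_lt measurable_const (measurable_p3 a b)).inter
      ((measurableSet_lt measurable_const (measurable_nd a b)).inter
      (measurableSet_lt (measurable_nd a b) measurable_const))))
  box := by
    intro z hz
    obtain ⟨h1, -, h2, h3⟩ := sCl_bounds ha (sOp_subset a b Y hz)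
    refine ⟨box_bound ha h2, box_bound ha ?_⟩
    nlinarith [sq_nonneg (a * z.2)]
  line := by
    intro p q u v
    obtain ⟨p1, d1, e1⟩ := poly_p1 a b p q u v
    obtain ⟨p2, d2, e2⟩ := poly_p2 a b p q u v
    obtain ⟨p3, d3, e3⟩ := poly_p3 a b p q u v
    obtain ⟨p4, d4, e4⟩ := poly_nd a b p q u v 1 0
    obtain ⟨p5, d5, e5⟩ := poly_nd a b p q u v (-1) Y
    have H := (fr_pos 1 p1 d1 e1).inter ((fr_pos 1 p2 d2 e2).inter ((fr_pos 2 p3 d3 e3).inter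
      ((fr_pos 3 p4 d4 e4).inter (fr_pos 3 p5 d5 e5))))
    convert H using 1
    ext t
    simp only [SOp, Set.mem_ofPred_eq, Set.mem_inter_iff]
    refine and_congr_right fun _ => and_congr_right fun _ => and_congr_right fun _ => ?_
    constructor <;> rintro ⟨h1, h2⟩ <;> constructor <;> linarith

lemma nice_sCl {a : ℝ} (ha : 0 < a) (b Y : ℝ) : Nice 10 (2 * √Y / a) (SCl a b Y) where
  meas := by
    refine (measurableSet_le measurable_const (measurable_p1 a b)).inter
      ((measurableSet_le measurable_const (measurable_p2 a b)).inter
      ((measurableSet_le measurable_const (measurable_p3 a b)).inter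
      ((measurableSet_lt measurable_const (measurable_nd a b)).inter
      (measurableSet_lt (measurable_nd a b) measurable_const))))
  box := by
    intro z hz
    obtain ⟨h1, -, h2, h3⟩ := sCl_bounds ha hz
    refine ⟨box_bound ha h2, box_bound ha ?_⟩
    nlinarith [sq_nonneg (a * z.2)]
  line := by
    intro p q u v
    obtain ⟨p1, d1, e1⟩ := poly_p1 a b p q u v
    obtain ⟨p2, d2, e2⟩ := poly_p2 a b p q u v
    obtain ⟨p3, d3, e3⟩ := poly_p3 a b p q u v
    obtain ⟨p4, d4, e4⟩ := poly_nd a b p q u v 1 0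
    obtain ⟨p5, d5, e5⟩ := poly_nd a b p q u v (-1) Y
    have H := (fr_nonneg 1 p1 d1 e1).inter ((fr_nonneg 1 p2 d2 e2).inter
      ((fr_nonneg 2 p3 d3 e3).inter ((fr_pos 3 p4 d4 e4).inter (fr_pos 3 p5 d5 e5))))
    convert H using 1
    ext t
    simp only [SCl, Set.mem_ofPred_eq, Set.mem_inter_iff]
    refine and_congr_right fun _ => and_congr_right fun _ => and_congr_right fun _ => ?_
    constructor <;> rintro ⟨h1, h2⟩ <;> constructor <;> linarith

/-- The derivative of `phi`. -/
noncomputable def dphi (a b : ℝ) (z : ℝ × ℝ) : ℝ × ℝ →L[ℝ] ℝ × ℝ :=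
  (Matrix.toLin (Module.Basis.finTwoProd ℝ) (Module.Basis.finTwoProd ℝ)
    !![-(3 / 2) * a * z.1 + a * (b / a), a;
      -a * (z.1 / 2 * (z.1 - b / a) + (z.2 + z.1 ^ 2 / 4)), -a * (z.1 - b / a)]).toContinuousLinearMap

lemma hasFDerivAt_phi (a b : ℝ) (z : ℝ × ℝ) : HasFDerivAt (phi a b) (dphi a b z) z := by
  have h1 : HasFDerivAt (fun z : ℝ × ℝ => z.1) (ContinuousLinearMap.fst ℝ ℝ ℝ) z := hasFDerivAt_fst
  have h2 : HasFDerivAt (fun z : ℝ × ℝ => z.2) (ContinuousLinearMap.snd ℝ ℝ ℝ) z := hasFDerivAt_snd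
  have hC := h2.add ((h1.pow 2).mul_const (1 / 4 : ℝ))
  have hth := h1.sub_const (b / a)
  have H := ((hC.sub (h1.mul hth)).const_mul a).prodMk ((hC.const_mul (-a)).mul hth)
  have e : phi a b = fun z => (a * (z.2 + z.1 ^ 2 * (1 / 4) - z.1 * (z.1 - b / a)),
      -a * (z.2 + z.1 ^ 2 * (1 / 4)) * (z.1 - b / a)) := by
    funext z; simp only [phi]; ext <;> simp only <;> ring
  rw [e]
  refine H.congr_fderiv ?_
  ext <;> simp [dphi, Matrix.toLin_finTwoProd_apply] <;> ring

lemma det_dphi (a b : ℝ) (z : ℝ × ℝ) : (dphi a b z).det = a ^ 2 * qd a b z := by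
  unfold dphi
  rw [LinearMap.det_toContinuousLinearMap, LinearMap.det_toLin, Matrix.det_fin_two_of]
  simp only [qd]; ring

/-- The density of the area. -/
noncomputable def dens (a b Y : ℝ) (z : ℝ × ℝ) : ℝ :=
  open scoped Classical in if ndc a b z < Y then a ^ 2 * qd a b z else 0

lemma measurable_qd (a b : ℝ) : Measurable (qd a b) := by unfold qd; fun_prop
lemma measurable_ndc (a b : ℝ) : Measurable (ndc a b) := by
  have := measurable_qd a b
  unfold ndc; fun_prop

lemma measurable_dens (a b Y : ℝ) : Measurable (dens a b Y) := by
  unfold dens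
  exact Measurable.ite (measurableSet_lt (measurable_ndc a b) measurable_const)
    ((measurable_qd a b).const_mul _) measurable_const

lemma measurableSet_rOp : MeasurableSet ROp := by
  refine (measurableSet_lt measurable_const measurable_fst).inter
    ((measurableSet_lt measurable_fst measurable_const).inter
    (measurableSet_lt measurable_const
      (show Measurable fun z : ℝ × ℝ => z.2 + z.1 ^ 2 / 4 by fun_prop)))

lemma measurableSet_rCl : MeasurableSet RCl := by
  refine (measurableSet_le measurable_const measurable_fst).inter
    ((measurableSet_le measurable_fst measurable_const).inter
    (measurableSet_le measurable_const
      (show Measurable fun z : ℝ × ℝ => z.2 + z.1 ^ 2 / 4 by fun_prop)))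

lemma rCl_ae_eq : RCl =ᵐ[volume] ROp := by
  have hnull : volume (RCl \ ROp) = 0 := by
    have hsub : RCl \ ROp ⊆ ({0} ×ˢ Set.univ) ∪ (({1} ×ˢ Set.univ) ∪
        {z : ℝ × ℝ | z.2 + z.1 ^ 2 / 4 = 1}) := by
      rintro z ⟨⟨h1, h2, h3⟩, h4⟩
      simp only [Set.mem_union, Set.mem_prod, Set.mem_singleton_iff, Set.mem_univ, and_true,
        Set.mem_ofPred_eq]
      by_contra h
      push Not at h
      exact h4 ⟨lt_of_le_of_ne h1 (Ne.symm h.1), lt_of_le_of_ne h2 h.2.1, lt_of_le_of_ne h3 (Ne.symm h.2.2)⟩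
    refine measure_mono_null hsub (measure_union_null ?_ (measure_union_null ?_ ?_))
    · rw [Measure.volume_eq_prod, Measure.prod_prod]; simp
    · rw [Measure.volume_eq_prod, Measure.prod_prod]; simp
    · rw [Measure.volume_eq_prod, Measure.measure_prod_null (measurableSet_eq_fun (by fun_prop) (by fun_prop))]
      refine Filter.Eventually.of_forall fun x => ?_
      have : (Prod.mk x ⁻¹' {z : ℝ × ℝ | z.2 + z.1 ^ 2 / 4 = 1}) ⊆ {1 - x ^ 2 / 4} := by
        intro y hy
        simp only [Set.mem_preimage, Set.mem_ofPred_eq] at hy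
        simp only [Set.mem_singleton_iff]; linarith
      exact measure_mono_null this (by simp)
  rw [ae_eq_set]
  exact ⟨hnull, by rw [Set.sdiff_eq_empty.mpr rOp_subset]; simp⟩

lemma qd_nonneg {a b : ℝ} {z : ℝ × ℝ} (h : z ∈ RCl) : 0 ≤ qd a b z := by
  have := pos_of_mem_rCl h
  unfold qd; positivity

lemma volume_image {a : ℝ} (ha : 0 < a) (b Y : ℝ) {R : Set (ℝ × ℝ)} (hR : MeasurableSet R)
    (hsub : R ⊆ RCl) : volume (phi a b '' {z | z ∈ R ∧ ndc a b z < Y}) =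
      ∫⁻ z in R, ENNReal.ofReal (dens a b Y z) := by
  have hm : MeasurableSet {z : ℝ × ℝ | ndc a b z < Y} :=
    measurableSet_lt (measurable_ndc a b) measurable_const
  have hinj : Set.InjOn (phi a b) {z | z ∈ R ∧ ndc a b z < Y} :=
    (phi_injOn ha).mono fun z hz => by
      have := pos_of_mem_rCl (hsub hz.1)
      simp only [Set.mem_ofPred_eq]; linarith
  refine (lintegral_abs_det_fderiv_eq_addHaar_image volume (hR.inter hm)
    (fun z _ => (hasFDerivAt_phi a b z).hasFDerivWithinAt) hinj).symm.trans ?_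
  rw [Set.inter_comm, ← setLIntegral_indicator hm]
  refine setLIntegral_congr_fun hR fun z hz => ?_
  have hq := qd_nonneg (a := a) (b := b) (hsub hz)
  simp only [Set.indicator, dens, Set.mem_ofPred_eq]
  split_ifs
  · rw [det_dphi, abs_of_nonneg (by positivity)]
  · simp

lemma volume_sOp {a : ℝ} (ha : 0 < a) (b Y : ℝ) :
    volume (SOp a b Y) = ∫⁻ z in ROp, ENNReal.ofReal (dens a b Y z) := by
  rw [sOp_eq_image ha, volume_image ha b Y measurableSet_rOp rOp_subset]

lemma volume_sCl {a : ℝ} (ha : 0 < a) (b Y : ℝ) : volume (SCl a b Y) = volume (SOp a b Y) := by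
  rw [volume_sOp ha, sCl_eq_image ha, volume_image ha b Y measurableSet_rCl le_rfl]
  exact setLIntegral_congr rCl_ae_eq

lemma dens_nonneg {a b Y : ℝ} {z : ℝ × ℝ} (h : z ∈ RCl) : 0 ≤ dens a b Y z := by
  have := qd_nonneg (a := a) (b := b) h
  unfold dens; split_ifs <;> positivity

lemma Nice.volume_lt_top {h : ℕ} {R : ℝ} {S : Set (ℝ × ℝ)} (H : Nice h R S) : volume S < ⊤ := by
  refine lt_of_le_of_lt (measure_mono (t := Set.Icc (-R, -R) (R, R)) fun z hz => ?_)
    isCompact_Icc.measure_lt_top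
  obtain ⟨h1, h2⟩ := H.box z hz
  exact ⟨⟨(abs_le.mp h1).1, (abs_le.mp h2).1⟩, ⟨(abs_le.mp h1).2, (abs_le.mp h2).2⟩⟩

lemma integrableOn_dens {a : ℝ} (ha : 0 < a) (b Y : ℝ) : IntegrableOn (dens a b Y) ROp := by
  refine ⟨(measurable_dens a b Y).aestronglyMeasurable, ?_⟩
  rw [hasFiniteIntegral_iff_ofReal, ← volume_sOp ha]
  · exact Nice.volume_lt_top (nice_sOp ha b Y)
  · filter_upwards [self_mem_ae_restrict measurableSet_rOp] with z hz
    exact dens_nonneg (rOp_subset hz)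

lemma area_eq {a : ℝ} (ha : 0 < a) (b Y : ℝ) :
    volume.real (SOp a b Y) = ∫ z in ROp, dens a b Y z := by
  rw [integral_eq_lintegral_of_nonneg_ae, ← volume_sOp ha]
  · rfl
  · filter_upwards [self_mem_ae_restrict measurableSet_rOp] with z hz
    exact dens_nonneg (rOp_subset hz)
  · exact (measurable_dens a b Y).aestronglyMeasurable

lemma area_sCl {a : ℝ} (ha : 0 < a) (b Y : ℝ) :
    volume.real (SCl a b Y) = volume.real (SOp a b Y) := by
  unfold Measure.real; rw [volume_sCl ha]

end Cub

end

section

open MeasureTheory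

namespace Cub
open BCF

lemma splitting_iff {f : BCF} (ha : 0 < f.a) (B C : ℝ) : (∃ θ, Splitting f θ B C) ↔
    phi f.a f.b (B, C - B ^ 2 / 4) = ((f.c : ℝ), (f.d : ℝ)) := by
  have ha' : (0 : ℝ) < f.a := by exact_mod_cast ha
  constructor
  · rintro ⟨θ, h⟩
    have e : B - (f.b : ℝ) / f.a = θ := by rw [h.hb]; field_simp; ring
    simp only [phi, e]
    ext
    · simp only; rw [h.hc]; ring
    · simp only; rw [h.hd]; ring
  · intro h
    simp only [phi, Prod.mk.injEq] at h
    refine ⟨B - f.b / f.a, ?_, ?_, ?_⟩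
    · field_simp; ring
    · rw [← h.1]; ring
    · rw [← h.2]; ring

lemma nd_eq (f : BCF) : nd f.a f.b ((f.c : ℝ), (f.d : ℝ)) = -(f.disc : ℝ) := by
  simp only [nd, disc]; push_cast; ring

lemma mem_sCl_iff {f : BCF} (ha : 0 < f.a) (Y : ℝ) :
    ((f.c : ℝ), (f.d : ℝ)) ∈ SCl f.a f.b Y ↔ CRed f ∧ -(f.disc : ℝ) < Y := by
  have ha' : (0 : ℝ) < f.a := by exact_mod_cast ha
  constructor
  · intro h
    rw [sCl_eq_image ha'] at h
    obtain ⟨z, ⟨hz, hY⟩, e⟩ := h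
    obtain ⟨θ, hS⟩ := (splitting_iff ha z.1 (z.2 + z.1 ^ 2 / 4)).mpr (by rw [← e]; simp)
    refine ⟨⟨ha, θ, _, _, hS, hz⟩, ?_⟩
    rw [← nd_eq, ← e, nd_phi ha']; exact hY
  · rintro ⟨⟨-, θ, B, C, hS, hz⟩, hY⟩
    have e := (splitting_iff ha B C).mp ⟨θ, hS⟩
    rw [← e, phi_mem_sCl ha', ← nd_phi ha', e, nd_eq]
    exact ⟨by simpa [RCl] using hz, hY⟩

lemma mem_sOp_iff {f : BCF} (ha : 0 < f.a) (Y : ℝ) :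
    ((f.c : ℝ), (f.d : ℝ)) ∈ SOp f.a f.b Y ↔ ORed f ∧ -(f.disc : ℝ) < Y := by
  have ha' : (0 : ℝ) < f.a := by exact_mod_cast ha
  constructor
  · intro h
    rw [sOp_eq_image ha'] at h
    obtain ⟨z, ⟨hz, hY⟩, e⟩ := h
    obtain ⟨θ, hS⟩ := (splitting_iff ha z.1 (z.2 + z.1 ^ 2 / 4)).mpr (by rw [← e]; simp)
    refine ⟨⟨ha, θ, _, _, hS, hz⟩, ?_⟩
    rw [← nd_eq, ← e, nd_phi ha']; exact hY
  · rintro ⟨⟨-, θ, B, C, hS, hz⟩, hY⟩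
    have e := (splitting_iff ha B C).mp ⟨θ, hS⟩
    rw [← e, phi_mem_sOp ha', ← nd_phi ha', e, nd_eq]
    exact ⟨by simpa [ROp] using hz, hY⟩

lemma CRed.disc_neg {f : BCF} (h : BCF.CRed f) : f.disc < 0 := by
  have := h.bounds.1
  have : 0 < f.a ^ 4 := by have := h.1; positivity
  linarith

/-- Reduced forms. -/
noncomputable def CL (Y : ℝ) : Finset BCF := (finite_cred Y).toFinset

lemma mem_CL {Y : ℝ} {f : BCF} : f ∈ CL Y ↔ CRed f ∧ -(f.disc : ℝ) < Y := by simp [CL]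

open scoped Classical in
/-- Strictly reduced forms. -/
noncomputable def OP (Y : ℝ) : Finset BCF := (CL Y).filter ORed

lemma mem_OP {Y : ℝ} {f : BCF} : f ∈ OP Y ↔ ORed f ∧ -(f.disc : ℝ) < Y := by
  simp only [OP, Finset.mem_filter, mem_CL]
  exact ⟨fun h => ⟨h.2, h.1.2⟩, fun h => ⟨⟨h.1.cred, h.2⟩, h.1⟩⟩

/-- The pairs `(c, d)` of coefficients. -/
noncomputable def JJ (N : ℕ) : Finset (ℤ × ℤ) :=
  Finset.Icc (-(2 * N ^ 2 : ℤ)) (2 * N ^ 2) ×ˢ Finset.Icc (-(2 * N ^ 2 : ℤ)) (2 * N ^ 2)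

/-- The coefficients `b`. -/
noncomputable def JB (N : ℕ) : Finset ℤ := Finset.Icc (-(2 * N : ℤ)) (2 * N)

lemma mem_JJ {N : ℕ} {Y : ℝ} (hY : Y ≤ N ^ 4) {a b : ℝ} (ha : 1 ≤ a) {c d : ℤ}
    (h : ((c : ℝ), (d : ℝ)) ∈ SCl a b Y) : (c, d) ∈ JJ N := by
  obtain ⟨-, -, h1, h2⟩ := sCl_bounds (by linarith) h
  simp only at h1 h2
  have key : ∀ x : ℤ, (a * x) ^ 2 ≤ 2 * Y → -(2 * N ^ 2 : ℤ) ≤ x ∧ x ≤ 2 * N ^ 2 := by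
    intro x hx
    have h3 : (x : ℝ) ^ 2 ≤ (2 * N ^ 2 : ℝ) ^ 2 := by
      have : (x : ℝ) ^ 2 ≤ (a * x) ^ 2 := by
        rw [mul_pow]; apply le_mul_of_one_le_left (sq_nonneg _); nlinarith
      have : (0 : ℝ) ≤ N ^ 4 := by positivity
      nlinarith
    have := abs_le_of_sq_le_sq' h3 (by positivity)
    constructor
    · exact_mod_cast this.1
    · exact_mod_cast this.2
  simp only [JJ, Finset.mem_product, Finset.mem_Icc]
  exact ⟨key c h1, key d (by nlinarith [sq_nonneg (a * d)])⟩

lemma le_of_mem_sCl {N : ℕ} {Y : ℝ} (hY : Y ≤ N ^ 4) {a b : ℤ} (ha : 0 < a) {z : ℝ × ℝ}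
    (h : z ∈ SCl a b Y) : a ≤ N ∧ b ∈ JB N := by
  obtain ⟨h1, h2, -, -⟩ := sCl_bounds (by exact_mod_cast ha) h
  constructor
  · have : (a : ℝ) ^ 4 ≤ (N : ℝ) ^ 4 := h1.trans hY
    have := abs_le_of_sq_le_sq' (a := (a : ℝ) ^ 2) (b := (N : ℝ) ^ 2) (by nlinarith) (by positivity)
    have := abs_le_of_sq_le_sq' this.2 (by positivity)
    exact_mod_cast this.2
  · have : (b : ℝ) ^ 4 ≤ (2 * N : ℝ) ^ 4 := by
      have : (0 : ℝ) ≤ N ^ 4 := by positivity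
      nlinarith
    have := abs_le_of_sq_le_sq' (a := (b : ℝ) ^ 2) (b := (2 * N : ℝ) ^ 2) (by nlinarith) (by positivity)
    have := abs_le_of_sq_le_sq' this.2 (by positivity)
    simp only [JB, Finset.mem_Icc]
    constructor
    · exact_mod_cast this.1
    · exact_mod_cast this.2

open scoped Classical in
lemma sum_param {S : ℝ → ℝ → Set (ℝ × ℝ)} {Y : ℝ} {N : ℕ} (hS : ∀ a b, S a b ⊆ SCl a b Y)
    (hY : Y ≤ N ^ 4) {F : Finset BCF} (hF : ∀ f, f ∈ F ↔ 0 < f.a ∧ ((f.c : ℝ), (f.d : ℝ)) ∈ S f.a f.b)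
    (g : BCF → ℝ) : ∑ f ∈ F, g f = ∑ a ∈ Finset.Icc 1 N, ∑ b ∈ JB N,
      ∑ z ∈ (JJ N).filter (fun z => ((z.1 : ℝ), (z.2 : ℝ)) ∈ S (a : ℕ) (b : ℤ)),
        g ⟨(a : ℕ), b, z.1, z.2⟩ := by
  simp only [Finset.sum_sigma']
  symm
  refine Finset.sum_nbij' (fun x => ⟨(x.1 : ℕ), x.2.1, x.2.2.1, x.2.2.2⟩)
    (fun f => ⟨f.a.toNat, f.b, (f.c, f.d)⟩) ?_ ?_ ?_ ?_ ?_
  · rintro ⟨a, b, c, d⟩ h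
    simp only [Finset.mem_sigma, Finset.mem_filter, Finset.mem_Icc] at h
    rw [hF]
    refine ⟨by simp only; omega, ?_⟩
    simpa using h.2.2.2
  · intro f hf
    obtain ⟨ha, hf⟩ := (hF f).mp hf
    have e : ((f.a.toNat : ℕ) : ℤ) = f.a := Int.toNat_of_nonneg ha.le
    have e' : ((f.a.toNat : ℕ) : ℝ) = f.a := by exact_mod_cast e
    obtain ⟨h1, h2⟩ := le_of_mem_sCl hY ha (hS _ _ hf)
    simp only [Finset.mem_sigma, Finset.mem_filter, Finset.mem_Icc]
    refine ⟨⟨by omega, by omega⟩, h2, mem_JJ hY (by exact_mod_cast ha) (hS _ _ hf), ?_⟩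
    rw [e']; exact hf
  · rintro ⟨a, b, c, d⟩ h; simp
  · intro f hf
    have ha := ((hF f).mp hf).1
    have e : ((f.a.toNat : ℕ) : ℤ) = f.a := Int.toNat_of_nonneg ha.le
    simp [e]
  · intro x _; rfl

open scoped Classical in
lemma sum_CL {Y : ℝ} {N : ℕ} (hY : Y ≤ N ^ 4) (g : BCF → ℝ) :
    ∑ f ∈ CL Y, g f = ∑ a ∈ Finset.Icc 1 N, ∑ b ∈ JB N,
      ∑ z ∈ (JJ N).filter (fun z => ((z.1 : ℝ), (z.2 : ℝ)) ∈ SCl (a : ℕ) (b : ℤ) Y),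
        g ⟨(a : ℕ), b, z.1, z.2⟩ := by
  refine sum_param (S := fun a b => SCl a b Y) (fun _ _ => le_rfl) hY (fun f => ?_) g
  rw [mem_CL]
  constructor
  · intro h; exact ⟨h.1.1, (mem_sCl_iff h.1.1 Y).mpr h⟩
  · rintro ⟨h, h'⟩; exact (mem_sCl_iff h Y).mp h'

open scoped Classical in
lemma sum_OP {Y : ℝ} {N : ℕ} (hY : Y ≤ N ^ 4) (g : BCF → ℝ) :
    ∑ f ∈ OP Y, g f = ∑ a ∈ Finset.Icc 1 N, ∑ b ∈ JB N,
      ∑ z ∈ (JJ N).filter (fun z => ((z.1 : ℝ), (z.2 : ℝ)) ∈ SOp (a : ℕ) (b : ℤ) Y),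
        g ⟨(a : ℕ), b, z.1, z.2⟩ := by
  refine sum_param (S := fun a b => SOp a b Y) (fun _ _ => sOp_subset _ _ _) hY (fun f => ?_) g
  rw [mem_OP]
  constructor
  · intro h; exact ⟨h.1.1, (mem_sOp_iff h.1.1 Y).mpr h⟩
  · rintro ⟨h, h'⟩; exact (mem_sOp_iff h Y).mp h'

open scoped Classical in
lemma sum_orb_le {Y : ℝ} {w : Orb → ℝ} {W : BCF → ℝ} (hW : ∀ f, 0 ≤ W f)
    (hw : ∀ f (hf : f.Good), w (orb f hf) = W f) :
    ∑ ω ∈ OmF Y, w ω ≤ ∑ f ∈ (CL Y).filter Irr, W f := by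
  have key : ∀ ω : Orb, ∃ f, ∃ hf : f.Good, orb f hf = ω ∧ CRed f := by
    intro ω
    obtain ⟨f, hf, rfl⟩ := ω.exists_rep
    obtain ⟨g, hg, hr⟩ := exists_cred hf
    have hg' : g.Good := by
      obtain ⟨p, q, r, s, hu, rfl⟩ := hg
      exact hf.sub hu.ne_zero
    exact ⟨g, hg', (orb_eq_iff.mpr hg).symm, hr⟩
  choose r hr e hc using key
  have hinj : Set.InjOn r (OmF Y) := by
    intro ω _ ω' _ h
    rw [← e ω, ← e ω']; congr
  have e1 : ∑ ω ∈ OmF Y, w ω = ∑ f ∈ (OmF Y).image r, W f := by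
    rw [Finset.sum_image hinj]
    exact Finset.sum_congr rfl fun ω _ => by rw [← hw _ (hr ω), e]
  rw [e1]
  refine Finset.sum_le_sum_of_subset_of_nonneg ?_ fun f _ _ => hW f
  intro f hf
  obtain ⟨ω, hω, rfl⟩ := Finset.mem_image.mp hf
  rw [Finset.mem_filter, mem_CL]
  refine ⟨⟨hc ω, ?_⟩, (hr ω).1⟩
  rw [mem_OmF, ← e ω, orb_disc] at hω
  exact hω

open scoped Classical in
lemma le_sum_orb {Y : ℝ} {w : Orb → ℝ} {W : BCF → ℝ} (hW : ∀ f, 0 ≤ W f)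
    (hw : ∀ f (hf : f.Good), w (orb f hf) = W f) :
    ∑ f ∈ (OP Y).filter Irr, W f ≤ ∑ ω ∈ OmF Y, w ω := by
  have hg : ∀ f ∈ (OP Y).filter Irr, f.Good := by
    intro f hf
    rw [Finset.mem_filter, mem_OP] at hf
    exact ⟨hf.2, CRed.disc_neg hf.1.1.cred⟩
  rw [← Finset.sum_attach]
  have e1 : ∑ x ∈ ((OP Y).filter Irr).attach, W x.1 =
      ∑ x ∈ ((OP Y).filter Irr).attach, w (orb x.1 (hg x.1 x.2)) :=
    Finset.sum_congr rfl fun x _ => (hw _ _).symm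
  rw [e1, ← Finset.sum_image (s := ((OP Y).filter Irr).attach) (f := w)
    (g := fun x => orb x.1 (hg x.1 x.2))]
  · refine Finset.sum_le_sum_of_subset_of_nonneg ?_ ?_
    · intro ω hω
      obtain ⟨x, -, rfl⟩ := Finset.mem_image.mp hω
      rw [mem_OmF, orb_disc]
      exact (mem_OP.mp (Finset.mem_filter.mp x.2).1).2
    · intro ω _ _
      obtain ⟨f, hf, rfl⟩ := ω.exists_rep
      exact (hw f hf).symm ▸ hW f
  · intro x _ y _ h
    have hx := (mem_OP.mp (Finset.mem_filter.mp x.2).1).1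
    have hy := (mem_OP.mp (Finset.mem_filter.mp y.2).1).1
    exact Subtype.ext (hx.eq_of_rel (hg x.1 x.2) (hg y.1 y.2) (orb_eq_iff.mp h) hy)

end Cub

end

section

open MeasureTheory

namespace Cub
open BCF

/-- The number of affine roots modulo `m`. -/
def nu (m : ℕ) (f : BCF) : ℕ := ((Finset.range m).filter fun r : ℕ => (m : ℤ) ∣ f.eval r 1).card

lemma eval_dvd_congr {m : ℕ} {f : BCF} {r s : ℕ} (h : r ≡ s [MOD m]) :
    (m : ℤ) ∣ f.eval r 1 ↔ (m : ℤ) ∣ f.eval s 1 := by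
  have h1 : (r : ℤ) ≡ s [ZMOD m] := Int.natCast_modEq_iff.mpr h
  have h2 : f.eval r 1 ≡ f.eval s 1 [ZMOD m] := by
    simp only [eval]
    gcongr
  exact ⟨fun h => (Int.modEq_zero_iff_dvd.mp (h2.symm.trans (Int.modEq_zero_iff_dvd.mpr h))),
    fun h => (Int.modEq_zero_iff_dvd.mp (h2.trans (Int.modEq_zero_iff_dvd.mpr h)))⟩

lemma nu_mul {m n : ℕ} (hm : 0 < m) (hn : 0 < n) (h : m.Coprime n) (f : BCF) :
    nu (m * n) f = nu m f * nu n f := by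
  unfold nu
  rw [← Finset.card_product]
  have hmn : IsCoprime (m : ℤ) n := Nat.isCoprime_iff_coprime.mpr h
  refine Finset.card_nbij' (fun r => (r % m, r % n))
    (fun x => (Nat.chineseRemainder h x.1 x.2 : ℕ)) ?_ ?_ ?_ ?_
  · intro r hr
    simp only [Finset.coe_filter, Finset.mem_range, Set.mem_ofPred_eq] at hr
    simp only [Finset.coe_product, Finset.coe_filter, Finset.mem_range, Set.mem_prod, Set.mem_ofPred_eq]
    have hd := hr.2
    push_cast at hd
    exact ⟨⟨Nat.mod_lt _ hm, (eval_dvd_congr (Nat.mod_modEq r m)).mpr ((dvd_mul_right _ _).trans hd)⟩,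
      ⟨Nat.mod_lt _ hn, (eval_dvd_congr (Nat.mod_modEq r n)).mpr ((dvd_mul_left _ _).trans hd)⟩⟩
  · rintro ⟨r, s⟩ hx
    simp only [Finset.coe_product, Finset.coe_filter, Finset.mem_range, Set.mem_prod, Set.mem_ofPred_eq] at hx
    simp only [Finset.coe_filter, Finset.mem_range, Set.mem_ofPred_eq]
    refine ⟨Nat.chineseRemainder_lt_mul h r s hm.ne' hn.ne', ?_⟩
    push_cast
    exact hmn.mul_dvd ((eval_dvd_congr (Nat.chineseRemainder h r s).2.1).mpr hx.1.2)
      ((eval_dvd_congr (Nat.chineseRemainder h r s).2.2).mpr hx.2.2)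
  · intro r hr
    simp only [Finset.coe_filter, Finset.mem_range, Set.mem_ofPred_eq] at hr
    simp only
    have h1 := (Nat.chineseRemainder h (r % m) (r % n)).2
    refine Nat.ModEq.eq_of_lt_of_lt (m := m * n) ?_
      (Nat.chineseRemainder_lt_mul h _ _ hm.ne' hn.ne') hr.1
    exact (Nat.modEq_and_modEq_iff_modEq_mul h).mp
      ⟨h1.1.trans (Nat.mod_modEq r m), h1.2.trans (Nat.mod_modEq r n)⟩
  · rintro ⟨r, s⟩ hx
    simp only [Finset.coe_product, Finset.coe_filter, Finset.mem_range, Set.mem_prod, Set.mem_ofPred_eq] at hx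
    have h1 := (Nat.chineseRemainder h r s).2
    simp only [Prod.mk.injEq]
    exact ⟨Eq.trans h1.1 (Nat.mod_eq_of_lt hx.1.1), Eq.trans h1.2 (Nat.mod_eq_of_lt hx.2.1)⟩

lemma nu_one (f : BCF) : nu 1 f = 1 := by simp [nu]

lemma prod_pos_of_prime {E : Finset ℕ} (hE : ∀ p ∈ E, p.Prime) : 0 < ∏ p ∈ E, p :=
  Finset.prod_pos fun p hp => (hE p hp).pos

lemma prod_nu {E : Finset ℕ} (hE : ∀ p ∈ E, p.Prime) (f : BCF) :
    ∏ p ∈ E, nu p f = nu (∏ p ∈ E, p) f := by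
  classical
  induction E using Finset.induction_on with
  | empty => simp [nu_one]
  | insert q E hq ih =>
    have hE' : ∀ p ∈ E, p.Prime := fun p hp => hE p (Finset.mem_insert_of_mem hp)
    have hqp := hE q (Finset.mem_insert_self _ _)
    rw [Finset.prod_insert hq, Finset.prod_insert hq, ih hE', nu_mul hqp.pos (prod_pos_of_prime hE')]
    refine Nat.Coprime.prod_right fun p hp => (Nat.coprime_primes hqp (hE' p hp)).mpr ?_
    rintro rfl; exact hq hp

open scoped Classical in
lemma sum_nu {h : ℕ} {R : ℝ} {S : Set (ℝ × ℝ)} (H : Nice h R S) (hR : 0 ≤ R) {m : ℕ}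
    (hm : 0 < m) (JJ : Finset (ℤ × ℤ))
    (hJJ : ∀ c d : ℤ, ((c : ℝ), (d : ℝ)) ∈ S → (c, d) ∈ JJ) (a b : ℤ) :
    |∑ z ∈ JJ.filter (fun z : ℤ × ℤ => ((z.1 : ℝ), (z.2 : ℝ)) ∈ S), (nu m ⟨a, b, z.1, z.2⟩ : ℝ)
      - volume.real S| ≤ h * (18 * R * (m : ℝ) ^ ((3 : ℝ) / 4) + m) := by
  have hm' : (0 : ℝ) ≤ m := Nat.cast_nonneg m
  have hM : ((m : ℝ) ^ ((1 : ℝ) / 4)) ^ 4 = m := by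
    rw [← Real.rpow_natCast, ← Real.rpow_mul hm']; norm_num
  have hM3 : ((m : ℝ) ^ ((1 : ℝ) / 4)) ^ 3 = (m : ℝ) ^ ((3 : ℝ) / 4) := by
    rw [← Real.rpow_natCast, ← Real.rpow_mul hm']; norm_num
  have K := sum_card_coset H hR hm (Real.rpow_nonneg hm' _) hM JJ hJJ
    (fun r => -(a * r ^ 3 + b * r ^ 2))
  rw [hM3] at K
  refine le_trans ?_ K
  have e1 : ∑ z ∈ JJ.filter (fun z : ℤ × ℤ => ((z.1 : ℝ), (z.2 : ℝ)) ∈ S), (nu m ⟨a, b, z.1, z.2⟩ : ℝ)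
      = ∑ r ∈ Finset.range m, ((JJ.filter (fun z : ℤ × ℤ => ((z.1 : ℝ), (z.2 : ℝ)) ∈ S ∧
      (m : ℤ) ∣ z.1 * r + z.2 - -(a * r ^ 3 + b * r ^ 2))).card : ℝ) := by
    simp only [nu, ← Finset.filter_filter _ _ JJ, Finset.card_filter, Nat.cast_sum]
    rw [Finset.sum_comm]
    refine Finset.sum_congr rfl fun r _ => Finset.sum_congr rfl fun z _ => ?_
    have : BCF.eval ⟨a, b, z.1, z.2⟩ r 1 = z.1 * r + z.2 - -(a * r ^ 3 + b * r ^ 2) := by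
      simp only [eval]; ring
    rw [this]
  have e2 : volume.real S = ∑ r ∈ Finset.range m, volume.real S / m := by
    rw [Finset.sum_const, Finset.card_range, nsmul_eq_mul]; field_simp
  rw [e1]
  nth_rw 1 [e2]
  rw [← Finset.sum_sub_distrib]
  exact Finset.abs_sum_le_sum_abs _ _

/-- Indicator of divisibility. -/
def dl (p : ℕ) (a : ℤ) : ℝ := if (p : ℤ) ∣ a then 1 else 0

lemma dl_nonneg (p : ℕ) (a : ℤ) : 0 ≤ dl p a := by unfold dl; split_ifs <;> norm_num
lemma dl_le_one (p : ℕ) (a : ℤ) : dl p a ≤ 1 := by unfold dl; split_ifs <;> norm_num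

lemma np_cast (p : ℕ) (f : BCF) : (np p f : ℝ) = nu p f + dl p f.a := by
  simp only [np, nu, dl]; push_cast; rfl

open scoped Classical in
lemma sum_np {h : ℕ} {R : ℝ} {S : Set (ℝ × ℝ)} (H : Nice h R S) (hR : 0 ≤ R) {E : Finset ℕ}
    (hE : ∀ p ∈ E, p.Prime) (JJ : Finset (ℤ × ℤ))
    (hJJ : ∀ c d : ℤ, ((c : ℝ), (d : ℝ)) ∈ S → (c, d) ∈ JJ) (a b : ℤ) :
    |∑ z ∈ JJ.filter (fun z : ℤ × ℤ => ((z.1 : ℝ), (z.2 : ℝ)) ∈ S),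
      ∏ p ∈ E, (np p ⟨a, b, z.1, z.2⟩ : ℝ) - (∏ p ∈ E, (1 + dl p a)) * volume.real S|
      ≤ 2 ^ E.card * (h * (18 * R * ((∏ p ∈ E, p : ℕ) : ℝ) ^ ((3 : ℝ) / 4) + (∏ p ∈ E, p : ℕ))) := by
  set F := JJ.filter (fun z : ℤ × ℤ => ((z.1 : ℝ), (z.2 : ℝ)) ∈ S)
  have e1 : ∑ z ∈ F, ∏ p ∈ E, (np p ⟨a, b, z.1, z.2⟩ : ℝ) = ∑ G ∈ E.powerset,
      (∏ p ∈ E \ G, dl p a) * ∑ z ∈ F, (nu (∏ p ∈ G, p) ⟨a, b, z.1, z.2⟩ : ℝ) := by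
    simp only [np_cast, Finset.prod_add]
    rw [Finset.sum_comm]
    refine Finset.sum_congr rfl fun G hG => ?_
    rw [Finset.mul_sum]
    refine Finset.sum_congr rfl fun z _ => ?_
    rw [← prod_nu (fun p hp => hE p (Finset.mem_powerset.mp hG hp)), mul_comm]
    push_cast
    rfl
  have e2 : (∏ p ∈ E, (1 + dl p a)) * volume.real S = ∑ G ∈ E.powerset,
      (∏ p ∈ E \ G, dl p a) * volume.real S := by
    rw [Finset.prod_add, Finset.sum_mul]
    simp
  rw [e1, e2, ← Finset.sum_sub_distrib]
  set e := ∏ p ∈ E, p with he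
  have e3 : 2 ^ E.card * (h * (18 * R * (e : ℝ) ^ ((3 : ℝ) / 4) + e)) = ∑ G ∈ E.powerset,
      (h * (18 * R * (e : ℝ) ^ ((3 : ℝ) / 4) + e) : ℝ) := by
    rw [Finset.sum_const, Finset.card_powerset, nsmul_eq_mul]; push_cast; rfl
  rw [e3]
  refine (Finset.abs_sum_le_sum_abs _ _).trans (Finset.sum_le_sum fun G hG => ?_)
  have hG' := Finset.mem_powerset.mp hG
  rw [← mul_sub, abs_mul]
  have hd0 : 0 ≤ ∏ p ∈ E \ G, dl p a := Finset.prod_nonneg fun p _ => dl_nonneg p a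
  have hd1 : ∏ p ∈ E \ G, dl p a ≤ 1 :=
    Finset.prod_le_one (fun p _ => dl_nonneg p a) fun p _ => dl_le_one p a
  have hGp : ∀ p ∈ G, p.Prime := fun p hp => hE p (hG' hp)
  have hle : ((∏ p ∈ G, p : ℕ) : ℝ) ≤ e := by
    exact_mod_cast Finset.prod_le_prod_of_subset_of_one_le' hG' fun p hp _ => (hE p hp).one_le
  rw [abs_of_nonneg hd0]
  refine (mul_le_of_le_one_left (abs_nonneg _) hd1).trans
    ((sum_nu H hR (prod_pos_of_prime hGp) JJ hJJ a b).trans ?_)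
  refine mul_le_mul_of_nonneg_left ?_ (Nat.cast_nonneg h)
  gcongr

end Cub

end

section

open MeasureTheory

namespace Cub
open BCF

/-- The range of the coefficient `a`. -/
noncomputable def Nc (Y : ℝ) : ℕ := ⌈Y ^ ((1 : ℝ) / 4)⌉₊

lemma le_nc_pow {Y : ℝ} (hY : 0 ≤ Y) : Y ≤ (Nc Y : ℝ) ^ 4 := by
  have h1 : Y ^ ((1 : ℝ) / 4) ≤ Nc Y := Nat.le_ceil _
  have h2 : (Y ^ ((1 : ℝ) / 4)) ^ 4 = Y := by
    rw [← Real.rpow_natCast, ← Real.rpow_mul hY]; norm_num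
  calc Y = (Y ^ ((1 : ℝ) / 4)) ^ 4 := h2.symm
    _ ≤ _ := by gcongr

/-- The main term. -/
noncomputable def mainE (Y : ℝ) (E : Finset ℕ) : ℝ :=
  ∑ a ∈ Finset.Icc 1 (Nc Y), (∏ p ∈ E, (1 + dl p a)) *
    ∑ b ∈ JB (Nc Y), volume.real (SOp (a : ℕ) (b : ℤ) Y)

lemma card_JB (N : ℕ) : ((JB N).card : ℝ) = 4 * N + 1 := by
  have : ((2 * N : ℤ) + 1 - -(2 * N : ℤ)).toNat = 4 * N + 1 := by omega
  rw [JB, Int.card_Icc, this]; push_cast; ring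

lemma harmonic_bound {N : ℕ} : ∑ a ∈ Finset.Icc 1 N, (1 : ℝ) / a ≤ 1 + Real.log N := by
  have := harmonic_le_one_add_log N
  rw [harmonic_eq_sum_Icc] at this
  push_cast at this
  simpa using this

open scoped Classical in
lemma sum_param_bound {E : Finset ℕ} (hE : ∀ p ∈ E, p.Prime) {Y : ℝ} (hY : 1 ≤ Y)
    {S : ℝ → ℝ → Set (ℝ × ℝ)} (hS : ∀ a b : ℝ, 0 < a → Nice 10 (2 * √Y / a) (S a b))
    (hsub : ∀ a b, S a b ⊆ SCl a b Y)
    (harea : ∀ a b : ℝ, 0 < a → volume.real (S a b) = volume.real (SOp a b Y)) :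
    |∑ a ∈ Finset.Icc 1 (Nc Y), ∑ b ∈ JB (Nc Y),
      ∑ z ∈ (JJ (Nc Y)).filter (fun z => ((z.1 : ℝ), (z.2 : ℝ)) ∈ S (a : ℕ) (b : ℤ)),
        ∏ p ∈ E, (np p ⟨(a : ℕ), b, z.1, z.2⟩ : ℝ) - mainE Y E| ≤
      20000 * 2 ^ E.card * (Y ^ ((19 : ℝ) / 24) * ((∏ p ∈ E, p : ℕ) : ℝ) ^ ((3 : ℝ) / 4)
        + ((∏ p ∈ E, p : ℕ) : ℝ) * Y ^ ((1 : ℝ) / 2)) := by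
  have hY0 : 0 ≤ Y := by linarith
  set N := Nc Y with hN
  set e := ∏ p ∈ E, p with he
  have hNY := le_nc_pow hY0
  have step : ∀ a ∈ Finset.Icc 1 N, ∀ b ∈ JB N,
      |∑ z ∈ (JJ N).filter (fun z => ((z.1 : ℝ), (z.2 : ℝ)) ∈ S (a : ℕ) (b : ℤ)),
        ∏ p ∈ E, (np p ⟨(a : ℕ), b, z.1, z.2⟩ : ℝ) -
        (∏ p ∈ E, (1 + dl p a)) * volume.real (SOp (a : ℕ) (b : ℤ) Y)| ≤
      2 ^ E.card * (10 * (18 * (2 * √Y / a) * (e : ℝ) ^ ((3 : ℝ) / 4) + e)) := by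
    intro a ha b _
    have ha1 : 1 ≤ a := (Finset.mem_Icc.mp ha).1
    have ha0 : (0 : ℝ) < a := by exact_mod_cast ha1
    rw [← harea _ _ ha0]
    have := sum_np (hS a b ha0) (by positivity) hE (JJ N)
      (fun c d h => mem_JJ hNY (by exact_mod_cast ha1) (hsub _ _ h)) a b
    rw [← he] at this
    simpa using this
  have e1 : mainE Y E = ∑ a ∈ Finset.Icc 1 N, ∑ b ∈ JB N,
      (∏ p ∈ E, (1 + dl p a)) * volume.real (SOp (a : ℕ) (b : ℤ) Y) := by
    simp only [mainE, Finset.mul_sum, hN]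
  rw [e1]
  have s1 : ∀ (f g : ℕ → ℤ → ℝ) (u : ℕ → ℝ), (∀ a ∈ Finset.Icc 1 N, ∀ b ∈ JB N, |f a b - g a b| ≤ u a) →
      |∑ a ∈ Finset.Icc 1 N, ∑ b ∈ JB N, f a b - ∑ a ∈ Finset.Icc 1 N, ∑ b ∈ JB N, g a b| ≤
        ∑ a ∈ Finset.Icc 1 N, (4 * N + 1) * u a := by
    intro f g u h
    rw [← Finset.sum_sub_distrib]
    refine (Finset.abs_sum_le_sum_abs _ _).trans (Finset.sum_le_sum fun a ha => ?_)
    rw [← Finset.sum_sub_distrib]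
    refine (Finset.abs_sum_le_sum_abs _ _).trans ((Finset.sum_le_sum fun b hb => h a ha b hb).trans ?_)
    rw [Finset.sum_const, nsmul_eq_mul, card_JB]
  refine (s1 _ _ _ step).trans ?_
  have e2 : ∑ a ∈ Finset.Icc 1 N, (4 * (N : ℝ) + 1) *
      (2 ^ E.card * (10 * (18 * (2 * √Y / a) * (e : ℝ) ^ ((3 : ℝ) / 4) + e))) =
      (4 * N + 1) * 2 ^ E.card * 10 * (36 * √Y * (e : ℝ) ^ ((3 : ℝ) / 4) *
        ∑ a ∈ Finset.Icc 1 N, (1 : ℝ) / a + N * e) := by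
    have : (N : ℝ) * e = ∑ a ∈ Finset.Icc 1 N, (e : ℝ) := by simp
    rw [this, Finset.mul_sum, ← Finset.sum_add_distrib, Finset.mul_sum]
    refine Finset.sum_congr rfl fun a _ => ?_
    ring
  rw [e2]
  -- everything in terms of `y = Y ^ (1 / 24)`
  set y := Y ^ ((1 : ℝ) / 24) with hy
  have hy1 : 1 ≤ y := Real.one_le_rpow hY (by norm_num)
  have p6 : Y ^ ((1 : ℝ) / 4) = y ^ 6 := by
    rw [hy, ← Real.rpow_natCast, ← Real.rpow_mul hY0]; norm_num
  have p12 : Y ^ ((1 : ℝ) / 2) = y ^ 12 := by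
    rw [hy, ← Real.rpow_natCast, ← Real.rpow_mul hY0]; norm_num
  have p19 : Y ^ ((19 : ℝ) / 24) = y ^ 19 := by
    rw [hy, ← Real.rpow_natCast, ← Real.rpow_mul hY0]; norm_num
  have hy6 : 1 ≤ y ^ 6 := one_le_pow₀ hy1
  have hNle : (N : ℝ) ≤ 2 * y ^ 6 := by
    have := (Nat.ceil_lt_add_one (show 0 ≤ Y ^ ((1 : ℝ) / 4) by positivity)).le
    rw [p6] at this
    rw [hN, Nc, p6]
    linarith
  have hN1 : (1 : ℝ) ≤ N := by
    have h1 : Y ^ ((1 : ℝ) / 4) ≤ N := Nat.le_ceil _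
    rw [p6] at h1; linarith
  have hlog : ∑ a ∈ Finset.Icc 1 N, (1 : ℝ) / a ≤ 6 * y := by
    refine harmonic_bound.trans ?_
    have h1 : Real.log N ≤ Real.log (2 * y ^ 6) := Real.log_le_log (by linarith) hNle
    rw [Real.log_mul (by norm_num) (by positivity), Real.log_pow] at h1
    have h2 := Real.log_le_sub_one_of_pos (show (0 : ℝ) < 2 by norm_num)
    have h3 := Real.log_le_sub_one_of_pos (show 0 < y by linarith)
    push_cast at h1
    linarith
  rw [Real.sqrt_eq_rpow, p12, p19]
  set E3 := (e : ℝ) ^ ((3 : ℝ) / 4) with hE3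
  have hE3' : 0 ≤ E3 := by positivity
  have he0 : (0 : ℝ) ≤ e := Nat.cast_nonneg _
  calc (4 * (N : ℝ) + 1) * 2 ^ E.card * 10 * (36 * y ^ 12 * E3 *
        ∑ a ∈ Finset.Icc 1 N, (1 : ℝ) / a + N * e)
      ≤ (9 * y ^ 6) * 2 ^ E.card * 10 * (36 * y ^ 12 * E3 * (6 * y) + (2 * y ^ 6) * e) := by
        gcongr; linarith
    _ = 2 ^ E.card * (19440 * (y ^ 19 * E3) + 180 * (e * y ^ 12)) := by ring
    _ ≤ 2 ^ E.card * (20000 * (y ^ 19 * E3) + 20000 * (e * y ^ 12)) := by gcongr <;> norm_num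
    _ = _ := by ring

lemma sum_CL_bound {E : Finset ℕ} (hE : ∀ p ∈ E, p.Prime) {Y : ℝ} (hY : 1 ≤ Y) :
    |∑ f ∈ CL Y, ∏ p ∈ E, (np p f : ℝ) - mainE Y E| ≤
      20000 * 2 ^ E.card * (Y ^ ((19 : ℝ) / 24) * ((∏ p ∈ E, p : ℕ) : ℝ) ^ ((3 : ℝ) / 4)
        + ((∏ p ∈ E, p : ℕ) : ℝ) * Y ^ ((1 : ℝ) / 2)) := by
  rw [sum_CL (le_nc_pow (by linarith))]
  exact sum_param_bound hE hY (S := fun a b => SCl a b Y) (fun a b ha => nice_sCl ha b Y)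
    (fun _ _ => le_rfl) fun a b ha => area_sCl ha b Y

lemma sum_OP_bound {E : Finset ℕ} (hE : ∀ p ∈ E, p.Prime) {Y : ℝ} (hY : 1 ≤ Y) :
    |∑ f ∈ OP Y, ∏ p ∈ E, (np p f : ℝ) - mainE Y E| ≤
      20000 * 2 ^ E.card * (Y ^ ((19 : ℝ) / 24) * ((∏ p ∈ E, p : ℕ) : ℝ) ^ ((3 : ℝ) / 4)
        + ((∏ p ∈ E, p : ℕ) : ℝ) * Y ^ ((1 : ℝ) / 2)) := by
  rw [sum_OP (le_nc_pow (by linarith))]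
  exact sum_param_bound hE hY (S := fun a b => SOp a b Y) (fun a b ha => nice_sOp ha b Y)
    (fun _ _ => sOp_subset _ _ _) fun a b _ => rfl

end Cub

end

section

open MeasureTheory

namespace Cub
open BCF

/-- Quadruples of positive integers with bounded product. -/
def P4 (L : ℕ) : Finset (ℕ × ℕ × ℕ × ℕ) :=
  (Finset.Icc 1 L ×ˢ Finset.Icc 1 L ×ˢ Finset.Icc 1 L ×ˢ Finset.Icc 1 L).filter
    fun q => q.1 * q.2.1 * q.2.2.1 * q.2.2.2 ≤ L

lemma mem_P4 {L s u r v : ℕ} (hs : 0 < s) (hu : 0 < u) (hr : 0 < r) (hv : 0 < v)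
    (h : s * u * r * v ≤ L) : (s, u, r, v) ∈ P4 L := by
  simp only [P4, Finset.mem_filter, Finset.mem_product, Finset.mem_Icc]
  have h1 : s ≤ s * u * r * v := by
    rw [mul_assoc, mul_assoc]; exact Nat.le_mul_of_pos_right _ (by positivity)
  have h2 : u ≤ s * u * r * v := by
    rw [mul_comm s u, mul_assoc, mul_assoc]; exact Nat.le_mul_of_pos_right _ (by positivity)
  have h3 : r ≤ s * u * r * v := by
    rw [mul_comm (s * u) r, mul_assoc]; exact Nat.le_mul_of_pos_right _ (by positivity)
  have h4 : v ≤ s * u * r * v := Nat.le_mul_of_pos_left _ (by positivity)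
  omega

lemma card_P4 (L : ℕ) : ((P4 L).card : ℝ) ≤ L * (1 + Real.log L) ^ 3 := by
  have e : P4 L ⊆ (Finset.Icc 1 L).biUnion fun x => (Finset.Icc 1 L).biUnion fun y =>
      (Finset.Icc 1 L).biUnion fun z => (Finset.Icc 1 (L / (x * y * z))).image fun w => (x, y, z, w) := by
    rintro ⟨x, y, z, w⟩ h
    simp only [P4, Finset.mem_filter, Finset.mem_product] at h
    simp only [Finset.mem_biUnion, Finset.mem_image]
    obtain ⟨⟨hx, hy, hz, hw⟩, h⟩ := h
    refine ⟨x, hx, y, hy, z, hz, w, ?_, rfl⟩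
    rw [Finset.mem_Icc] at *
    refine ⟨hw.1, ?_⟩
    rw [Nat.le_div_iff_mul_le (by have := hx.1; have := hy.1; have := hz.1; positivity), mul_comm]
    exact h
  have h1 : (P4 L).card ≤ ∑ x ∈ Finset.Icc 1 L, ∑ y ∈ Finset.Icc 1 L, ∑ z ∈ Finset.Icc 1 L,
      L / (x * y * z) := by
    refine (Finset.card_le_card e).trans (Finset.card_biUnion_le.trans (Finset.sum_le_sum fun x _ =>
      Finset.card_biUnion_le.trans (Finset.sum_le_sum fun y _ =>
      Finset.card_biUnion_le.trans (Finset.sum_le_sum fun z _ => Finset.card_image_le.trans ?_))))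
    simp
  have h2 : ((P4 L).card : ℝ) ≤ ∑ x ∈ Finset.Icc 1 L, ∑ y ∈ Finset.Icc 1 L, ∑ z ∈ Finset.Icc 1 L,
      (L : ℝ) * ((1 / x) * (1 / y) * (1 / z)) := by
    refine (Nat.cast_le.mpr h1).trans ?_
    push_cast
    refine Finset.sum_le_sum fun x _ => Finset.sum_le_sum fun y _ => Finset.sum_le_sum fun z _ => ?_
    refine Nat.cast_div_le.trans (le_of_eq ?_)
    push_cast
    rw [div_eq_mul_inv, mul_inv, mul_inv]; ring
  refine h2.trans ?_
  simp only [← Finset.mul_sum, ← Finset.sum_mul]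
  have h3 := harmonic_bound (N := L)
  have h0 : 0 ≤ ∑ a ∈ Finset.Icc 1 L, (1 : ℝ) / a := Finset.sum_nonneg fun _ _ => by positivity
  calc _ = (L : ℝ) * (∑ a ∈ Finset.Icc 1 L, (1 : ℝ) / a) ^ 3 := by ring
    _ ≤ _ := by gcongr

/-- A form with a rational zero, given a factorisation of its outer coefficients. -/
def redForm (x : Bool × (ℤ × ℤ) × ℤ × (ℕ × ℕ × ℕ × ℕ)) : BCF :=
  let e := x.2.1
  let b := x.2.2.1
  let q := x.2.2.2
  let s : ℤ := q.1
  let u : ℤ := q.2.1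
  let r : ℤ := e.1 * q.2.2.1
  let v : ℤ := e.2 * q.2.2.2
  if x.1 then ⟨s * u, b, r * v, 0⟩
  else ⟨s * u, b, -(s * u * r ^ 3 + b * r ^ 2 * s + r * v * s ^ 3) / (r * s ^ 2), r * v⟩

lemma exists_coprime_zero {f : BCF} (ha : f.a ≠ 0) (h : ¬ f.Irr) :
    ∃ r s : ℤ, IsCoprime r s ∧ 0 < s ∧ f.eval r s = 0 := by
  unfold Irr at h
  push Not at h
  obtain ⟨x, y, h0, hxy⟩ := h
  have hy : y ≠ 0 := by
    intro hy
    subst hy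
    have : f.a * x ^ 3 = 0 := by simpa [eval] using h0
    rcases mul_eq_zero.mp this with h | h
    · exact ha h
    · exact hxy (pow_eq_zero_iff (by norm_num) |>.mp h) rfl
  have hg : 0 < Int.gcd x y := Int.gcd_pos_of_ne_zero_right _ hy
  obtain ⟨r, s, hc, hx, hy'⟩ := Int.exists_gcd_one hg
  have hev : f.eval r s = 0 := by
    have : f.eval x y = f.eval r s * (Int.gcd x y) ^ 3 := by
      generalize ((Int.gcd x y : ℕ) : ℤ) = g at hx hy'
      subst hx hy'
      simp only [eval]; ring
    rw [h0] at this
    have h3 : ((Int.gcd x y : ℕ) : ℤ) ^ 3 ≠ 0 := by positivity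
    exact (mul_eq_zero.mp this.symm).resolve_right h3
  have hs : s ≠ 0 := by rintro rfl; exact hy (by rw [hy']; simp)
  have hc' : IsCoprime r s := Int.isCoprime_iff_gcd_eq_one.mpr hc
  rcases lt_or_gt_of_ne hs with h | h
  · refine ⟨-r, -s, hc'.neg_neg, by omega, ?_⟩
    have : f.eval (-r) (-s) = - f.eval r s := by simp only [eval]; ring
    rw [this, hev, neg_zero]
  · exact ⟨r, s, hc', h, hev⟩

lemma exists_sign (x : ℤ) : ∃ e ∈ ({1, -1} : Finset ℤ), e * (x.natAbs : ℤ) = x := by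
  rcases Int.natAbs_eq x with h | h
  · exact ⟨1, by simp, by rw [one_mul]; exact h.symm⟩
  · exact ⟨-1, by simp, by rw [neg_one_mul]; exact h.symm⟩

open scoped Classical in
lemma mem_redForm {N L : ℕ} {f : BCF} (ha : 0 < f.a) (hb : f.b ∈ JB N)
    (hac : f.a * |f.c| ≤ L) (had : f.a * |f.d| ≤ L) (hcd : f.c ≠ 0 ∨ f.d ≠ 0) (h : ¬ f.Irr) :
    f ∈ (Finset.univ ×ˢ (({1, -1} : Finset ℤ) ×ˢ ({1, -1} : Finset ℤ)) ×ˢ JB N ×ˢ P4 L).image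
      redForm := by
  rw [Finset.mem_image]
  by_cases hd : f.d = 0
  · have hc : f.c ≠ 0 := by tauto
    obtain ⟨e, he, hec⟩ := exists_sign f.c
    refine ⟨(true, (e, 1), f.b, (f.a.natAbs, 1, f.c.natAbs, 1)), ?_, ?_⟩
    · simp only [Finset.mem_product, Finset.mem_univ, true_and]
      refine ⟨⟨he, by simp⟩, hb, mem_P4 (by omega) one_pos (by omega) one_pos ?_⟩
      have : (f.a.natAbs : ℤ) * f.c.natAbs ≤ L := by
        rw [Int.natCast_natAbs, Int.natCast_natAbs, abs_of_pos ha]; exact hac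
      rw [mul_one, mul_one]
      exact_mod_cast this
    · have : |f.a| = f.a := abs_of_pos ha
      ext <;> simp [redForm, this, hd]
      rw [← Int.natCast_natAbs, hec]
  · obtain ⟨r, s, hc, hs, h0⟩ := exists_coprime_zero ha.ne' h
    have hr : r ≠ 0 := by
      rintro rfl
      have : f.d * s ^ 3 = 0 := by simpa [eval] using h0
      rcases mul_eq_zero.mp this with h | h
      · exact hd h
      · have := pow_eq_zero_iff (n := 3) (by norm_num) |>.mp h; omega
    have h1 : s ∣ f.a := by
      have : s ∣ f.a * r ^ 3 := by
        refine ⟨-(f.b * r ^ 2 + f.c * r * s + f.d * s ^ 2), ?_⟩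
        simp only [eval] at h0; linear_combination h0
      exact (hc.symm.pow_right (n := 3)).dvd_of_dvd_mul_right this
    have h2 : r ∣ f.d := by
      have : r ∣ f.d * s ^ 3 := by
        refine ⟨-(f.a * r ^ 2 + f.b * r * s + f.c * s ^ 2), ?_⟩
        simp only [eval] at h0; linear_combination h0
      exact (hc.pow_right (n := 3)).dvd_of_dvd_mul_right this
    obtain ⟨u, hu⟩ := h1
    obtain ⟨v, hv⟩ := h2
    have hu0 : 0 < u := by
      have : 0 < s * u := by rw [← hu]; exact ha
      exact pos_of_mul_pos_right this hs.le
    have hv0 : v ≠ 0 := by rintro rfl; exact hd (by rw [hv, mul_zero])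
    obtain ⟨e, he, her⟩ := exists_sign r
    obtain ⟨e', he', hev⟩ := exists_sign v
    refine ⟨(false, (e, e'), f.b, (s.natAbs, u.natAbs, r.natAbs, v.natAbs)), ?_, ?_⟩
    · simp only [Finset.mem_product, Finset.mem_univ, true_and]
      refine ⟨⟨he, he'⟩, hb, mem_P4 (by omega) (by omega) (by omega) (by omega) ?_⟩
      have : (s.natAbs : ℤ) * u.natAbs * r.natAbs * v.natAbs ≤ L := by
        simp only [Int.natCast_natAbs]
        rw [abs_of_pos hs, abs_of_pos hu0, ← hu, mul_assoc, ← abs_mul, ← hv]; exact had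
      exact_mod_cast this
    · have k1 : ((s.natAbs : ℕ) : ℤ) = s := by rw [Int.natCast_natAbs, abs_of_pos hs]
      have k2 : ((u.natAbs : ℕ) : ℤ) = u := by rw [Int.natCast_natAbs, abs_of_pos hu0]
      simp only [redForm, Bool.false_eq_true, if_false, k1, k2, her, hev]
      ext
      · exact hu.symm
      · rfl
      · refine Int.ediv_eq_of_eq_mul_left (by positivity) ?_
        simp only [eval] at h0
        rw [← hu, mul_comm r v, mul_comm v r, ← hv]
        linear_combination -h0
      · exact hv.symm

open scoped Classical in
lemma card_reducible {Y : ℝ} (hY : 1 ≤ Y) :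
    (((CL Y).filter fun f => ¬ f.Irr).card : ℝ) ≤ 10 ^ 8 * Y ^ ((19 : ℝ) / 24) := by
  have hY0 : 0 ≤ Y := by linarith
  set N := Nc Y with hN
  set L := ⌊2 * √Y⌋₊ with hL
  have hNY := le_nc_pow hY0
  have sub : (CL Y).filter (fun f => ¬ f.Irr) ⊆
      (Finset.univ ×ˢ (({1, -1} : Finset ℤ) ×ˢ ({1, -1} : Finset ℤ)) ×ˢ JB N ×ˢ P4 L).image
        redForm := by
    intro f hf
    rw [Finset.mem_filter, mem_CL] at hf
    obtain ⟨⟨hr, hd⟩, hi⟩ := hf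
    obtain ⟨-, -, b3, b4⟩ := hr.bounds
    have key : ∀ x : ℤ, f.a ^ 2 * x ^ 2 ≤ 2 * -f.disc → f.a * |x| ≤ L := by
      intro x hx
      have h1 : ((f.a * |x| : ℤ) : ℝ) ^ 2 ≤ (2 * √Y) ^ 2 := by
        rw [mul_pow, Real.sq_sqrt hY0]
        have : ((f.a ^ 2 * x ^ 2 : ℤ) : ℝ) ≤ ((2 * -f.disc : ℤ) : ℝ) := by exact_mod_cast hx
        push_cast at this ⊢
        rw [mul_pow, sq_abs]; nlinarith
      have h2 := abs_le_of_sq_le_sq' h1 (by positivity) |>.2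
      have h3 : (f.a * |x|).toNat ≤ L := by
        rw [hL]
        apply Nat.le_floor
        have : ((f.a * |x|).toNat : ℤ) = f.a * |x| :=
          Int.toNat_of_nonneg (mul_nonneg hr.1.le (abs_nonneg _))
        have : (((f.a * |x|).toNat : ℕ) : ℝ) = ((f.a * |x| : ℤ) : ℝ) := by exact_mod_cast this
        rw [this]; exact h2
      omega
    refine mem_redForm hr.1 ?_ (key _ b3) (key _ (by have := CRed.disc_neg hr; linarith)) ?_ hi
    · exact (le_of_mem_sCl hNY hr.1 ((mem_sCl_iff hr.1 Y).mpr ⟨hr, hd⟩)).2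
    · by_contra h
      push Not at h
      have := CRed.disc_neg hr
      simp [disc, h.1, h.2] at this
  have h1 := (Finset.card_le_card sub).trans Finset.card_image_le
  have h2 : (((CL Y).filter fun f => ¬ f.Irr).card : ℝ) ≤ 2 * (2 * 2 * ((4 * N + 1) * (P4 L).card)) := by
    rw [← card_JB]
    refine (Nat.cast_le.mpr h1).trans (le_of_eq ?_)
    simp only [Finset.card_product]
    push_cast
    simp
  refine h2.trans ?_
  set t := Y ^ ((1 : ℝ) / 144) with ht
  have ht1 : 1 ≤ t := Real.one_le_rpow hY (by norm_num)
  have pw : ∀ (k : ℕ) (q : ℝ), q = k / 144 → Y ^ q = t ^ k := by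
    intro k q h
    rw [ht, ← Real.rpow_natCast, ← Real.rpow_mul hY0, h]; congr 1; ring
  have hs : √Y = t ^ 72 := by rw [Real.sqrt_eq_rpow]; exact pw 72 _ (by norm_num)
  have hNle : (N : ℝ) ≤ 2 * t ^ 36 := by
    have := (Nat.ceil_lt_add_one (show 0 ≤ Y ^ ((1 : ℝ) / 4) by positivity)).le
    rw [pw 36 _ (by norm_num)] at this
    rw [hN, Nc, pw 36 _ (by norm_num)]
    have : 1 ≤ t ^ 36 := one_le_pow₀ ht1
    linarith
  have hLle : (L : ℝ) ≤ 2 * t ^ 72 := by rw [← hs]; exact Nat.floor_le (by positivity)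
  have h72 : 1 ≤ t ^ 72 := one_le_pow₀ ht1
  have hL1 : (1 : ℝ) ≤ L := by
    have : 1 ≤ L := by rw [hL, Nat.one_le_floor_iff, hs]; linarith
    exact_mod_cast this
  have hlog : 1 + Real.log L ≤ 72 * t := by
    have h1 : Real.log L ≤ Real.log (2 * t ^ 72) := Real.log_le_log (by linarith) hLle
    rw [Real.log_mul (by norm_num) (by positivity), Real.log_pow] at h1
    have h2 := Real.log_le_sub_one_of_pos (show (0 : ℝ) < 2 by norm_num)
    have h3 := Real.log_le_sub_one_of_pos (show 0 < t by linarith)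
    push_cast at h1
    linarith
  have hlog0 : 0 ≤ Real.log L := Real.log_nonneg hL1
  have hP : ((P4 L).card : ℝ) ≤ 2 * t ^ 72 * (72 * t) ^ 3 :=
    (card_P4 L).trans (by gcongr)
  rw [pw 114 _ (by norm_num)]
  have h36 : 1 ≤ t ^ 36 := one_le_pow₀ ht1
  calc 2 * (2 * 2 * ((4 * (N : ℝ) + 1) * (P4 L).card))
      ≤ 2 * (2 * 2 * ((9 * t ^ 36) * (2 * t ^ 72 * (72 * t) ^ 3))) := by gcongr; linarith
    _ = 2 * (2 * 2 * (9 * (2 * 72 ^ 3))) * t ^ 111 := by ring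
    _ ≤ 10 ^ 8 * t ^ 114 := by gcongr <;> norm_num

end Cub

end

section

open MeasureTheory

namespace Cub
open BCF

lemma splitting_smul {n : ℤ} (hn : n ≠ 0) {f : BCF} {θ B C : ℝ} :
    Splitting (BCF.smul n f) θ B C ↔ Splitting f θ B C := by
  have hn' : (n : ℝ) ≠ 0 := by exact_mod_cast hn
  constructor
  · rintro ⟨h1, h2, h3⟩
    simp only [BCF.smul] at h1 h2 h3
    push_cast at h1 h2 h3
    exact ⟨mul_left_cancel₀ hn' (by linear_combination h1),
      mul_left_cancel₀ hn' (by linear_combination h2), mul_left_cancel₀ hn' (by linear_combination h3)⟩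
  · rintro ⟨h1, h2, h3⟩
    constructor <;> simp only [BCF.smul] <;> push_cast
    · rw [h1]; ring
    · rw [h2]; ring
    · rw [h3]; ring

lemma cred_smul {n : ℤ} (hn : 0 < n) {f : BCF} : CRed (BCF.smul n f) ↔ CRed f := by
  have : 0 < (BCF.smul n f).a ↔ 0 < f.a := by
    simp only [BCF.smul]; exact mul_pos_iff_of_pos_left hn
  simp only [CRed, this, splitting_smul hn.ne']

lemma irr_smul {n : ℤ} (hn : n ≠ 0) {f : BCF} : (BCF.smul n f).Irr ↔ f.Irr := by
  simp only [Irr, smul_eval, mul_eq_zero, hn, false_or]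

open scoped Classical in
/-- The contribution of the content. -/
noncomputable def cw (p : ℕ) (f : BCF) : ℝ := if Dvd p f then p else 0

lemma cw_nonneg (p : ℕ) (f : BCF) : 0 ≤ cw p f := by unfold cw; split_ifs <;> positivity

lemma dvd_iff {p : ℤ} {f : BCF} : Dvd p f ↔ p ∣ f.a ∧ p ∣ f.b ∧ p ∣ f.c ∧ p ∣ f.d := by
  constructor
  · rintro ⟨g, rfl⟩
    simp [BCF.smul]
  · rintro ⟨⟨a, ha⟩, ⟨b, hb⟩, ⟨c, hc⟩, ⟨d, hd⟩⟩
    exact ⟨⟨a, b, c, d⟩, by ext <;> simpa [BCF.smul]⟩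

lemma cw_smul {p q : ℕ} (hp : p.Prime) (hq : q.Prime) (h : p ≠ q) (f : BCF) :
    cw p (BCF.smul q f) = cw p f := by
  have hc : IsCoprime (p : ℤ) q := Nat.isCoprime_iff_coprime.mpr ((Nat.coprime_primes hp hq).mpr h)
  have : Dvd (p : ℤ) (BCF.smul q f) ↔ Dvd (p : ℤ) f := by
    have h (x : ℤ) : (p : ℤ) ∣ q * x ↔ (p : ℤ) ∣ x :=
      ⟨fun h => IsCoprime.dvd_of_dvd_mul_left hc h, fun h => h.mul_left _⟩
    simp only [dvd_iff, BCF.smul, h]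
  unfold cw
  by_cases h' : Dvd (p : ℤ) f
  · rw [if_pos h', if_pos (this.mpr h')]
  · rw [if_neg h', if_neg (mt this.mp h')]

open scoped Classical in
lemma sum_content {P : BCF → Prop} [DecidablePred P] (hP : ∀ (n : ℕ) f, 0 < n → (P (BCF.smul n f) ↔ P f)) {s C : ℝ}
    (hs : 1 / 4 ≤ s) (hC : ∀ Y : ℝ, 0 < Y → (((CL Y).filter P).card : ℝ) ≤ C * Y ^ s) {m : ℝ}
    (hm : 0 ≤ m) {E : Finset ℕ} (hE : ∀ p ∈ E, p.Prime) : ∀ {Y : ℝ}, 0 < Y →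
    ∑ f ∈ (CL Y).filter P, ∏ p ∈ E, (m + cw p f) ≤ (m + 1) ^ E.card * (C * Y ^ s) := by
  induction E using Finset.induction_on with
  | empty => intro Y hY; simpa using hC Y hY
  | insert q E hq ih =>
    intro Y hY
    have hE' : ∀ p ∈ E, p.Prime := fun p hp => hE p (Finset.mem_insert_of_mem hp)
    have hqp := hE q (Finset.mem_insert_self _ _)
    have hq1 : (1 : ℝ) ≤ q := by exact_mod_cast hqp.one_lt.le
    have hq0 : (0 : ℝ) < q := by linarith
    have ih1 := ih hE' hY
    have ih2 := ih hE' (show 0 < Y / q ^ 4 by positivity)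
    have hnn : ∀ f, 0 ≤ ∏ p ∈ E, (m + cw p f) := fun f =>
      Finset.prod_nonneg fun p _ => add_nonneg hm (cw_nonneg _ _)
    have hC0 : 0 ≤ C * Y ^ s := (Nat.cast_nonneg _).trans (hC Y hY)
    have e1 : ∑ f ∈ (CL Y).filter P, ∏ p ∈ insert q E, (m + cw p f) =
        m * ∑ f ∈ (CL Y).filter P, ∏ p ∈ E, (m + cw p f) +
        q * ∑ f ∈ ((CL Y).filter P).filter (fun f => Dvd q f), ∏ p ∈ E, (m + cw p f) := by
      rw [Finset.mul_sum, Finset.mul_sum, Finset.sum_filter (p := fun f => Dvd q f),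
        ← Finset.sum_add_distrib]
      refine Finset.sum_congr rfl fun f _ => ?_
      rw [Finset.prod_insert hq]
      by_cases h : Dvd q f
      · rw [if_pos h]; simp only [cw, if_pos h]; ring
      · rw [if_neg h]; simp only [cw, if_neg h]; ring
    have e2 : ∑ f ∈ ((CL Y).filter P).filter (fun f => Dvd q f), ∏ p ∈ E, (m + cw p f) ≤
        ∑ f ∈ (CL (Y / q ^ 4)).filter P, ∏ p ∈ E, (m + cw p f) := by
      have inj : Set.InjOn (BCF.smul (q : ℤ)) ((CL (Y / q ^ 4)).filter P) := fun f _ g _ h =>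
        smul_inj (by exact_mod_cast hqp.ne_zero) h
      have e3 : ∑ f ∈ (CL (Y / q ^ 4)).filter P, ∏ p ∈ E, (m + cw p f) =
          ∑ f ∈ ((CL (Y / q ^ 4)).filter P).image (BCF.smul (q : ℤ)), ∏ p ∈ E, (m + cw p f) := by
        rw [Finset.sum_image inj]
        refine Finset.sum_congr rfl fun f _ => Finset.prod_congr rfl fun p hp => ?_
        rw [cw_smul (hE' p hp) hqp (by rintro rfl; exact hq hp)]
      rw [e3]
      refine Finset.sum_le_sum_of_subset_of_nonneg ?_ fun f _ _ => hnn f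
      intro f hf
      simp only [Finset.mem_filter, mem_CL] at hf
      obtain ⟨⟨⟨h1, h2⟩, h3⟩, g, rfl⟩ := hf
      refine Finset.mem_image_of_mem _ ?_
      simp only [Finset.mem_filter, mem_CL]
      refine ⟨⟨(cred_smul (by exact_mod_cast hqp.pos)).mp h1, ?_⟩, (hP q g hqp.pos).mp h3⟩
      rw [lt_div_iff₀ (by positivity)]
      rw [smul_disc] at h2
      push_cast at h2
      linarith
    have e4 : q * (C * (Y / q ^ 4) ^ s) ≤ C * Y ^ s := by
      rw [Real.div_rpow hY.le (by positivity), ← Real.rpow_natCast, ← Real.rpow_mul hq0.le]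
      have h1 : (q : ℝ) ≤ (q : ℝ) ^ ((4 : ℕ) * s : ℝ) := by
        calc (q : ℝ) = (q : ℝ) ^ (1 : ℝ) := (Real.rpow_one _).symm
          _ ≤ _ := Real.rpow_le_rpow_of_exponent_le hq1 (by push_cast; linarith)
      have h2 : (0 : ℝ) < (q : ℝ) ^ ((4 : ℕ) * s : ℝ) := by positivity
      rw [← mul_div_assoc C, mul_div_assoc', div_le_iff₀ h2, mul_comm]
      gcongr
    rw [e1, Finset.card_insert_of_notMem hq, pow_succ]
    calc _ ≤ m * ((m + 1) ^ E.card * (C * Y ^ s)) +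
          q * ((m + 1) ^ E.card * (C * (Y / q ^ 4) ^ s)) := by
          gcongr; exact e2.trans ih2
      _ = m * ((m + 1) ^ E.card * (C * Y ^ s)) +
          (m + 1) ^ E.card * (q * (C * (Y / q ^ 4) ^ s)) := by ring
      _ ≤ m * ((m + 1) ^ E.card * (C * Y ^ s)) +
          (m + 1) ^ E.card * (C * Y ^ s) := by gcongr
      _ = _ := by ring

open Polynomial in
lemma np_le {p : ℕ} (hp : p.Prime) (f : BCF) : (np p f : ℝ) ≤ 3 + cw p f := by
  have := Fact.mk hp
  unfold cw
  split_ifs with h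
  · have : np p f ≤ p + 1 := by
      unfold np
      have h1 := Finset.card_filter_le (Finset.range p) fun t : ℕ => (p : ℤ) ∣ f.eval t 1
      rw [Finset.card_range] at h1
      split_ifs <;> omega
    have : (np p f : ℝ) ≤ p + 1 := by exact_mod_cast this
    linarith
  · set Q : (ZMod p)[X] := C (f.a : ZMod p) * X ^ 3 + C (f.b : ZMod p) * X ^ 2 +
      C (f.c : ZMod p) * X + C (f.d : ZMod p) with hQ
    have hz : ∀ x : ℤ, (x : ZMod p) = 0 ↔ (p : ℤ) ∣ x := fun x =>
      ZMod.intCast_zmod_eq_zero_iff_dvd x p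
    have hQ0 : Q ≠ 0 := by
      intro h0
      apply h
      rw [dvd_iff, ← hz, ← hz, ← hz, ← hz]
      have c3 := congrArg (fun P => P.coeff 3) h0
      have c2 := congrArg (fun P => P.coeff 2) h0
      have c1 := congrArg (fun P => P.coeff 1) h0
      have c0 := congrArg (fun P => P.coeff 0) h0
      have hT : Q = Cubic.toPoly ⟨(f.a : ZMod p), f.b, f.c, f.d⟩ := rfl
      simp only [hT, Cubic.coeff_eq_a, Cubic.coeff_eq_b, Cubic.coeff_eq_c, Cubic.coeff_eq_d,
        coeff_zero] at c3 c2 c1 c0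
      exact ⟨c3, c2, c1, c0⟩
    have hroots : ((Finset.range p).filter fun t : ℕ => (p : ℤ) ∣ f.eval t 1).card ≤ Q.natDegree := by
      refine le_trans ?_ (Q.card_roots')
      refine le_trans ?_ (Multiset.toFinset_card_le _)
      refine Finset.card_le_card_of_injOn (fun t : ℕ => (t : ZMod p)) ?_ ?_
      · intro t ht
        simp only [Finset.coe_filter, Finset.mem_range, Set.mem_ofPred_eq] at ht
        simp only [SetLike.mem_coe, Multiset.mem_toFinset, mem_roots hQ0, IsRoot.def]
        have := (hz _).mpr ht.2
        simp only [BCF.eval] at this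
        push_cast at this
        simp only [hQ, eval_add, eval_mul, eval_C, eval_pow, eval_X]
        linear_combination this
      · intro x hx y hy hxy
        simp only [Finset.coe_filter, Finset.mem_range, Set.mem_ofPred_eq] at hx hy
        have := (ZMod.natCast_eq_natCast_iff' x y p).mp hxy
        rwa [Nat.mod_eq_of_lt hx.1, Nat.mod_eq_of_lt hy.1] at this
    have : np p f ≤ 3 := by
      unfold np
      split_ifs with ha
      · have : Q.natDegree ≤ 2 := by
          rw [hQ, (hz _).mpr ha]
          simp only [C_0, zero_mul, zero_add]
          exact natDegree_quadratic_le
        omega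
      · have : Q.natDegree ≤ 3 := natDegree_cubic_le
        omega
    have : (np p f : ℝ) ≤ 3 := by exact_mod_cast this
    linarith

open scoped Classical in
lemma sum_reducible {E : Finset ℕ} (hE : ∀ p ∈ E, p.Prime) {Y : ℝ} (hY : 0 < Y) :
    ∑ f ∈ (CL Y).filter (fun f => ¬ f.Irr), ∏ p ∈ E, (np p f : ℝ) ≤
      4 ^ E.card * (10 ^ 8 * Y ^ ((19 : ℝ) / 24)) := by
  have h1 : ∀ Y : ℝ, 0 < Y → (((CL Y).filter fun f => ¬ f.Irr).card : ℝ) ≤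
      10 ^ 8 * Y ^ ((19 : ℝ) / 24) := by
    intro Y hY
    rcases le_total 1 Y with h | h
    · exact card_reducible h
    · have : (CL Y).filter (fun f => ¬ f.Irr) = ∅ := by
        rw [Finset.eq_empty_iff_forall_notMem]
        intro f hf
        rw [Finset.mem_filter, mem_CL] at hf
        have h2 := CRed.disc_neg hf.1.1
        have h3 : (f.disc : ℝ) ≤ -1 := by exact_mod_cast (show f.disc ≤ -1 by omega)
        linarith [hf.1.2]
      rw [this]; simp; positivity
  have h2 := sum_content (P := fun f => ¬ f.Irr) (fun n f hn => by
    rw [irr_smul (by exact_mod_cast hn.ne')]) (s := 19 / 24) (by norm_num) h1 (show (0 : ℝ) ≤ 3 by norm_num) hE hY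
  norm_num at h2 ⊢
  refine le_trans (Finset.sum_le_sum fun f _ => Finset.prod_le_prod (fun _ _ => by positivity)
    fun p hp => np_le (hE p hp) f) h2

/-- The error term. -/
noncomputable def errT (Y k : ℝ) : ℝ := Y ^ ((19 : ℝ) / 24) * k ^ ((3 : ℝ) / 4) + k * Y ^ ((1 : ℝ) / 2)

lemma errT_mono {Y k k' : ℝ} (hY : 0 ≤ Y) (hk : 0 ≤ k) (h : k ≤ k') : errT Y k ≤ errT Y k' := by
  unfold errT; gcongr

open scoped Classical in
lemma sum_OmF_bound {E : Finset ℕ} (hE : ∀ p ∈ E, p.Prime) {Y : ℝ} (hY : 1 ≤ Y) :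
    |∑ ω ∈ OmF Y, ∏ p ∈ E, (ω.np p : ℝ) - mainE Y E| ≤
      2 * 10 ^ 8 * 4 ^ E.card * errT Y (∏ p ∈ E, p : ℕ) := by
  have hY0 : 0 < Y := by linarith
  set W : BCF → ℝ := fun f => ∏ p ∈ E, (np p f : ℝ) with hW
  have hW0 : ∀ f, 0 ≤ W f := fun f => Finset.prod_nonneg fun _ _ => Nat.cast_nonneg _
  have hw : ∀ f (hf : f.Good), ∏ p ∈ E, ((orb f hf).np p : ℝ) = W f := fun f hf =>
    Finset.prod_congr rfl fun p hp => by rw [np_orb (hE p hp) hf]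
  have u := sum_orb_le (Y := Y) (w := fun ω => ∏ p ∈ E, (ω.np p : ℝ)) hW0 hw
  have l := le_sum_orb (Y := Y) (w := fun ω => ∏ p ∈ E, (ω.np p : ℝ)) hW0 hw
  have c := sum_CL_bound hE hY
  have o := sum_OP_bound hE hY
  have r := sum_reducible hE hY0
  have u2 : ∑ f ∈ (CL Y).filter Irr, W f ≤ ∑ f ∈ CL Y, W f :=
    Finset.sum_le_sum_of_subset_of_nonneg (Finset.filter_subset _ _) fun f _ _ => hW0 f
  have l2 : ∑ f ∈ (OP Y).filter Irr, W f + ∑ f ∈ (OP Y).filter (fun f => ¬ f.Irr), W f =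
      ∑ f ∈ OP Y, W f := Finset.sum_filter_add_sum_filter_not _ _ _
  have l3 : ∑ f ∈ (OP Y).filter (fun f => ¬ f.Irr), W f ≤ ∑ f ∈ (CL Y).filter (fun f => ¬ f.Irr), W f := by
    refine Finset.sum_le_sum_of_subset_of_nonneg ?_ fun f _ _ => hW0 f
    exact Finset.filter_subset_filter _ (Finset.filter_subset _ _)
  set k : ℝ := ((∏ p ∈ E, p : ℕ) : ℝ) with hk
  have hk1 : 1 ≤ k := by rw [hk]; exact_mod_cast prod_pos_of_prime hE
  have e1 : Y ^ ((19 : ℝ) / 24) ≤ errT Y k := by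
    unfold errT
    have : 1 ≤ k ^ ((3 : ℝ) / 4) := Real.one_le_rpow hk1 (by norm_num)
    have h2 : 0 ≤ Y ^ ((19 : ℝ) / 24) := by positivity
    have h3 : 0 ≤ k * Y ^ ((1 : ℝ) / 2) := by positivity
    nlinarith
  have e2 : (2 : ℝ) ^ E.card ≤ 4 ^ E.card := by gcongr; norm_num
  have e0 : 0 ≤ errT Y k := le_trans (by positivity) e1
  have c' : |∑ f ∈ CL Y, W f - mainE Y E| ≤ 20000 * 4 ^ E.card * errT Y k := c.trans (by
    change 20000 * 2 ^ E.card * errT Y k ≤ _; gcongr)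
  have o' : |∑ f ∈ OP Y, W f - mainE Y E| ≤ 20000 * 4 ^ E.card * errT Y k := o.trans (by
    change 20000 * 2 ^ E.card * errT Y k ≤ _; gcongr)
  have r' : ∑ f ∈ (CL Y).filter (fun f => ¬ f.Irr), W f ≤ 10 ^ 8 * (4 ^ E.card * errT Y k) :=
    r.trans (by
      have : 10 ^ 8 * (4 ^ E.card * Y ^ ((19 : ℝ) / 24)) ≤ 10 ^ 8 * (4 ^ E.card * errT Y k) := by gcongr
      linarith)
  have h0 : 0 ≤ 4 ^ E.card * errT Y k := by positivity
  rw [abs_le] at c' o' ⊢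
  constructor <;> nlinarith

/-- The main term for the weights `np - 1`. -/
noncomputable def mainH (Y : ℝ) (K : Finset ℕ) : ℝ :=
  ∑ a ∈ Finset.Icc 1 (Nc Y), (∏ p ∈ K, dl p a) * ∑ b ∈ JB (Nc Y), volume.real (SOp (a : ℕ) (b : ℤ) Y)

lemma prod_sub_one {ι : Type*} [DecidableEq ι] (K : Finset ι) (x : ι → ℝ) :
    ∏ p ∈ K, (x p - 1) = ∑ E ∈ K.powerset, (-1) ^ (K \ E).card * ∏ p ∈ E, x p := by
  simp only [sub_eq_add_neg, Finset.prod_add, Finset.prod_const]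
  exact Finset.sum_congr rfl fun E _ => mul_comm _ _

lemma mainH_eq (Y : ℝ) (K : Finset ℕ) :
    mainH Y K = ∑ E ∈ K.powerset, (-1) ^ (K \ E).card * mainE Y E := by
  simp only [mainH, mainE, Finset.mul_sum (s := Finset.Icc 1 (Nc Y))]
  rw [Finset.sum_comm]
  refine Finset.sum_congr rfl fun a _ => ?_
  have : ∏ p ∈ K, dl p a = ∏ p ∈ K, ((1 + dl p a) - 1) := Finset.prod_congr rfl fun _ _ => by ring
  rw [this, prod_sub_one, Finset.sum_mul]
  exact Finset.sum_congr rfl fun E _ => by ring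

/-- The sum over classes of the weights `np - 1`. -/
noncomputable def HK (Y : ℝ) (K : Finset ℕ) : ℝ := ∑ ω ∈ OmF Y, ∏ p ∈ K, ((ω.np p : ℝ) - 1)

lemma HK_eq (Y : ℝ) (K : Finset ℕ) :
    HK Y K = ∑ E ∈ K.powerset, (-1) ^ (K \ E).card * ∑ ω ∈ OmF Y, ∏ p ∈ E, (ω.np p : ℝ) := by
  simp only [HK, prod_sub_one, Finset.mul_sum]
  rw [Finset.sum_comm]

lemma sum_powerset_pow (K : Finset ℕ) (c : ℝ) : ∑ E ∈ K.powerset, c ^ E.card = (c + 1) ^ K.card := by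
  have := (Finset.prod_add (fun _ : ℕ => c) (fun _ => 1) K)
  simp only [Finset.prod_const, one_pow, mul_one] at this
  exact this.symm

lemma HK_bound {K : Finset ℕ} (hK : ∀ p ∈ K, p.Prime) {Y : ℝ} (hY : 1 ≤ Y) :
    |HK Y K - mainH Y K| ≤ 2 * 10 ^ 8 * 5 ^ K.card * errT Y (∏ p ∈ K, p : ℕ) := by
  rw [HK_eq, mainH_eq, ← Finset.sum_sub_distrib]
  refine (Finset.abs_sum_le_sum_abs _ _).trans ?_
  have : ∀ E ∈ K.powerset, |(-1) ^ (K \ E).card * ∑ ω ∈ OmF Y, ∏ p ∈ E, (ω.np p : ℝ) -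
      (-1) ^ (K \ E).card * mainE Y E| ≤ 2 * 10 ^ 8 * errT Y (∏ p ∈ K, p : ℕ) * 4 ^ E.card := by
    intro E hE
    have hE' := Finset.mem_powerset.mp hE
    rw [← mul_sub, abs_mul, abs_pow, abs_neg, abs_one, one_pow, one_mul]
    refine (sum_OmF_bound (fun p hp => hK p (hE' hp)) hY).trans ?_
    have : errT Y (∏ p ∈ E, p : ℕ) ≤ errT Y (∏ p ∈ K, p : ℕ) := by
      refine errT_mono (by linarith) (Nat.cast_nonneg _) ?_
      exact_mod_cast Finset.prod_le_prod_of_subset_of_one_le' hE' fun p hp _ => (hK p hp).one_lt.le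
    calc _ = 2 * 10 ^ 8 * 4 ^ E.card * errT Y (∏ p ∈ E, p : ℕ) := rfl
      _ ≤ 2 * 10 ^ 8 * 4 ^ E.card * errT Y (∏ p ∈ K, p : ℕ) := by gcongr
      _ = _ := by ring
  refine (Finset.sum_le_sum this).trans (le_of_eq ?_)
  rw [← Finset.mul_sum, sum_powerset_pow]; norm_num; ring

open scoped Classical in
lemma HK_trivial {C : ℝ} (hC : ∀ Y : ℝ, 0 < Y → ((CL Y).card : ℝ) ≤ C * Y) {K : Finset ℕ}
    (hK : ∀ p ∈ K, p.Prime) {Y : ℝ} (hY : 0 < Y) : |HK Y K| ≤ 5 ^ K.card * (C * Y) := by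
  rw [HK_eq]
  refine (Finset.abs_sum_le_sum_abs _ _).trans ?_
  have : ∀ E ∈ K.powerset, |(-1) ^ (K \ E).card * ∑ ω ∈ OmF Y, ∏ p ∈ E, (ω.np p : ℝ)| ≤
      4 ^ E.card * (C * Y) := by
    intro E hE
    have hE' : ∀ p ∈ E, p.Prime := fun p hp => hK p (Finset.mem_powerset.mp hE hp)
    rw [abs_mul, abs_pow, abs_neg, abs_one, one_pow, one_mul, abs_of_nonneg
      (Finset.sum_nonneg fun _ _ => Finset.prod_nonneg fun _ _ => Nat.cast_nonneg _)]
    have hW0 : ∀ f, 0 ≤ ∏ p ∈ E, (np p f : ℝ) := fun f =>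
      Finset.prod_nonneg fun _ _ => Nat.cast_nonneg _
    refine (sum_orb_le hW0 fun f hf => Finset.prod_congr rfl fun p hp => by
      rw [np_orb (hE' p hp) hf]).trans ?_
    have h2 := sum_content (P := fun _ => True) (fun _ _ _ => Iff.rfl) (s := 1) (C := C) (by norm_num)
      (by simpa using hC) (show (0 : ℝ) ≤ 3 by norm_num) hE' hY
    norm_num at h2
    refine le_trans (Finset.sum_le_sum_of_subset_of_nonneg (Finset.filter_subset _ _)
      fun f _ _ => hW0 f) (le_trans (Finset.sum_le_sum fun f _ =>
      Finset.prod_le_prod (fun _ _ => by positivity) fun p hp => np_le (hE' p hp) f) h2)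
  refine (Finset.sum_le_sum this).trans (le_of_eq ?_)
  rw [← Finset.sum_mul, sum_powerset_pow]; norm_num

end Cub

end

section

open MeasureTheory

namespace Cub
open BCF

lemma sum_sub_integral_le {h : ℕ} {g : ℝ → ℝ} {M : ℝ} (hg0 : ∀ x, 0 ≤ g x) (hgM : ∀ x, g x ≤ M)
    (hm : Measurable g) {x0 x1 : ℝ} (hs : ∀ x, g x ≠ 0 → x ∈ Set.Icc x0 x1)
    (hF : ∀ l, 0 ≤ l → Fr h {x | l < g x}) {J : Finset ℤ} (hJ : ∀ n : ℤ, g n ≠ 0 → n ∈ J) :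
    |∑ n ∈ J, g n - ∫ x, g x| ≤ h * M := by
  classical
  have hM : 0 ≤ M := (hg0 0).trans (hgM 0)
  have hsub : ∀ l, 0 ≤ l → {x | l < g x} ⊆ Set.Icc x0 x1 := fun l hl x hx =>
    hs x (ne_of_gt (lt_of_le_of_lt hl hx))
  have hint : Integrable g := by
    have h1 : IntegrableOn g (Set.Icc x0 x1) := by
      refine Measure.integrableOn_of_bounded (M := M) isCompact_Icc.measure_lt_top.ne
        hm.aestronglyMeasurable ?_
      filter_upwards with x
      rw [Real.norm_of_nonneg (hg0 x)]; exact hgM x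
    exact (integrableOn_iff_integrable_of_support_subset fun x hx => hs x hx).mp h1
  have hlt : ∀ l, 0 ≤ l → volume {x | l < g x} < ⊤ := fun l hl =>
    lt_of_le_of_lt (measure_mono (hsub l hl)) isCompact_Icc.measure_lt_top
  have e1 : ∫ x, g x = ∫ t in Set.Ioc 0 M, volume.real {x | t < g x} := by
    rw [hint.integral_eq_integral_meas_lt (Eventually.of_forall hg0)]
    refine setIntegral_eq_of_subset_of_forall_sdiff_eq_zero measurableSet_Ioi Set.Ioc_subset_Ioi_self
      fun t ht => ?_
    have : {x | t < g x} = ∅ := by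
      rw [Set.eq_empty_iff_forall_notMem]
      intro x hx
      have h1 : t < g x := hx
      have h2 := hgM x
      exact ht.2 ⟨ht.1, by linarith⟩
    simp [this]
  have e2 : ∀ n : ℤ, g n = ∫ t in Set.Ioc 0 M, (Set.Iio (g n)).indicator (1 : ℝ → ℝ) t := by
    intro n
    rw [setIntegral_indicator measurableSet_Iio]
    have : Set.Ioc 0 M ∩ Set.Iio (g n) = Set.Ioo 0 (g n) := by
      ext t
      simp only [Set.mem_inter_iff, Set.mem_Ioc, Set.mem_Iio, Set.mem_Ioo]
      have := hgM n
      constructor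
      · rintro ⟨⟨a, b⟩, c⟩; exact ⟨a, c⟩
      · rintro ⟨a, b⟩; exact ⟨⟨a, by linarith⟩, b⟩
    rw [this]
    simp [hg0 n]
  have i1 : ∀ n : ℤ, IntegrableOn ((Set.Iio (g n)).indicator (1 : ℝ → ℝ)) (Set.Ioc 0 M) := by
    intro n
    refine Integrable.indicator ?_ measurableSet_Iio
    exact integrableOn_const (hs := measure_Ioc_lt_top.ne) (hC := by simp)
  have i2 : IntegrableOn (fun t => volume.real {x | t < g x}) (Set.Ioc 0 M) := by
    refine IntegrableOn.mono_set ?_ Set.Ioc_subset_Icc_self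
    refine AntitoneOn.integrableOn_isCompact isCompact_Icc fun s hs' t ht hst => ?_
    refine ENNReal.toReal_mono (hlt s hs'.1).ne (measure_mono fun x hx => ?_)
    exact lt_of_le_of_lt hst hx
  rw [e1, Finset.sum_congr rfl fun n _ => e2 n, ← integral_finsetSum _ fun n _ => i1 n,
    ← integral_sub (integrable_finsetSum _ fun n _ => i1 n) i2]
  have := norm_setIntegral_le_of_norm_le_const (μ := volume) (s := Set.Ioc 0 M)
    (f := fun t => ∑ n ∈ J, (Set.Iio (g n)).indicator (1 : ℝ → ℝ) t - volume.real {x | t < g x})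
    (C := h) measure_Ioc_lt_top (fun t ht => by
      have ht0 := ht.1.le
      have c := (hF t ht0).card_int (measurableSet_lt measurable_const hm) (hsub t ht0) (J := J)
        (fun n hn => hJ n (ne_of_gt (lt_of_le_of_lt ht0 hn)))
      have : ∑ n ∈ J, (Set.Iio (g n)).indicator (1 : ℝ → ℝ) t =
          ((J.filter (fun n : ℤ => (n : ℝ) ∈ {x | t < g x})).card : ℝ) := by
        rw [Finset.card_filter]; push_cast
        refine Finset.sum_congr rfl fun n _ => ?_
        simp [Set.indicator_apply]
      rw [Real.norm_eq_abs, this]; exact c)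
  rw [Real.norm_eq_abs] at this
  simpa [hM] using this

/-- The scale of `a`. -/
noncomputable def Xs (Y D : ℝ) : ℝ := (Y / (4 * D ^ 3)) ^ ((1 : ℝ) / 4)

lemma xs_pow {Y D : ℝ} (hY : 0 < Y) (hD : 0 < D) : Xs Y D ^ 4 = Y / (4 * D ^ 3) := by
  rw [Xs, ← Real.rpow_natCast, ← Real.rpow_mul (by positivity)]; norm_num

lemma xs_pos {Y D : ℝ} (hY : 0 < Y) (hD : 0 < D) : 0 < Xs Y D := by unfold Xs; positivity

open scoped Classical in
/-- The integral of `1 + s²` over `1 + s² < y²`. -/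
noncomputable def hI (y : ℝ) : ℝ := ∫ s : ℝ, if 1 + s ^ 2 < y ^ 2 then 1 + s ^ 2 else 0

lemma ndc_lt_iff {a Y B D b : ℝ} (ha : 0 < a) (hY : 0 < Y) (hD : 0 < D) :
    ndc a b (B, D) < Y ↔ a ^ 2 * qd a b (B, D) < D * Xs Y D ^ 2 := by
  have h4 := xs_pow hY hD
  have hX := xs_pos hY hD
  have hq : 0 ≤ qd a b (B, D) := by simp only [qd]; positivity
  have e : Y = 4 * D * (D * Xs Y D ^ 2) ^ 2 := by
    rw [mul_pow, ← pow_mul, h4]; field_simp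
  have e2 : ndc a b (B, D) = 4 * D * (a ^ 2 * qd a b (B, D)) ^ 2 := by
    simp only [ndc]; ring
  rw [e2]
  conv_lhs => rw [e]
  rw [mul_lt_mul_iff_right₀ (by positivity), sq_lt_sq₀ (by positivity) (by positivity)]

open Polynomial in
lemma sum_dens {a : ℝ} (ha : 0 < a) {Y B D : ℝ} (hY : 0 < Y) (hD : 0 < D) {J : Finset ℤ}
    (hJ : ∀ b : ℤ, dens a b Y (B, D) ≠ 0 → b ∈ J) :
    |∑ b ∈ J, dens a b Y (B, D) - a ^ 3 * D ^ ((3 : ℝ) / 2) * hI (Xs Y D / a)| ≤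
      6 * (if a < Xs Y D then D * Xs Y D ^ 2 else 0) := by
  set X := Xs Y D with hX
  have hX0 : 0 < X := xs_pos hY hD
  have dens_eq : ∀ b, dens a b Y (B, D) = if a ^ 2 * qd a b (B, D) < D * X ^ 2 then
      a ^ 2 * qd a b (B, D) else 0 := by
    intro b
    unfold dens
    by_cases h : ndc a b (B, D) < Y
    · rw [if_pos h, if_pos ((ndc_lt_iff ha hY hD).mp h)]
    · rw [if_neg h, if_neg (mt (ndc_lt_iff ha hY hD).mpr h)]
  have hq : ∀ b, D ≤ qd a b (B, D) := fun b => by simp only [qd]; nlinarith [sq_nonneg (3 / 2 * B - b / a)]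
  by_cases hax : a < X
  · rw [if_pos hax]
    set g : ℝ → ℝ := fun b => dens a b Y (B, D) with hg
    have hmg : Measurable g := by
      have : Measurable fun b => a ^ 2 * qd a b (B, D) := by unfold qd; fun_prop
      simp only [hg, dens_eq]
      exact Measurable.ite (measurableSet_lt this measurable_const) this measurable_const
    have key := sum_sub_integral_le (h := 6) (g := g) (M := D * X ^ 2) (x0 := a * (3 / 2 * B) - √D * X)
      (x1 := a * (3 / 2 * B) + √D * X)
      (fun b => by
        have := hq b
        simp only [hg, dens_eq]; have : 0 ≤ qd a b (B, D) := hD.le.trans this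
        split_ifs <;> positivity)
      (fun b => by simp only [hg, dens_eq]; split_ifs with h; exacts [h.le, by positivity]) hmg
      (fun b hb => by
        simp only [hg, dens_eq] at hb
        have h1 : a ^ 2 * qd a b (B, D) < D * X ^ 2 := by
          by_contra h; exact hb (if_neg h)
        have e : a ^ 2 * qd a b (B, D) = (a * (3 / 2 * B) - b) ^ 2 + a ^ 2 * D := by
          simp only [qd]; field_simp
        have h2 : (a * (3 / 2 * B) - b) ^ 2 ≤ (√D * X) ^ 2 := by
          rw [mul_pow, Real.sq_sqrt hD.le]
          have : 0 < a ^ 2 * D := by positivity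
          linarith
        have h3 := abs_le_of_sq_le_sq' h2 (by positivity)
        constructor <;> linarith [h3.1, h3.2])
      (fun l hl => by
        have e : {x | l < g x} = {x | 0 < a ^ 2 * qd a x (B, D) - l} ∩
            {x | 0 < D * X ^ 2 - a ^ 2 * qd a x (B, D)} := by
          ext x
          simp only [hg, dens_eq, Set.mem_ofPred_eq, Set.mem_inter_iff, sub_pos]
          split_ifs with h
          · simp [h]
          · simp [h, hl]
        rw [e]
        refine (Fr.inter (h := 2) (k := 2) ?_ ?_).mono (by norm_num)
        · refine fr_pos 2 (C (a ^ 2) * ((C (3 / 2 * B) - C a⁻¹ * Polynomial.X) ^ 2 + C D) - C l) ?_ ?_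
          · compute_degree
          · intro t; simp only [qd, eval_sub, eval_mul, eval_C, eval_add, eval_pow, eval_X]; ring
        · refine fr_pos 2 (C (D * X ^ 2) - C (a ^ 2) * ((C (3 / 2 * B) - C a⁻¹ * Polynomial.X) ^ 2 + C D)) ?_ ?_
          · compute_degree
          · intro t; simp only [qd, eval_sub, eval_mul, eval_C, eval_add, eval_pow, eval_X]; ring)
      hJ
    have ei : ∫ b, g b = a ^ 3 * D ^ ((3 : ℝ) / 2) * hI (X / a) := by
      have e1 : ∫ s, g (a * (3 / 2 * B) - (a * √D) * s) = |(a * √D)⁻¹| * ∫ b, g b := by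
        rw [Measure.integral_comp_mul_left (fun s => g (a * (3 / 2 * B) - s)),
          integral_sub_left_eq_self g volume, smul_eq_mul]
      have e2 : ∫ s, g (a * (3 / 2 * B) - (a * √D) * s) = a ^ 2 * D * hI (X / a) := by
        rw [hI, ← integral_const_mul]
        congr 1
        ext s
        have e3 : qd a (a * (3 / 2 * B) - (a * √D) * s) (B, D) = D * (1 + s ^ 2) := by
          simp only [qd]
          have : 3 / 2 * B - (a * (3 / 2 * B) - a * √D * s) / a = √D * s := by field_simp; ring
          rw [this, mul_pow, Real.sq_sqrt hD.le]; ring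
        have e4 : a ^ 2 * (D * (1 + s ^ 2)) < D * X ^ 2 ↔ 1 + s ^ 2 < (X / a) ^ 2 := by
          rw [div_pow, lt_div_iff₀ (by positivity), show a ^ 2 * (D * (1 + s ^ 2)) =
            D * ((1 + s ^ 2) * a ^ 2) by ring, mul_lt_mul_iff_right₀ hD]
        simp only [hg, dens_eq, e3, e4]
        split_ifs <;> ring
      have h0 : 0 < a * √D := by positivity
      rw [e2, abs_of_pos (by positivity)] at e1
      have e5 : D ^ ((3 : ℝ) / 2) = D * √D := by
        rw [Real.sqrt_eq_rpow, ← Real.rpow_one_add' hD.le (by norm_num)]; norm_num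
      rw [e5]
      field_simp at e1
      linear_combination -e1
    rw [ei] at key
    exact_mod_cast key
  · rw [if_neg hax]
    push Not at hax
    have z1 : ∀ b ∈ J, dens a b Y (B, D) = 0 := by
      intro b _
      rw [dens_eq, if_neg]
      have : X ^ 2 ≤ a ^ 2 := by gcongr
      have := hq b
      nlinarith [sq_nonneg a]
    have z2 : hI (X / a) = 0 := by
      have : ∀ s : ℝ, ¬ (1 + s ^ 2 < (X / a) ^ 2) := by
        intro s
        have h1 : X / a ≤ 1 := (div_le_one ha).mpr hax
        have h2 : (X / a) ^ 2 ≤ 1 := pow_le_one₀ (by positivity) h1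
        nlinarith [sq_nonneg s]
      simp [hI, this]
    rw [Finset.sum_eq_zero z1, z2]; simp

end Cub

end

section

open MeasureTheory

namespace Cub

/-- The sum of the cubes of the natural numbers below `y`. -/
noncomputable def cubeSum (y : ℝ) : ℝ := ∑ n ∈ Finset.range ⌈y⌉₊, (n : ℝ) ^ 3

/-- The error of the integral approximation to `cubeSum`. -/
noncomputable def cubeErr (y : ℝ) : ℝ := cubeSum y - y ^ 4 / 4

lemma sum_range_cube (m : ℕ) :
    ∑ n ∈ Finset.range m, (n : ℝ) ^ 3 = ((m : ℝ) * (m - 1) / 2) ^ 2 := by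
  induction m with
  | zero => simp
  | succ k ih => rw [Finset.sum_range_succ, ih]; push_cast; ring

lemma cubeErr_le_one {y : ℝ} (h0 : 0 < y) (h1 : y ≤ 1) : cubeErr y = -(y ^ 4 / 4) := by
  have : ⌈y⌉₊ = 1 := by
    rw [Nat.ceil_eq_iff (by norm_num)]; simpa using ⟨h0, h1⟩
  simp [cubeErr, cubeSum, this]

lemma abs_cubeErr_le_cube {y : ℝ} (h1 : 1 ≤ y) : |cubeErr y| ≤ y ^ 3 := by
  have a1 := Nat.le_ceil y
  have a2 := Nat.ceil_lt_add_one (zero_le_one.trans h1)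
  unfold cubeErr cubeSum
  rw [sum_range_cube]
  set m : ℝ := (⌈y⌉₊ : ℝ)
  have u1 : y * (y - 1) / 2 ≤ m * (m - 1) / 2 := by nlinarith
  have u2 : m * (m - 1) / 2 ≤ (y + 1) * y / 2 := by nlinarith
  have u3 : (0 : ℝ) ≤ y * (y - 1) / 2 := by
    have : 0 ≤ y - 1 := by linarith
    positivity
  have v1 : (y * (y - 1) / 2) ^ 2 ≤ (m * (m - 1) / 2) ^ 2 := by gcongr
  have v2 : (m * (m - 1) / 2) ^ 2 ≤ ((y + 1) * y / 2) ^ 2 := pow_le_pow_left₀ (u3.trans u1) u2 2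
  rw [abs_le]
  have : y ^ 2 ≤ y ^ 3 := pow_le_pow_right₀ h1 (by norm_num)
  have : 0 ≤ y ^ 2 := by positivity
  constructor <;> nlinarith

lemma abs_cubeErr_le {y p : ℝ} (hy : 0 < y) (h3 : 3 ≤ p) (h4 : p ≤ 4) : |cubeErr y| ≤ y ^ p := by
  rcases le_total y 1 with h | h
  · rw [cubeErr_le_one hy h, abs_neg, abs_of_pos (by positivity)]
    have : y ^ (4 : ℝ) ≤ y ^ p := Real.rpow_le_rpow_of_exponent_ge hy h h4
    have e : y ^ (4 : ℝ) = y ^ (4 : ℕ) := Real.rpow_ofNat y 4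
    rw [e] at this
    exact (div_le_self (by positivity) (by norm_num)).trans this
  · refine (abs_cubeErr_le_cube h).trans ?_
    have : y ^ (3 : ℝ) ≤ y ^ p := Real.rpow_le_rpow_of_exponent_le h h3
    have e : y ^ (3 : ℝ) = y ^ (3 : ℕ) := Real.rpow_ofNat y 3
    rwa [e] at this

lemma measurable_cubeErr : Measurable cubeErr := by
  unfold cubeErr cubeSum
  refine Measurable.sub ?_ (by fun_prop)
  exact (measurable_from_top (f := fun m : ℕ => ∑ n ∈ Finset.range m, (n : ℝ) ^ 3)).comp
    Nat.measurable_ceil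

/-- The error term after integration over the fibre. -/
noncomputable def vph (x : ℝ) : ℝ := ∫ s : ℝ, (1 + s ^ 2) * cubeErr (x / √(1 + s ^ 2))

lemma sqrt_rpow {w p : ℝ} (hw : 0 < w) : w * (√w)⁻¹ ^ p = w ^ (1 - p / 2) := by
  rw [Real.sqrt_eq_rpow, ← Real.rpow_neg hw.le, ← Real.rpow_mul hw.le]
  nth_rewrite 1 [← Real.rpow_one w]
  rw [← Real.rpow_add hw]
  congr 1; ring

lemma fibre_bound {x p : ℝ} (hx : 0 < x) (h3 : 3 ≤ p) (h4 : p ≤ 4) (s : ℝ) :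
    |(1 + s ^ 2) * cubeErr (x / √(1 + s ^ 2))| ≤ x ^ p * (1 + s ^ 2) ^ (1 - p / 2) := by
  have hw : 0 < 1 + s ^ 2 := by positivity
  rw [abs_mul, abs_of_pos hw, ← sqrt_rpow hw]
  have := abs_cubeErr_le (y := x / √(1 + s ^ 2)) (by positivity) h3 h4
  rw [div_eq_mul_inv, Real.mul_rpow hx.le (by positivity)] at this
  calc _ ≤ (1 + s ^ 2) * _ := mul_le_mul_of_nonneg_left this hw.le
    _ = _ := by ring

lemma integrable_one_add_sq {r : ℝ} (hr : 1 / 2 < r) :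
    Integrable fun s : ℝ => (1 + s ^ 2) ^ (-r) := by
  have := integrable_rpow_neg_one_add_norm_sq (E := ℝ) (μ := volume) (r := 2 * r)
    (by simp; linarith)
  convert this using 3 with s
  · simp
  · ring

lemma integrable_fibre {x : ℝ} (hx : 0 < x) :
    Integrable fun s : ℝ => (1 + s ^ 2) * cubeErr (x / √(1 + s ^ 2)) := by
  refine Integrable.mono' ((integrable_one_add_sq (r := 1) (by norm_num)).const_mul (x ^ (4 : ℝ)))
    ?_ (Eventually.of_forall fun s => ?_)
  · exact (Measurable.mul (by fun_prop) (measurable_cubeErr.comp (by fun_prop))).aestronglyMeasurable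
  · have := fibre_bound hx (p := 4) (by norm_num) le_rfl s
    norm_num at this ⊢; exact this

lemma abs_vph_le {p : ℝ} (h3 : 3 < p) (h4 : p ≤ 4) :
    ∃ A : ℝ, 0 ≤ A ∧ ∀ x, 0 < x → |vph x| ≤ A * x ^ p := by
  have hi := integrable_one_add_sq (r := p / 2 - 1) (by linarith)
  rw [show -(p / 2 - 1) = 1 - p / 2 by ring] at hi
  refine ⟨∫ s : ℝ, (1 + s ^ 2) ^ (1 - p / 2), integral_nonneg fun s => by positivity, fun x hx => ?_⟩
  rw [mul_comm, ← integral_const_mul]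
  rw [vph, ← Real.norm_eq_abs]
  refine norm_integral_le_of_norm_le (hi.const_mul _) (Eventually.of_forall fun s => ?_)
  exact fibre_bound hx h3.le h4 s

lemma measurable_vph : Measurable vph := by
  have : StronglyMeasurable (Function.uncurry fun x s : ℝ => (1 + s ^ 2) * cubeErr (x / √(1 + s ^ 2))) :=
    (Measurable.mul (by fun_prop) (measurable_cubeErr.comp (by fun_prop))).stronglyMeasurable
  exact this.integral_prod_right.measurable

lemma sum_cube_hI {x : ℝ} (hx : 0 < x) {M : ℕ} (hM : ∀ n : ℕ, n < x → n ≤ M) :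
    ∑ n ∈ Finset.Icc 1 M, (n : ℝ) ^ 3 * hI (x / n) = Real.pi * x ^ 4 / 4 + vph x := by
  classical
  have e1 : ∀ s : ℝ, ∑ n ∈ Finset.Icc 1 M, (n : ℝ) ^ 3 *
      (if 1 + s ^ 2 < (x / n) ^ 2 then 1 + s ^ 2 else 0) =
      (x ^ 4 / 4) * (1 + s ^ 2)⁻¹ + (1 + s ^ 2) * cubeErr (x / √(1 + s ^ 2)) := by
    intro s
    have hw : 0 < 1 + s ^ 2 := by positivity
    have h1 : 1 ≤ √(1 + s ^ 2) := Real.one_le_sqrt.mpr (by nlinarith [sq_nonneg s])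
    have : ∑ n ∈ Finset.Icc 1 M, (n : ℝ) ^ 3 *
        (if 1 + s ^ 2 < (x / n) ^ 2 then 1 + s ^ 2 else 0) =
        (1 + s ^ 2) * cubeSum (x / √(1 + s ^ 2)) := by
      rw [cubeSum, Finset.mul_sum]
      simp only [mul_ite, mul_zero]
      rw [← Finset.sum_filter, ← Finset.sum_subset (s₁ := (Finset.range ⌈x / √(1 + s ^ 2)⌉₊).erase 0)
        (Finset.erase_subset _ _)]
      · refine Finset.sum_congr ?_ fun n _ => by ring
        ext n
        simp only [Finset.mem_filter, Finset.mem_Icc, Finset.mem_erase, Finset.mem_range, Nat.lt_ceil]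
        have key : 1 ≤ n → (1 + s ^ 2 < (x / n) ^ 2 ↔ (n : ℝ) < x / √(1 + s ^ 2)) := by
          intro hn
          have hn : (0 : ℝ) < n := by exact_mod_cast hn
          rw [lt_div_iff₀ (by positivity), ← Real.sqrt_lt' (by positivity), lt_div_iff₀ hn, mul_comm]
        constructor
        · rintro ⟨⟨a, b⟩, c⟩
          exact ⟨by omega, (key a).mp c⟩
        · rintro ⟨a, b⟩
          have a : 1 ≤ n := by omega
          exact ⟨⟨a, hM n (b.trans_le (div_le_self hx.le h1))⟩, (key a).mpr b⟩
      · intro n hn hn'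
        have : n = 0 := by
          by_contra h; exact hn' (Finset.mem_erase.mpr ⟨h, hn⟩)
        simp [this]
    rw [this, cubeErr, div_pow, show √(1 + s ^ 2) ^ 4 = (√(1 + s ^ 2) ^ 2) ^ 2 by ring,
      Real.sq_sqrt hw.le]
    field_simp; ring
  have e2 : ∀ n ∈ Finset.Icc 1 M, Integrable fun s : ℝ => (n : ℝ) ^ 3 *
      (if 1 + s ^ 2 < (x / n) ^ 2 then 1 + s ^ 2 else 0) := by
    intro n hn
    refine Integrable.const_mul ?_ _
    have hm : Measurable fun s : ℝ => if 1 + s ^ 2 < (x / n) ^ 2 then 1 + s ^ 2 else 0 :=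
      Measurable.ite (measurableSet_lt (by fun_prop) (by fun_prop)) (by fun_prop) (by fun_prop)
    refine ((integrable_one_add_sq (r := 1) (by norm_num)).const_mul ((x / n) ^ 4)).mono'
      hm.aestronglyMeasurable (Eventually.of_forall fun s => ?_)
    have hw : 0 < 1 + s ^ 2 := by positivity
    rw [Real.rpow_neg_one]
    split_ifs with h
    · rw [Real.norm_of_nonneg hw.le, ← div_eq_mul_inv, le_div_iff₀ hw]
      nlinarith
    · simp; positivity
  simp only [hI, ← integral_const_mul]
  rw [← integral_finsetSum _ e2]
  simp only [e1]
  rw [integral_add (integrable_inv_one_add_sq.const_mul _) (integrable_fibre hx), integral_const_mul,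
    integral_univ_inv_one_add_sq, vph]
  ring

end Cub

end

section

open MeasureTheory

namespace Cub

lemma integrableOn_strip {g : ℝ → ℝ} {T : Set ℝ} (hg : IntegrableOn g T) :
    IntegrableOn (fun z : ℝ × ℝ => g z.2) (Set.Ioo 0 1 ×ˢ T) := by
  have h1 : IntegrableOn (fun _ : ℝ => (1 : ℝ)) (Set.Ioo 0 1) := by simp
  have := Integrable.mul_prod h1 hg
  rw [Measure.prod_restrict] at this
  simpa [IntegrableOn, Measure.volume_eq_prod] using this

lemma integral_strip (g : ℝ → ℝ) (T : Set ℝ) :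
    ∫ z in Set.Ioo (0 : ℝ) 1 ×ˢ T, g z.2 = ∫ y in T, g y := by
  have := setIntegral_prod_mul (μ := volume) (ν := volume) (fun _ : ℝ => (1 : ℝ)) g (Set.Ioo 0 1) T
  simpa [Measure.volume_eq_prod] using this

lemma rOp_subset_strip : ROp ⊆ Set.Ioo (0 : ℝ) 1 ×ˢ Set.Ioi (3 / 4) := fun z hz => by
  refine ⟨⟨hz.1, hz.2.1⟩, ?_⟩
  have h0 := hz.1
  have h1 := hz.2.1
  have h2 := hz.2.2
  simp only [Set.mem_Ioi]; nlinarith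

lemma integrableOn_rOp {g : ℝ → ℝ} (hg : IntegrableOn g (Set.Ioi (3 / 4))) :
    IntegrableOn (fun z : ℝ × ℝ => g z.2) ROp :=
  (integrableOn_strip hg).mono_set rOp_subset_strip

lemma abs_integral_rOp_sub {g : ℝ → ℝ} (hg : IntegrableOn g (Set.Ioi 0)) :
    |(∫ z in ROp, g z.2) - ∫ y in Set.Ioi 0, g y| ≤ ∫ y in Set.Ioc 0 1, |g y| := by
  have hs : ROp ⊆ Set.Ioo (0 : ℝ) 1 ×ˢ Set.Ioi 0 := rOp_subset_strip.trans
    (Set.prod_mono subset_rfl (Set.Ioi_subset_Ioi (by norm_num)))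
  have hi := integrableOn_strip hg
  have hn := integrableOn_strip (g := fun y => |g y|) (T := Set.Ioc 0 1)
    (hg.mono_set Set.Ioc_subset_Ioi_self).abs
  rw [← integral_strip g, ← integral_strip (fun y => |g y|), abs_sub_comm,
    ← setIntegral_sdiff measurableSet_rOp hi hs, ← Real.norm_eq_abs]
  refine (norm_integral_le_integral_norm _).trans (setIntegral_mono_set hn
    (Eventually.of_forall fun z => abs_nonneg _) (LE.le.eventuallyLE ?_))
  rintro z ⟨⟨h1, h2⟩, h3⟩
  refine ⟨h1, h2, ?_⟩
  by_contra h
  push Not at h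
  exact h3 ⟨h1.1, h1.2, by nlinarith [sq_nonneg z.1]⟩

lemma integral_inner {c : ℝ} (hc : 0 < c) : ∫ y in Set.Ioi c, y ^ (-(3 / 2 : ℝ)) = 2 / √c := by
  rw [integral_Ioi_rpow_of_lt (by norm_num) hc, Real.sqrt_eq_rpow]
  norm_num
  rw [Real.rpow_neg hc.le]; ring

lemma integral_rOp_rpow : ∫ z in ROp, z.2 ^ (-(3 / 2 : ℝ)) = 2 * Real.pi / 3 := by
  have hi : IntegrableOn (fun z : ℝ × ℝ => z.2 ^ (-(3 / 2 : ℝ))) ROp :=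
    integrableOn_rOp (g := fun y => y ^ (-(3 / 2 : ℝ)))
      (integrableOn_Ioi_rpow_of_lt (by norm_num) (by norm_num))
  rw [← integral_indicator measurableSet_rOp, Measure.volume_eq_prod,
    integral_prod _ (by rw [← Measure.volume_eq_prod]; exact hi.integrable_indicator measurableSet_rOp)]
  have e1 : ∀ x : ℝ, ∫ y, ROp.indicator (fun z : ℝ × ℝ => z.2 ^ (-(3 / 2 : ℝ))) (x, y) =
      (Set.Ioo (0 : ℝ) 1).indicator (fun x => 4 * (1 / √(1 - (x / 2) ^ 2) * (1 / 2))) x := by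
    intro x
    by_cases hx : x ∈ Set.Ioo (0 : ℝ) 1
    · rw [Set.indicator_of_mem hx]
      have hc : 0 < 1 - (x / 2) ^ 2 := by nlinarith [hx.1, hx.2]
      rw [show 4 * (1 / √(1 - (x / 2) ^ 2) * (1 / 2)) = 2 / √(1 - (x / 2) ^ 2) by ring,
        ← integral_inner hc, ← integral_indicator measurableSet_Ioi]
      congr 1; ext y
      have : (x, y) ∈ ROp ↔ y ∈ Set.Ioi (1 - (x / 2) ^ 2) := by
        simp only [ROp, Set.mem_ofPred_eq, Set.mem_Ioi]
        constructor
        · rintro ⟨-, -, h⟩; linarith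
        · intro h; exact ⟨hx.1, hx.2, by linarith⟩
      by_cases h : (x, y) ∈ ROp
      · rw [Set.indicator_of_mem h, Set.indicator_of_mem (this.mp h)]
      · rw [Set.indicator_of_notMem h, Set.indicator_of_notMem (mt this.mpr h)]
    · rw [Set.indicator_of_notMem hx]
      have : ∀ y, ROp.indicator (fun z : ℝ × ℝ => z.2 ^ (-(3 / 2 : ℝ))) (x, y) = 0 := fun y =>
        Set.indicator_of_notMem (fun h => hx ⟨h.1, h.2.1⟩) _
      simp [this]
  simp only [e1]
  rw [integral_indicator measurableSet_Ioo, ← integral_Ioc_eq_integral_Ioo,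
    ← intervalIntegral.integral_of_le zero_le_one, intervalIntegral.integral_const_mul]
  have hd : ∀ x ∈ Set.uIcc (0 : ℝ) 1, HasDerivAt (fun x => Real.arcsin (x / 2))
      (1 / √(1 - (x / 2) ^ 2) * (1 / 2)) x := by
    intro x hx
    rw [Set.uIcc_of_le zero_le_one] at hx
    exact (Real.hasDerivAt_arcsin (x := x / 2) (by linarith [hx.1]) (by linarith [hx.2])).comp x
      ((hasDerivAt_id x).div_const 2)
  rw [intervalIntegral.integral_eq_sub_of_hasDerivAt hd]
  · have : Real.arcsin (1 / 2) = Real.pi / 6 := by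
      rw [← Real.sin_pi_div_six, Real.arcsin_sin] <;> linarith [Real.pi_pos]
    simp only [this]; simp; ring
  · refine ContinuousOn.intervalIntegrable fun x hx => ContinuousAt.continuousWithinAt ?_
    rw [Set.uIcc_of_le zero_le_one] at hx
    have hc : √(1 - (x / 2) ^ 2) ≠ 0 := (Real.sqrt_pos.mpr (by nlinarith [hx.1, hx.2])).ne'
    fun_prop (disch := assumption)

/-- The Mellin transform of `vph` at `-10/3`. -/
noncomputable def vphInt : ℝ := ∫ x in Set.Ioi 0, x ^ (-(13 / 3 : ℝ)) * vph x

lemma xs_eq {Y D : ℝ} (hY : 0 < Y) (hD : 0 < D) :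
    Xs Y D = (Y / 4) ^ ((1 : ℝ) / 4) * D ^ (-(3 / 4 : ℝ)) := by
  rw [Xs, show Y / (4 * D ^ 3) = (Y / 4) * (D ^ (3 : ℝ))⁻¹ by rw [Real.rpow_ofNat]; field_simp,
    Real.mul_rpow (by positivity) (by positivity), ← Real.rpow_neg hD.le, ← Real.rpow_mul hD.le]
  norm_num

/-- The secondary part of the fibre sum. -/
noncomputable def sec (Y : ℝ) (k : ℕ) (D : ℝ) : ℝ := D ^ ((3 : ℝ) / 2) * k ^ 3 * vph (Xs Y D / k)

lemma integral_sec {Y : ℝ} (hY : 0 < Y) {k : ℕ} (hk : 0 < k) :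
    ∫ D in Set.Ioi 0, sec Y k D =
      4 / 3 * (4 : ℝ) ^ (-(5 / 6 : ℝ)) * vphInt * Y ^ ((5 : ℝ) / 6) * (k : ℝ) ^ (-(1 / 3 : ℝ)) := by
  have hk : (0 : ℝ) < k := by exact_mod_cast hk
  set c : ℝ := (Y / 4) ^ ((1 : ℝ) / 4) / k with hc
  have hc0 : 0 < c := by positivity
  have e1 := integral_comp_mul_left_Ioi (fun x : ℝ => x ^ (-(13 / 3 : ℝ)) * vph x) 0 hc0
  have e2 := integral_comp_rpow_Ioi (fun y : ℝ => (c * y) ^ (-(13 / 3 : ℝ)) * vph (c * y))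
    (p := -(3 / 4)) (by norm_num)
  rw [e1, mul_zero, smul_eq_mul, ← vphInt] at e2
  have e3 : ∀ D ∈ Set.Ioi (0 : ℝ), sec Y k D = k ^ 3 * (4 / 3) * c ^ (13 / 3 : ℝ) *
      ((|(-(3 / 4 : ℝ))| * D ^ (-(3 / 4 : ℝ) - 1)) • ((c * D ^ (-(3 / 4 : ℝ))) ^ (-(13 / 3 : ℝ)) *
        vph (c * D ^ (-(3 / 4 : ℝ))))) := by
    intro D hD
    have hD : 0 < D := hD
    rw [sec, xs_eq hY hD, Real.mul_rpow hc0.le (by positivity), ← Real.rpow_mul hD.le,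
      show (Y / 4) ^ ((1 : ℝ) / 4) * D ^ (-(3 / 4 : ℝ)) / k = c * D ^ (-(3 / 4 : ℝ)) by rw [hc]; ring,
      Real.rpow_neg hc0.le, smul_eq_mul]
    have a1 : c ^ (13 / 3 : ℝ) ≠ 0 := by positivity
    have a2 : D ^ ((3 : ℝ) / 2) = D ^ (-(3 / 4 : ℝ) - 1) * D ^ (-(3 / 4 : ℝ) * -(13 / 3)) := by
      rw [← Real.rpow_add hD]; norm_num
    rw [a2, abs_neg, abs_of_pos (by norm_num)]
    field_simp
  rw [setIntegral_congr_fun measurableSet_Ioi e3, integral_const_mul, e2]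
  have b1 : c ^ (13 / 3 : ℝ) * c⁻¹ = (Y / 4) ^ ((5 : ℝ) / 6) * ((k : ℝ) ^ (10 / 3 : ℝ))⁻¹ := by
    rw [← Real.rpow_neg_one c, ← Real.rpow_add hc0, hc, Real.div_rpow (by positivity) hk.le,
      ← Real.rpow_mul (by positivity)]
    norm_num; rfl
  have b2 : (k : ℝ) ^ 3 * ((k : ℝ) ^ (10 / 3 : ℝ))⁻¹ = (k : ℝ) ^ (-(1 / 3 : ℝ)) := by
    rw [← Real.rpow_neg hk.le, ← Real.rpow_natCast, ← Real.rpow_add hk]; norm_num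
  have b3 : (Y / 4) ^ ((5 : ℝ) / 6) = Y ^ ((5 : ℝ) / 6) * (4 : ℝ) ^ (-(5 / 6 : ℝ)) := by
    rw [Real.div_rpow hY.le (by norm_num), Real.rpow_neg (by norm_num)]; rfl
  rw [← b2]
  linear_combination (k : ℝ) ^ 3 * (4 / 3) * vphInt * (b1 + b3 * ((k : ℝ) ^ (10 / 3 : ℝ))⁻¹)

lemma abs_sec_le {p A : ℝ} (hA : ∀ x, 0 < x → |vph x| ≤ A * x ^ p) (hA0 : 0 ≤ A)
    (hp : 3 < p) {Y : ℝ} (hY : 0 < Y) {k : ℕ} (hk : 0 < k) {D : ℝ} (hD : 0 < D) :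
    |sec Y k D| ≤ A * Y ^ (p / 4) * D ^ (3 / 2 - 3 / 4 * p) := by
  have hk1 : (1 : ℝ) ≤ k := by exact_mod_cast hk
  have hk : (0 : ℝ) < k := by exact_mod_cast hk
  have hX := xs_pos hY hD
  have h1 := hA (Xs Y D / k) (by positivity)
  rw [sec, abs_mul, abs_of_pos (by positivity : 0 < D ^ ((3 : ℝ) / 2) * (k : ℝ) ^ 3)]
  have h2 : (Xs Y D / k) ^ p * (k : ℝ) ^ 3 ≤ Y ^ (p / 4) * D ^ (-(3 / 4) * p) := by
    rw [Real.div_rpow hX.le hk.le, xs_eq hY hD, Real.mul_rpow (by positivity) (by positivity),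
      ← Real.rpow_mul (by positivity), ← Real.rpow_mul (by positivity)]
    have a1 : (k : ℝ) ^ 3 ≤ (k : ℝ) ^ p := by
      rw [← Real.rpow_natCast]; exact Real.rpow_le_rpow_of_exponent_le hk1 (by norm_num; linarith)
    have a2 : (Y / 4) ^ (1 / 4 * p) ≤ Y ^ (p / 4) := by
      rw [show 1 / 4 * p = p / 4 by ring]
      exact Real.rpow_le_rpow (by positivity) (by linarith) (by linarith)
    rw [div_mul_eq_mul_div, div_le_iff₀ (by positivity)]
    gcongr
  calc _ ≤ D ^ ((3 : ℝ) / 2) * k ^ 3 * (A * (Xs Y D / k) ^ p) := by gcongr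
    _ = A * D ^ ((3 : ℝ) / 2) * ((Xs Y D / k) ^ p * (k : ℝ) ^ 3) := by ring
    _ ≤ A * D ^ ((3 : ℝ) / 2) * (Y ^ (p / 4) * D ^ (-(3 / 4) * p)) := by gcongr
    _ = A * Y ^ (p / 4) * (D ^ ((3 : ℝ) / 2) * D ^ (-(3 / 4) * p)) := by ring
    _ = _ := by rw [← Real.rpow_add hD]; congr 2; ring

lemma measurable_sec (Y : ℝ) (k : ℕ) : Measurable (sec Y k) := by
  unfold sec
  refine Measurable.mul (by fun_prop) (measurable_vph.comp ?_)
  unfold Xs; fun_prop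

lemma integrableOn_sec {Y : ℝ} (hY : 0 < Y) {k : ℕ} (hk : 0 < k) :
    IntegrableOn (sec Y k) (Set.Ioi 0) := by
  obtain ⟨A, hA0, hA⟩ := abs_vph_le (p := 19 / 6) (by norm_num) (by norm_num)
  obtain ⟨A', hA0', hA'⟩ := abs_vph_le (p := 4) (by norm_num) (by norm_num)
  rw [← Set.Ioc_union_Ioi_eq_Ioi zero_le_one]
  refine IntegrableOn.union ?_ ?_
  · have : IntegrableOn (fun D : ℝ => D ^ (3 / 2 - 3 / 4 * (19 / 6) : ℝ)) (Set.Ioc 0 1) :=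
      (intervalIntegral.intervalIntegrable_rpow' (by norm_num)).1
    refine Integrable.mono' (this.const_mul (A * Y ^ (19 / 6 / 4 : ℝ)))
      (measurable_sec Y k).aestronglyMeasurable ?_
    filter_upwards [self_mem_ae_restrict measurableSet_Ioc] with D hD
    exact abs_sec_le hA hA0 (by norm_num) hY hk hD.1
  · have : IntegrableOn (fun D : ℝ => D ^ (3 / 2 - 3 / 4 * 4 : ℝ)) (Set.Ioi 1) :=
      integrableOn_Ioi_rpow_of_lt (by norm_num) (by norm_num)
    refine Integrable.mono' (this.const_mul (A' * Y ^ (4 / 4 : ℝ)))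
      (measurable_sec Y k).aestronglyMeasurable ?_
    filter_upwards [self_mem_ae_restrict measurableSet_Ioi] with D hD
    exact abs_sec_le hA' hA0' (by norm_num) hY hk (zero_lt_one.trans hD)

lemma integral_rOp_sec : ∃ C : ℝ, 0 ≤ C ∧ ∀ Y : ℝ, 0 < Y → ∀ k : ℕ, 0 < k →
    |(∫ z in ROp, sec Y k z.2) - ∫ D in Set.Ioi 0, sec Y k D| ≤ C * Y ^ ((19 : ℝ) / 24) := by
  obtain ⟨A, hA0, hA⟩ := abs_vph_le (p := 19 / 6) (by norm_num) (by norm_num)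
  refine ⟨A * 8, by positivity, fun Y hY k hk => ?_⟩
  refine (abs_integral_rOp_sub (integrableOn_sec hY hk)).trans ?_
  have h1 : IntegrableOn (fun D : ℝ => D ^ (-(7 / 8) : ℝ)) (Set.Ioc 0 1) :=
    (intervalIntegral.intervalIntegrable_rpow' (by norm_num)).1
  calc ∫ D in Set.Ioc 0 1, |sec Y k D| ≤
      ∫ D in Set.Ioc 0 1, A * Y ^ ((19 : ℝ) / 24) * D ^ (-(7 / 8) : ℝ) := by
        refine setIntegral_mono_on ((integrableOn_sec hY hk).mono_set Set.Ioc_subset_Ioi_self).abs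
          (h1.const_mul _) measurableSet_Ioc fun D hD => ?_
        have := abs_sec_le hA hA0 (by norm_num) hY hk hD.1
        norm_num at this ⊢; exact this
    _ = _ := by
        rw [integral_const_mul, ← intervalIntegral.integral_of_le zero_le_one,
          integral_rpow (Or.inl (by norm_num))]
        norm_num; ring

end Cub

end

section

open MeasureTheory

namespace Cub

lemma fibre_sum {Y : ℝ} (hY : 1 ≤ Y) {k : ℕ} (hk : 0 < k) {z : ℝ × ℝ} (hz : z ∈ ROp) :
    |∑ n ∈ Finset.Icc 1 (Nc Y / k), ∑ b ∈ JB (Nc Y), dens ((k * n : ℕ) : ℝ) (b : ℤ) Y z -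
      (Real.pi * Y / (16 * k) * z.2 ^ (-(3 / 2 : ℝ)) + sec Y k z.2)| ≤
      6 * Y ^ ((3 : ℝ) / 4) * z.2 ^ (-(5 / 4 : ℝ)) := by
  obtain ⟨B, D⟩ := z
  have hz' := rOp_subset hz
  have hD : 3 / 4 ≤ D := pos_of_mem_rCl hz'
  have hD0 : 0 < D := by linarith
  have hY0 : 0 < Y := by linarith
  set N := Nc Y with hN
  set X := Xs Y D with hX
  have hX0 : 0 < X := xs_pos hY0 hD0
  have hX4 : X ^ 4 = Y / (4 * D ^ 3) := xs_pow hY0 hD0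
  have hkR : (0 : ℝ) < k := by exact_mod_cast hk
  have hk1 : (1 : ℝ) ≤ k := by exact_mod_cast hk
  have hYN : Y ≤ (N : ℝ) ^ 4 := le_nc_pow hY0.le
  have hD3 : 1 ≤ 4 * D ^ 3 := by
    have : (3 / 4 : ℝ) ^ 3 ≤ D ^ 3 := by gcongr
    norm_num at this; linarith
  have hXN : X ≤ N := by
    refine le_of_pow_le_pow_left₀ (n := 4) (by norm_num) (by positivity) ?_
    rw [hX4]; exact (div_le_self hY0.le hD3).trans hYN
  have key : ∀ n ∈ Finset.Icc 1 (N / k), |∑ b ∈ JB N, dens ((k * n : ℕ) : ℝ) (b : ℤ) Y (B, D) -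
      D ^ ((3 : ℝ) / 2) * k ^ 3 * ((n : ℝ) ^ 3 * hI (X / k / n))| ≤
      if n ∈ Finset.Icc 1 ⌊X⌋₊ then 6 * (D * X ^ 2) else 0 := by
    intro n hn
    have hn1 : 1 ≤ n := (Finset.mem_Icc.mp hn).1
    have hnR : (0 : ℝ) < n := by exact_mod_cast hn1
    have ha : (0 : ℝ) < ((k * n : ℕ) : ℝ) := by push_cast; positivity
    have h1 := sum_dens ha (B := B) hY0 hD0 (J := JB N) (by
      intro b hb
      have hlt : ndc ((k * n : ℕ) : ℝ) b (B, D) < Y := by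
        by_contra h; exact hb (by unfold dens; rw [if_neg h])
      obtain ⟨-, i2, -, -⟩ := BCF.red_ineq (a := ((k * n : ℕ) : ℝ)) (B := B)
        (t := 3 / 2 * B - b / ((k * n : ℕ) : ℝ)) hz'.1 hz'.2.1 hD
      have e0 : ((k * n : ℕ) : ℝ) ^ 4 * (4 * D) * ((3 / 2 * B - b / ((k * n : ℕ) : ℝ)) ^ 2 + D) ^ 2 =
          ndc ((k * n : ℕ) : ℝ) b (B, D) := by simp only [ndc, qd]; ring
      have e1 : ((k * n : ℕ) : ℝ) * (B - (3 / 2 * B - b / ((k * n : ℕ) : ℝ) - B / 2)) = b := by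
        field_simp; ring
      rw [e0, e1] at i2
      have h4 : (b : ℝ) ^ 4 ≤ (2 * N : ℝ) ^ 4 := by
        rw [mul_pow]; nlinarith
      have h5 : |(b : ℝ)| ≤ 2 * N := by
        refine le_of_pow_le_pow_left₀ (n := 4) (by norm_num) (by positivity) ?_
        rwa [Even.pow_abs (by decide)]
      have h6 : |b| ≤ 2 * (N : ℤ) := by exact_mod_cast h5
      exact Finset.mem_Icc.mpr (abs_le.mp h6))
    have e2 : ((k * n : ℕ) : ℝ) ^ 3 * D ^ ((3 : ℝ) / 2) * hI (Xs Y D / ((k * n : ℕ) : ℝ)) =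
        D ^ ((3 : ℝ) / 2) * k ^ 3 * ((n : ℝ) ^ 3 * hI (X / k / n)) := by
      push_cast; rw [div_div]; ring
    rw [e2] at h1
    refine h1.trans ?_
    by_cases hlt : ((k * n : ℕ) : ℝ) < Xs Y D
    · rw [if_pos hlt, if_pos]
      refine Finset.mem_Icc.mpr ⟨hn1, Nat.le_floor ?_⟩
      push_cast at hlt
      nlinarith
    · rw [if_neg hlt, mul_zero]
      split_ifs
      · positivity
      · exact le_rfl
  have hsum := sum_cube_hI (x := X / k) (by positivity) (M := N / k) (by
    intro n hn
    rw [Nat.le_div_iff_mul_le hk]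
    have h1 := (lt_div_iff₀ hkR).mp hn
    have h2 : (n : ℝ) * k ≤ N := h1.le.trans hXN
    exact_mod_cast h2)
  have e3 : Real.pi * Y / (16 * k) * D ^ (-(3 / 2 : ℝ)) + sec Y k D =
      ∑ n ∈ Finset.Icc 1 (N / k), D ^ ((3 : ℝ) / 2) * k ^ 3 * ((n : ℝ) ^ 3 * hI (X / k / n)) := by
    rw [← Finset.mul_sum, hsum, sec, div_pow, hX4]
    have : D ^ (-(3 / 2 : ℝ)) = D ^ ((3 : ℝ) / 2) / D ^ 3 := by
      rw [← Real.rpow_natCast D 3, ← Real.rpow_sub hD0]; norm_num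
    rw [this]
    field_simp
    ring
  simp only
  rw [e3, ← Finset.sum_sub_distrib]
  refine (Finset.abs_sum_le_sum_abs _ _).trans ((Finset.sum_le_sum key).trans ?_)
  rw [← Finset.sum_filter, Finset.sum_const, nsmul_eq_mul]
  have hcard : ((((Finset.Icc 1 (N / k)).filter fun n => n ∈ Finset.Icc 1 ⌊X⌋₊).card : ℕ) : ℝ) ≤ X := by
    have h1 := Finset.card_le_card (s := (Finset.Icc 1 (N / k)).filter fun n => n ∈ Finset.Icc 1 ⌊X⌋₊)
      (t := Finset.Icc 1 ⌊X⌋₊) (fun n hn => (Finset.mem_filter.mp hn).2)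
    rw [Nat.card_Icc, Nat.add_sub_cancel] at h1
    exact (Nat.cast_le.mpr h1).trans (Nat.floor_le hX0.le)
  have e4 : D * X ^ 3 ≤ Y ^ ((3 : ℝ) / 4) * D ^ (-(5 / 4 : ℝ)) := by
    rw [hX, xs_eq hY0 hD0, mul_pow, ← Real.rpow_natCast, ← Real.rpow_natCast, ← Real.rpow_mul (by positivity),
      ← Real.rpow_mul hD0.le]
    have a1 : (Y / 4) ^ ((1 : ℝ) / 4 * ((3 : ℕ) : ℝ)) ≤ Y ^ ((3 : ℝ) / 4) := by
      norm_num
      exact Real.rpow_le_rpow (by positivity) (by linarith) (by norm_num)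
    have a2 : D * D ^ (-(3 / 4 : ℝ) * ((3 : ℕ) : ℝ)) = D ^ (-(5 / 4 : ℝ)) := by
      nth_rewrite 1 [← Real.rpow_one D]
      rw [← Real.rpow_add hD0]; norm_num
    rw [← a2]
    calc _ = (Y / 4) ^ ((1 : ℝ) / 4 * ((3 : ℕ) : ℝ)) * (D * D ^ (-(3 / 4 : ℝ) * ((3 : ℕ) : ℝ))) := by ring
      _ ≤ _ := by gcongr
  calc _ ≤ X * (6 * (D * X ^ 2)) := by gcongr
    _ = 6 * (D * X ^ 3) := by ring
    _ ≤ 6 * (Y ^ ((3 : ℝ) / 4) * D ^ (-(5 / 4 : ℝ))) := by gcongr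
    _ = _ := by ring

lemma prod_dl {K : Finset ℕ} (hK : ∀ p ∈ K, p.Prime) (a : ℕ) :
    ∏ p ∈ K, dl p a = if (∏ p ∈ K, p) ∣ a then 1 else 0 := by
  have h : ∏ p ∈ K, dl p a = if ∀ p ∈ K, p ∣ a then 1 else 0 := by
    simp only [dl, Int.natCast_dvd_natCast]
    split_ifs with h
    · exact Finset.prod_eq_one fun p hp => if_pos (h p hp)
    · push Not at h
      obtain ⟨p, hp, h⟩ := h
      exact Finset.prod_eq_zero hp (if_neg h)
  have h2 : (∏ p ∈ K, p) ∣ a ↔ ∀ p ∈ K, p ∣ a :=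
    ⟨fun h p hp => (Finset.dvd_prod_of_mem _ hp).trans h,
      fun h => Finset.prod_primes_dvd a (fun p hp => (hK p hp).prime) h⟩
  rw [h]; simp only [h2]

lemma sum_dvd (k N : ℕ) (hk : 0 < k) (f : ℕ → ℝ) :
    ∑ a ∈ Finset.Icc 1 N, (if k ∣ a then 1 else 0) * f a =
      ∑ n ∈ Finset.Icc 1 (N / k), f (k * n) := by
  simp only [ite_mul, one_mul, zero_mul]
  rw [← Finset.sum_filter]
  symm
  refine Finset.sum_nbij (fun n => k * n) (fun n hn => ?_) (fun a _ b _ h => Nat.eq_of_mul_eq_mul_left hk h)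
    (fun a ha => ?_) (fun _ _ => rfl)
  · obtain ⟨h1, h2⟩ := Finset.mem_Icc.mp hn
    rw [Nat.le_div_iff_mul_le hk, mul_comm] at h2
    exact Finset.mem_filter.mpr ⟨Finset.mem_Icc.mpr ⟨Nat.mul_pos hk h1, h2⟩, dvd_mul_right _ _⟩
  · obtain ⟨h1, n, rfl⟩ := Finset.mem_filter.mp (Finset.mem_coe.mp ha)
    obtain ⟨h1, h2⟩ := Finset.mem_Icc.mp h1
    refine ⟨n, Finset.mem_coe.mpr (Finset.mem_Icc.mpr ⟨Nat.pos_of_mul_pos_left h1, ?_⟩), rfl⟩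
    rwa [Nat.le_div_iff_mul_le hk, mul_comm]

/-- The leading constant of the counting function. -/
noncomputable def kap : ℝ := Real.pi ^ 2 / 24

/-- The secondary constant of the counting function. -/
noncomputable def kap2 : ℝ := 4 / 3 * (4 : ℝ) ^ (-(5 / 6 : ℝ)) * vphInt

lemma mainH_asymp : ∃ C : ℝ, 0 ≤ C ∧ ∀ K : Finset ℕ, (∀ p ∈ K, p.Prime) → ∀ Y : ℝ, 1 ≤ Y →
    |mainH Y K - (kap * Y / ((∏ p ∈ K, p : ℕ) : ℝ) +
      kap2 * Y ^ ((5 : ℝ) / 6) * ((∏ p ∈ K, p : ℕ) : ℝ) ^ (-(1 / 3 : ℝ)))| ≤ C * Y ^ ((19 : ℝ) / 24) := by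
  obtain ⟨C, hC0, hC⟩ := integral_rOp_sec
  set I := ∫ z in ROp, z.2 ^ (-(5 / 4 : ℝ)) with hI
  have i5 : IntegrableOn (fun z : ℝ × ℝ => z.2 ^ (-(5 / 4 : ℝ))) ROp :=
    integrableOn_rOp (g := fun y => y ^ (-(5 / 4 : ℝ)))
      (integrableOn_Ioi_rpow_of_lt (by norm_num) (by norm_num))
  have i3 : IntegrableOn (fun z : ℝ × ℝ => z.2 ^ (-(3 / 2 : ℝ))) ROp :=
    integrableOn_rOp (g := fun y => y ^ (-(3 / 2 : ℝ)))
      (integrableOn_Ioi_rpow_of_lt (by norm_num) (by norm_num))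
  have hI0 : 0 ≤ I := setIntegral_nonneg measurableSet_rOp fun z hz => by
    have := pos_of_mem_rCl (rOp_subset hz)
    positivity
  refine ⟨C + 6 * I, by positivity, fun K hK Y hY => ?_⟩
  have hY0 : 0 < Y := by linarith
  have hk : 0 < ∏ p ∈ K, p := Finset.prod_pos fun p hp => (hK p hp).pos
  set k := ∏ p ∈ K, p with hkdef
  have hkR : (0 : ℝ) < k := by exact_mod_cast hk
  have ia : ∀ n ∈ Finset.Icc 1 (Nc Y / k), ∀ b ∈ JB (Nc Y),
      IntegrableOn (dens ((k * n : ℕ) : ℝ) (b : ℤ) Y) ROp := fun n hn b _ =>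
    integrableOn_dens (by exact_mod_cast Nat.mul_pos hk (Finset.mem_Icc.mp hn).1) b Y
  have ib : IntegrableOn (fun z => ∑ n ∈ Finset.Icc 1 (Nc Y / k), ∑ b ∈ JB (Nc Y),
      dens ((k * n : ℕ) : ℝ) (b : ℤ) Y z) ROp :=
    integrable_finsetSum _ fun n hn => integrable_finsetSum _ fun b hb => ia n hn b hb
  have is : IntegrableOn (fun z : ℝ × ℝ => sec Y k z.2) ROp :=
    integrableOn_rOp ((integrableOn_sec hY0 hk).mono_set (Set.Ioi_subset_Ioi (by norm_num)))
  have e1 : mainH Y K = ∫ z in ROp, ∑ n ∈ Finset.Icc 1 (Nc Y / k), ∑ b ∈ JB (Nc Y),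
      dens ((k * n : ℕ) : ℝ) (b : ℤ) Y z := by
    unfold mainH
    simp only [prod_dl hK]
    rw [sum_dvd _ _ hk, integral_finsetSum _ fun n hn => integrable_finsetSum _ fun b hb => ia n hn b hb]
    refine Finset.sum_congr rfl fun n hn => ?_
    rw [integral_finsetSum _ fun b hb => ia n hn b hb]
    refine Finset.sum_congr rfl fun b hb => ?_
    exact area_eq (by exact_mod_cast Nat.mul_pos hk (Finset.mem_Icc.mp hn).1) b Y
  have e2 : ∫ z in ROp, (Real.pi * Y / (16 * k) * z.2 ^ (-(3 / 2 : ℝ)) + sec Y k z.2) =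
      kap * Y / k + ∫ z in ROp, sec Y k z.2 := by
    rw [integral_add (i3.const_mul _) is, integral_const_mul, integral_rOp_rpow, kap]
    field_simp; ring
  have e3 : |mainH Y K - ∫ z in ROp, (Real.pi * Y / (16 * k) * z.2 ^ (-(3 / 2 : ℝ)) + sec Y k z.2)| ≤
      6 * Y ^ ((3 : ℝ) / 4) * I := by
    have ic : IntegrableOn (fun z : ℝ × ℝ => Real.pi * Y / (16 * k) * z.2 ^ (-(3 / 2 : ℝ)) +
        sec Y k z.2) ROp := (i3.const_mul _).add is
    rw [e1, ← integral_sub ib ic, hI, ← integral_const_mul, ← Real.norm_eq_abs]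
    refine norm_integral_le_of_norm_le (i5.const_mul _) ?_
    filter_upwards [self_mem_ae_restrict measurableSet_rOp] with z hz
    exact fibre_sum hY hk hz
  have e4 := hC Y hY0 k hk
  rw [integral_sec hY0 hk, ← kap2] at e4
  have e5 : Y ^ ((3 : ℝ) / 4) ≤ Y ^ ((19 : ℝ) / 24) :=
    Real.rpow_le_rpow_of_exponent_le hY (by norm_num)
  rw [e2] at e3
  have e6 : 6 * Y ^ ((3 : ℝ) / 4) * I ≤ 6 * I * Y ^ ((19 : ℝ) / 24) := by
    rw [mul_right_comm]; gcongr
  rw [abs_le] at *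
  constructor <;> linarith [e3.1, e3.2, e4.1, e4.2]

end Cub

end

section

open MeasureTheory

namespace Cub

section
open Complex

/-- The local terms in the continuation of `(s - 1) ζ(s)`. -/
noncomputable def zt (n : ℕ) (s : ℂ) : ℂ :=
  (s - 1) * ((n : ℂ) + 1) ^ (-s) + ((n : ℂ) + 2) ^ (1 - s) - ((n : ℂ) + 1) ^ (1 - s)

lemma norm_cpow_sub_le {m t : ℝ} (hm : 0 < m) (ht : 0 ≤ t) {s : ℂ} (hs : 0 ≤ s.re) :
    ‖((m + t : ℝ) : ℂ) ^ (-s) - (m : ℂ) ^ (-s)‖ ≤ ‖s‖ * m ^ (-s.re - 1) * t := by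
  have hd : ∀ x ∈ Set.Icc m (m + t), HasDerivWithinAt (fun x : ℝ => (x : ℂ) ^ (-s))
      (-s * (x : ℂ) ^ (-s - 1)) (Set.Icc m (m + t)) x := by
    intro x hx
    have hx0 : 0 < x := hm.trans_le hx.1
    by_cases h : s = 0
    · subst h; simpa using hasDerivWithinAt_const x _ (1 : ℂ)
    · have a1 := (hasDerivAt_ofReal_cpow_const' hx0.ne' (r := -s - 1) (by
        intro h'; exact h (by linear_combination -h'))).const_mul (-s)
      have a3 : (fun y : ℝ => -s * ((y : ℂ) ^ (-s - 1 + 1) / (-s - 1 + 1))) =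
          fun y : ℝ => (y : ℂ) ^ (-s) := by
        ext y
        rw [show -s - 1 + 1 = -s by ring, mul_div_cancel₀ _ (neg_ne_zero.mpr h)]
      rw [a3] at a1
      exact a1.hasDerivWithinAt
  have := (convex_Icc m (m + t)).norm_image_sub_le_of_norm_hasDerivWithin_le
    (C := ‖s‖ * m ^ (-s.re - 1)) hd (fun x hx => by
      have hx0 : 0 < x := hm.trans_le hx.1
      rw [norm_mul, norm_neg, norm_cpow_eq_rpow_re_of_pos hx0]
      gcongr
      simp only [sub_re, neg_re, one_re]
      exact Real.rpow_le_rpow_of_nonpos hm hx.1 (by linarith))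
    (Set.left_mem_Icc.mpr (by linarith)) (Set.right_mem_Icc.mpr (by linarith))
  simpa [abs_of_nonneg ht] using this

lemma norm_zt_le (n : ℕ) {s : ℂ} (hs : 0 ≤ s.re) :
    ‖zt n s‖ ≤ ‖s - 1‖ * (‖s‖ * ((n : ℝ) + 1) ^ (-s.re - 1)) := by
  set m : ℝ := (n : ℝ) + 1 with hmdef
  have hm : 0 < m := by positivity
  have hm' : ((n : ℂ) + 1) = (m : ℂ) := by simp [hmdef]
  by_cases h1 : s = 1
  · simp [zt, h1]
  have h1' : 1 - s ≠ 0 := sub_ne_zero.mpr (Ne.symm h1)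
  have hd : ∀ t ∈ Set.Icc (0 : ℝ) 1, HasDerivWithinAt
      (fun t : ℝ => (s - 1) * (m : ℂ) ^ (-s) * t + ((m + t : ℝ) : ℂ) ^ (1 - s))
      ((1 - s) * (((m + t : ℝ) : ℂ) ^ (-s) - (m : ℂ) ^ (-s))) (Set.Icc 0 1) t := by
    intro t ht
    have hx : m + t ≠ 0 := (add_pos_of_pos_of_nonneg hm ht.1).ne'
    have a1 : HasDerivAt (fun t : ℝ => (s - 1) * (m : ℂ) ^ (-s) * t) ((s - 1) * (m : ℂ) ^ (-s)) t := by
      simpa using (ofRealCLM.hasDerivAt (x := t)).const_mul ((s - 1) * (m : ℂ) ^ (-s))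
    have a2 := ((hasDerivAt_ofReal_cpow_const' hx (r := -s) (by
      intro h'; exact h1 (by linear_combination -h'))).comp_const_add m t).const_mul (1 - s)
    have a3 : (fun t : ℝ => (1 - s) * (((m + t : ℝ) : ℂ) ^ (-s + 1) / (-s + 1))) =
        fun t : ℝ => ((m + t : ℝ) : ℂ) ^ (1 - s) := by
      ext t
      rw [show -s + 1 = 1 - s by ring]; field_simp
    rw [a3] at a2
    exact ((a1.add a2).congr_deriv (by ring)).hasDerivWithinAt
  have := (convex_Icc (0 : ℝ) 1).norm_image_sub_le_of_norm_hasDerivWithin_le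
    (C := ‖s - 1‖ * (‖s‖ * m ^ (-s.re - 1))) hd (fun t ht => by
      rw [norm_mul, norm_sub_rev 1 s]
      gcongr
      refine (norm_cpow_sub_le hm ht.1 hs).trans (mul_le_of_le_one_right (by positivity) ht.2))
    (Set.left_mem_Icc.mpr zero_le_one) (Set.right_mem_Icc.mpr zero_le_one)
  have e : ((m + 1 : ℝ) : ℂ) = (n : ℂ) + 2 := by simp [hmdef]; ring
  simp only [e] at this
  simp only [zt, hm']
  simpa [sub_eq_add_neg, add_assoc] using this

/-- The region on which the continuation is used. -/
def zU : Set ℂ := {s | 1 / 4 < s.re} ∩ Metric.ball 0 4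

lemma norm_zt_le_of_mem (n : ℕ) {s : ℂ} (hs : s ∈ zU) :
    ‖zt n s‖ ≤ 5 * (4 * ((n : ℝ) + 1) ^ (-(5 / 4 : ℝ))) := by
  have h1 : 1 / 4 < s.re := hs.1
  have h2 : ‖s‖ < 4 := by simpa using hs.2
  have h3 : ‖s - 1‖ ≤ 5 := (norm_sub_le _ _).trans (by rw [norm_one]; linarith)
  refine (norm_zt_le n (by linarith)).trans ?_
  gcongr
  · linarith
  · linarith

lemma summable_zt_bound : Summable fun n : ℕ => 5 * (4 * ((n : ℝ) + 1) ^ (-(5 / 4 : ℝ))) := by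
  have := (summable_nat_add_iff 1).mpr (Real.summable_nat_rpow.mpr (by norm_num : (-(5 / 4 : ℝ)) < -1))
  push_cast at this
  exact (this.mul_left 4).mul_left 5

lemma isOpen_zU : IsOpen zU :=
  (isOpen_lt continuous_const continuous_re).inter Metric.isOpen_ball

lemma differentiable_zt (n : ℕ) : Differentiable ℂ (zt n) := by
  have h1 : ((n : ℂ) + 1) ≠ 0 := Nat.cast_add_one_ne_zero n
  have h2 : ((n : ℂ) + 2) ≠ 0 := by exact_mod_cast (by omega : n + 2 ≠ 0)
  unfold zt
  refine Differentiable.sub (Differentiable.add (Differentiable.mul (by fun_prop) ?_) ?_) ?_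
  · exact (differentiable_id.neg).const_cpow (Or.inl h1)
  · exact (differentiable_id.const_sub 1).const_cpow (Or.inl h2)
  · exact (differentiable_id.const_sub 1).const_cpow (Or.inl h1)

lemma sum_zt (s : ℂ) (N : ℕ) : ∑ n ∈ Finset.range N, zt n s =
    (s - 1) * ∑ n ∈ Finset.range N, ((n : ℂ) + 1) ^ (-s) + ((N : ℂ) + 1) ^ (1 - s) - 1 := by
  induction N with
  | zero => simp
  | succ k ih =>
    rw [Finset.sum_range_succ, Finset.sum_range_succ, ih, zt]
    push_cast
    rw [show (k : ℂ) + 1 + 1 = k + 2 by ring]; ring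

lemma tsum_zt {s : ℂ} (hs : s ∈ zU) (h1 : 1 < s.re) : (s - 1) * riemannZeta s = 1 + ∑' n, zt n s := by
  have a1 := (Summable.of_norm_bounded summable_zt_bound fun n => norm_zt_le_of_mem n hs).hasSum.tendsto_sum_nat
  have a2 : HasSum (fun n : ℕ => ((n : ℂ) + 1) ^ (-s)) (riemannZeta s) := by
    rw [zeta_eq_tsum_one_div_nat_add_one_cpow h1]
    have : Summable fun n : ℕ => 1 / ((n : ℂ) + 1) ^ s := by
      have := (summable_nat_add_iff 1).mpr (Complex.summable_one_div_nat_cpow.mpr h1)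
      simpa using this
    simpa [cpow_neg] using this.hasSum
  have a3 : Tendsto (fun N : ℕ => ((N : ℂ) + 1) ^ (1 - s)) atTop (𝓝 0) := by
    rw [tendsto_zero_iff_norm_tendsto_zero]
    have : ∀ N : ℕ, ‖((N : ℂ) + 1) ^ (1 - s)‖ = ((N : ℝ) + 1) ^ (-(s.re - 1)) := by
      intro N
      have := norm_cpow_eq_rpow_re_of_pos (x := (N : ℝ) + 1) (by positivity) (1 - s)
      push_cast at this
      rw [this]; simp
    simp only [this]
    exact (tendsto_rpow_neg_atTop (by linarith)).comp
      (tendsto_atTop_add_const_right _ _ tendsto_natCast_atTop_atTop)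
  have a4 := ((a2.tendsto_sum_nat.const_mul (s - 1)).add a3).sub_const 1
  simp only [← sum_zt] at a4
  have := tendsto_nhds_unique a1 a4
  rw [this]; ring

lemma zeta_continuation {s : ℂ} (hs : s ∈ zU) (h1 : s ≠ 1) :
    (s - 1) * riemannZeta s = 1 + ∑' n, zt n s := by
  have d1 : DifferentiableOn ℂ (fun s => 1 + ∑' n, zt n s) zU :=
    (differentiableOn_const _).add (differentiableOn_tsum_of_summable_norm summable_zt_bound
      (fun n => (differentiable_zt n).differentiableOn) isOpen_zU fun n w hw => norm_zt_le_of_mem n hw)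
  have d2 : DifferentiableOn ℂ riemannZeta₁ zU := differentiable_riemannZeta₁.differentiableOn
  have hc : IsPreconnected zU :=
    ((convex_halfSpace_re_gt _).inter (convex_ball 0 4)).isPreconnected
  have e : ∀ s, s ≠ 1 → riemannZeta₁ s = (s - 1) * riemannZeta s := by
    intro s h
    have := sub_ne_zero.mpr h
    rw [riemannZeta_eq_inv_sub_mul h]; field_simp
  have h2 : (2 : ℂ) ∈ zU := by constructor <;> simp <;> norm_num
  have ev : riemannZeta₁ =ᶠ[𝓝 2] fun s => 1 + ∑' n, zt n s := by
    have : {s : ℂ | 1 < s.re} ∩ zU ∈ 𝓝 (2 : ℂ) :=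
      ((isOpen_lt continuous_const continuous_re).inter isOpen_zU).mem_nhds ⟨by simp, h2⟩
    filter_upwards [this] with s hs
    rw [e s (fun h => by have := hs.1; simp [h] at this), tsum_zt hs.2 hs.1]
  rw [← e s h1]
  exact (d2.analyticOnNhd isOpen_zU).eqOn_of_preconnected_of_eventuallyEq (d1.analyticOnNhd isOpen_zU)
    hc h2 ev hs

lemma tendsto_zeta_third : Tendsto (fun N : ℕ => ∑ n ∈ Finset.range N, ((n : ℝ) + 1) ^ (-(1 / 3 : ℝ)) -
    3 / 2 * ((N : ℝ) + 1) ^ (2 / 3 : ℝ)) atTop (𝓝 (riemannZeta (1 / 3)).re) := by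
  have hs : (1 / 3 : ℂ) ∈ zU := by
    constructor
    · simp; norm_num
    · simp; norm_num
  have a1 := (Summable.of_norm_bounded summable_zt_bound fun n => norm_zt_le_of_mem n hs).hasSum.tendsto_sum_nat
  have a2 := zeta_continuation hs (by norm_num)
  have a3 := ((a1.const_add 1).const_mul (-(3 / 2) : ℂ))
  rw [← a2] at a3
  have a4 := (continuous_re.tendsto _).comp a3
  rw [show -(3 / 2 : ℂ) * ((1 / 3 - 1) * riemannZeta (1 / 3)) = riemannZeta (1 / 3) by ring] at a4
  refine a4.congr fun N => ?_
  simp only [Function.comp_apply]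
  rw [sum_zt]
  have c1 : ∀ n : ℕ, ((n : ℂ) + 1) ^ (-(1 / 3) : ℂ) = ((((n : ℝ) + 1) ^ (-(1 / 3 : ℝ)) : ℝ) : ℂ) := by
    intro n; rw [ofReal_cpow (by positivity)]; push_cast; rfl
  have c2 : ((N : ℂ) + 1) ^ (1 - 1 / 3 : ℂ) = ((((N : ℝ) + 1) ^ (2 / 3 : ℝ) : ℝ) : ℂ) := by
    rw [ofReal_cpow (by positivity)]; push_cast; norm_num
  simp only [c1, c2]
  rw [← ofReal_re (∑ n ∈ Finset.range N, ((n : ℝ) + 1) ^ (-(1 / 3 : ℝ)) -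
    3 / 2 * ((N : ℝ) + 1) ^ (2 / 3 : ℝ))]
  congr 1
  push_cast
  ring

end

end Cub

end

section

open MeasureTheory

namespace Cub

/-- The Mellin transform of `cubeErr` at the point giving the secondary term. -/
noncomputable def errInt : ℝ := ∫ x in Set.Ioi 0, x ^ (-(13 / 3 : ℝ)) * cubeErr x

lemma integrable_cubeErr_prod : Integrable (Function.uncurry fun x s : ℝ =>
    x ^ (-(13 / 3 : ℝ)) * ((1 + s ^ 2) * cubeErr (x / √(1 + s ^ 2))))
    ((volume.restrict (Set.Ioi 0)).prod volume) := by
  have hm : Measurable (Function.uncurry fun x s : ℝ =>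
      x ^ (-(13 / 3 : ℝ)) * ((1 + s ^ 2) * cubeErr (x / √(1 + s ^ 2)))) := by
    unfold Function.uncurry
    exact Measurable.mul (by fun_prop) (Measurable.mul (by fun_prop) (measurable_cubeErr.comp (by fun_prop)))
  have i1 : Integrable (fun z : ℝ × ℝ => z.1 ^ (-(1 / 3 : ℝ)) * (1 + z.2 ^ 2) ^ (-(7 / 12 : ℝ)))
      ((volume.restrict (Set.Ioc 0 1)).prod volume) := by
    refine Integrable.mul_prod (f := fun x : ℝ => x ^ (-(1 / 3 : ℝ))) ?_ (integrable_one_add_sq (by norm_num))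
    rw [← IntegrableOn, ← intervalIntegrable_iff_integrableOn_Ioc_of_le zero_le_one]
    exact intervalIntegral.intervalIntegrable_rpow' (by norm_num)
  have i2 : Integrable (fun z : ℝ × ℝ => z.1 ^ (-(7 / 6 : ℝ)) * (1 + z.2 ^ 2) ^ (-(7 / 12 : ℝ)))
      ((volume.restrict (Set.Ioi 1)).prod volume) :=
    Integrable.mul_prod (f := fun x : ℝ => x ^ (-(7 / 6 : ℝ)))
      (integrableOn_Ioi_rpow_of_lt (by norm_num) one_pos) (integrable_one_add_sq (by norm_num))
  have key : ∀ p q : ℝ, 3 ≤ p → p ≤ 4 → 1 - p / 2 ≤ -(7 / 12) → q = -(13 / 3) + p → ∀ x s : ℝ, 0 < x →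
      ‖x ^ (-(13 / 3 : ℝ)) * ((1 + s ^ 2) * cubeErr (x / √(1 + s ^ 2)))‖ ≤
        x ^ q * (1 + s ^ 2) ^ (-(7 / 12 : ℝ)) := by
    intro p q h3 h4 h5 h6 x s hx
    rw [norm_mul, Real.norm_eq_abs, Real.norm_eq_abs, abs_of_pos (Real.rpow_pos_of_pos hx _), h6,
      Real.rpow_add hx, mul_assoc]
    refine mul_le_mul_of_nonneg_left ((fibre_bound hx h3 h4 s).trans ?_) (by positivity)
    refine mul_le_mul_of_nonneg_left ?_ (by positivity)
    exact Real.rpow_le_rpow_of_exponent_le (by nlinarith [sq_nonneg s]) h5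
  have e : (volume.restrict (Set.Ioi (0 : ℝ))) =
      volume.restrict (Set.Ioc 0 1) + volume.restrict (Set.Ioi 1) := by
    rw [← Measure.restrict_union (Set.Ioc_disjoint_Ioi le_rfl) measurableSet_Ioi,
      Set.Ioc_union_Ioi_eq_Ioi zero_le_one]
  rw [e, Measure.add_prod]
  refine Integrable.add_measure (i1.mono' hm.aestronglyMeasurable ?_) (i2.mono' hm.aestronglyMeasurable ?_)
  · have : ∀ᵐ x ∂(volume.restrict (Set.Ioc (0 : ℝ) 1)), x ∈ Set.Ioc (0 : ℝ) 1 :=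
      ae_restrict_mem measurableSet_Ioc
    have h := (Measure.quasiMeasurePreserving_fst (μ := volume.restrict (Set.Ioc (0 : ℝ) 1))
      (ν := (volume : Measure ℝ))).ae this
    filter_upwards [h] with z hz
    exact key 4 _ (by norm_num) (by norm_num) (by norm_num) (by norm_num) _ _ hz.1
  · have : ∀ᵐ x ∂(volume.restrict (Set.Ioi (1 : ℝ))), x ∈ Set.Ioi (1 : ℝ) :=
      ae_restrict_mem measurableSet_Ioi
    have h := (Measure.quasiMeasurePreserving_fst (μ := volume.restrict (Set.Ioi (1 : ℝ)))
      (ν := (volume : Measure ℝ))).ae this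
    filter_upwards [h] with z hz
    exact key (19 / 6) _ (by norm_num) (by norm_num) (by norm_num) (by norm_num) _ _
      (one_pos.trans hz)

lemma vphInt_eq : vphInt = (∫ s : ℝ, (1 + s ^ 2) ^ (-(2 / 3 : ℝ))) * errInt := by
  have h := integral_integral_swap integrable_cubeErr_prod
  rw [vphInt]
  simp only [vph, ← integral_const_mul]
  rw [h, ← integral_mul_const]
  congr 1; ext s
  have hw : 0 < 1 + s ^ 2 := by positivity
  have hb : 0 < (√(1 + s ^ 2))⁻¹ := by positivity
  have h1 := integral_comp_mul_left_Ioi (fun x : ℝ => x ^ (-(13 / 3 : ℝ)) * cubeErr x) 0 hb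
  rw [mul_zero, smul_eq_mul, ← errInt] at h1
  set b := (√(1 + s ^ 2))⁻¹
  have h2 : ∫ x in Set.Ioi 0, x ^ (-(13 / 3 : ℝ)) * ((1 + s ^ 2) * cubeErr (x / √(1 + s ^ 2))) =
      ∫ x in Set.Ioi 0, ((1 + s ^ 2) * b ^ (13 / 3 : ℝ)) * ((b * x) ^ (-(13 / 3 : ℝ)) * cubeErr (b * x)) := by
    refine setIntegral_congr_fun measurableSet_Ioi fun x hx => ?_
    have hx : (0 : ℝ) < x := hx
    have h3 : b ^ (13 / 3 : ℝ) * b ^ (-(13 / 3 : ℝ)) = 1 := by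
      rw [← Real.rpow_add hb]; norm_num
    have h4 : x / √(1 + s ^ 2) = b * x := div_eq_inv_mul _ _
    rw [h4, Real.mul_rpow hb.le hx.le]
    linear_combination -(1 + s ^ 2) * x ^ (-(13 / 3 : ℝ)) * cubeErr (b * x) * h3
  rw [h2, integral_const_mul, h1]
  have h4 := sqrt_rpow (p := 10 / 3) hw
  have h5 : b ^ (13 / 3 : ℝ) = b ^ (10 / 3 : ℝ) * b := by
    rw [← Real.rpow_add_one hb.ne']; norm_num
  rw [show (1 : ℝ) - 10 / 3 / 2 = -(2 / 3) by norm_num] at h4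
  rw [← h4, h5]
  change _ = (1 + s ^ 2) * b ^ (10 / 3 : ℝ) * errInt
  field_simp

lemma integrableOn_errInt : IntegrableOn (fun x : ℝ => x ^ (-(13 / 3 : ℝ)) * cubeErr x) (Set.Ioi 0) := by
  have hm : Measurable fun x : ℝ => x ^ (-(13 / 3 : ℝ)) * cubeErr x :=
    Measurable.mul (by fun_prop) measurable_cubeErr
  have key : ∀ p q : ℝ, 3 ≤ p → p ≤ 4 → q = -(13 / 3) + p → ∀ x : ℝ, 0 < x →
      ‖x ^ (-(13 / 3 : ℝ)) * cubeErr x‖ ≤ x ^ q := by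
    intro p q h3 h4 h6 x hx
    rw [norm_mul, Real.norm_eq_abs, Real.norm_eq_abs, abs_of_pos (Real.rpow_pos_of_pos hx _), h6,
      Real.rpow_add hx]
    exact mul_le_mul_of_nonneg_left (abs_cubeErr_le hx h3 h4) (by positivity)
  rw [← Set.Ioc_union_Ioi_eq_Ioi zero_le_one]
  refine IntegrableOn.union ?_ ?_
  · have h1 : IntegrableOn (fun x : ℝ => x ^ (-(1 / 3 : ℝ))) (Set.Ioc 0 1) := by
      rw [← intervalIntegrable_iff_integrableOn_Ioc_of_le zero_le_one]
      exact intervalIntegral.intervalIntegrable_rpow' (by norm_num)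
    refine Integrable.mono' h1 hm.aestronglyMeasurable ?_
    filter_upwards [ae_restrict_mem measurableSet_Ioc] with x hx
    exact key 4 _ (by norm_num) (by norm_num) (by norm_num) x hx.1
  · have h1 : IntegrableOn (fun x : ℝ => x ^ (-(7 / 6 : ℝ))) (Set.Ioi 1) :=
      integrableOn_Ioi_rpow_of_lt (by norm_num) one_pos
    refine Integrable.mono' h1 hm.aestronglyMeasurable ?_
    filter_upwards [ae_restrict_mem measurableSet_Ioi] with x hx
    exact key (19 / 6) _ (by norm_num) (by norm_num) (by norm_num) x (one_pos.trans hx)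

lemma intervalIntegral_err (N : ℕ) : ∫ x in (0 : ℝ)..((N : ℝ) + 1), x ^ (-(13 / 3 : ℝ)) * cubeErr x =
    3 / 10 * (∑ n ∈ Finset.range N, ((n : ℝ) + 1) ^ (-(1 / 3 : ℝ)) -
      ((N : ℝ) + 1) ^ (-(10 / 3 : ℝ)) * (((N : ℝ) + 1) * N / 2) ^ 2) -
      3 / 8 * ((N : ℝ) + 1) ^ (2 / 3 : ℝ) := by
  have hint : ∀ a b : ℝ, 0 ≤ a → a ≤ b →
      IntervalIntegrable (fun x : ℝ => x ^ (-(13 / 3 : ℝ)) * cubeErr x) volume a b := fun a b ha hb => by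
    rw [intervalIntegrable_iff_integrableOn_Ioc_of_le hb]
    exact integrableOn_errInt.mono_set fun x hx => ha.trans_lt hx.1
  induction N with
  | zero =>
    have : ∫ x in (0 : ℝ)..1, x ^ (-(13 / 3 : ℝ)) * cubeErr x =
        ∫ x in (0 : ℝ)..1, -(1 / 4) * x ^ (-(1 / 3 : ℝ)) := by
      refine intervalIntegral.integral_congr_ae (Eventually.of_forall fun x hx => ?_)
      rw [Set.uIoc_of_le zero_le_one] at hx
      have e : x ^ (-(1 / 3 : ℝ)) = x ^ (-(13 / 3 : ℝ)) * x ^ 4 := by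
        rw [← Real.rpow_natCast, ← Real.rpow_add hx.1]; norm_num
      rw [cubeErr_le_one hx.1 hx.2, e]; ring
    simp only [Nat.cast_zero, zero_add, Finset.range_zero, Finset.sum_empty]
    rw [this, intervalIntegral.integral_const_mul, integral_rpow (Or.inl (by norm_num))]
    norm_num
  | succ N ih =>
    have hN : (0 : ℝ) < (N : ℝ) + 1 := by positivity
    have hN2 : (0 : ℝ) < (N : ℝ) + 1 + 1 := by positivity
    have hnot : (0 : ℝ) ∉ Set.uIcc ((N : ℝ) + 1) ((N : ℝ) + 1 + 1) := by
      rw [Set.uIcc_of_le (by linarith)]; intro h; linarith [h.1]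
    push_cast
    rw [← intervalIntegral.integral_add_adjacent_intervals (hint _ _ le_rfl hN.le)
      (hint ((N : ℝ) + 1) ((N : ℝ) + 1 + 1) hN.le (by linarith)), ih, Finset.sum_range_succ]
    have : ∫ x in ((N : ℝ) + 1)..((N : ℝ) + 1 + 1), x ^ (-(13 / 3 : ℝ)) * cubeErr x =
        ∫ x in ((N : ℝ) + 1)..((N : ℝ) + 1 + 1),
          ((((N : ℝ) + 1 + 1) * (N + 1) / 2) ^ 2 * x ^ (-(13 / 3 : ℝ)) - (1 / 4) * x ^ (-(1 / 3 : ℝ))) := by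
      refine intervalIntegral.integral_congr_ae (Eventually.of_forall fun x hx => ?_)
      rw [Set.uIoc_of_le (by linarith)] at hx
      have hx0 : 0 < x := hN.trans hx.1
      have e : x ^ (-(1 / 3 : ℝ)) = x ^ (-(13 / 3 : ℝ)) * x ^ 4 := by
        rw [← Real.rpow_natCast, ← Real.rpow_add hx0]; norm_num
      have hc : ⌈x⌉₊ = N + 2 := by
        rw [Nat.ceil_eq_iff (by norm_num)]; push_cast
        exact ⟨by linarith [hx.1], by linarith [hx.2]⟩
      rw [cubeErr, cubeSum, hc, sum_range_cube, e]; push_cast; ring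
    rw [this, intervalIntegral.integral_sub, intervalIntegral.integral_const_mul,
      intervalIntegral.integral_const_mul, integral_rpow (Or.inr ⟨by norm_num, hnot⟩),
      integral_rpow (Or.inr ⟨by norm_num, hnot⟩)]
    · have e1 : (-(13 / 3 : ℝ) + 1) = -(10 / 3) := by norm_num
      have e2 : (-(1 / 3 : ℝ) + 1) = 2 / 3 := by norm_num
      rw [e1, e2]
      have e3 : ((N : ℝ) + 1) ^ (-(1 / 3 : ℝ)) = ((N : ℝ) + 1) ^ (-(10 / 3 : ℝ)) * ((N : ℝ) + 1) ^ 3 := by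
        rw [← Real.rpow_natCast, ← Real.rpow_add hN]; norm_num
      rw [e3]; ring
    · exact (intervalIntegral.intervalIntegrable_rpow (Or.inr hnot)).const_mul _
    · exact (intervalIntegral.intervalIntegrable_rpow (Or.inr hnot)).const_mul _

lemma errInt_eq : errInt = 3 / 10 * (riemannZeta (1 / 3)).re := by
  have hN : Tendsto (fun N : ℕ => (N : ℝ) + 1) atTop atTop :=
    tendsto_atTop_add_const_right _ _ tendsto_natCast_atTop_atTop
  have h1 := (intervalIntegral_tendsto_integral_Ioi 0 integrableOn_errInt hN)
  simp only [intervalIntegral_err] at h1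
  refine tendsto_nhds_unique h1 ?_
  have t1 : Tendsto (fun N : ℕ => ((N : ℝ) + 1) ^ (-(1 / 3 : ℝ))) atTop (𝓝 0) :=
    (tendsto_rpow_neg_atTop (by norm_num)).comp hN
  have t2 : Tendsto (fun N : ℕ => ((N : ℝ) + 1) ^ (-(4 / 3 : ℝ))) atTop (𝓝 0) :=
    (tendsto_rpow_neg_atTop (by norm_num)).comp hN
  have t3 := (((tendsto_zeta_third.add (t1.const_mul (1 / 2))).sub (t2.const_mul (1 / 4))).const_mul (3 / 10))
  simp only [mul_zero, add_zero, sub_zero] at t3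
  refine t3.congr fun N => ?_
  have hN : (0 : ℝ) < (N : ℝ) + 1 := by positivity
  set m : ℝ := (N : ℝ) + 1
  have e0 : (N : ℝ) = m - 1 := by simp [m]
  have e1 : m ^ (-(1 / 3 : ℝ)) = m ^ (-(10 / 3 : ℝ)) * m ^ 3 := by
    rw [← Real.rpow_natCast, ← Real.rpow_add hN]; norm_num
  have e2 : m ^ (-(4 / 3 : ℝ)) = m ^ (-(10 / 3 : ℝ)) * m ^ 2 := by
    rw [← Real.rpow_natCast, ← Real.rpow_add hN]; norm_num
  have e3 : m ^ (2 / 3 : ℝ) = m ^ (-(10 / 3 : ℝ)) * m ^ 4 := by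
    rw [← Real.rpow_natCast, ← Real.rpow_add hN]; norm_num
  rw [e1, e2, e3, e0]; ring

lemma integral_one_add_sq_gamma :
    Real.Gamma (2 / 3) * ∫ s : ℝ, (1 + s ^ 2) ^ (-(2 / 3 : ℝ)) = √Real.pi * Real.Gamma (1 / 6) := by
  set F : ℝ → ℝ → ℝ := fun s t => t ^ ((2 / 3 : ℝ) - 1) * Real.exp (-t) * Real.exp (-t * s ^ 2) with hF
  have inn : ∀ t : ℝ, 0 < t → ∫ s : ℝ, F s t = √Real.pi * (Real.exp (-t) * t ^ ((1 / 6 : ℝ) - 1)) := by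
    intro t ht
    simp only [hF]
    rw [integral_const_mul, integral_gaussian, Real.sqrt_div Real.pi_pos.le, Real.sqrt_eq_rpow t]
    have : t ^ ((2 / 3 : ℝ) - 1) = t ^ ((1 / 6 : ℝ) - 1) * t ^ (1 / 2 : ℝ) := by
      rw [← Real.rpow_add ht]; norm_num
    rw [this]
    field_simp
  have hi : Integrable (Function.uncurry F) (volume.prod (volume.restrict (Set.Ioi 0))) := by
    have hm : Measurable (Function.uncurry F) := by
      simp only [hF]; unfold Function.uncurry; fun_prop
    rw [integrable_prod_iff' hm.aestronglyMeasurable]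
    constructor
    · filter_upwards [ae_restrict_mem measurableSet_Ioi] with t ht
      exact (integrable_exp_neg_mul_sq ht).const_mul (t ^ ((2 / 3 : ℝ) - 1) * Real.exp (-t))
    · refine (((Real.GammaIntegral_convergent (s := 1 / 6) (by norm_num)).const_mul (√Real.pi))).congr ?_
      filter_upwards [ae_restrict_mem measurableSet_Ioi] with t ht
      have ht : 0 < t := ht
      rw [← inn t ht]
      refine integral_congr_ae (Eventually.of_forall fun s => ?_)
      simp only [Function.uncurry, hF]
      rw [Real.norm_of_nonneg (by positivity)]
  have h := integral_integral_swap hi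
  rw [setIntegral_congr_fun measurableSet_Ioi (fun t ht => inn t ht), integral_const_mul,
    ← Real.Gamma_eq_integral (by norm_num)] at h
  rw [← h, ← integral_const_mul]
  congr 1; ext s
  have hw : 0 < 1 + s ^ 2 := by positivity
  have := Real.integral_rpow_mul_exp_neg_mul_Ioi (a := 2 / 3) (by norm_num) hw
  simp only [hF]
  rw [show (fun t : ℝ => t ^ ((2 / 3 : ℝ) - 1) * Real.exp (-t) * Real.exp (-t * s ^ 2)) =
    fun t : ℝ => t ^ ((2 / 3 : ℝ) - 1) * Real.exp (-((1 + s ^ 2) * t)) by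
      ext t; rw [mul_assoc, ← Real.exp_add]; ring_nf, this, one_div, Real.inv_rpow hw.le,
      ← Real.rpow_neg hw.le, mul_comm]

lemma gamma_sixth : Real.Gamma (1 / 6) * Real.Gamma (2 / 3) ^ 2 =
    (2 : ℝ) ^ (5 / 3 : ℝ) * Real.pi * √Real.pi / √3 := by
  have h1 := Real.Gamma_mul_Gamma_add_half (1 / 6)
  have h2 := Real.Gamma_mul_Gamma_one_sub (1 / 3)
  rw [show Real.pi * (1 / 3 : ℝ) = Real.pi / 3 by ring, Real.sin_pi_div_three] at h2
  norm_num at h1 h2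
  have e : (2 : ℝ) ^ (5 / 3 : ℝ) = 2 ^ (2 / 3 : ℝ) * 2 := by
    rw [← Real.rpow_add_one (by norm_num)]; norm_num
  rw [e]
  have h3 : Real.Gamma (1 / 3) * Real.Gamma (2 / 3) = 2 * Real.pi / √3 := by
    rw [h2]; field_simp
  calc _ = (Real.Gamma (1 / 6) * Real.Gamma (2 / 3)) * Real.Gamma (2 / 3) := by ring
    _ = (Real.Gamma (1 / 3) * Real.Gamma (2 / 3)) * 2 ^ (2 / 3 : ℝ) * √Real.pi := by rw [h1]; ring
    _ = _ := by rw [h3]; ring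

lemma kap2_eq : kap2 = 2 * √3 / 15 * Real.pi ^ 2 * (riemannZeta (1 / 3)).re / Real.Gamma (2 / 3) ^ 3 := by
  have hG : Real.Gamma (2 / 3) ≠ 0 := (Real.Gamma_pos_of_pos (by norm_num)).ne'
  have h1 := integral_one_add_sq_gamma
  have h2 := gamma_sixth
  have h3 : ∫ s : ℝ, (1 + s ^ 2) ^ (-(2 / 3 : ℝ)) =
      (2 : ℝ) ^ (5 / 3 : ℝ) * Real.pi ^ 2 / (√3 * Real.Gamma (2 / 3) ^ 3) := by
    have hp : √Real.pi * √Real.pi = Real.pi := Real.mul_self_sqrt Real.pi_pos.le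
    have h4 : (√3 : ℝ) ≠ 0 := by positivity
    rw [eq_div_iff (by positivity)]
    rw [eq_div_iff h4] at h2
    linear_combination √3 * Real.Gamma (2 / 3) ^ 2 * h1 + √Real.pi * h2 + 2 ^ (5 / 3 : ℝ) * Real.pi * hp
  have h5 : (4 : ℝ) ^ (-(5 / 6 : ℝ)) * (2 : ℝ) ^ (5 / 3 : ℝ) = 1 := by
    rw [show (4 : ℝ) = 2 ^ (2 : ℝ) by norm_num, ← Real.rpow_mul (by norm_num),
      ← Real.rpow_add (by norm_num)]
    norm_num
  have hs : (√3 : ℝ) * √3 = 3 := Real.mul_self_sqrt (by norm_num)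
  have h4 : (√3 : ℝ) ≠ 0 := by positivity
  rw [kap2, vphInt_eq, errInt_eq, h3]
  field_simp
  linear_combination (riemannZeta (1 / 3)).re * (60 * h5 - 20 * hs)

end Cub

end

section

open MeasureTheory

namespace Cub

open BCF

lemma tendsto_euler {s : ℝ} (hs : 1 < s) :
    Tendsto (fun N : ℕ => ∏ p ∈ Nat.primesBelow N, (1 - (p : ℝ) ^ (-s))) atTop
      (𝓝 (riemannZeta (s : ℂ)).re⁻¹) := by
  have h := (Complex.continuous_re.tendsto _).comp
    (riemannZeta_eulerProduct (s := (s : ℂ)) (by simpa using hs))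
  have e : (Complex.re ∘ fun N : ℕ => ∏ p ∈ Nat.primesBelow N, (1 - (p : ℂ) ^ (-(s : ℂ)))⁻¹) =
      fun N : ℕ => ∏ p ∈ Nat.primesBelow N, (1 - (p : ℝ) ^ (-s))⁻¹ := by
    ext N
    simp only [Function.comp_apply]
    rw [← Complex.ofReal_re (∏ p ∈ Nat.primesBelow N, (1 - (p : ℝ) ^ (-s))⁻¹)]
    congr 1
    push_cast
    refine Finset.prod_congr rfl fun p _ => ?_
    rw [Complex.ofReal_cpow (Nat.cast_nonneg _)]; simp
  rw [e] at h
  have h1 : 1 ≤ (riemannZeta (s : ℂ)).re := by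
    refine ge_of_tendsto' h fun N => ?_
    refine (Finset.prod_const_one (s := Nat.primesBelow N)).symm.trans_le ?_
    refine Finset.prod_le_prod (fun _ _ => zero_le_one) fun p hp => ?_
    have hp1 : (1 : ℝ) < p := by exact_mod_cast (Nat.prime_of_mem_primesBelow hp).one_lt
    have h2 : (p : ℝ) ^ (-s) < 1 := Real.rpow_lt_one_of_one_lt_of_neg hp1 (by linarith)
    have h3 : 0 < (p : ℝ) ^ (-s) := by positivity
    exact (one_le_inv₀ (by linarith)).mpr (by linarith)
  have := h.inv₀ (by linarith)
  simpa using this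

lemma sum_powerset_rpow {P : Finset ℕ} (c r : ℝ) :
    ∑ J ∈ P.powerset, c ^ J.card * ((∏ p ∈ J, p : ℕ) : ℝ) ^ r = ∏ p ∈ P, (1 + c * (p : ℝ) ^ r) := by
  rw [Finset.prod_one_add]
  refine Finset.sum_congr rfl fun J _ => ?_
  rw [Finset.prod_mul_distrib, Finset.prod_const, Nat.cast_prod,
    Real.finsetProd_rpow _ _ fun p _ => Nat.cast_nonneg _]

lemma exists_card_CL_le : ∃ C : ℝ, 0 ≤ C ∧ ∀ Y : ℝ, 0 < Y → ((CL Y).card : ℝ) ≤ C * Y := by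
  obtain ⟨C, hC, h⟩ := mainH_asymp
  have hk : 0 ≤ kap := by unfold kap; positivity
  refine ⟨40000 + (C + kap + |kap2|), by positivity, fun Y hY => ?_⟩
  rcases lt_or_ge Y 1 with h1 | h1
  · have : CL Y = ∅ := by
      refine Finset.eq_empty_of_forall_notMem fun f hf => ?_
      rw [mem_CL] at hf
      have h2 := hf.1.bounds.1
      have h3 : 0 < f.a := hf.1.1
      have h4 : (1 : ℤ) ≤ -f.disc := (by positivity : 0 < f.a ^ 4).trans_le h2
      have h5 : (1 : ℝ) ≤ -(f.disc : ℝ) := by exact_mod_cast h4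
      linarith [hf.2]
    rw [this]; simp; positivity
  · have b1 := sum_CL_bound (E := ∅) (by simp) h1
    have b2 := h ∅ (by simp) Y h1
    have e : mainH Y ∅ = mainE Y ∅ := by simp [mainH_eq]
    rw [e] at b2
    simp only [Finset.prod_empty, Finset.sum_const, nsmul_eq_mul, mul_one, Finset.card_empty, pow_zero,
      Nat.cast_one, Real.one_rpow, one_mul, div_one] at b1 b2
    have p1 : ∀ r : ℝ, r ≤ 1 → Y ^ r ≤ Y := fun r hr => by
      simpa using Real.rpow_le_rpow_of_exponent_le h1 hr
    have q1 := p1 (19 / 24) (by norm_num)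
    have q2 := p1 (1 / 2) (by norm_num)
    have q3 := p1 (5 / 6) (by norm_num)
    have q4 : kap2 * Y ^ ((5 : ℝ) / 6) ≤ |kap2| * Y := by
      have := le_abs_self kap2
      have := abs_nonneg kap2
      have := Real.rpow_nonneg hY.le ((5 : ℝ) / 6)
      nlinarith
    have q5 : C * Y ^ ((19 : ℝ) / 24) ≤ C * Y := by gcongr
    have r1 := (abs_le.mp b1).2
    have r2 := (abs_le.mp b2).2
    nlinarith

/-- The main term of `HK`. -/
noncomputable def mainT (Y k : ℝ) : ℝ := kap * Y / k + kap2 * Y ^ ((5 : ℝ) / 6) * k ^ (-(1 / 3 : ℝ))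

lemma exists_HK_bounds : ∃ C : ℝ, 0 ≤ C ∧ ∀ K : Finset ℕ, (∀ p ∈ K, p.Prime) →
    (∀ Y : ℝ, 1 ≤ Y → |HK Y K - mainT Y (∏ p ∈ K, p : ℕ)| ≤ C * 5 ^ K.card * errT Y (∏ p ∈ K, p : ℕ)) ∧
    (∀ Y : ℝ, 0 < Y → |HK Y K| ≤ C * 5 ^ K.card * Y) := by
  obtain ⟨C, hC, h⟩ := mainH_asymp
  obtain ⟨D, hD, hD'⟩ := exists_card_CL_le
  refine ⟨2 * 10 ^ 8 + C + D, by positivity, fun K hK => ⟨fun Y hY => ?_, fun Y hY => ?_⟩⟩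
  · have b1 := HK_bound hK hY
    have b2 := h K hK Y hY
    set k : ℝ := ((∏ p ∈ K, p : ℕ) : ℝ) with hk
    have hk1 : 1 ≤ k := by
      rw [hk]; exact_mod_cast Finset.prod_pos fun p hp => (hK p hp).pos
    have e0 : Y ^ ((19 : ℝ) / 24) ≤ errT Y k := by
      unfold errT
      have := Real.one_le_rpow hk1 (z := 3 / 4) (by norm_num)
      have : 0 ≤ Y ^ ((19 : ℝ) / 24) := by positivity
      have : 0 ≤ k * Y ^ ((1 : ℝ) / 2) := by positivity
      nlinarith
    have e1 : (1 : ℝ) ≤ 5 ^ K.card := one_le_pow₀ (by norm_num)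
    have e2 : 0 ≤ errT Y k := le_trans (by positivity) e0
    have b3 := abs_sub_le (HK Y K) (mainH Y K) (mainT Y k)
    have e3 : C * Y ^ ((19 : ℝ) / 24) ≤ C * 5 ^ K.card * errT Y k := by
      calc _ ≤ C * 1 * errT Y k := by rw [mul_one]; gcongr
        _ ≤ _ := by gcongr
    have e4 : 0 ≤ D * 5 ^ K.card * errT Y k := by positivity
    have b2' : |mainH Y K - mainT Y k| ≤ C * Y ^ ((19 : ℝ) / 24) := b2
    linarith
  · refine (HK_trivial hD' hK hY).trans ?_
    have : 0 ≤ (2 * 10 ^ 8 + C) * (5 ^ K.card * Y) := by positivity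
    linarith

lemma rpow_bound {X q a b c d : ℝ} (hX : 1 ≤ X) (hq : 1 ≤ q) (h : q ≤ X ^ (1 / 5 : ℝ)) (hbd : d ≤ b)
    (hac : a + (b - d) / 5 ≤ c) : X ^ a * q ^ b ≤ X ^ c * q ^ d := by
  have hX0 : 0 < X := by linarith
  have hq0 : 0 < q := by linarith
  have e : q ^ b = q ^ (b - d) * q ^ d := by rw [← Real.rpow_add hq0]; congr 1; ring
  rw [e, ← mul_assoc]
  refine mul_le_mul_of_nonneg_right ?_ (by positivity)
  calc X ^ a * q ^ (b - d) ≤ X ^ a * (X ^ (1 / 5 : ℝ)) ^ (b - d) := by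
        gcongr
    _ = X ^ (a + (b - d) / 5) := by
        rw [← Real.rpow_mul hX0.le, ← Real.rpow_add hX0]; congr 1; ring
    _ ≤ _ := Real.rpow_le_rpow_of_exponent_le hX hac

lemma rpow_bound' {X q a b c d : ℝ} (hX : 1 ≤ X) (h : X ^ (1 / 5 : ℝ) ≤ q) (hbd : b ≤ d)
    (hac : a + (b - d) / 5 ≤ c) : X ^ a * q ^ b ≤ X ^ c * q ^ d := by
  have hX0 : 0 < X := by linarith
  have hq0 : 0 < q := (by positivity : 0 < X ^ (1 / 5 : ℝ)).trans_le h
  have e : q ^ b = q ^ (b - d) * q ^ d := by rw [← Real.rpow_add hq0]; congr 1; ring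
  rw [e, ← mul_assoc]
  refine mul_le_mul_of_nonneg_right ?_ (by positivity)
  calc X ^ a * q ^ (b - d) ≤ X ^ a * (X ^ (1 / 5 : ℝ)) ^ (b - d) := by
        gcongr X ^ a * ?_
        exact Real.rpow_le_rpow_of_nonpos (by positivity) h (by linarith)
    _ = X ^ (a + (b - d) / 5) := by
        rw [← Real.rpow_mul hX0.le, ← Real.rpow_add hX0]; congr 1; ring
    _ ≤ _ := Real.rpow_le_rpow_of_exponent_le hX hac

lemma div_sq_rpow {X q : ℝ} (hX : 0 < X) (hq : 0 < q) (r : ℝ) :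
    (X / q ^ 2) ^ r = X ^ r * q ^ (-(2 * r)) := by
  rw [Real.div_rpow hX.le (by positivity), ← Real.rpow_natCast q 2, ← Real.rpow_mul hq.le,
    Real.rpow_neg hq.le, div_eq_mul_inv]
  norm_num

lemma exists_term_bound : ∃ C : ℝ, 0 ≤ C ∧ ∀ K : Finset ℕ, (∀ p ∈ K, p.Prime) → ∀ X : ℝ, 1 ≤ X →
    ∀ j : ℝ, 1 ≤ j → |HK (X / (j * (∏ p ∈ K, p : ℕ)) ^ 2) K -
      mainT (X / (j * (∏ p ∈ K, p : ℕ)) ^ 2) (∏ p ∈ K, p : ℕ)| ≤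
      C * 5 ^ K.card * (X ^ (497 / 600 : ℝ) * (j * (∏ p ∈ K, p : ℕ)) ^ (-(61 / 60 : ℝ))) := by
  obtain ⟨C, hC, h⟩ := exists_HK_bounds
  have hkap : 0 ≤ kap := by unfold kap; positivity
  refine ⟨2 * C + kap + |kap2|, by positivity, fun K hK X hX j hj => ?_⟩
  obtain ⟨hM, hT⟩ := h K hK
  set k : ℝ := ((∏ p ∈ K, p : ℕ) : ℝ) with hk
  have hk1 : 1 ≤ k := by
    rw [hk]; exact_mod_cast Finset.prod_pos fun p hp => (hK p hp).pos
  have hk0 : 0 < k := by linarith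
  have hkq : k ≤ j * k := by nlinarith
  set q : ℝ := j * k
  have hq1 : 1 ≤ q := hk1.trans hkq
  have hq0 : 0 < q := by linarith
  have hX0 : 0 < X := by linarith
  have e1 : (1 : ℝ) ≤ 5 ^ K.card := one_le_pow₀ (by norm_num)
  set Z : ℝ := X ^ (497 / 600 : ℝ) * q ^ (-(61 / 60 : ℝ)) with hZ
  have hZ0 : 0 ≤ Z := by positivity
  rcases le_total q (X ^ (1 / 5 : ℝ)) with hc | hc
  · have hY : 1 ≤ X / q ^ 2 := by
      rw [le_div_iff₀ (by positivity), one_mul]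
      calc q ^ 2 ≤ (X ^ (1 / 5 : ℝ)) ^ 2 := by gcongr
        _ = X ^ (2 / 5 : ℝ) := by rw [← Real.rpow_natCast, ← Real.rpow_mul hX0.le]; norm_num
        _ ≤ X := by simpa using Real.rpow_le_rpow_of_exponent_le hX (show (2 / 5 : ℝ) ≤ 1 by norm_num)
    have b := hM _ hY
    have e2 : errT (X / q ^ 2) k ≤ 2 * Z := by
      refine (errT_mono (by linarith) hk0.le hkq).trans ?_
      unfold errT
      rw [div_sq_rpow hX0 hq0, div_sq_rpow hX0 hq0]
      have r1 := rpow_bound (a := 19 / 24) (b := -(5 / 6)) (c := 497 / 600) (d := -(61 / 60)) hX hq1 hc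
        (by norm_num) (by norm_num)
      have r2 := rpow_bound (a := 1 / 2) (b := 0) (c := 497 / 600) (d := -(61 / 60)) hX hq1 hc
        (by norm_num) (by norm_num)
      have t1 : X ^ ((19 : ℝ) / 24) * q ^ (-(2 * (19 / 24 : ℝ))) * q ^ ((3 : ℝ) / 4) =
          X ^ (19 / 24 : ℝ) * q ^ (-(5 / 6 : ℝ)) := by
        rw [mul_assoc, ← Real.rpow_add hq0]; norm_num
      have t2 : q * (X ^ ((1 : ℝ) / 2) * q ^ (-(2 * (1 / 2 : ℝ)))) = X ^ (1 / 2 : ℝ) * q ^ (0 : ℝ) := by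
        rw [show -(2 * (1 / 2 : ℝ)) = -1 by norm_num, Real.rpow_neg_one, Real.rpow_zero]
        field_simp
      rw [t1, t2]
      linarith
    refine b.trans ?_
    calc C * 5 ^ K.card * errT (X / q ^ 2) k ≤ C * 5 ^ K.card * (2 * Z) := by gcongr
      _ ≤ _ := by
        have : 0 ≤ (kap + |kap2|) * 5 ^ K.card * Z := by positivity
        linarith
  · have hY : 0 < X / q ^ 2 := by positivity
    have b := hT _ hY
    have y1 : X / q ^ 2 ≤ Z := by
      have := rpow_bound' (a := 1) (b := -2) (c := 497 / 600) (d := -(61 / 60)) hX hc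
        (by norm_num) (by norm_num)
      have e := div_sq_rpow hX0 hq0 1
      rw [Real.rpow_one, mul_one] at e
      rw [e]; exact this
    have y2 : (X / q ^ 2) ^ ((5 : ℝ) / 6) ≤ Z := by
      rw [div_sq_rpow hX0 hq0]
      exact rpow_bound' hX hc (by norm_num) (by norm_num)
    have y3 : |mainT (X / q ^ 2) k| ≤ (kap + |kap2|) * Z := by
      unfold mainT
      refine (abs_add_le _ _).trans ?_
      rw [abs_of_nonneg (by positivity), abs_mul, abs_mul,
        abs_of_nonneg (by positivity : 0 ≤ (X / q ^ 2) ^ ((5 : ℝ) / 6)),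
        abs_of_nonneg (by positivity : 0 ≤ k ^ (-(1 / 3 : ℝ)))]
      have z1 : kap * (X / q ^ 2) / k ≤ kap * Z := by
        refine (div_le_self (by positivity) hk1).trans (by gcongr)
      have z2 : |kap2| * (X / q ^ 2) ^ ((5 : ℝ) / 6) * k ^ (-(1 / 3 : ℝ)) ≤ |kap2| * Z * 1 := by
        gcongr
        exact Real.rpow_le_one_of_one_le_of_nonpos hk1 (by norm_num)
      linarith
    have y4 : C * 5 ^ K.card * (X / q ^ 2) ≤ C * 5 ^ K.card * Z := by gcongr
    have y5 : (kap + |kap2|) * 1 * Z ≤ (kap + |kap2|) * 5 ^ K.card * Z := by gcongr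
    have y6 : 0 ≤ C * 5 ^ K.card * Z := by positivity
    refine (abs_sub _ _).trans ?_
    linarith

/-- Bound for the sieved count. -/
lemma exists_sieve_bound : ∃ C : ℝ, ∀ P : Finset ℕ, (∀ p ∈ P, p.Prime) → ∀ X : ℝ, 1 ≤ X →
    |∑ ω ∈ OmF X, ∏ p ∈ P, ω.maxInd p -
      (kap * X * ((∏ p ∈ P, (1 - (p : ℝ) ^ (-2 : ℝ))) * ∏ p ∈ P, (1 - (p : ℝ) ^ (-3 : ℝ))) +
        kap2 * X ^ ((5 : ℝ) / 6) * ((∏ p ∈ P, (1 - (p : ℝ) ^ (-(5 / 3 : ℝ)))) *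
          ∏ p ∈ P, (1 - (p : ℝ) ^ (-2 : ℝ))))| ≤ C * X ^ (497 / 600 : ℝ) := by
  obtain ⟨C, hC, h⟩ := exists_term_bound
  have hsum : Summable fun n : ℕ => (n : ℝ) ^ (-(61 / 60 : ℝ)) :=
    Real.summable_nat_rpow.mpr (by norm_num)
  set S : ℝ := ∑' n : ℕ, (n : ℝ) ^ (-(61 / 60 : ℝ))
  refine ⟨C * (Real.exp S * Real.exp (5 * S)), fun P hP X hX => ?_⟩
  have hX0 : 0 < X := by linarith
  have hpow : ∀ (c r : ℝ), ∏ p ∈ P, (1 + c * (p : ℝ) ^ r) =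
      ∑ J ∈ P.powerset, c ^ J.card * ((∏ p ∈ J, p : ℕ) : ℝ) ^ r := fun c r => (sum_powerset_rpow c r).symm
  have hneg : ∀ r : ℝ, ∏ p ∈ P, (1 - (p : ℝ) ^ r) =
      ∑ J ∈ P.powerset, (-1) ^ J.card * ((∏ p ∈ J, p : ℕ) : ℝ) ^ r := fun r => by
    rw [← hpow]; exact Finset.prod_congr rfl fun p _ => by ring
  have pos : ∀ J ∈ P.powerset, (1 : ℝ) ≤ ((∏ p ∈ J, p : ℕ) : ℝ) := fun J hJ => by
    exact_mod_cast Finset.prod_pos fun p hp => (hP p (Finset.mem_powerset.mp hJ hp)).pos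
  have s1 := sieve P hP (fun _ => 1) (fun p _ => stable_one p) X
  simp only [one_mul] at s1
  have m1 : kap * X * ((∏ p ∈ P, (1 - (p : ℝ) ^ (-2 : ℝ))) * ∏ p ∈ P, (1 - (p : ℝ) ^ (-3 : ℝ))) +
        kap2 * X ^ ((5 : ℝ) / 6) * ((∏ p ∈ P, (1 - (p : ℝ) ^ (-(5 / 3 : ℝ)))) *
          ∏ p ∈ P, (1 - (p : ℝ) ^ (-2 : ℝ))) =
      ∑ J ∈ P.powerset, ∑ K ∈ P.powerset, (-1) ^ (J.card + K.card) *
        mainT (X / (((∏ p ∈ J, p : ℕ) : ℝ) * ((∏ p ∈ K, p : ℕ) : ℝ)) ^ 2) ((∏ p ∈ K, p : ℕ) : ℝ) := by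
    rw [hneg, hneg, hneg, Finset.sum_mul_sum, Finset.sum_mul_sum, Finset.mul_sum, Finset.mul_sum,
      ← Finset.sum_add_distrib]
    refine Finset.sum_congr rfl fun J hJ => ?_
    rw [Finset.mul_sum, Finset.mul_sum, ← Finset.sum_add_distrib]
    refine Finset.sum_congr rfl fun K hK => ?_
    have hj := pos J hJ
    have hk := pos K hK
    set j : ℝ := ((∏ p ∈ J, p : ℕ) : ℝ)
    set k : ℝ := ((∏ p ∈ K, p : ℕ) : ℝ)
    have hj0 : 0 < j := by linarith
    have hk0 : 0 < k := by linarith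
    have e1 : X / (j * k) ^ 2 = X * (j ^ (-2 : ℝ) * k ^ (-2 : ℝ)) := by
      have := div_sq_rpow hX0 (mul_pos hj0 hk0) 1
      rw [Real.rpow_one, mul_one, Real.rpow_one, Real.mul_rpow hj0.le hk0.le] at this
      exact this
    have e2 : (X / (j * k) ^ 2) ^ ((5 : ℝ) / 6) =
        X ^ ((5 : ℝ) / 6) * (j ^ (-(5 / 3 : ℝ)) * k ^ (-(5 / 3 : ℝ))) := by
      rw [div_sq_rpow hX0 (mul_pos hj0 hk0), Real.mul_rpow hj0.le hk0.le]; norm_num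
    have e3 : k ^ (-3 : ℝ) = k ^ (-2 : ℝ) / k := by
      rw [← Real.rpow_sub_one hk0.ne']; norm_num
    have e4 : k ^ (-2 : ℝ) = k ^ (-(5 / 3 : ℝ)) * k ^ (-(1 / 3 : ℝ)) := by
      rw [← Real.rpow_add hk0]; norm_num
    unfold mainT
    rw [e2, e1, e3]
    nth_rewrite 2 [e4]
    rw [pow_add]
    ring
  rw [s1, m1, ← Finset.sum_sub_distrib]
  have hb : ∀ c : ℝ, 0 ≤ c → ∏ p ∈ P, (1 + c * (p : ℝ) ^ (-(61 / 60 : ℝ))) ≤ Real.exp (c * S) := by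
    intro c hc
    calc _ ≤ ∏ p ∈ P, Real.exp (c * (p : ℝ) ^ (-(61 / 60 : ℝ))) := by
          refine Finset.prod_le_prod (fun p _ => by positivity) fun p _ => ?_
          rw [add_comm]; exact Real.add_one_le_exp _
      _ = Real.exp (c * ∑ p ∈ P, (p : ℝ) ^ (-(61 / 60 : ℝ))) := by
          rw [Finset.mul_sum, Real.exp_sum]
      _ ≤ _ := by
          gcongr
          exact hsum.sum_le_tsum _ fun n _ => by positivity
  have hb1 := hb 1 zero_le_one
  have hb5 := hb 5 (by norm_num)
  rw [hpow] at hb1 hb5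
  rw [one_mul] at hb1
  calc _ ≤ ∑ J ∈ P.powerset, ∑ K ∈ P.powerset, C * X ^ (497 / 600 : ℝ) *
        ((1 ^ J.card * ((∏ p ∈ J, p : ℕ) : ℝ) ^ (-(61 / 60 : ℝ))) *
          (5 ^ K.card * ((∏ p ∈ K, p : ℕ) : ℝ) ^ (-(61 / 60 : ℝ)))) := by
        refine (Finset.abs_sum_le_sum_abs _ _).trans (Finset.sum_le_sum fun J hJ => ?_)
        rw [← Finset.sum_sub_distrib]
        refine (Finset.abs_sum_le_sum_abs _ _).trans (Finset.sum_le_sum fun K hK => ?_)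
        rw [← mul_sub, abs_mul, abs_pow, abs_neg, abs_one, one_pow, one_mul]
        have := h K (fun p hp => hP p (Finset.mem_powerset.mp hK hp)) X hX _ (pos J hJ)
        refine this.trans_eq ?_
        rw [Real.mul_rpow (by linarith [pos J hJ]) (by linarith [pos K hK]), one_pow]
        ring
    _ = C * X ^ (497 / 600 : ℝ) * ((∑ J ∈ P.powerset, 1 ^ J.card * ((∏ p ∈ J, p : ℕ) : ℝ) ^ (-(61 / 60 : ℝ))) *
          ∑ K ∈ P.powerset, 5 ^ K.card * ((∏ p ∈ K, p : ℕ) : ℝ) ^ (-(61 / 60 : ℝ))) := by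
        rw [Finset.sum_mul_sum, Finset.mul_sum]
        exact Finset.sum_congr rfl fun J _ => by rw [Finset.mul_sum]
    _ ≤ C * X ^ (497 / 600 : ℝ) * (Real.exp S * Real.exp (5 * S)) := by
        gcongr
    _ = _ := by ring

lemma tendsto_sieve_count (X : ℝ) :
    Tendsto (fun N : ℕ => ∑ ω ∈ OmF X, ∏ p ∈ Nat.primesBelow N, ω.maxInd p) atTop
      (𝓝 (countCubic (fun d => -X < (d : ℝ) ∧ (d : ℝ) < 0) : ℝ)) := by
  classical
  have e : (countCubic (fun d => -X < (d : ℝ) ∧ (d : ℝ) < 0) : ℝ) =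
      ∑ ω ∈ OmF X, if ∀ p : ℕ, p.Prime → ω.MaxAt p then (1 : ℝ) else 0 := by
    rw [countCubic_eq, Finset.sum_boole]
  rw [e]
  refine tendsto_finsetSum _ fun ω _ => ?_
  split_ifs with hω
  · refine tendsto_const_nhds.congr fun N => ?_
    rw [Finset.prod_eq_one]
    intro p hp
    rw [Orb.maxInd, if_pos (hω p (Nat.prime_of_mem_primesBelow hp))]
  · push Not at hω
    obtain ⟨p, hp, hm⟩ := hω
    refine tendsto_const_nhds.congr' ?_
    filter_upwards [eventually_gt_atTop p] with N hN
    rw [Finset.prod_eq_zero (i := p) (Nat.mem_primesBelow.mpr ⟨hN, hp⟩)]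
    rw [Orb.maxInd, if_neg hm]

lemma exists_count_bound : ∃ C : ℝ, ∀ X : ℝ, 1 ≤ X →
    |(countCubic (fun d => -X < (d : ℝ) ∧ (d : ℝ) < 0) : ℝ) - X / (4 * (riemannZeta 3).re)
        - 4 * Real.sqrt 3 * (riemannZeta (1/3)).re * X ^ ((5 : ℝ)/6)
            / (5 * Real.Gamma (2/3) ^ 3 * (riemannZeta (5/3)).re)| ≤ C * X ^ (497 / 600 : ℝ) := by
  obtain ⟨C, h⟩ := exists_sieve_bound
  refine ⟨C, fun X hX => ?_⟩
  have t2 := tendsto_euler (s := 2) (by norm_num)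
  have t3 := tendsto_euler (s := 3) (by norm_num)
  have t5 := tendsto_euler (s := 5 / 3) (by norm_num)
  have t := ((tendsto_sieve_count X).sub (((t2.mul t3).const_mul (kap * X)).add
    ((t5.mul t2).const_mul (kap2 * X ^ ((5 : ℝ) / 6))))).abs
  have hb := le_of_tendsto' t fun N =>
    h (Nat.primesBelow N) (fun p hp => Nat.prime_of_mem_primesBelow hp) X hX
  refine le_trans (le_of_eq ?_) hb
  have z2 : (riemannZeta ((2 : ℝ) : ℂ)).re = Real.pi ^ 2 / 6 := by
    push_cast
    rw [riemannZeta_two]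
    norm_cast
  rw [z2, kap2_eq, kap]
  push_cast
  congr 1
  have hpi := Real.pi_ne_zero
  have e1 : Real.pi ^ 2 / 24 * X * ((Real.pi ^ 2 / 6)⁻¹ * (riemannZeta 3).re⁻¹) =
      X / (4 * (riemannZeta 3).re) := by
    rw [div_eq_mul_inv X, mul_inv]; field_simp; ring
  have e2 : 2 * √3 / 15 * Real.pi ^ 2 * (riemannZeta (1 / 3)).re / Real.Gamma (2 / 3) ^ 3 *
      X ^ ((5 : ℝ) / 6) * ((riemannZeta (5 / 3)).re⁻¹ * (Real.pi ^ 2 / 6)⁻¹) =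
      4 * Real.sqrt 3 * (riemannZeta (1/3)).re * X ^ ((5 : ℝ)/6)
            / (5 * Real.Gamma (2/3) ^ 3 * (riemannZeta (5/3)).re) := by
    rw [div_eq_mul_inv _ (5 * _ * _), mul_inv, mul_inv]; field_simp; ring
  rw [e1, e2]; ring

end Cub

end

/-- The Davenport-Heilbronn theorem with the Roberts secondary term, for negative
discriminants: `N_3^-(X) = X/(4 ζ(3)) + √3 · (4 ζ(1/3)/(5 Γ(2/3)³ ζ(5/3))) X^{5/6}
+ o(X^{5/6})` as `X → ∞`. -/
theorem secondary_term_cubic_fields_negative_disc :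
    Tendsto (fun X : ℝ =>
      ((countCubic (fun d => -X < (d : ℝ) ∧ (d : ℝ) < 0) : ℝ)
        - X / (4 * (riemannZeta 3).re)
        - 4 * Real.sqrt 3 * (riemannZeta (1/3)).re * X ^ ((5 : ℝ)/6)
            / (5 * Real.Gamma (2/3) ^ 3 * (riemannZeta (5/3)).re))
      / X ^ ((5 : ℝ)/6)) atTop (𝓝 0) := by
  obtain ⟨C, h⟩ := Cub.exists_count_bound
  have ht : Tendsto (fun X : ℝ => C * X ^ (-(1 / 200 : ℝ))) atTop (𝓝 0) := by
    simpa using (tendsto_rpow_neg_atTop (by norm_num : (0 : ℝ) < 1 / 200)).const_mul C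
  refine squeeze_zero_norm' ?_ ht
  filter_upwards [eventually_ge_atTop 1] with X hX
  have hX0 : 0 < X := by linarith
  rw [norm_div, Real.norm_eq_abs, Real.norm_of_nonneg (by positivity), div_le_iff₀ (by positivity),
    mul_assoc C, ← Real.rpow_add hX0, show (-(1 / 200) + 5 / 6 : ℝ) = 497 / 600 by norm_num]
  exact h X hX
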